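/- Let m ≥ 1 be an integer and let S be a subset of the lattice ℤ¹⁰ of integral ternary cubic forms that is invariant under the action of SL₃(ℤ) and is a union of exactly k distinct cosets of the sublattice m·ℤ¹⁰. Let N⁺(S;X) denote the number of SL₃(ℤ)-equivalence classes of strongly irreducible forms in S with Δ > 0 and height < X, and N⁻(S;X) the analogous count with Δ < 0. Then lim_{X→∞} N⁺(S;X)/X^{5/6} = (k/m¹⁰)·(32/45)·ζ(2)·ζ(3) and lim_{X→∞} N⁻(S;X)/X^{5/6} = (k/m¹⁰)·(128/45)·ζ(2)·ζ(3). -/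

import Mathlib

open MvPolynomial

/-- The action of a 3×3 matrix on ternary forms: `(γ·f)(x,y,z) = f((x,y,z)·γ)`. -/
noncomputable def actGL {R : Type*} [CommRing R] (γ : Matrix (Fin 3) (Fin 3) R)
    (f : MvPolynomial (Fin 3) R) : MvPolynomial (Fin 3) R :=
  bind₁ (fun j => ∑ i : Fin 3, C (γ i j) * X i) f

/-- The Hessian of a ternary form: the determinant of the matrix of second partials. -/
noncomputable def hess {R : Type*} [CommRing R] (f : MvPolynomial (Fin 3) R) :
    MvPolynomial (Fin 3) R :=
  Matrix.det (Matrix.of fun i j => pderiv i (pderiv j f))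

/-- The exponent vectors of the ten monomials of a ternary cubic form. -/
def expo : Fin 10 → Fin 3 → ℕ :=
  ![![3,0,0], ![0,3,0], ![0,0,3], ![2,1,0], ![2,0,1],
    ![1,2,0], ![0,2,1], ![1,0,2], ![0,1,2], ![1,1,1]]

/-- The ternary cubic form with coefficient vector `c : Fin 10 → R`. -/
noncomputable def cubic {R : Type*} [CommRing R] (c : Fin 10 → R) : MvPolynomial (Fin 3) R :=
  ∑ k : Fin 10, C (c k) * ∏ i : Fin 3, X i ^ expo k i

/-- The coefficient vector of the Weierstrass cubic `x³ + A·x·z² + B·z³ − y²·z`. -/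
noncomputable def wcoeffs {R : Type*} [CommRing R] (A B : R) : Fin 10 → R :=
  ![1, 0, B, 0, 0, 0, -1, A, 0, 0]

/-- The generic ternary cubic form, whose coefficients are the 10 indeterminates. -/
noncomputable def genCubic (R : Type*) [CommRing R] :
    MvPolynomial (Fin 3) (MvPolynomial (Fin 10) R) :=
  cubic (fun k => X k)

/-- `P` and `Q` are the invariants `I` and `J`: they are homogeneous of degrees 4 and 6
in the ten coefficients, they satisfy the identity
`H(H(f)) = 12288·I(f)²·f + 512·J(f)·H(f)` (stated for the generic ternary cubic form,
hence for every ternary cubic form over every commutative `R`-algebra), and they are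
normalized so that `x³ + A·x·z² + B·z³ − y²·z` has `I = −3A` and `J = −27B`. -/
def IsInvariantPair (R : Type*) [CommRing R] (P Q : MvPolynomial (Fin 10) R) : Prop :=
  P.IsHomogeneous 4 ∧ Q.IsHomogeneous 6 ∧
  hess (hess (genCubic R)) =
    12288 * C P ^ 2 * genCubic R + 512 * C Q * hess (genCubic R) ∧
  ∀ A B : R, aeval (wcoeffs A B) P = -3 * A ∧ aeval (wcoeffs A B) Q = -27 * B

/-- The invariant `I` of the integral ternary cubic form with coefficients `c`,
where `P` is the degree-4 invariant polynomial. -/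
noncomputable def Iinv (P : MvPolynomial (Fin 10) ℚ) (c : Fin 10 → ℤ) : ℚ :=
  aeval (fun k => (c k : ℚ)) P

/-- The invariant `J` of the integral ternary cubic form with coefficients `c`,
where `Q` is the degree-6 invariant polynomial. -/
noncomputable def Jinv (Q : MvPolynomial (Fin 10) ℚ) (c : Fin 10 → ℤ) : ℚ :=
  aeval (fun k => (c k : ℚ)) Q

/-- The discriminant `Δ = (4I³ − J²)/27` of the integral ternary cubic form `c`. -/
noncomputable def Δinv (P Q : MvPolynomial (Fin 10) ℚ) (c : Fin 10 → ℤ) : ℚ :=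
  (4 * Iinv P c ^ 3 - Jinv Q c ^ 2) / 27

/-- The height `H = max(|I|³, J²/4)` of the integral ternary cubic form `c`. -/
noncomputable def Hinv (P Q : MvPolynomial (Fin 10) ℚ) (c : Fin 10 → ℤ) : ℚ :=
  max (|Iinv P c| ^ 3) (Jinv Q c ^ 2 / 4)

/-- An integral ternary cubic form is strongly irreducible if `f` and its Hessian have no
common nontrivial rational zero. -/
def StronglyIrred (c : Fin 10 → ℤ) : Prop :=
  ¬ ∃ v : Fin 3 → ℚ, v ≠ 0 ∧ eval v (cubic fun k => (c k : ℚ)) = 0 ∧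
      eval v (hess (cubic fun k => (c k : ℚ))) = 0

/-- The `SL₃(ℤ)`-orbit (equivalence class) of the integral ternary cubic form `c`. -/
noncomputable def orbitZ (c : Fin 10 → ℤ) : Set (Fin 10 → ℤ) :=
  {c' | ∃ γ : Matrix.SpecialLinearGroup (Fin 3) ℤ,
    actGL (γ : Matrix (Fin 3) (Fin 3) ℤ) (cubic c) = cubic c'}

/-- `ζ(2)`. -/
noncomputable def zeta2 : ℝ := ∑' n : ℕ, (1 : ℝ) / (n + 1) ^ 2

/-- `ζ(3)`. -/
noncomputable def zeta3 : ℝ := ∑' n : ℕ, (1 : ℝ) / (n + 1) ^ 3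

/-- The number of `SL₃(ℤ)`-equivalence classes of strongly irreducible integral ternary
cubic forms in `S` with `Δ > 0` and height `< X`. -/
noncomputable def NposS (P Q : MvPolynomial (Fin 10) ℚ) (S : Set (Fin 10 → ℤ)) (X : ℝ) : ℕ :=
  Set.ncard {T : Set (Fin 10 → ℤ) | ∃ c ∈ S, StronglyIrred c ∧
    0 < Δinv P Q c ∧ (Hinv P Q c : ℝ) < X ∧ T = orbitZ c}

/-- The number of `SL₃(ℤ)`-equivalence classes of strongly irreducible integral ternary
cubic forms in `S` with `Δ < 0` and height `< X`. -/
noncomputable def NnegS (P Q : MvPolynomial (Fin 10) ℚ) (S : Set (Fin 10 → ℤ)) (X : ℝ) : ℕ :=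
  Set.ncard {T : Set (Fin 10 → ℤ) | ∃ c ∈ S, StronglyIrred c ∧
    Δinv P Q c < 0 ∧ (Hinv P Q c : ℝ) < X ∧ T = orbitZ c}


namespace TC
open Matrix

section basic
variable {R : Type*} [CommRing R]

/-- value of the cubic with coefficients `c` at `u` -/
def ev (c : Fin 10 → R) (u : Fin 3 → R) : R :=
  c 0 * u 0 ^ 3 + c 1 * u 1 ^ 3 + c 2 * u 2 ^ 3 + c 3 * u 0 ^ 2 * u 1 + c 4 * u 0 ^ 2 * u 2
  + c 5 * u 0 * u 1 ^ 2 + c 6 * u 1 ^ 2 * u 2 + c 7 * u 0 * u 2 ^ 2 + c 8 * u 1 * u 2 ^ 2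
  + c 9 * u 0 * u 1 * u 2

/-- derivative at `u` in direction `v` -/
def d1 (c : Fin 10 → R) (u v : Fin 3 → R) : R :=
  3 * c 0 * u 0 ^ 2 * v 0 + 3 * c 1 * u 1 ^ 2 * v 1 + 3 * c 2 * u 2 ^ 2 * v 2
  + c 3 * (2 * u 0 * v 0 * u 1 + u 0 ^ 2 * v 1) + c 4 * (2 * u 0 * v 0 * u 2 + u 0 ^ 2 * v 2)
  + c 5 * (v 0 * u 1 ^ 2 + 2 * u 0 * u 1 * v 1) + c 6 * (2 * u 1 * v 1 * u 2 + u 1 ^ 2 * v 2)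
  + c 7 * (v 0 * u 2 ^ 2 + 2 * u 0 * u 2 * v 2) + c 8 * (v 1 * u 2 ^ 2 + 2 * u 1 * u 2 * v 2)
  + c 9 * (v 0 * u 1 * u 2 + u 0 * v 1 * u 2 + u 0 * u 1 * v 2)

/-- full polarisation -/
def d3 (c : Fin 10 → R) (u v w : Fin 3 → R) : R :=
  6 * c 0 * u 0 * v 0 * w 0 + 6 * c 1 * u 1 * v 1 * w 1 + 6 * c 2 * u 2 * v 2 * w 2
  + 2 * c 3 * (u 0 * v 0 * w 1 + u 0 * v 1 * w 0 + u 1 * v 0 * w 0)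
  + 2 * c 4 * (u 0 * v 0 * w 2 + u 0 * v 2 * w 0 + u 2 * v 0 * w 0)
  + 2 * c 5 * (u 0 * v 1 * w 1 + u 1 * v 0 * w 1 + u 1 * v 1 * w 0)
  + 2 * c 6 * (u 1 * v 1 * w 2 + u 1 * v 2 * w 1 + u 2 * v 1 * w 1)
  + 2 * c 7 * (u 0 * v 2 * w 2 + u 2 * v 0 * w 2 + u 2 * v 2 * w 0)
  + 2 * c 8 * (u 1 * v 2 * w 2 + u 2 * v 1 * w 2 + u 2 * v 2 * w 1)
  + c 9 * (u 0 * v 1 * w 2 + u 0 * v 2 * w 1 + u 1 * v 0 * w 2 + u 1 * v 2 * w 0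
      + u 2 * v 0 * w 1 + u 2 * v 1 * w 0)

/-- the action on coefficient vectors -/
def act (g : Matrix (Fin 3) (Fin 3) R) (c : Fin 10 → R) : Fin 10 → R :=
  ![ev c (g 0), ev c (g 1), ev c (g 2), d1 c (g 0) (g 1), d1 c (g 0) (g 2), d1 c (g 1) (g 0),
    d1 c (g 1) (g 2), d1 c (g 2) (g 0), d1 c (g 2) (g 1), d3 c (g 0) (g 1) (g 2)]

/-- coefficients of the Hessian -/
def hc (c : Fin 10 → R) : Fin 10 → R :=
  ![24*c 0*c 5*c 7 - 6*c 0*c 9^2 + 8*c 3*c 4*c 9 - 8*c 3^2*c 7 - 8*c 4^2*c 5,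
    24*c 1*c 3*c 8 - 6*c 1*c 9^2 - 8*c 3*c 6^2 + 8*c 5*c 6*c 9 - 8*c 5^2*c 8,
    24*c 2*c 4*c 6 - 6*c 2*c 9^2 - 8*c 4*c 8^2 - 8*c 6*c 7^2 + 8*c 7*c 8*c 9,
    72*c 0*c 1*c 7 + 24*c 0*c 5*c 8 - 24*c 0*c 6*c 9 - 24*c 1*c 4^2 + 16*c 3*c 4*c 6
      - 8*c 3*c 5*c 7 + 2*c 3*c 9^2 - 8*c 3^2*c 8,
    72*c 0*c 2*c 5 + 24*c 0*c 6*c 7 - 24*c 0*c 8*c 9 - 24*c 2*c 3^2 + 16*c 3*c 4*c 8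
      - 8*c 4*c 5*c 7 + 2*c 4*c 9^2 - 8*c 4^2*c 6,
    72*c 0*c 1*c 8 - 24*c 0*c 6^2 + 24*c 1*c 3*c 7 - 24*c 1*c 4*c 9 - 8*c 3*c 5*c 8
      + 16*c 4*c 5*c 6 + 2*c 5*c 9^2 - 8*c 5^2*c 7,
    72*c 1*c 2*c 3 + 24*c 1*c 4*c 8 - 24*c 1*c 7*c 9 - 24*c 2*c 5^2 - 8*c 3*c 6*c 8
      - 8*c 4*c 6^2 + 16*c 5*c 6*c 7 + 2*c 6*c 9^2,
    72*c 0*c 2*c 6 - 24*c 0*c 8^2 - 24*c 2*c 3*c 9 + 24*c 2*c 4*c 5 + 16*c 3*c 7*c 8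
      - 8*c 4*c 6*c 7 - 8*c 5*c 7^2 + 2*c 7*c 9^2,
    72*c 1*c 2*c 4 - 24*c 1*c 7^2 + 24*c 2*c 3*c 6 - 24*c 2*c 5*c 9 - 8*c 3*c 8^2
      - 8*c 4*c 6*c 8 + 16*c 5*c 7*c 8 + 2*c 8*c 9^2,
    216*c 0*c 1*c 2 - 24*c 0*c 6*c 8 - 24*c 1*c 4*c 7 - 24*c 2*c 3*c 5 + 24*c 3*c 6*c 7
      - 8*c 3*c 8*c 9 + 24*c 4*c 5*c 8 - 8*c 4*c 6*c 9 - 8*c 5*c 7*c 9 + 2*c 9^3]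

/-- matrix of second derivatives -/
def hm (c : Fin 10 → R) (u : Fin 3 → R) : Matrix (Fin 3) (Fin 3) R :=
  !![6*c 0*u 0+2*c 3*u 1+2*c 4*u 2, 2*c 3*u 0+2*c 5*u 1+c 9*u 2, 2*c 4*u 0+c 9*u 1+2*c 7*u 2;
     2*c 3*u 0+2*c 5*u 1+c 9*u 2, 2*c 5*u 0+6*c 1*u 1+2*c 6*u 2, c 9*u 0+2*c 6*u 1+2*c 8*u 2;
     2*c 4*u 0+c 9*u 1+2*c 7*u 2, c 9*u 0+2*c 6*u 1+2*c 8*u 2, 2*c 7*u 0+2*c 8*u 1+6*c 2*u 2]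

lemma ext10 {S : Type*} {a b : Fin 10 → S} (h0 : a 0 = b 0) (h1 : a 1 = b 1) (h2 : a 2 = b 2)
    (h3 : a 3 = b 3) (h4 : a 4 = b 4) (h5 : a 5 = b 5) (h6 : a 6 = b 6) (h7 : a 7 = b 7)
    (h8 : a 8 = b 8) (h9 : a 9 = b 9) : a = b := by
  funext i
  fin_cases i <;> assumption

lemma vm0 (u : Fin 3 → R) (g : Matrix (Fin 3) (Fin 3) R) (j : Fin 3) :
    (u ᵥ* g) j = u 0 * g 0 j + u 1 * g 1 j + u 2 * g 2 j := by
  simp [Matrix.vecMul, dotProduct, Fin.sum_univ_three]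

lemma hc_0 (c : Fin 10 → R) : hc c 0 =
    24*c 0*c 5*c 7 - 6*c 0*c 9^2 + 8*c 3*c 4*c 9 - 8*c 3^2*c 7
      - 8*c 4^2*c 5 := rfl
lemma hc_1 (c : Fin 10 → R) : hc c 1 =
    24*c 1*c 3*c 8 - 6*c 1*c 9^2 - 8*c 3*c 6^2 + 8*c 5*c 6*c 9
      - 8*c 5^2*c 8 := rfl
lemma hc_2 (c : Fin 10 → R) : hc c 2 =
    24*c 2*c 4*c 6 - 6*c 2*c 9^2 - 8*c 4*c 8^2 - 8*c 6*c 7^2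
      + 8*c 7*c 8*c 9 := rfl
lemma hc_3 (c : Fin 10 → R) : hc c 3 =
    72*c 0*c 1*c 7 + 24*c 0*c 5*c 8 - 24*c 0*c 6*c 9 - 24*c 1*c 4^2
      + 16*c 3*c 4*c 6 - 8*c 3*c 5*c 7 + 2*c 3*c 9^2 - 8*c 3^2*c 8 := rfl
lemma hc_4 (c : Fin 10 → R) : hc c 4 =
    72*c 0*c 2*c 5 + 24*c 0*c 6*c 7 - 24*c 0*c 8*c 9 - 24*c 2*c 3^2
      + 16*c 3*c 4*c 8 - 8*c 4*c 5*c 7 + 2*c 4*c 9^2 - 8*c 4^2*c 6 := rfl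
lemma hc_5 (c : Fin 10 → R) : hc c 5 =
    72*c 0*c 1*c 8 - 24*c 0*c 6^2 + 24*c 1*c 3*c 7 - 24*c 1*c 4*c 9
      - 8*c 3*c 5*c 8 + 16*c 4*c 5*c 6 + 2*c 5*c 9^2 - 8*c 5^2*c 7 := rfl
lemma hc_6 (c : Fin 10 → R) : hc c 6 =
    72*c 1*c 2*c 3 + 24*c 1*c 4*c 8 - 24*c 1*c 7*c 9 - 24*c 2*c 5^2
      - 8*c 3*c 6*c 8 - 8*c 4*c 6^2 + 16*c 5*c 6*c 7 + 2*c 6*c 9^2 := rfl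
lemma hc_7 (c : Fin 10 → R) : hc c 7 =
    72*c 0*c 2*c 6 - 24*c 0*c 8^2 - 24*c 2*c 3*c 9 + 24*c 2*c 4*c 5
      + 16*c 3*c 7*c 8 - 8*c 4*c 6*c 7 - 8*c 5*c 7^2 + 2*c 7*c 9^2 := rfl
lemma hc_8 (c : Fin 10 → R) : hc c 8 =
    72*c 1*c 2*c 4 - 24*c 1*c 7^2 + 24*c 2*c 3*c 6 - 24*c 2*c 5*c 9
      - 8*c 3*c 8^2 - 8*c 4*c 6*c 8 + 16*c 5*c 7*c 8 + 2*c 8*c 9^2 := rfl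
lemma hc_9 (c : Fin 10 → R) : hc c 9 =
    216*c 0*c 1*c 2 - 24*c 0*c 6*c 8 - 24*c 1*c 4*c 7 - 24*c 2*c 3*c 5
      + 24*c 3*c 6*c 7 - 8*c 3*c 8*c 9 + 24*c 4*c 5*c 8 - 8*c 4*c 6*c 9
      - 8*c 5*c 7*c 9 + 2*c 9^3 := rfl

lemma act_0 (g : Matrix (Fin 3) (Fin 3) R) (c : Fin 10 → R) : act g c 0 = ev c (g 0) := rfl
lemma act_1 (g : Matrix (Fin 3) (Fin 3) R) (c : Fin 10 → R) : act g c 1 = ev c (g 1) := rfl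
lemma act_2 (g : Matrix (Fin 3) (Fin 3) R) (c : Fin 10 → R) : act g c 2 = ev c (g 2) := rfl
lemma act_3 (g : Matrix (Fin 3) (Fin 3) R) (c : Fin 10 → R) : act g c 3 = d1 c (g 0) (g 1) := rfl
lemma act_4 (g : Matrix (Fin 3) (Fin 3) R) (c : Fin 10 → R) : act g c 4 = d1 c (g 0) (g 2) := rfl
lemma act_5 (g : Matrix (Fin 3) (Fin 3) R) (c : Fin 10 → R) : act g c 5 = d1 c (g 1) (g 0) := rfl
lemma act_6 (g : Matrix (Fin 3) (Fin 3) R) (c : Fin 10 → R) : act g c 6 = d1 c (g 1) (g 2) := rfl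
lemma act_7 (g : Matrix (Fin 3) (Fin 3) R) (c : Fin 10 → R) : act g c 7 = d1 c (g 2) (g 0) := rfl
lemma act_8 (g : Matrix (Fin 3) (Fin 3) R) (c : Fin 10 → R) : act g c 8 = d1 c (g 2) (g 1) := rfl
lemma act_9 (g : Matrix (Fin 3) (Fin 3) R) (c : Fin 10 → R) :
    act g c 9 = d3 c (g 0) (g 1) (g 2) := rfl

lemma ev_act (g : Matrix (Fin 3) (Fin 3) R) (c : Fin 10 → R) (u : Fin 3 → R) :
    ev (act g c) u = ev c (u ᵥ* g) := by
  have h0 := vm0 u g 0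
  have h1 := vm0 u g 1
  have h2 := vm0 u g 2
  rw [ev.eq_1 c (u ᵥ* g), h0, h1, h2]
  simp only [ev, act_0, act_1, act_2, act_3, act_4, act_5, act_6, act_7, act_8, act_9, d1, d3]
  ring

lemma d1_act (g : Matrix (Fin 3) (Fin 3) R) (c : Fin 10 → R) (u v : Fin 3 → R) :
    d1 (act g c) u v = d1 c (u ᵥ* g) (v ᵥ* g) := by
  rw [d1.eq_1 c (u ᵥ* g)]
  simp only [vm0]
  simp only [ev, act_0, act_1, act_2, act_3, act_4, act_5, act_6, act_7, act_8, act_9, d1, d3]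
  ring

lemma d3_act (g : Matrix (Fin 3) (Fin 3) R) (c : Fin 10 → R) (u v w : Fin 3 → R) :
    d3 (act g c) u v w = d3 c (u ᵥ* g) (v ᵥ* g) (w ᵥ* g) := by
  rw [d3.eq_1 c (u ᵥ* g)]
  simp only [vm0]
  simp only [ev, act_0, act_1, act_2, act_3, act_4, act_5, act_6, act_7, act_8, act_9, d1, d3]
  ring

lemma mulrow (g h : Matrix (Fin 3) (Fin 3) R) (i : Fin 3) : (g * h) i = g i ᵥ* h := by
  ext j; simp [Matrix.mul_apply, Matrix.vecMul, dotProduct]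

lemma act_mul (g h : Matrix (Fin 3) (Fin 3) R) (c : Fin 10 → R) :
    act (g * h) c = act g (act h c) := by
  simp only [act.eq_1 (g * h), mulrow, act.eq_1 g, ev_act, d1_act, d3_act]

lemma act_one (c : Fin 10 → R) : act 1 c = c := by
  ext i
  fin_cases i <;> simp [act, ev, d1, d3]

lemma act_add (g : Matrix (Fin 3) (Fin 3) R) (c d : Fin 10 → R) :
    act g (c + d) = act g c + act g d := by
  apply ext10 <;> simp only [Pi.add_apply, act_0, act_1, act_2, act_3, act_4, act_5, act_6, act_7, act_8, act_9, ev, d1, d3] <;> ring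

lemma act_smul (g : Matrix (Fin 3) (Fin 3) R) (t : R) (c : Fin 10 → R) :
    act g (t • c) = t • act g c := by
  apply ext10 <;> simp only [Pi.smul_apply, smul_eq_mul, act_0, act_1, act_2, act_3, act_4, act_5, act_6, act_7, act_8, act_9, ev, d1, d3] <;> ring

lemma act_scalar (t : R) (g : Matrix (Fin 3) (Fin 3) R) (c : Fin 10 → R) :
    act (t • g) c = t ^ 3 • act g c := by
  have h1 : ∀ c : Fin 10 → R, act (t • (1 : Matrix (Fin 3) (Fin 3) R)) c = t ^ 3 • c := by
    intro c
    ext i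
    fin_cases i <;> simp [act, ev, d1, d3] <;> ring
  have : t • g = (t • (1 : Matrix (Fin 3) (Fin 3) R)) * g := by simp
  rw [this, act_mul, h1]

lemma hc_smul (t : R) (c : Fin 10 → R) : hc (t • c) = t ^ 3 • hc c := by
  apply ext10 <;> simp only [Pi.smul_apply, smul_eq_mul, hc_0, hc_1, hc_2, hc_3, hc_4, hc_5, hc_6,
    hc_7, hc_8, hc_9] <;> ring

lemma ev_hc (c : Fin 10 → R) (u : Fin 3 → R) : ev (hc c) u = (hm c u).det := by
  rw [Matrix.det_fin_three]
  simp only [ev, hc_0, hc_1, hc_2, hc_3, hc_4, hc_5, hc_6, hc_7, hc_8, hc_9, hm, Matrix.of_apply,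
    Matrix.cons_val, Matrix.cons_val_zero, Matrix.cons_val_one]
  ring

lemma hm_act (g : Matrix (Fin 3) (Fin 3) R) (c : Fin 10 → R) (u : Fin 3 → R) :
    hm (act g c) u = g * hm c (u ᵥ* g) * gᵀ := by
  ext i j
  rw [Matrix.mul_apply, Fin.sum_univ_three]
  simp only [Matrix.mul_apply, Fin.sum_univ_three, Matrix.transpose_apply]
  fin_cases i <;> fin_cases j <;>
    simp [hm, vm0] <;>
    simp only [ev, act_0, act_1, act_2, act_3, act_4, act_5, act_6, act_7, act_8, act_9, d1, d3] <;>
    ring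

lemma ev_hc_act (g : Matrix (Fin 3) (Fin 3) R) (c : Fin 10 → R) (u : Fin 3 → R) :
    ev (hc (act g c)) u = ev (g.det ^ 2 • act g (hc c)) u := by
  have : ev (g.det ^ 2 • act g (hc c)) u = g.det ^ 2 * ev (act g (hc c)) u := by
    simp [ev]; ring
  rw [this, ev_act, ev_hc, ev_hc, hm_act, Matrix.det_mul, Matrix.det_mul, Matrix.det_transpose]
  ring

end basic
end TC


namespace TC
open Matrix MvPolynomial

section mv
variable {R S : Type*} [CommRing R] [CommRing S]

lemma ev_map (φ : R →+* S) (c : Fin 10 → R) (u : Fin 3 → R) :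
    ev (fun k => φ (c k)) (fun k => φ (u k)) = φ (ev c u) := by
  simp only [ev, map_add, map_mul, map_pow]

lemma d1_map (φ : R →+* S) (c : Fin 10 → R) (u v : Fin 3 → R) :
    d1 (fun k => φ (c k)) (fun k => φ (u k)) (fun k => φ (v k)) = φ (d1 c u v) := by
  simp only [d1, map_add, map_mul, map_pow, map_ofNat]

lemma d3_map (φ : R →+* S) (c : Fin 10 → R) (u v w : Fin 3 → R) :
    d3 (fun k => φ (c k)) (fun k => φ (u k)) (fun k => φ (v k)) (fun k => φ (w k))
      = φ (d3 c u v w) := by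
  simp only [d3, map_add, map_mul, map_ofNat]

lemma act_map (φ : R →+* S) (g : Matrix (Fin 3) (Fin 3) R) (c : Fin 10 → R) :
    act (g.map φ) (fun k => φ (c k)) = fun k => φ (act g c k) := by
  have h : ∀ i, (g.map φ) i = fun k => φ (g i k) := fun i => rfl
  apply ext10 <;> simp only [act_0, act_1, act_2, act_3, act_4, act_5, act_6, act_7, act_8, act_9,
    h, ev_map, d1_map, d3_map]

lemma hc_map (φ : R →+* S) (c : Fin 10 → R) :
    hc (fun k => φ (c k)) = fun k => φ (hc c k) := by
  apply ext10 <;> simp only [hc_0, hc_1, hc_2, hc_3, hc_4, hc_5, hc_6,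
    hc_7, hc_8, hc_9, map_add, map_sub, map_mul, map_pow, map_ofNat]

lemma cubic_eq_ev (c : Fin 10 → R) :
    cubic c = ev (fun k => (C (c k) : MvPolynomial (Fin 3) R)) X := by
  simp only [cubic, Fin.sum_univ_succ, Fin.prod_univ_three, ev]
  simp [expo]
  ring

lemma eval_cubic (c : Fin 10 → R) (v : Fin 3 → R) : eval v (cubic c) = ev c v := by
  rw [cubic_eq_ev, ← ev_map (eval v : MvPolynomial (Fin 3) R →+* R)]
  simp

/-- exponents as finsupp -/
noncomputable def expoF (k : Fin 10) : Fin 3 →₀ ℕ := Finsupp.equivFunOnFinite.symm (expo k)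

lemma expoF_inj : Function.Injective expoF := by
  intro a b h
  have h' : expo a = expo b := Finsupp.equivFunOnFinite.symm.injective h
  have key : ∀ a b, expo a = expo b → a = b := by decide
  exact key a b h'

lemma cubic_eq_mono (c : Fin 10 → R) : cubic c = ∑ k, monomial (expoF k) (c k) := by
  unfold cubic
  refine Finset.sum_congr rfl fun k _ => ?_
  rw [monomial_eq, Finsupp.prod_fintype _ _ (by simp)]
  simp [expoF]

lemma cubic_inj : Function.Injective (cubic : (Fin 10 → R) → _) := by
  intro c d h
  funext k
  have := congrArg (coeff (expoF k)) h
  simpa [cubic_eq_mono, coeff_sum, coeff_monomial, expoF_inj.eq_iff] using this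

lemma actGL_cubic (g : Matrix (Fin 3) (Fin 3) R) (c : Fin 10 → R) :
    actGL g (cubic c) = cubic (act g c) := by
  rw [cubic_eq_ev (act g c), ← act_map, ev_act, cubic_eq_ev]
  unfold actGL
  generalize hL : (fun j => ∑ i : Fin 3, C (g i j) * X i : Fin 3 → MvPolynomial (Fin 3) R) = L
  have hv : (X ᵥ* g.map C : Fin 3 → MvPolynomial (Fin 3) R) = L := by
    rw [← hL]
    funext j
    simp [Matrix.vecMul, dotProduct, mul_comm]
  rw [hv]
  simp only [ev, map_add, map_mul, map_pow, bind₁_C_right, bind₁_X_right]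

lemma hess_cubic (c : Fin 10 → R) : hess (cubic c) = cubic (hc c) := by
  rw [cubic_eq_ev (hc c), ← hc_map, ev_hc, cubic_eq_ev]
  unfold hess
  have p2 : ∀ i : Fin 3, pderiv i (2 : MvPolynomial (Fin 3) R) = 0 := by
    intro i
    exact pderiv_C (a := (2 : R))
  have p3 : ∀ i : Fin 3, pderiv i (3 : MvPolynomial (Fin 3) R) = 0 := by
    intro i
    exact pderiv_C (a := (3 : R))
  congr 1
  ext1 i j
  fin_cases i <;> fin_cases j <;>
    simp [p2, p3, ev, hm, pderiv_X, Pi.single_apply, Derivation.leibniz, Derivation.leibniz_pow] <;> ring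

lemma hc_act (g : Matrix (Fin 3) (Fin 3) R) (c : Fin 10 → R) :
    hc (act g c) = g.det ^ 2 • act g (hc c) := by
  apply cubic_inj
  rw [cubic_eq_ev, cubic_eq_ev]
  have h := ev_hc_act (g.map (C : R →+* MvPolynomial (Fin 3) R)) (fun k => C (c k)) X
  rw [act_map, hc_map, hc_map, act_map] at h
  rw [h]
  congr 1
  funext k
  simp only [Pi.smul_apply, smul_eq_mul, map_mul, map_pow]
  rw [RingHom.map_det]; rfl

end mv

section inv
variable {P Q : MvPolynomial (Fin 10) ℚ} (h : IsInvariantPair ℚ P Q)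
include h

lemma hh_gen : hc (hc (X : Fin 10 → MvPolynomial (Fin 10) ℚ)) =
    (12288 * P ^ 2) • (X : Fin 10 → MvPolynomial (Fin 10) ℚ) + (512 * Q) • hc X := by
  apply cubic_inj
  have h3 := h.2.2.1
  have e : genCubic ℚ = cubic (X : Fin 10 → MvPolynomial (Fin 10) ℚ) := rfl
  rw [e, hess_cubic, hess_cubic] at h3
  rw [h3]
  have lin : ∀ a b : MvPolynomial (Fin 10) ℚ, ∀ c d : Fin 10 → MvPolynomial (Fin 10) ℚ,
      cubic (a • c + b • d) = C a * cubic c + C b * cubic d := by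
    intro a b c d
    simp only [cubic_eq_ev, ev, Pi.add_apply, Pi.smul_apply, smul_eq_mul, map_add, map_mul]
    ring
  rw [lin]
  simp only [map_mul, map_pow, map_ofNat]

lemma hh {A : Type*} [CommRing A] [Algebra ℚ A] (c : Fin 10 → A) :
    hc (hc c) = (12288 * aeval c P ^ 2) • c + (512 * aeval c Q) • hc c := by
  have h1 := hh_gen h
  have h2 : (fun k => aeval c (hc (hc (X : Fin 10 → MvPolynomial (Fin 10) ℚ)) k)) = hc (hc c) := by
    have := hc_map (aeval c : MvPolynomial (Fin 10) ℚ →ₐ[ℚ] A).toRingHom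
    simp only [AlgHom.toRingHom_eq_coe, RingHom.coe_coe] at this
    rw [← this, ← this]
    simp
  have h3 : (fun k => aeval c (hc (X : Fin 10 → MvPolynomial (Fin 10) ℚ) k)) = hc c := by
    have := hc_map (aeval c : MvPolynomial (Fin 10) ℚ →ₐ[ℚ] A).toRingHom
    simp only [AlgHom.toRingHom_eq_coe, RingHom.coe_coe] at this
    rw [← this]
    simp
  rw [← h2, h1]
  funext k
  simp [← congrFun h3 k]

lemma inv_generic {A : Type*} [CommRing A] [IsDomain A] [Algebra ℚ A] (c : Fin 10 → A)
    (g : Matrix (Fin 3) (Fin 3) A) (hg : g.det ≠ 0) (i j : Fin 10)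
    (hij : c i * hc c j - c j * hc c i ≠ 0) :
    aeval (act g c) P ^ 2 = g.det ^ 8 * aeval c P ^ 2 ∧
    aeval (act g c) Q = g.det ^ 6 * aeval c Q := by
  have e1 := hh h c
  have e2 := hh h (act g c)
  have e3 : hc (hc (act g c)) = g.det ^ 8 • act g (hc (hc c)) := by
    rw [hc_act, hc_smul, hc_act, smul_smul]; congr 1; ring
  rw [e3, e1, hc_act] at e2
  have e4 : act g.adjugate (g.det ^ 8 • act g ((12288 * (aeval c) P ^ 2) • c + (512 * (aeval c) Q) • hc c))
    = act g.adjugate ((12288 * (aeval (act g c)) P ^ 2) • act g c + (512 * (aeval (act g c)) Q) • g.det ^ 2 • act g (hc c)) := by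
    rw [e2]
  simp only [act_add, act_smul, ← act_mul, Matrix.adjugate_mul, act_scalar, act_one] at e4
  have z : ∀ n : ℕ, (n : A) = 0 → n = 0 := by
    have : CharZero A := algebraRat.charZero A
    intro n hn; exact_mod_cast hn
  have f := fun k => congrFun e4 k
  simp only [Pi.add_apply, Pi.smul_apply, smul_eq_mul] at f
  have fi := f i
  have fj := f j
  have d3 : g.det ^ 3 ≠ 0 := pow_ne_zero _ hg
  have : CharZero A := algebraRat.charZero A
  constructor
  · have : g.det ^ 3 * 12288 * (c i * hc c j - c j * hc c i) *
      (aeval (act g c) P ^ 2 - g.det ^ 8 * aeval c P ^ 2) = 0 := by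
      linear_combination (hc c i) * fj - (hc c j) * fi
    have h12 : (12288 : A) ≠ 0 := by norm_num
    have := (mul_eq_zero.mp this).resolve_left (by
      exact mul_ne_zero (mul_ne_zero d3 h12) hij)
    linear_combination this
  · have : g.det ^ 3 * g.det ^ 2 * 512 * (c i * hc c j - c j * hc c i) *
      (aeval (act g c) Q - g.det ^ 6 * aeval c Q) = 0 := by
      linear_combination (c j) * fi - (c i) * fj
    have h12 : (512 : A) ≠ 0 := by norm_num
    have := (mul_eq_zero.mp this).resolve_left (by
      exact mul_ne_zero (mul_ne_zero (mul_ne_zero d3 (pow_ne_zero _ hg)) h12) hij)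
    linear_combination this

end inv
end TC


namespace TC
open Matrix MvPolynomial

/-- the real invariant attached to an invariant polynomial -/
noncomputable def iv (P : MvPolynomial (Fin 10) ℚ) (c : Fin 10 → ℝ) : ℝ := aeval c P

lemma iv_continuous (P : MvPolynomial (Fin 10) ℚ) : Continuous (iv P) := by
  have : iv P = fun c => eval c (map (algebraMap ℚ ℝ) P) := by
    funext c
    simp [iv, aeval_def, eval_map]
  rw [this]
  exact MvPolynomial.continuous_eval _

lemma iv_cast (P : MvPolynomial (Fin 10) ℚ) (c : Fin 10 → ℚ) :
    iv P (fun k => (c k : ℝ)) = ((aeval c P : ℚ) : ℝ) := by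
  exact MvPolynomial.aeval_algebraMap_apply ℝ c P

lemma cbrt (t : ℝ) : ∃ s : ℝ, s ^ 3 = t := by
  have h : ∀ t : ℝ, 0 ≤ t → ∃ s : ℝ, s ^ 3 = t := by
    intro t ht
    refine ⟨t ^ ((1 : ℝ) / 3), ?_⟩
    rw [← Real.rpow_natCast, ← Real.rpow_mul ht]
    norm_num
  rcases le_total 0 t with ht | ht
  · exact h t ht
  · obtain ⟨s, hs⟩ := h (-t) (by linarith)
    exact ⟨-s, by rw [Odd.neg_pow (by decide), hs]; ring⟩

section inv
variable {P Q : MvPolynomial (Fin 10) ℚ} (h : IsInvariantPair ℚ P Q)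
include h

lemma iv_W (A B : ℝ) : iv P (wcoeffs A B) = -3 * A ∧ iv Q (wcoeffs A B) = -27 * B := by
  have hc : ∀ p : MvPolynomial (Fin 10) ℚ, Continuous fun x : ℝ × ℝ => iv p (wcoeffs x.1 x.2) := by
    intro p
    refine (iv_continuous p).comp ?_
    refine continuous_pi fun i => ?_
    fin_cases i <;> simp [wcoeffs] <;> fun_prop
  have hd : DenseRange fun x : ℚ × ℚ => ((x.1 : ℝ), (x.2 : ℝ)) :=
    Rat.denseRange_cast.prodMap Rat.denseRange_cast
  have hw : ∀ x : ℚ × ℚ, wcoeffs (x.1 : ℝ) (x.2 : ℝ) = fun k => ((wcoeffs x.1 x.2 k : ℚ) : ℝ) := by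
    intro x
    apply ext10 <;> simp [wcoeffs]
  constructor
  · have := DenseRange.equalizer hd (g := fun x : ℝ × ℝ => iv P (wcoeffs x.1 x.2))
      (h := fun x => -3 * x.1) (hc P) (by fun_prop) (by
        funext x
        simp only [Function.comp]
        rw [hw, iv_cast, (h.2.2.2 x.1 x.2).1]
        push_cast; ring)
    exact congrFun this (A, B)
  · have := DenseRange.equalizer hd (g := fun x : ℝ × ℝ => iv Q (wcoeffs x.1 x.2))
      (h := fun x => -27 * x.2) (hc Q) (by fun_prop) (by
        funext x
        simp only [Function.comp]
        rw [hw, iv_cast, (h.2.2.2 x.1 x.2).2]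
        push_cast; ring)
    exact congrFun this (A, B)

open Polynomial in
lemma iv_act (g : Matrix (Fin 3) (Fin 3) ℝ) (c : Fin 10 → ℝ) :
    iv P (act g c) = g.det ^ 4 * iv P c ∧ iv Q (act g c) = g.det ^ 6 * iv Q c := by
  let G : Matrix (Fin 3) (Fin 3) ℝ[X] := 1 + (Polynomial.X : ℝ[X]) • (g - 1).map Polynomial.C
  let w : Fin 10 → ℝ := wcoeffs 1 1
  let c' : Fin 10 → ℝ[X] := fun k =>
    Polynomial.C (w k) + Polynomial.X * Polynomial.C (c k - w k)
  have hG : ∀ t : ℝ, G.map (Polynomial.evalRingHom t) = 1 + t • (g - 1) := by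
    intro t
    ext i j
    by_cases hij : i = j <;> simp [G, hij] <;> ring
  have hc' : ∀ t : ℝ, (fun k => Polynomial.evalRingHom t (c' k)) = fun k => w k + t * (c k - w k) := by
    intro t; funext k; simp [c']
  have hdet : ∀ t : ℝ, Polynomial.evalRingHom t G.det = (1 + t • (g - 1)).det := by
    intro t
    rw [RingHom.map_det, ← hG t]; rfl
  have hae : ∀ (t : ℝ) (p : MvPolynomial (Fin 10) ℚ) (d : Fin 10 → ℝ[X]),
      Polynomial.evalRingHom t (MvPolynomial.aeval d p)
        = iv p (fun k => Polynomial.evalRingHom t (d k)) := by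
    intro t p d
    have := (MvPolynomial.comp_aeval_apply (R := ℚ) (f := d)
      ((Polynomial.aeval t : ℝ[X] →ₐ[ℝ] ℝ).restrictScalars ℚ) p)
    have e : ∀ q : ℝ[X], ((Polynomial.aeval t : ℝ[X] →ₐ[ℝ] ℝ).restrictScalars ℚ) q
        = Polynomial.evalRingHom t q := by
      intro q; simp [Polynomial.aeval_def]
    simp only [e] at this
    exact this
  have hact : ∀ t : ℝ, (fun k => Polynomial.evalRingHom t (act G c' k))
      = act (1 + t • (g - 1)) (fun k => w k + t * (c k - w k)) := by
    intro t
    rw [← act_map, hG, hc']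
  have hd0 : G.det ≠ 0 := by
    intro h0
    have := hdet 0
    rw [h0] at this
    simp at this
  have hm : c' 0 * hc c' 5 - c' 5 * hc c' 0 ≠ 0 := by
    intro h0
    have := congrArg (Polynomial.evalRingHom (0 : ℝ)) h0
    rw [map_sub, map_mul, map_mul] at this
    have e : ∀ k, Polynomial.evalRingHom (0 : ℝ) (hc c' k) = hc w k := by
      intro k
      have h1 := congrFun (hc_map (Polynomial.evalRingHom (0 : ℝ)) c') k
      rw [← h1, hc' 0]
      simp
    have e' : ∀ k, Polynomial.evalRingHom (0 : ℝ) (c' k) = w k := by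
      intro k; simp [c']
    rw [e, e, e', e', hc_5, hc_0] at this
    simp [w, wcoeffs] at this
  obtain ⟨h1, h2⟩ := inv_generic h c' G hd0 0 5 hm
  have at1 : (fun k => Polynomial.evalRingHom (1 : ℝ) (act G c' k)) = act g c := by
    rw [hact]; simp
  have at1c : (fun k => Polynomial.evalRingHom (1 : ℝ) (c' k)) = c := by
    rw [hc']; simp
  have at1d : Polynomial.evalRingHom (1 : ℝ) G.det = g.det := by rw [hdet]; simp
  have at0 : (fun k => Polynomial.evalRingHom (0 : ℝ) (act G c' k)) = w := by
    rw [hact]; simp [act_one]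
  have at0c : (fun k => Polynomial.evalRingHom (0 : ℝ) (c' k)) = w := by
    rw [hc']; simp
  have at0d : Polynomial.evalRingHom (0 : ℝ) G.det = 1 := by rw [hdet]; simp
  constructor
  · have h3 : (MvPolynomial.aeval (act G c') P - G.det ^ 4 * MvPolynomial.aeval c' P) *
        (MvPolynomial.aeval (act G c') P + G.det ^ 4 * MvPolynomial.aeval c' P) = 0 := by
      linear_combination h1
    have wI : iv P w = -3 := by rw [(iv_W h 1 1).1]; norm_num
    rcases mul_eq_zero.mp h3 with h4 | h4
    · have := congrArg (Polynomial.evalRingHom (1 : ℝ)) h4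
      rw [map_sub, map_mul, map_pow, hae, hae, at1, at1c, at1d, map_zero] at this
      linarith
    · exfalso
      have := congrArg (Polynomial.evalRingHom (0 : ℝ)) h4
      rw [map_add, map_mul, map_pow, hae, hae, at0, at0c, at0d, map_zero, wI] at this
      norm_num at this
  · have := congrArg (Polynomial.evalRingHom (1 : ℝ)) h2
    rw [map_mul, map_pow, hae, hae, at1, at1c, at1d] at this
    exact this

lemma iv_smul (t : ℝ) (c : Fin 10 → ℝ) :
    iv P (t • c) = t ^ 4 * iv P c ∧ iv Q (t • c) = t ^ 6 * iv Q c := by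
  obtain ⟨s, rfl⟩ := cbrt t
  have e : (s ^ 3) • c = act (s • (1 : Matrix (Fin 3) (Fin 3) ℝ)) c := by
    rw [act_scalar, act_one]
  have h1 := iv_act h (s • (1 : Matrix (Fin 3) (Fin 3) ℝ)) c
  rw [← e] at h1
  have hd : (s • (1 : Matrix (Fin 3) (Fin 3) ℝ)).det = s ^ 3 := by simp [Matrix.det_smul]
  rw [hd] at h1
  exact h1

end inv
end TC


namespace TC
open Matrix MvPolynomial

/-- generalized Weierstrass coefficients -/
def gw (a b k c e : ℝ) : Fin 10 → ℝ := ![a, 0, e, 0, b, 0, k, c, 0, 0]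

/-- Hesse form -/
def hes {R : Type*} [CommRing R] (δ : R) : Fin 10 → R := ![1, 1, 1, 0, 0, 0, 0, 0, 0, δ]

lemma gw_W (a b k c e : ℝ) (ha : a ≠ 0) (hk : k ≠ 0) : ∃ (g : Matrix (Fin 3) (Fin 3) ℝ) (A B : ℝ),
    g.det = 1 ∧ gw a b k c e = act g (wcoeffs A B) ∧
    -3 * A = k ^ 2 * (b ^ 2 - 3 * a * c) ∧
    -27 * B = k ^ 3 * (27 * a ^ 2 * e - 9 * a * b * c + 2 * b ^ 3) := by
  obtain ⟨p, rfl⟩ := cbrt a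
  have hp : p ≠ 0 := by rintro rfl; simp at ha
  refine ⟨!![p, 0, 0; 0, -k * p, 0; b / (3 * p ^ 2), 0, - 1 / (k * p ^ 2)],
    k ^ 2 * (b ^ 2 - 3 * p ^ 3 * c) / (-3),
    k ^ 3 * (27 * (p ^ 3) ^ 2 * e - 9 * p ^ 3 * b * c + 2 * b ^ 3) / (-27), ?_, ?_, by ring, by ring⟩
  · rw [Matrix.det_fin_three]; simp; field_simp
  · apply ext10 <;> simp [act, gw, ev, d1, d3, wcoeffs] <;> field_simp <;> ring

lemma dense_ne2 (a k : ℝ) : Dense {t : ℝ | a + t ≠ 0 ∧ k + t ≠ 0} := by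
  have : {t : ℝ | a + t ≠ 0 ∧ k + t ≠ 0} = ({-a, -k} : Set ℝ)ᶜ := by
    ext t
    simp only [Set.mem_ofPred_eq, Set.mem_compl_iff, Set.mem_insert_iff, Set.mem_singleton_iff,
      not_or]
    constructor
    · rintro ⟨h1, h2⟩
      exact ⟨fun h => h1 (by rw [h]; ring), fun h => h2 (by rw [h]; ring)⟩
    · rintro ⟨h1, h2⟩
      exact ⟨fun h => h1 (by linarith), fun h => h2 (by linarith)⟩
  rw [this]
  exact Set.Countable.dense_compl ℝ (Set.toFinite _).countable

section inv
variable {P Q : MvPolynomial (Fin 10) ℚ} (h : IsInvariantPair ℚ P Q)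
include h

lemma gw_inv (a b k c e : ℝ) : iv P (gw a b k c e) = k ^ 2 * (b ^ 2 - 3 * a * c) ∧
    iv Q (gw a b k c e) = k ^ 3 * (27 * a ^ 2 * e - 9 * a * b * c + 2 * b ^ 3) := by
  have hcont : Continuous fun t : ℝ => gw (a + t) b (k + t) c e := by
    refine continuous_pi fun i => ?_
    fin_cases i <;> simp [gw] <;> fun_prop
  have key : ∀ t ∈ {t : ℝ | a + t ≠ 0 ∧ k + t ≠ 0},
    iv P (gw (a + t) b (k + t) c e) = (k + t) ^ 2 * (b ^ 2 - 3 * (a + t) * c) ∧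
    iv Q (gw (a + t) b (k + t) c e)
      = (k + t) ^ 3 * (27 * (a + t) ^ 2 * e - 9 * (a + t) * b * c + 2 * b ^ 3) := by
    rintro t ⟨h1, h2⟩
    obtain ⟨g, A, B, hg, e1, e2, e3⟩ := gw_W (a + t) b (k + t) c e h1 h2
    rw [e1, (iv_act h g _).1, (iv_act h g _).2, (iv_W h A B).1, (iv_W h A B).2, hg, ← e2, ← e3]
    constructor <;> ring
  constructor
  · have := Continuous.ext_on (dense_ne2 a k) ((iv_continuous P).comp hcont)
      (g := fun t => (k + t) ^ 2 * (b ^ 2 - 3 * (a + t) * c)) (by fun_prop)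
      (fun t ht => (key t ht).1)
    simpa using congrFun this 0
  · have := Continuous.ext_on (dense_ne2 a k) ((iv_continuous Q).comp hcont)
      (g := fun t => (k + t) ^ 3 * (27 * (a + t) ^ 2 * e - 9 * (a + t) * b * c + 2 * b ^ 3))
      (by fun_prop) (fun t ht => (key t ht).2)
    simpa using congrFun this 0

/-- weighted limit: the terms of positive weight do not matter -/
lemma iv_limit (c : Fin 10 → ℝ) (hh : (c 2 = 0 ∧ c 7 = 0 ∧ c 8 = 0) ∨
      (c 0 = 0 ∧ c 1 = 0 ∧ c 3 = 0 ∧ c 5 = 0)) :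
    iv P c = iv P ![0, 0, 0, 0, c 4, 0, c 6, 0, 0, c 9] ∧
    iv Q c = iv Q ![0, 0, 0, 0, c 4, 0, c 6, 0, 0, c 9] := by
  have hd : ∀ s : ℝ, s ≠ 0 → (!![s, 0, 0; 0, s, 0; 0, 0, (s ^ 2)⁻¹] : Matrix (Fin 3) (Fin 3) ℝ).det = 1 := by
    intro s hs
    rw [Matrix.det_fin_three]; simp; field_simp
  have hden : Dense {s : ℝ | s ≠ 0} := by
    have := dense_ne2 0 0; simpa using this
  have key : ∀ (p : MvPolynomial (Fin 10) ℚ) (n : ℕ), (∀ g c, iv p (act g c) = Matrix.det g ^ n * iv p c) →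
      iv p c = iv p ![0, 0, 0, 0, c 4, 0, c 6, 0, 0, c 9] := by
    intro p n hp
    rcases hh with ⟨h2, h7, h8⟩ | ⟨h0, h1, h3, h5⟩
    · have hcont : Continuous fun s : ℝ =>
          (![s ^ 3 * c 0, s ^ 3 * c 1, 0, s ^ 3 * c 3, c 4, s ^ 3 * c 5, c 6, 0, 0, c 9] : Fin 10 → ℝ) := by
        refine continuous_pi fun i => ?_
        fin_cases i <;> simp <;> fun_prop
      have := Continuous.ext_on hden ((iv_continuous p).comp hcont)
        (g := fun _ => iv p c) (by fun_prop) (by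
          intro s hs
          have hs' : s ≠ 0 := hs
          have e : (![s ^ 3 * c 0, s ^ 3 * c 1, 0, s ^ 3 * c 3, c 4, s ^ 3 * c 5, c 6, 0, 0, c 9] : Fin 10 → ℝ)
            = act !![s, 0, 0; 0, s, 0; 0, 0, (s ^ 2)⁻¹] c := by
            apply ext10 <;> simp [act, ev, d1, d3, h2, h7, h8] <;> field_simp
          simp only [Function.comp]
          rw [e, hp, hd s hs']; simp)
      have h0 := congrFun this 0
      simpa using h0.symm
    · have hcont : Continuous fun s : ℝ =>
          (![0, 0, s ^ 6 * c 2, 0, c 4, 0, c 6, s ^ 3 * c 7, s ^ 3 * c 8, c 9] : Fin 10 → ℝ) := by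
        refine continuous_pi fun i => ?_
        fin_cases i <;> simp <;> fun_prop
      have := Continuous.ext_on hden ((iv_continuous p).comp hcont)
        (g := fun _ => iv p c) (by fun_prop) (by
          intro s hs
          have hs' : s ≠ 0 := hs
          have e : (![0, 0, s ^ 6 * c 2, 0, c 4, 0, c 6, s ^ 3 * c 7, s ^ 3 * c 8, c 9] : Fin 10 → ℝ)
            = act !![s⁻¹, 0, 0; 0, s⁻¹, 0; 0, 0, ((s⁻¹) ^ 2)⁻¹] c := by
            apply ext10 <;> simp [act, ev, d1, d3, h0, h1, h3, h5] <;> field_simp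
          simp only [Function.comp]
          rw [e, hp, hd s⁻¹ (inv_ne_zero hs')]; simp)
      have h0 := congrFun this 0
      simpa using h0.symm
  exact ⟨key P 4 fun g c => (iv_act h g c).1, key Q 6 fun g c => (iv_act h g c).2⟩

lemma disc_q (b k t : ℝ) :
    4 * iv P ![0, 0, 0, 0, b, 0, k, 0, 0, t] ^ 3 = iv Q ![0, 0, 0, 0, b, 0, k, 0, 0, t] ^ 2 := by
  have hcont : Continuous fun s : ℝ => (![0, 0, 0, 0, b, 0, k + s, 0, 0, t] : Fin 10 → ℝ) := by
    refine continuous_pi fun i => ?_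
    fin_cases i <;> simp <;> fun_prop
  have := Continuous.ext_on (dense_ne2 k k) (f := fun s =>
      4 * iv P ![0, 0, 0, 0, b, 0, k + s, 0, 0, t] ^ 3) (g := fun s =>
      iv Q ![0, 0, 0, 0, b, 0, k + s, 0, 0, t] ^ 2)
      (by have := (iv_continuous P).comp hcont; simp only [Function.comp_def] at this; fun_prop)
      (by have := (iv_continuous Q).comp hcont; simp only [Function.comp_def] at this; fun_prop) (by
      rintro s ⟨hs, -⟩
      have e : (![0, 0, 0, 0, b, 0, k + s, 0, 0, t] : Fin 10 → ℝ)
        = act !![1, t / (2 * (k + s)), 0; 0, 1, 0; 0, 0, 1]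
          (gw 0 (b - t ^ 2 / (4 * (k + s))) (k + s) 0 0) := by
        apply ext10 <;> simp [act, ev, d1, d3, gw] <;> field_simp <;> ring
      have hd : (!![1, t / (2 * (k + s)), 0; 0, 1, 0; 0, 0, 1] : Matrix (Fin 3) (Fin 3) ℝ).det = 1 := by
        rw [Matrix.det_fin_three]; simp
      simp only
      rw [e, (iv_act h _ _).1, (iv_act h _ _).2, hd, (gw_inv h _ _ _ _ _).1, (gw_inv h _ _ _ _ _).2]
      ring)
  simpa using congrFun this 0

/-- a real singular point forces vanishing discriminant -/
lemma disc_sing0 (c : Fin 10 → ℝ) (h2 : c 2 = 0) (h7 : c 7 = 0) (h8 : c 8 = 0) :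
    4 * iv P c ^ 3 = iv Q c ^ 2 := by
  have := iv_limit h c (Or.inl ⟨h2, h7, h8⟩)
  rw [this.1, this.2, disc_q h]

lemma disc_line (c : Fin 10 → ℝ) (h0 : c 0 = 0) (h1 : c 1 = 0) (h3 : c 3 = 0) (h5 : c 5 = 0) :
    4 * iv P c ^ 3 = iv Q c ^ 2 := by
  have := iv_limit h c (Or.inr ⟨h0, h1, h3, h5⟩)
  rw [this.1, this.2, disc_q h]

lemma disc_act (g : Matrix (Fin 3) (Fin 3) ℝ) (hg : g.det ≠ 0) (c : Fin 10 → ℝ)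
    (hc : 4 * iv P (act g c) ^ 3 = iv Q (act g c) ^ 2) : 4 * iv P c ^ 3 = iv Q c ^ 2 := by
  rw [(iv_act h g c).1, (iv_act h g c).2] at hc
  have : g.det ^ 12 * (4 * iv P c ^ 3 - iv Q c ^ 2) = 0 := by linear_combination hc
  have := (mul_eq_zero.mp this).resolve_left (pow_ne_zero _ hg)
  linarith

lemma hes_inv (δ : ℝ) : iv P (hes δ) = δ * (δ ^ 3 - 216) / 16 ∧
    iv Q (hes δ) = -(δ ^ 6 + 540 * δ ^ 3 - 5832) / 32 := by
  have e : act !![1, δ/6, δ/6; 0, 1, -1; 0, 1/6, 1/6] (hes δ)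
     = gw ((27 + δ ^ 3) / 27) (δ ^ 2 / 12) 1 (δ / 18) (1/108) := by
    apply ext10 <;> simp [act, ev, d1, d3, gw, hes] <;> ring
  have hd : (!![1, δ/6, δ/6; 0, 1, -1; 0, 1/6, 1/6] : Matrix (Fin 3) (Fin 3) ℝ).det = 1/3 := by
    rw [Matrix.det_fin_three]; simp; norm_num
  have h1 := (iv_act h !![1, δ/6, δ/6; 0, 1, -1; 0, 1/6, 1/6] (hes δ)).1
  have h2 := (iv_act h !![1, δ/6, δ/6; 0, 1, -1; 0, 1/6, 1/6] (hes δ)).2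
  rw [e, hd, (gw_inv h _ _ _ _ _).1] at h1
  rw [e, hd, (gw_inv h _ _ _ _ _).2] at h2
  constructor
  · linear_combination -81 * h1
  · linear_combination -729 * h2

end inv
end TC


namespace TC
open Matrix MvPolynomial

lemma odd_root (p : Polynomial ℝ) (hp : Odd p.natDegree) : ∃ x, p.eval x = 0 := by
  have main : ∀ p : Polynomial ℝ, Odd p.natDegree → 0 < p.leadingCoeff → ∃ x, p.eval x = 0 := by
    intro p hp hl
    have hpos : 0 < p.natDegree := hp.pos
    have h1 : Filter.Tendsto (fun x => p.eval x) Filter.atTop Filter.atTop :=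
      p.tendsto_atTop_of_leadingCoeff_nonneg (Polynomial.natDegree_pos_iff_degree_pos.mp hpos) hl.le
    have hq : (p.comp (-Polynomial.X)).natDegree = p.natDegree := by
      rw [Polynomial.natDegree_comp]; simp
    have hql : (p.comp (-Polynomial.X)).leadingCoeff = - p.leadingCoeff := by
      rw [Polynomial.leadingCoeff_comp (by simp)]
      simp [hp.neg_one_pow]
    have h2 : Filter.Tendsto (fun x => (p.comp (-Polynomial.X)).eval x) Filter.atTop Filter.atBot := by
      apply Polynomial.tendsto_atBot_of_leadingCoeff_nonpos
      · rw [← Polynomial.natDegree_pos_iff_degree_pos, hq]; exact hpos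
      · rw [hql]; linarith
    obtain ⟨x, hx⟩ := (h1.eventually_ge_atTop 0).exists
    obtain ⟨y, hy⟩ := (h2.eventually_le_atBot 0).exists
    simp at hy
    have := mem_range_of_exists_le_of_exists_ge p.continuous ⟨-y, hy⟩ ⟨x, hx⟩
    exact this
  rcases lt_trichotomy 0 p.leadingCoeff with hl | hl | hl
  · exact main p hp hl
  · rw [eq_comm, Polynomial.leadingCoeff_eq_zero] at hl
    exact ⟨0, by simp [hl]⟩
  · obtain ⟨x, hx⟩ := main (-p) (by simpa using hp) (by simpa using hl)
    exact ⟨x, by simpa using hx⟩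

/-- a vector can be completed to a basis of determinant one (third row) -/
lemma exists_basis {K : Type*} [Field K] (v : Fin 3 → K) (hv : v ≠ 0) :
    ∃ g : Matrix (Fin 3) (Fin 3) K, g.det = 1 ∧ g 2 = v := by
  have : v 0 ≠ 0 ∨ v 1 ≠ 0 ∨ v 2 ≠ 0 := by
    by_contra hcon
    push Not at hcon
    exact hv (by ext i; fin_cases i; exacts [hcon.1, hcon.2.1, hcon.2.2])
  rcases this with h | h | h
  · refine ⟨!![0, 1, 0; 0, 0, 1 / v 0; v 0, v 1, v 2], ?_, ?_⟩
    · rw [Matrix.det_fin_three]; simp [h]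
    · ext i; fin_cases i <;> rfl
  · refine ⟨!![0, 0, 1; 1 / v 1, 0, 0; v 0, v 1, v 2], ?_, ?_⟩
    · rw [Matrix.det_fin_three]; simp [h]
    · ext i; fin_cases i <;> rfl
  · refine ⟨!![1, 0, 0; 0, 1 / v 2, 0; v 0, v 1, v 2], ?_, ?_⟩
    · rw [Matrix.det_fin_three]; simp [h]
    · ext i; fin_cases i <;> rfl

lemma exists_basis0 {K : Type*} [Field K] (v : Fin 3 → K) (hv : v ≠ 0) :
    ∃ g : Matrix (Fin 3) (Fin 3) K, g.det = 1 ∧ g 0 = v := by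
  obtain ⟨g, h1, h2⟩ := exists_basis v hv
  refine ⟨!![0, 0, 1; 1, 0, 0; 0, 1, 0] * g, ?_, ?_⟩
  · rw [Matrix.det_mul, h1, Matrix.det_fin_three]; simp
  · rw [mulrow, ← h2]
    ext j
    rw [vm0]; simp

lemma act_inv_eq {K : Type*} [Field K] {g : Matrix (Fin 3) (Fin 3) K} (hg : g.det ≠ 0)
    {c d : Fin 10 → K} (h : act g c = d) : c = act g⁻¹ d := by
  rw [← h, ← act_mul, Matrix.nonsing_inv_mul _ (isUnit_iff_ne_zero.mpr hg), act_one]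

lemma det_inv_ne {K : Type*} [Field K] {g : Matrix (Fin 3) (Fin 3) K} (hg : g.det ≠ 0) :
    (g⁻¹).det ≠ 0 := by
  rw [Matrix.det_nonsing_inv]; simpa using hg

lemma exists_zero (c : Fin 10 → ℝ) : ∃ v : Fin 3 → ℝ, v ≠ 0 ∧ ev c v = 0 := by
  by_cases h0 : c 0 = 0
  · exact ⟨![1, 0, 0], by intro hh; simpa using congrFun hh 0, by simp [ev, h0]⟩
  · obtain ⟨x, hx⟩ := odd_root (Polynomial.C (c 0) * Polynomial.X ^ 3 + Polynomial.C (c 3) * Polynomial.X ^ 2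
      + Polynomial.C (c 5) * Polynomial.X + Polynomial.C (c 1)) (by
        rw [Polynomial.natDegree_cubic h0]; decide)
    refine ⟨![x, 1, 0], by intro hh; simpa using congrFun hh 1, ?_⟩
    simp at hx
    simp [ev]; linarith

/-- equivalent to a Weierstrass cubic -/
def Wp (c : Fin 10 → ℝ) : Prop :=
  ∃ (g : Matrix (Fin 3) (Fin 3) ℝ) (A B : ℝ), g.det ≠ 0 ∧ c = act g (wcoeffs A B)

lemma Wp_act {g : Matrix (Fin 3) (Fin 3) ℝ} (hg : g.det ≠ 0) {c : Fin 10 → ℝ} (h : Wp (act g c)) :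
    Wp c := by
  obtain ⟨g', A, B, h1, h2⟩ := h
  refine ⟨g⁻¹ * g', A, B, ?_, ?_⟩
  · rw [Matrix.det_mul]; exact mul_ne_zero (det_inv_ne hg) h1
  · rw [act_mul, ← h2]; exact act_inv_eq hg rfl

lemma Wp_one {c : Fin 10 → ℝ} (h : Wp c) :
    ∃ (g : Matrix (Fin 3) (Fin 3) ℝ) (A B : ℝ), g.det = 1 ∧ c = act g (wcoeffs A B) := by
  obtain ⟨g, A, B, h1, h2⟩ := h
  have e : act !![1, 0, 0; 0, g.det, 0; 0, 0, 1] (wcoeffs A B) = gw 1 0 (-g.det ^ 2) A B := by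
    apply ext10 <;> simp [act, ev, d1, d3, gw, wcoeffs]
  have hd : (!![1, 0, 0; 0, g.det, 0; 0, 0, 1] : Matrix (Fin 3) (Fin 3) ℝ).det = g.det := by
    rw [Matrix.det_fin_three]; simp
  have e' := act_inv_eq (by rw [hd]; exact h1) e
  obtain ⟨g', A', B', h3, h4, -⟩ := gw_W 1 0 (-g.det ^ 2) A B one_ne_zero (by
    simpa using h1)
  refine ⟨g * (!![1, 0, 0; 0, g.det, 0; 0, 0, 1])⁻¹ * g', A', B', ?_, ?_⟩
  · rw [Matrix.det_mul, Matrix.det_mul, h3, Matrix.det_nonsing_inv, hd]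
    simp [h1]
  · rw [act_mul, act_mul, ← h4, ← e', h2]

section inv
variable {P Q : MvPolynomial (Fin 10) ℚ} (h : IsInvariantPair ℚ P Q)
include h

lemma flexW0 (c : Fin 10 → ℝ) (h1 : c 1 = 0) (h5 : c 5 = 0) (h3 : c 3 = 0)
    (hD : 4 * iv P c ^ 3 ≠ iv Q c ^ 2) : Wp c := by
  have hk : c 6 ≠ 0 := by
    intro h6
    apply hD
    apply disc_act h !![1, 0, 0; 0, 0, 1; 0, 1, 0] (by rw [Matrix.det_fin_three]; simp)
    apply disc_sing0 h <;> simp [act, ev, d1, h1, h5, h6]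
  have ha : c 0 ≠ 0 := by
    intro h0
    exact hD (disc_line h c h0 h1 h3 h5)
  have e : act !![1, -c 9 / (2 * c 6), 0; 0, 1, 0; 0, -c 8 / (2 * c 6), 1] c
     = gw (c 0) (c 4 - c 9 ^ 2 / (4 * c 6)) (c 6) (c 7 - c 8 * c 9 / (2 * c 6))
        (c 2 - c 8 ^ 2 / (4 * c 6)) := by
    apply ext10 <;> simp [act, ev, d1, d3, gw, h1, h3, h5] <;> field_simp <;> ring
  have hd : (!![1, -c 9 / (2 * c 6), 0; 0, 1, 0; 0, -c 8 / (2 * c 6), 1] :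
    Matrix (Fin 3) (Fin 3) ℝ).det ≠ 0 := by
    rw [Matrix.det_fin_three]; simp
  apply Wp_act hd
  rw [e]
  obtain ⟨g, A, B, k1, k2, -⟩ := gw_W (c 0) (c 4 - c 9 ^ 2 / (4 * c 6)) (c 6)
    (c 7 - c 8 * c 9 / (2 * c 6)) (c 2 - c 8 ^ 2 / (4 * c 6)) ha hk
  exact ⟨g, A, B, by rw [k1]; exact one_ne_zero, k2⟩

/-- flex at `v` with tangent direction `w` -/
lemma flexW (c : Fin 10 → ℝ) (v w u : Fin 3 → ℝ)
    (hg : (Matrix.of ![w, v, u]).det ≠ 0) (h1 : ev c v = 0) (h2 : d1 c v w = 0) (h3 : d1 c w v = 0)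
    (hD : 4 * iv P c ^ 3 ≠ iv Q c ^ 2) : Wp c := by
  apply Wp_act hg
  apply flexW0 h
  · exact h1
  · exact h2
  · exact h3
  · intro hh; exact hD (disc_act h _ hg c hh)

lemma singD (c : Fin 10 → ℝ) (v : Fin 3 → ℝ) (hv : v ≠ 0) (hd : ∀ w, d1 c v w = 0) :
    4 * iv P c ^ 3 = iv Q c ^ 2 := by
  obtain ⟨g, hg, hg2⟩ := exists_basis v hv
  apply disc_act h g (by rw [hg]; exact one_ne_zero)
  apply disc_sing0 h
  · rw [act_2, hg2]
    have := hd v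
    have e : d1 c v v = 3 * ev c v := by simp only [d1, ev]; ring
    linarith
  · rw [act_7, hg2]; exact hd _
  · rw [act_8, hg2]; exact hd _

lemma normalW (q r s : ℝ) (hD : 4 * iv P ![0, 0, s, 0, 1, 1, q, 0, r, 0] ^ 3 ≠
    iv Q ![0, 0, s, 0, 1, 1, q, 0, r, 0] ^ 2) : Wp ![0, 0, s, 0, 1, 1, q, 0, r, 0] := by
  by_cases hr : r = 0
  · subst hr
    apply flexW h _ ![0, 1, 0] ![-q, 0, 1] ![1, 0, 0] _ _ _ _ hD
    · rw [Matrix.det_fin_three]; simp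
    · simp [ev]
    · simp [d1]
    · simp [d1]
  · set a := -4 * q with ha
    set b := -4 * r with hb
    set c := -4 * s with hc
    have hb0 : 64 * b ≠ 0 := by rw [hb]; intro h0; apply hr; linarith
    let k : Polynomial ℝ := Polynomial.C (64 * b) * Polynomial.X ^ 9 +
      (Polynomial.C (-48*a^2 + 192*c) * Polynomial.X ^ 8 +
      Polynomial.C (256*a*c - 64*a^3 + 48*b^2) * Polynomial.X ^ 6 +
      Polynomial.C (-192*a^2*b + 384*b*c) * Polynomial.X ^ 5 +
      Polynomial.C (-216*a*b^2 - 96*a^2*c + 384*c^2) * Polynomial.X ^ 4 +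
      Polynomial.C (-256*a*b*c - 96*b^3) * Polynomial.X ^ 3 +
      Polynomial.C (-240*b^2*c) * Polynomial.X ^ 2 +
      Polynomial.C (-192*b*c^2) * Polynomial.X + 
      Polynomial.C (-8*a*b^2*c + 16*a^2*c^2 + b^4 - 64*c^3))
    have hk : k.natDegree = 9 := by
      have h1 : (Polynomial.C (64 * b) * Polynomial.X ^ 9 : Polynomial ℝ).natDegree = 9 :=
        Polynomial.natDegree_C_mul_X_pow 9 _ hb0
      rw [← h1]
      apply Polynomial.natDegree_add_eq_left_of_natDegree_lt
      rw [h1]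
      refine Nat.lt_of_le_of_lt (m := 8) ?_ (by norm_num)
      compute_degree
    obtain ⟨θ, hθ⟩ := odd_root k (by rw [hk]; decide)
    simp only [k, Polynomial.eval_add, Polynomial.eval_mul, Polynomial.eval_C, Polynomial.eval_pow,
      Polynomial.eval_X] at hθ
    set D := θ ^ 4 + a * θ ^ 2 + b * θ + c with hDdef
    set D' := 4 * θ ^ 3 + 2 * a * θ + b with hD'
    set N := 2 * D * (12 * θ ^ 2 + 2 * a) - D' ^ 2 with hN
    have hNK : N ^ 2 = 64 * D ^ 3 := by
      rw [hN, hDdef, hD']; linear_combination hθ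
    rcases eq_or_ne D 0 with h0 | h0
    · exfalso
      have hN0 : N = 0 := by rw [h0] at hNK; simpa using hNK
      have hD0 : D' = 0 := by rw [h0] at hN; rw [hN0] at hN; nlinarith
      apply hD
      apply singD h _ ![-θ ^ 2 / 2, θ, 1] (by intro hh; simpa using congrFun hh 2)
      intro w
      simp [d1]
      have e1 : θ ^ 4 - 4 * q * θ ^ 2 - 4 * r * θ - 4 * s = 0 := by
        rw [hDdef, ha, hb, hc] at h0; linarith
      have e2 : 4 * θ ^ 3 - 8 * q * θ - 4 * r = 0 := by
        rw [hD', ha, hb] at hD0; linarith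
      linear_combination ((-1/4) * w 1 - 1/4 * w 2 * (-θ)) * e2 - (3/4) * w 2 * e1
    · set S := N / (8 * D) with hS
      have hS2 : S ^ 2 = D := by rw [hS, div_pow, hNK]; field_simp; ring
      have hSN : 8 * S * D = N := by rw [hS]; field_simp
      have hS0 : S ≠ 0 := by intro h'; rw [h'] at hS2; apply h0; rw [← hS2]; ring
      apply flexW h _ ![(-θ ^ 2 + S) / 2, θ, 1] ![(-2 * θ + D' / (2 * S)) / 2, 1, 0] ![1, 0, 0] _ _ _ _ hD
      · rw [Matrix.det_fin_three]; simp
      · simp [ev]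
        rw [hDdef, ha, hb, hc] at hS2
        linear_combination hS2 / 4
      · simp [d1]
        field_simp
        rw [hD', ha, hb]
        ring
      · simp [d1]
        have e : N = 2 * S ^ 2 * (12 * θ ^ 2 + 2 * a) - D' ^ 2 := by rw [hS2]
        have e3 : 8 * S ^ 3 = 2 * S ^ 2 * (12 * θ ^ 2 + 2 * a) - D' ^ 2 := by
          rw [← e, ← hSN, ← hS2]; ring
        field_simp
        rw [ha] at e3
        linear_combination e3

omit h in
lemma vec_of (c' : Fin 10 → ℝ) (k0 : c' 0 = 0) (k1 : c' 1 = 0) (k3 : c' 3 = 0) (k4 : c' 4 = 1)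
    (k5 : c' 5 = 1) (k7 : c' 7 = 0) (k9 : c' 9 = 0) :
    c' = ![0, 0, c' 2, 0, 1, 1, c' 6, 0, c' 8, 0] := by
  apply ext10
  · exact k0
  · exact k1
  · rfl
  · exact k3
  · exact k4
  · exact k5
  · rfl
  · exact k7
  · rfl
  · exact k9

omit h in
lemma exW_c0 (c : Fin 10 → ℝ) (lam mu nu : ℝ) (hlam : lam = -c 1) (hnu : nu = (2 * c 1 - c 9) / 2)
    (hmu : mu = -(c 7 + c 9 * nu + nu ^ 2) / 2) (m0 : c 0 = 0) (m3 : c 3 = 0) (m4 : c 4 = 1) (m5 : c 5 = 1) 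
    (g : Matrix (Fin 3) (Fin 3) ℝ) (hg : g = !![1, 0, 0; lam, 1, 0; mu, nu, 1]) :
    act g c 0 = 0 ∧ act g c 1 = 0 ∧ act g c 3 = 0 ∧ act g c 4 = 1 ∧ act g c 5 = 1 ∧ act g c 7 = 0 ∧
    act g c 9 = 0 := by
  refine ⟨?_, ?_, ?_, ?_, ?_, ?_, ?_⟩
  · rw [hg]; simp [act, ev, m0]
  · rw [hg]; simp [act, ev, m0, m3, m5]; rw [hlam]; ring
  · rw [hg]; simp [act, d1, m0, m3]
  · rw [hg]; simp [act, d1, m0, m3, m4]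
  · rw [hg]; simp [act, d1, m0, m3, m5]
  · rw [hg]; simp [act, d1, m0, m3, m4, m5]; rw [hmu]; ring
  · rw [hg]; simp [act, d3, m0, m3, m4, m5]; rw [hlam, hnu]; ring

lemma exW_c1 (c : Fin 10 → ℝ) (k0 : c 0 = 0) (k1 : c 1 = 0) (k3 : c 3 = 0) (k4 : c 4 = 1)
    (k5 : c 5 = 1) (k7 : c 7 = 0) (k9 : c 9 = 0)
    (hD : 4 * iv P c ^ 3 ≠ iv Q c ^ 2) : Wp c := by
  have e := vec_of c k0 k1 k3 k4 k5 k7 k9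
  have := normalW h (c 6) (c 8) (c 2)
  rw [← e] at this
  exact this hD

lemma exW_c (c : Fin 10 → ℝ) (m0 : c 0 = 0) (m3 : c 3 = 0) (m4 : c 4 = 1) (m5 : c 5 = 1)
    (hD : 4 * iv P c ^ 3 ≠ iv Q c ^ 2) : Wp c := by
  obtain ⟨lam, hlam⟩ : ∃ x, x = -c 1 := ⟨_, rfl⟩
  obtain ⟨nu, hnu⟩ : ∃ x, x = (2 * c 1 - c 9) / 2 := ⟨_, rfl⟩
  obtain ⟨mu, hmu⟩ : ∃ x, x = -(c 7 + c 9 * nu + nu ^ 2) / 2 := ⟨_, rfl⟩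
  obtain ⟨g, hg⟩ : ∃ g : Matrix (Fin 3) (Fin 3) ℝ, g = !![1, 0, 0; lam, 1, 0; mu, nu, 1] := ⟨_, rfl⟩
  have hdet : g.det ≠ 0 := by
    rw [hg, Matrix.det_fin_three]; simp
  obtain ⟨k0, k1, k3, k4, k5, k7, k9⟩ := exW_c0 c lam mu nu hlam hnu hmu m0 m3 m4 m5 g hg
  apply Wp_act hdet
  apply exW_c1 h _ k0 k1 k3 k4 k5 k7 k9
  intro hh; exact hD (disc_act h _ hdet c hh)

lemma exW_b (c : Fin 10 → ℝ) (k0 : c 0 = 0) (k3 : c 3 = 0) (k4 : c 4 = 1)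
    (hD : 4 * iv P c ^ 3 ≠ iv Q c ^ 2) : Wp c := by
  by_cases h5 : c 5 = 0
  · apply flexW h c ![1, 0, 0] ![0, 1, 0] ![0, 0, 1] _ _ _ _ hD
    · rw [Matrix.det_fin_three]; simp
    · simp [ev, k0]
    · simp [d1, k0, k3]
    · simp [d1, k0, h5]
  obtain ⟨α, hα⟩ : ∃ α, α = c 5 := ⟨_, rfl⟩
  rw [← hα] at h5
  obtain ⟨g, hg⟩ : ∃ g : Matrix (Fin 3) (Fin 3) ℝ, g = !![α, 0, 0; 0, 1 / α, 0; 0, 0, 1 / α ^ 2] := ⟨_, rfl⟩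
  have hdet : g.det ≠ 0 := by
    rw [hg, Matrix.det_fin_three]; simp [h5]
  apply Wp_act hdet
  apply exW_c h
  · rw [hg]; simp [act, ev, k0]
  · rw [hg]; simp [act, d1, k0, k3]
  · rw [hg]; simp [act, d1, k0, k3, k4, h5]
  · rw [hg]; simp [act, d1, k0, k3, k4, ← hα]; field_simp
  · intro hh; exact hD (disc_act h _ hdet c hh)

lemma exW_a (c : Fin 10 → ℝ) (z0 : c 0 = 0)
    (hD : 4 * iv P c ^ 3 ≠ iv Q c ^ 2) : Wp c := by
  have : ∃ g : Matrix (Fin 3) (Fin 3) ℝ, g.det ≠ 0 ∧ act g c 0 = 0 ∧ act g c 3 = 0 ∧ act g c 4 = 1 := by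
    by_cases h3 : c 3 = 0
    · have h4 : c 4 ≠ 0 := by
        intro h4
        apply hD
        apply singD h c ![1, 0, 0] (by intro hh; simpa using congrFun hh 0)
        intro w; simp [d1, z0, h3, h4]
      refine ⟨!![1, 0, 0; 0, 1, 0; 0, 0, 1 / c 4], ?_, ?_, ?_, ?_⟩
      · rw [Matrix.det_fin_three]; simp [h4]
      · simp [act, ev, z0]
      · simp [act, d1, z0, h3]
      · simp [act, d1, z0, h3, h4]
    · refine ⟨!![1, 0, 0; 0, c 4, -c 3; 0, 1 / c 3, 0], ?_, ?_, ?_, ?_⟩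
      · rw [Matrix.det_fin_three]; simp [h3]
      · simp [act, ev, z0]
      · simp [act, d1, z0]; ring
      · simp [act, d1, z0, h3]
  obtain ⟨g2, hg2, k0, k3, k4⟩ := this
  apply Wp_act hg2
  apply exW_b h _ k0 k3 k4
  intro hh; exact hD (disc_act h _ hg2 c hh)

lemma exists_W (c : Fin 10 → ℝ) (hD : 4 * iv P c ^ 3 ≠ iv Q c ^ 2) : Wp c := by
  obtain ⟨v, hv, hv0⟩ := exists_zero c
  obtain ⟨g, hg, hg0⟩ := exists_basis0 v hv
  have hg' : g.det ≠ 0 := by rw [hg]; exact one_ne_zero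
  apply Wp_act hg'
  apply exW_a h
  · rw [act_0, hg0, hv0]
  · intro hh; exact hD (disc_act h g hg' c hh)

end inv
end TC


namespace TC
open Matrix MvPolynomial

noncomputable def Ih (δ : ℝ) : ℝ := δ * (δ ^ 3 - 216) / 16
noncomputable def Jh (δ : ℝ) : ℝ := -(δ ^ 6 + 540 * δ ^ 3 - 5832) / 32

lemma disc_h (δ : ℝ) : 4 * Ih δ ^ 3 - Jh δ ^ 2 = -(27 / 16) * (δ ^ 3 + 27) ^ 3 := by
  unfold Ih Jh; ring

lemma cube_inj {a b : ℝ} (h : a ^ 3 = b ^ 3) : a = b :=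
  (Odd.strictMono_pow (n := 3) (by decide)).injective h

lemma exists_root_pos (n : ℕ) (hn : n ≠ 0) (x : ℝ) (hx : 0 < x) : ∃ t : ℝ, 0 < t ∧ t ^ n = x := by
  refine ⟨x ^ ((n : ℝ)⁻¹), Real.rpow_pos_of_pos hx _, ?_⟩
  rw [Real.rpow_inv_natCast_pow hx.le hn]

lemma solve_of_u (I0 J0 u : ℝ) (hD : 4 * I0 ^ 3 ≠ J0 ^ 2)
    (h1 : u * (u - 216) ^ 3 / 4096 * J0 ^ 2 = I0 ^ 3 * (-(u ^ 2 + 540 * u - 5832) / 32) ^ 2)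
    (h2 : 0 < J0 * (-(u ^ 2 + 540 * u - 5832) / 32) ∨
      (J0 = 0 ∧ (-(u ^ 2 + 540 * u - 5832) / 32) = 0 ∧ 0 < I0 * (u * (u - 216) ^ 3 / 4096))) :
    ∃ t δ : ℝ, 0 < t ∧ δ ≠ -3 ∧ t ^ 12 * Ih δ = I0 ∧ t ^ 18 * Jh δ = J0 := by
  obtain ⟨δ, hδ⟩ := cbrt u
  have eJ : Jh δ = -(u ^ 2 + 540 * u - 5832) / 32 := by rw [← hδ]; unfold Jh; ring
  have eI : Ih δ ^ 3 = u * (u - 216) ^ 3 / 4096 := by rw [← hδ]; unfold Ih; ring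
  rw [← eJ, ← eI] at h1 h2
  have key : ∃ t, 0 < t ∧ t ^ 12 * Ih δ = I0 ∧ t ^ 18 * Jh δ = J0 := by
    rcases h2 with h2 | ⟨h2, h3, h4⟩
    · have hJ : Jh δ ≠ 0 := by rintro h; rw [h] at h2; simp at h2
      obtain ⟨t, ht, ht1⟩ := exists_root_pos 18 (by norm_num) (J0 / Jh δ) (by
        have : J0 / Jh δ = J0 * Jh δ / (Jh δ ^ 2) := by field_simp
        rw [this]; positivity)
      have e2 : t ^ 18 * Jh δ = J0 := by rw [ht1]; field_simp
      refine ⟨t, ht, ?_, e2⟩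
      apply cube_inj
      have hJ2 : Jh δ ^ 2 ≠ 0 := pow_ne_zero _ hJ
      apply mul_right_cancel₀ hJ2
      rw [← h1, ← e2]; ring
    · have h5 : 0 < I0 / Ih δ := by
        have hI : Ih δ ≠ 0 := by rintro h; rw [h] at h4; simp at h4
        have : I0 / Ih δ = I0 * Ih δ ^ 3 / (Ih δ ^ 2) ^ 2 := by field_simp
        rw [this]; positivity
      obtain ⟨t, ht, ht1⟩ := exists_root_pos 12 (by norm_num) (I0 / Ih δ) h5
      refine ⟨t, ht, ?_, by rw [h3, h2]; ring⟩
      rw [ht1]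
      have hI : Ih δ ≠ 0 := by rintro h; rw [h] at h4; simp at h4
      field_simp
  obtain ⟨t, ht, e1, e2⟩ := key
  refine ⟨t, δ, ht, ?_, e1, e2⟩
  rintro rfl
  apply hD
  rw [← e1, ← e2]; unfold Ih Jh; ring

/-- the polynomial whose zero we look for -/
noncomputable def GG (I0 J0 u : ℝ) : ℝ :=
  u * (u - 216) ^ 3 / 4096 * J0 ^ 2 - I0 ^ 3 * (-(u ^ 2 + 540 * u - 5832) / 32) ^ 2

lemma GG_cont (I0 J0 : ℝ) : Continuous (GG I0 J0) := by unfold GG; fun_prop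

lemma GG_eq (I0 J0 u : ℝ) : 4 * GG I0 J0 u = (J0 ^ 2 - 4 * I0 ^ 3) * (-(u ^ 2 + 540 * u - 5832) / 32) ^ 2
   - (27 / 16) * J0 ^ 2 * (u + 27) ^ 3 := by unfold GG; ring

lemma hesse_solve (I0 J0 : ℝ) (hD : 4 * I0 ^ 3 ≠ J0 ^ 2) :
    ∃ t δ : ℝ, 0 < t ∧ δ ≠ -3 ∧ t ^ 12 * Ih δ = I0 ∧ t ^ 18 * Jh δ = J0 := by
  have hq : √78732 ^ 2 = 78732 := Real.sq_sqrt (by norm_num)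
  have hq0 : 0 ≤ √78732 := Real.sqrt_nonneg _
  obtain ⟨r, hr⟩ : ∃ r, r = √78732 := ⟨_, rfl⟩
  rw [← hr] at hq hq0
  clear hr
  have hr1 : 280 < r := by nlinarith
  have hr2 : r < 281 := by nlinarith
  have fac : ∀ u : ℝ, u ^ 2 + 540 * u - 5832 = (u + 270 - r) * (u + 270 + r) := by
    intro u; linear_combination hq
  rcases lt_or_gt_of_ne hD with hlt | hgt
  · rcases lt_trichotomy J0 0 with hJ | hJ | hJ
    · -- J0 < 0
      have hk : 0 < J0 ^ 2 - 4 * I0 ^ 3 := by linarith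
      obtain ⟨C, hC⟩ : ∃ C, C = J0 ^ 2 / (J0 ^ 2 - 4 * I0 ^ 3) := ⟨_, rfl⟩
      have hC0 : 0 ≤ C := by rw [hC]; positivity
      have hCk : J0 ^ 2 = C * (J0 ^ 2 - 4 * I0 ^ 3) := by rw [hC]; field_simp
      have hM : 0 < GG I0 J0 (27 + 14000 * C) := by
        obtain ⟨M, hM⟩ : ∃ M, M = 27 + 14000 * C := ⟨_, rfl⟩
        rw [← hM]
        have hM27 : 27 ≤ M := by linarith
        have e := GG_eq I0 J0 M
        have a1 : (M ^ 2 / 32) ^ 2 ≤ (-(M ^ 2 + 540 * M - 5832) / 32) ^ 2 := by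
          rw [neg_div, neg_sq]; apply pow_le_pow_left₀ (by positivity); linarith
        have a2 : (M + 27) ^ 3 ≤ (2 * M) ^ 3 := pow_le_pow_left₀ (by linarith) (by linarith) _
        have a3 : (27 / 16) * C * (M + 27) ^ 3 < (-(M ^ 2 + 540 * M - 5832) / 32) ^ 2 := by
          have : (27 / 16) * C * (M + 27) ^ 3 ≤ (27 / 16) * C * (2 * M) ^ 3 := by gcongr
          have : (27 / 16) * C * (2 * M) ^ 3 < (M ^ 2 / 32) ^ 2 := by
            have : 0 < M ^ 3 * (M - 14000 * C) := by
              apply mul_pos (by positivity); linarith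
            have : 0 ≤ M ^ 3 * C := by positivity
            nlinarith
          linarith
        have : 0 < (J0 ^ 2 - 4 * I0 ^ 3) * ((-(M ^ 2 + 540 * M - 5832) / 32) ^ 2 - (27 / 16) * C * (M + 27) ^ 3) := by
          apply mul_pos hk; linarith
        rw [hCk] at e
        nlinarith
      have h1 : GG I0 J0 (-270 + r) < 0 := by
        have : (-(((-270 + r)) ^ 2 + 540 * (-270 + r) - 5832) / 32) = 0 := by rw [fac]; ring
        unfold GG; rw [this]
        have : (-270 + r) * (-270 + r - 216) ^ 3 < 0 := by
          apply mul_neg_of_pos_of_neg (by linarith)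
          apply Odd.pow_neg (by decide); linarith
        have hJ2 : 0 < J0 ^ 2 := by nlinarith
        nlinarith
      obtain ⟨u, hu, hu0⟩ := intermediate_value_Ioo (a := -270 + r) (b := 27 + 14000 * C) (by linarith)
        (GG_cont I0 J0).continuousOn ⟨h1, hM⟩
      apply solve_of_u I0 J0 u hD
      · unfold GG at hu0; linarith
      · left
        rw [fac]
        have : 0 < (u + 270 - r) * (u + 270 + r) := mul_pos (by linarith [hu.1]) (by linarith [hu.1])
        nlinarith
    · subst hJ
      have hI : I0 < 0 := by
        by_contra hh; push Not at hh
        have : 0 ≤ I0 ^ 3 := by positivity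
        nlinarith
      have : (-(((-270 + r)) ^ 2 + 540 * (-270 + r) - 5832) / 32) = 0 := by rw [fac]; ring
      apply solve_of_u I0 0 (-270 + r) hD
      · rw [this]; ring
      · right
        refine ⟨rfl, this, ?_⟩
        have : (-270 + r) * (-270 + r - 216) ^ 3 < 0 := by
          apply mul_neg_of_pos_of_neg (by linarith)
          apply Odd.pow_neg (by decide); linarith
        apply mul_pos_of_neg_of_neg hI; linarith
    · -- J0 > 0
      have h1 : GG I0 J0 (-270 + r) < 0 := by
        have : (-(((-270 + r)) ^ 2 + 540 * (-270 + r) - 5832) / 32) = 0 := by rw [fac]; ring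
        unfold GG; rw [this]
        have : (-270 + r) * (-270 + r - 216) ^ 3 < 0 := by
          apply mul_neg_of_pos_of_neg (by linarith)
          apply Odd.pow_neg (by decide); linarith
        have hJ2 : 0 < J0 ^ 2 := by nlinarith
        nlinarith
      have h2 : 0 < GG I0 J0 (-27) := by
        have e := GG_eq I0 J0 (-27)
        nlinarith
      obtain ⟨u, hu, hu0⟩ := intermediate_value_Ioo' (a := -27) (b := -270 + r) (by linarith)
        (GG_cont I0 J0).continuousOn ⟨h1, h2⟩
      apply solve_of_u I0 J0 u hD
      · unfold GG at hu0; linarith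
      · left
        rw [fac]
        have : (u + 270 - r) * (u + 270 + r) < 0 :=
          mul_neg_of_neg_of_pos (by linarith [hu.2]) (by linarith [hu.1])
        nlinarith
  · have hI : 0 < I0 := by
      by_contra hh; push Not at hh
      have : I0 ^ 3 ≤ 0 := Odd.pow_nonpos (by decide) hh
      nlinarith [sq_nonneg J0]
    have apos : 0 < (-270 - r) * (-270 - r - 216) ^ 3 := by
      apply mul_pos_of_neg_of_neg (by linarith)
      apply Odd.pow_neg (by decide); linarith
    have j0 : (-(((-270 - r)) ^ 2 + 540 * (-270 - r) - 5832) / 32) = 0 := by rw [fac]; ring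
    rcases lt_trichotomy J0 0 with hJ | hJ | hJ
    · have hk : 0 < 4 * I0 ^ 3 - J0 ^ 2 := by linarith
      obtain ⟨C, hC⟩ : ∃ C, C = J0 ^ 2 / (4 * I0 ^ 3 - J0 ^ 2) := ⟨_, rfl⟩
      have hC0 : 0 ≤ C := by rw [hC]; positivity
      have hCk : J0 ^ 2 = C * (4 * I0 ^ 3 - J0 ^ 2) := by rw [hC]; field_simp
      have hM : GG I0 J0 (-(1100 + 8000 * C)) < 0 := by
        obtain ⟨M, hM⟩ : ∃ M, M = 1100 + 8000 * C := ⟨_, rfl⟩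
        rw [← hM]
        have hM27 : 1100 ≤ M := by linarith
        have e := GG_eq I0 J0 (-M)
        have a1 : (M ^ 2 / 64) ^ 2 ≤ (-((-M) ^ 2 + 540 * (-M) - 5832) / 32) ^ 2 := by
          rw [neg_div, neg_sq]; apply pow_le_pow_left₀ (by positivity); nlinarith
        have a2 : (M - 27) ^ 3 ≤ M ^ 3 := pow_le_pow_left₀ (by linarith) (by linarith) _
        have a3 : (27 / 16) * C * (M - 27) ^ 3 < (-((-M) ^ 2 + 540 * (-M) - 5832) / 32) ^ 2 := by
          have : (27 / 16) * C * (M - 27) ^ 3 ≤ (27 / 16) * C * M ^ 3 := by gcongr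
          have : (27 / 16) * C * M ^ 3 < (M ^ 2 / 64) ^ 2 := by
            have : 0 < M ^ 3 * (M - 8000 * C) := by
              apply mul_pos (by positivity); linarith
            have : 0 ≤ M ^ 3 * C := by positivity
            nlinarith
          linarith
        have : 0 < (4 * I0 ^ 3 - J0 ^ 2) * ((-((-M) ^ 2 + 540 * (-M) - 5832) / 32) ^ 2 - (27 / 16) * C * (M - 27) ^ 3) := by
          apply mul_pos hk; linarith
        have e' : 4 * GG I0 J0 (-M) = -((4 * I0 ^ 3 - J0 ^ 2) * (-((-M) ^ 2 + 540 * (-M) - 5832) / 32) ^ 2)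
            + (27 / 16) * J0 ^ 2 * (M - 27) ^ 3 := by rw [e]; ring
        rw [hCk] at e'
        nlinarith
      have h1 : 0 < GG I0 J0 (-270 - r) := by
        unfold GG; rw [j0]
        have hJ2 : 0 < J0 ^ 2 := by nlinarith
        nlinarith
      obtain ⟨u, hu, hu0⟩ := intermediate_value_Ioo (a := -(1100 + 8000 * C)) (b := -270 - r) (by linarith)
        (GG_cont I0 J0).continuousOn ⟨hM, h1⟩
      apply solve_of_u I0 J0 u hD
      · unfold GG at hu0; linarith
      · left
        rw [fac]
        have : 0 < (u + 270 - r) * (u + 270 + r) :=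
          mul_pos_of_neg_of_neg (by linarith [hu.2]) (by linarith [hu.2])
        nlinarith
    · subst hJ
      apply solve_of_u I0 0 (-270 - r) hD
      · rw [j0]; ring
      · right
        refine ⟨rfl, j0, ?_⟩
        apply mul_pos hI; linarith
    · have h1 : 0 < GG I0 J0 (-270 - r) := by
        unfold GG; rw [j0]
        have hJ2 : 0 < J0 ^ 2 := by nlinarith
        nlinarith
      have h2 : GG I0 J0 (-27) < 0 := by
        have e := GG_eq I0 J0 (-27)
        nlinarith
      obtain ⟨u, hu, hu0⟩ := intermediate_value_Ioo' (a := -270 - r) (b := -27) (by linarith)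
        (GG_cont I0 J0).continuousOn ⟨h2, h1⟩
      apply solve_of_u I0 J0 u hD
      · unfold GG at hu0; linarith
      · left
        rw [fac]
        have : (u + 270 - r) * (u + 270 + r) < 0 :=
          mul_neg_of_neg_of_pos (by linarith [hu.2]) (by linarith [hu.1])
        nlinarith

section inv
variable {P Q : MvPolynomial (Fin 10) ℚ} (h : IsInvariantPair ℚ P Q)
include h

lemma iv_hes (g : Matrix (Fin 3) (Fin 3) ℝ) (δ : ℝ) :
    iv P (act g (hes δ)) = g.det ^ 4 * Ih δ ∧ iv Q (act g (hes δ)) = g.det ^ 6 * Jh δ := by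
  rw [(iv_act h g _).1, (iv_act h g _).2, (hes_inv h δ).1, (hes_inv h δ).2]
  exact ⟨rfl, rfl⟩

lemma same_inv (c c' : Fin 10 → ℝ) (hD : 4 * iv P c ^ 3 ≠ iv Q c ^ 2) (h1 : iv P c = iv P c')
    (h2 : iv Q c = iv Q c') : ∃ g : Matrix (Fin 3) (Fin 3) ℝ, g.det = 1 ∧ c = act g c' := by
  obtain ⟨g, A, B, hg, hc⟩ := Wp_one (exists_W h c hD)
  obtain ⟨g', A', B', hg', hc'⟩ := Wp_one (exists_W h c' (by rw [← h1, ← h2]; exact hD))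
  have i1 := iv_act h g (wcoeffs A B)
  have i2 := iv_act h g' (wcoeffs A' B')
  rw [← hc, hg, (iv_W h A B).1, (iv_W h A B).2] at i1
  rw [← hc', hg', (iv_W h A' B').1, (iv_W h A' B').2] at i2
  have hA : A = A' := by linarith [i1.1, i2.1]
  have hB : B = B' := by linarith [i1.2, i2.2]
  subst hA hB
  refine ⟨g * g'⁻¹, ?_, ?_⟩
  · rw [Matrix.det_mul, Matrix.det_nonsing_inv, hg, hg']; simp
  · rw [act_mul, ← act_inv_eq (by rw [hg']; exact one_ne_zero) hc'.symm, hc]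

lemma exists_hesse (c : Fin 10 → ℝ) (hD : 4 * iv P c ^ 3 ≠ iv Q c ^ 2) :
    ∃ (g : Matrix (Fin 3) (Fin 3) ℝ) (δ : ℝ), 0 < g.det ∧ δ ≠ -3 ∧ c = act g (hes δ) := by
  obtain ⟨t, δ, ht, hδ, e1, e2⟩ := hesse_solve _ _ hD
  have hdt : (t • (1 : Matrix (Fin 3) (Fin 3) ℝ)).det = t ^ 3 := by
    rw [Matrix.det_smul]; simp
  obtain ⟨i1, i2⟩ := iv_hes h (t • (1 : Matrix (Fin 3) (Fin 3) ℝ)) δ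
  rw [hdt] at i1 i2
  obtain ⟨g, hg, hgc⟩ := same_inv h c (act (t • (1 : Matrix (Fin 3) (Fin 3) ℝ)) (hes δ)) hD
    (by rw [i1, ← e1]; ring) (by rw [i2, ← e2]; ring)
  refine ⟨g * (t • (1 : Matrix (Fin 3) (Fin 3) ℝ)), δ, ?_, hδ, ?_⟩
  · rw [Matrix.det_mul, hg, hdt]; positivity
  · rw [act_mul]; exact hgc

end inv
end TC


namespace TC
open Matrix MvPolynomial

section pencil
variable {R : Type*} [CommRing R]

/-- `α x³ + β y³ + γ z³ + δ xyz` -/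
def gh (α β γ δ : R) : Fin 10 → R := ![α, β, γ, 0, 0, 0, 0, 0, 0, δ]

lemma hes_gh (δ : R) : hes δ = gh 1 1 1 δ := rfl

lemma hc_gh (α β γ δ : R) : hc (gh α β γ δ) =
    gh (-6 * α * δ ^ 2) (-6 * β * δ ^ 2) (-6 * γ * δ ^ 2) (216 * α * β * γ + 2 * δ ^ 3) := by
  apply ext10 <;> simp [hc, gh]

lemma gh_add (α β γ δ α' β' γ' δ' : R) : gh α β γ δ + gh α' β' γ' δ' =
    gh (α + α') (β + β') (γ + γ') (δ + δ') := by
  apply ext10 <;> simp [gh]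

lemma gh_smul (t α β γ δ : R) : t • gh α β γ δ = gh (t * α) (t * β) (t * γ) (t * δ) := by
  apply ext10 <;> simp [gh]

lemma pencil (h : Matrix (Fin 3) (Fin 3) R) (α β γ δ δ' : R)
    (e : act h (gh α β γ δ) = gh α β γ δ') :
    act h (gh (6 * (δ' ^ 2 - h.det ^ 2 * δ ^ 2) * α) (6 * (δ' ^ 2 - h.det ^ 2 * δ ^ 2) * β)
      (6 * (δ' ^ 2 - h.det ^ 2 * δ ^ 2) * γ) (h.det ^ 2 * (216 * α * β * γ + 2 * δ ^ 3) + 6 * δ' ^ 2 * δ))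
    = gh 0 0 0 (8 * (27 * α * β * γ + δ' ^ 3)) := by
  have h1 := hc_act h (gh α β γ δ)
  rw [e, hc_gh, hc_gh, ← act_smul] at h1
  have h2 : (6 * δ' ^ 2) • act h (gh α β γ δ) = (6 * δ' ^ 2) • gh α β γ δ' := by rw [e]
  rw [← act_smul, gh_smul, gh_smul] at h2
  have h3 := congrArg₂ (· + ·) h1.symm h2
  rw [← act_add, gh_smul, gh_add, gh_add] at h3
  convert h3 using 2
  · congr 1 <;> ring
  · ring
  · ring
  · ring
  · ring

lemma d1_gh (α β γ δ : R) (u v : Fin 3 → R) : d1 (gh α β γ δ) u v =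
    (3 * α * u 0 ^ 2 + δ * u 1 * u 2) * v 0 + (3 * β * u 1 ^ 2 + δ * u 0 * u 2) * v 1
    + (3 * γ * u 2 ^ 2 + δ * u 0 * u 1) * v 2 := by
  simp [d1, gh]; ring

lemma ev_gh (α β γ δ : R) (u : Fin 3 → R) : ev (gh α β γ δ) u =
    α * u 0 ^ 3 + β * u 1 ^ 3 + γ * u 2 ^ 3 + δ * u 0 * u 1 * u 2 := by
  simp [ev, gh]

lemma d1_self (c : Fin 10 → R) (u : Fin 3 → R) : d1 c u u = 3 * ev c u := by
  simp only [d1, ev]; ring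
end pencil

lemma grad {K : Type*} [Field K] (h : Matrix (Fin 3) (Fin 3) K) (hd : h.det ≠ 0) (α β γ δ κ : K)
    (e : act h (gh α β γ δ) = gh 0 0 0 κ) (i : Fin 3) :
    3 * α * h i 0 ^ 2 + δ * h i 1 * h i 2 = 0 ∧ 3 * β * h i 1 ^ 2 + δ * h i 0 * h i 2 = 0 ∧
    3 * γ * h i 2 ^ 2 + δ * h i 0 * h i 1 = 0 := by
  have key : ∀ j, d1 (gh α β γ δ) (h i) (h j) = 0 := by
    intro j
    have e0 := congrFun e 0
    have e1 := congrFun e 1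
    have e2 := congrFun e 2
    have e3 := congrFun e 3
    have e4 := congrFun e 4
    have e5 := congrFun e 5
    have e6 := congrFun e 6
    have e7 := congrFun e 7
    have e8 := congrFun e 8
    rw [act_0] at e0
    rw [act_1] at e1
    rw [act_2] at e2
    rw [act_3] at e3
    rw [act_4] at e4
    rw [act_5] at e5
    rw [act_6] at e6
    rw [act_7] at e7
    rw [act_8] at e8
    have E0 : ev (gh α β γ δ) (h 0) = 0 := e0
    have E1 : ev (gh α β γ δ) (h 1) = 0 := e1
    have E2 : ev (gh α β γ δ) (h 2) = 0 := e2
    fin_cases i <;> fin_cases j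
    · exact (d1_self _ (h 0)).trans (by rw [E0, mul_zero])
    · exact e3
    · exact e4
    · exact e5
    · exact (d1_self _ (h 1)).trans (by rw [E1, mul_zero])
    · exact e6
    · exact e7
    · exact e8
    · exact (d1_self _ (h 2)).trans (by rw [E2, mul_zero])
  have hz := Matrix.eq_zero_of_mulVec_eq_zero hd
    (v := ![3 * α * h i 0 ^ 2 + δ * h i 1 * h i 2, 3 * β * h i 1 ^ 2 + δ * h i 0 * h i 2,
      3 * γ * h i 2 ^ 2 + δ * h i 0 * h i 1]) (by
    ext j
    have := key j
    rw [d1_gh] at this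
    simp only [Matrix.mulVec, dotProduct, Fin.sum_univ_three, Pi.zero_apply]
    simp
    linear_combination this)
  exact ⟨by simpa using congrFun hz 0, by simpa using congrFun hz 1, by simpa using congrFun hz 2⟩

/-- a row with all pairwise products zero -/
lemma row_mono {K : Type*} [Field K] (v : Fin 3 → K) (hv : v ≠ 0) (h01 : v 0 * v 1 = 0) (h02 : v 0 * v 2 = 0)
    (h12 : v 1 * v 2 = 0) :
    (v 0 ≠ 0 ∧ v 1 = 0 ∧ v 2 = 0) ∨ (v 0 = 0 ∧ v 1 ≠ 0 ∧ v 2 = 0) ∨ (v 0 = 0 ∧ v 1 = 0 ∧ v 2 ≠ 0) := by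
  by_cases h0 : v 0 = 0
  · by_cases h1 : v 1 = 0
    · refine Or.inr (Or.inr ⟨h0, h1, fun h2 => hv ?_⟩)
      ext i; fin_cases i; exacts [h0, h1, h2]
    · exact Or.inr (Or.inl ⟨h0, h1, by simpa [h1] using h12⟩)
  · exact Or.inl ⟨h0, by simpa [h0] using h01, by simpa [h0] using h02⟩

lemma row_ne {K : Type*} [Field K] (h : Matrix (Fin 3) (Fin 3) K) (hd : h.det ≠ 0) (i : Fin 3) : h i ≠ 0 := by
  intro hi
  exact hd (Matrix.det_eq_zero_of_row_eq_zero i (fun j => congrFun hi j))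

/-- the cyclic permutation matrices -/
def cyc1 : Matrix (Fin 3) (Fin 3) ℝ := !![0, 1, 0; 0, 0, 1; 1, 0, 0]
def cyc2 : Matrix (Fin 3) (Fin 3) ℝ := !![0, 0, 1; 1, 0, 0; 0, 1, 0]

lemma act_cyc1 (δ : ℝ) : act cyc1 (hes δ) = hes δ := by
  apply ext10 <;> simp [act, ev, d1, d3, hes, cyc1]
lemma act_cyc2 (δ : ℝ) : act cyc2 (hes δ) = hes δ := by
  apply ext10 <;> simp [act, ev, d1, d3, hes, cyc2]

lemma hes_unique0 (h : Matrix (Fin 3) (Fin 3) ℝ) (hd : 0 < h.det) (δ δ' : ℝ) (hδ' : δ' ≠ -3)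
    (e : act h (hes δ) = hes δ') : δ = δ' ∧ (h = 1 ∨ h = cyc1 ∨ h = cyc2) := by
  rw [hes_gh, hes_gh] at e
  have hp := pencil h 1 1 1 δ δ' e
  have hg := grad h hd.ne' _ _ _ _ _ hp
  have hκ : 8 * (27 * 1 * 1 * 1 + δ' ^ 3) ≠ 0 := by
    intro h0; apply hδ'
    apply cube_inj; linarith
  generalize hμ : 6 * (δ' ^ 2 - h.det ^ 2 * δ ^ 2) * 1 = μ at hg hp
  generalize hν : h.det ^ 2 * (216 * 1 * 1 * 1 + 2 * δ ^ 3) + 6 * δ' ^ 2 * δ = ν at hg hp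
  by_cases hμ0 : μ = 0
  · have hν0 : ν ≠ 0 := by
      intro h0
      rw [hμ0, h0] at hp
      have := congrFun hp 9
      rw [act_9] at this
      simp [d3, gh] at this
      exact hκ (by linarith)
    have hrow : ∀ i, h i = ![1, 0, 0] ∨ h i = ![0, 1, 0] ∨ h i = ![0, 0, 1] := by
      intro i
      obtain ⟨a1, a2, a3⟩ := hg i
      rw [hμ0] at a1 a2 a3
      have hev : ev (gh 1 1 1 δ) (h i) = 1 := by
        fin_cases i
        · exact congrFun e 0
        · exact congrFun e 1
        · exact congrFun e 2
      rw [ev_gh] at hev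
      have b0 : h i 1 * h i 2 = 0 := by
        have : ν * (h i 1 * h i 2) = 0 := by linarith
        simpa [hν0] using this
      have b1 : h i 0 * h i 2 = 0 := by
        have : ν * (h i 0 * h i 2) = 0 := by linarith
        simpa [hν0] using this
      have b2 : h i 0 * h i 1 = 0 := by
        have : ν * (h i 0 * h i 1) = 0 := by linarith
        simpa [hν0] using this
      rcases row_mono (h i) (row_ne h hd.ne' i) b2 b1 b0 with ⟨c0, c1, c2⟩ | ⟨c0, c1, c2⟩ | ⟨c0, c1, c2⟩
      · left
        rw [c1, c2] at hev
        have : h i 0 = 1 := by apply cube_inj; linarith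
        ext j; fin_cases j <;> simp [this, c1, c2]
      · right; left
        rw [c0, c2] at hev
        have : h i 1 = 1 := by apply cube_inj; linarith
        ext j; fin_cases j <;> simp [this, c0, c2]
      · right; right
        rw [c0, c1] at hev
        have : h i 2 = 1 := by apply cube_inj; linarith
        ext j; fin_cases j <;> simp [this, c0, c1]
    have e9 := congrFun e 9
    rw [act_9] at e9
    rw [Matrix.det_fin_three] at hd
    have hh : h = !![h 0 0, h 0 1, h 0 2; h 1 0, h 1 1, h 1 2; h 2 0, h 2 1, h 2 2] := by
      ext i j; fin_cases i <;> fin_cases j <;> rfl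
    have hcyc : (h = 1 ∨ h = cyc1 ∨ h = cyc2) := by
      rcases hrow 0 with r0 | r0 | r0 <;> rcases hrow 1 with r1 | r1 | r1 <;>
      rcases hrow 2 with r2 | r2 | r2 <;> (rw [r0, r1, r2] at hd; simp at hd) <;>
      · rw [r0, r1, r2] at hh
        simp at hh
        first
        | (exfalso; linarith)
        | (rw [hh, cyc1, cyc2]; simp [Matrix.one_fin_three])
    refine ⟨?_, hcyc⟩
    rcases hcyc with rfl | rfl | rfl
    · rw [act_one] at e; simpa [gh] using congrFun e 9
    · rw [← hes_gh, act_cyc1] at e; simpa [gh, hes] using congrFun e 9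
    · rw [← hes_gh, act_cyc2] at e; simpa [gh, hes] using congrFun e 9
  · exfalso
    have hrow : ∀ i, h i 1 = h i 0 ∧ h i 2 = h i 0 := by
      intro i
      obtain ⟨a1, a2, a3⟩ := hg i
      have c0 : 3 * μ ≠ 0 := by simpa using hμ0
      constructor
      · apply cube_inj
        apply mul_left_cancel₀ c0
        linear_combination h i 1 * a2 - h i 0 * a1
      · apply cube_inj
        apply mul_left_cancel₀ c0
        linear_combination h i 2 * a3 - h i 0 * a1
    rw [Matrix.det_fin_three, (hrow 0).1, (hrow 0).2, (hrow 1).1, (hrow 1).2, (hrow 2).1, (hrow 2).2] at hd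
    apply lt_irrefl (0 : ℝ)
    calc (0 : ℝ) < _ := hd
      _ = 0 := by ring

lemma det_cyc1 : cyc1.det = 1 := by rw [Matrix.det_fin_three]; simp [cyc1]
lemma det_cyc2 : cyc2.det = 1 := by rw [Matrix.det_fin_three]; simp [cyc2]

lemma hes_unique (g g' : Matrix (Fin 3) (Fin 3) ℝ) (hd : 0 < g.det) (hd' : 0 < g'.det) (δ δ' : ℝ)
    (hδ : δ ≠ -3) (e : act g (hes δ) = act g' (hes δ')) :
    δ = δ' ∧ (g' = g ∨ g' = g * cyc1 ∨ g' = g * cyc2) := by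
  have hu := isUnit_iff_ne_zero.mpr hd.ne'
  have e2 : act (g⁻¹ * g') (hes δ') = hes δ := by
    rw [act_mul, ← e, ← act_mul, Matrix.nonsing_inv_mul _ hu, act_one]
  obtain ⟨h1, h2⟩ := hes_unique0 (g⁻¹ * g') (by
    rw [Matrix.det_mul, Matrix.det_nonsing_inv]; simp [hd, hd']) δ' δ hδ e2
  refine ⟨h1.symm, ?_⟩
  have e3 : g' = g * (g⁻¹ * g') := by rw [← mul_assoc, Matrix.mul_nonsing_inv _ hu, one_mul]
  rcases h2 with h2 | h2 | h2 <;> rw [h2] at e3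
  · left; rw [e3, mul_one]
  · right; left; exact e3
  · right; right; exact e3

end TC


namespace TC
open Matrix MvPolynomial

abbrev M3 := Matrix (Fin 3) (Fin 3) ℝ
abbrev SLZ := Matrix.SpecialLinearGroup (Fin 3) ℤ

/-- squared length of the `i`-th row -/
def rn (g : M3) (i : Fin 3) : ℝ := g i 0 ^ 2 + g i 1 ^ 2 + g i 2 ^ 2
def ip (g : M3) (i j : Fin 3) : ℝ := g i 0 * g j 0 + g i 1 * g j 1 + g i 2 * g j 2
def N2 (g : M3) : ℝ := rn g 0 + rn g 1 + rn g 2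

lemma rn_nonneg (g : M3) (i : Fin 3) : 0 ≤ rn g i := by unfold rn; positivity
lemma N2_nonneg (g : M3) : 0 ≤ N2 g := by
  unfold N2; linarith [rn_nonneg g 0, rn_nonneg g 1, rn_nonneg g 2]

lemma entry_le (g : M3) (i j : Fin 3) : g i j ^ 2 ≤ rn g i := by
  unfold rn
  fin_cases j <;> simp <;> nlinarith [sq_nonneg (g i 0), sq_nonneg (g i 1), sq_nonneg (g i 2)]

lemma rn_le_N2 (g : M3) (i : Fin 3) : rn g i ≤ N2 g := by
  unfold N2
  fin_cases i <;> simp <;> linarith [rn_nonneg g 0, rn_nonneg g 1, rn_nonneg g 2]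

lemma rn_pos (g : M3) (hg : g.det ≠ 0) (i : Fin 3) : 0 < rn g i := by
  rcases (rn_nonneg g i).lt_or_eq with h | h
  · exact h
  · exfalso
    apply row_ne g hg i
    ext j
    have := entry_le g i j
    rw [← h] at this
    simpa using le_antisymm this (sq_nonneg _)

/-- `γ` as a real matrix -/
def rz (γ : SLZ) : M3 := (γ : Matrix (Fin 3) (Fin 3) ℤ).map (Int.castRingHom ℝ)

lemma rz_det (γ : SLZ) : (rz γ).det = 1 := by
  unfold rz
  rw [← RingHom.mapMatrix_apply, ← RingHom.map_det]; simp

lemma rz_mul (γ γ' : SLZ) : rz (γ * γ') = rz γ * rz γ' := by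
  unfold rz
  rw [Matrix.SpecialLinearGroup.coe_mul, Matrix.map_mul]

lemma rz_one : rz 1 = 1 := by
  unfold rz; simp

lemma rz_inj {γ γ' : SLZ} (h : rz γ = rz γ') : γ = γ' := by
  ext i j
  have := congrFun (congrFun h i) j
  simpa [rz] using this

lemma rz_inv_mul (γ : SLZ) : rz γ⁻¹ * rz γ = 1 := by rw [← rz_mul]; simp [rz_one]

/-- integer matrices with bounded entries are finite in number -/
lemma finite_bdd (B : ℝ) : {γ : SLZ | ∀ i j, |rz γ i j| ≤ B}.Finite := by
  have h1 : (Set.pi Set.univ (fun _ : Fin 3 => Set.pi Set.univ (fun _ : Fin 3 => Set.Icc (-⌈B⌉) ⌈B⌉))).Finite :=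
    Set.Finite.pi' (fun _ => Set.Finite.pi' (fun _ => Set.finite_Icc _ _)) |>.subset (by
      intro x hx i j; exact hx i trivial j trivial)
  apply Set.Finite.of_finite_image (f := fun γ : SLZ => (fun i j => (γ : Matrix (Fin 3) (Fin 3) ℤ) i j))
  · apply h1.subset
    rintro _ ⟨γ, hγ, rfl⟩ i - j -
    have := hγ i j
    have e : rz γ i j = (((γ : Matrix (Fin 3) (Fin 3) ℤ) i j : ℤ) : ℝ) := rfl
    rw [e, abs_le] at this
    have hB := Int.le_ceil B
    constructor
    · have : (-(⌈B⌉ : ℝ)) ≤ (((γ : Matrix (Fin 3) (Fin 3) ℤ) i j : ℤ) : ℝ) := by linarith [this.1]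
      exact_mod_cast this
    · have : (((γ : Matrix (Fin 3) (Fin 3) ℤ) i j : ℤ) : ℝ) ≤ (⌈B⌉ : ℝ) := by linarith [this.2]
      exact_mod_cast this
  · intro γ _ γ' _ h
    ext i j
    exact congrFun (congrFun h i) j

lemma N2_entry (g : M3) (i j : Fin 3) {R : ℝ} (h : N2 g ≤ R ^ 2) (hR : 0 ≤ R) : |g i j| ≤ R := by
  apply abs_le_of_sq_le_sq _ hR
  exact (entry_le g i j).trans ((rn_le_N2 g i).trans h)

lemma mul_entry_le (A B : M3) (a b : ℝ) (ha : ∀ i j, |A i j| ≤ a) (hb : ∀ i j, |B i j| ≤ b) (i j : Fin 3) :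
    |(A * B) i j| ≤ 3 * (a * b) := by
  have ha0 : 0 ≤ a := (abs_nonneg _).trans (ha 0 0)
  rw [Matrix.mul_apply]
  refine (Finset.abs_sum_le_sum_abs _ _).trans ?_
  have : ∀ k ∈ Finset.univ, |A i k * B k j| ≤ a * b := by
    intro k _; rw [abs_mul]; exact mul_le_mul (ha i k) (hb k j) (abs_nonneg _) ha0
  refine (Finset.sum_le_sum this).trans ?_
  simp

lemma exists_bd (A : M3) : ∃ b, 0 ≤ b ∧ ∀ i j, |A i j| ≤ b := by
  refine ⟨∑ i, ∑ j, |A i j|, by positivity, fun i j => ?_⟩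
  refine le_trans ?_ (Finset.single_le_sum (f := fun i => ∑ j, |A i j|) (fun _ _ => by positivity) (Finset.mem_univ i))
  exact Finset.single_le_sum (f := fun j => |A i j|) (fun _ _ => abs_nonneg _) (Finset.mem_univ j)

lemma finite_N2 (g : M3) (hg : g.det ≠ 0) (R : ℝ) : {γ : SLZ | N2 (rz γ * g) ≤ R}.Finite := by
  obtain ⟨b, hb0, hb⟩ := exists_bd g⁻¹
  apply (finite_bdd (3 * ((|R| + 1) * b))).subset
  intro γ hγ i j
  have e : rz γ = (rz γ * g) * g⁻¹ := by
    rw [mul_assoc, Matrix.mul_nonsing_inv _ (isUnit_iff_ne_zero.mpr hg), mul_one]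
  rw [e]
  apply mul_entry_le _ _ _ _ _ hb
  intro i j
  apply N2_entry _ _ _ _ (by positivity)
  have h1 : N2 (rz γ * g) ≤ R := hγ
  nlinarith [le_abs_self R, abs_nonneg R]

lemma exists_min (g : M3) (hg : g.det ≠ 0) : ∃ γ : SLZ, ∀ γ' : SLZ, N2 (rz γ * g) ≤ N2 (rz γ' * g) := by
  have hf := finite_N2 g hg (N2 (rz 1 * g))
  obtain ⟨γ, hγ, hmin⟩ := Set.exists_min_image _ (fun γ => N2 (rz γ * g)) hf ⟨1, by exact le_refl (N2 (rz 1 * g))⟩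
  refine ⟨γ, fun γ' => ?_⟩
  by_cases h : N2 (rz γ' * g) ≤ N2 (rz 1 * g)
  · exact hmin γ' h
  · exact (show N2 (rz γ * g) ≤ N2 (rz 1 * g) from hγ).trans (not_le.mp h).le

/-- signed permutation sorting the rows -/
def sl (a b c d e f p q r : ℤ) (h : Matrix.det !![a, b, c; d, e, f; p, q, r] = 1) : SLZ := ⟨_, h⟩

lemma rz_sl (a b c d e f p q r : ℤ) (h : Matrix.det !![a, b, c; d, e, f; p, q, r] = 1) :
    rz (sl a b c d e f p q r h) = !![(a:ℝ), b, c; d, e, f; p, q, r] := by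
  ext i j; fin_cases i <;> fin_cases j <;> simp [rz, sl]

lemma rn_mul (a b c d e f p q r : ℝ) (g : M3) :
    rn (!![a, b, c; d, e, f; p, q, r] * g) 0 = a ^ 2 * rn g 0 + b ^ 2 * rn g 1 + c ^ 2 * rn g 2
      + 2 * a * b * ip g 0 1 + 2 * a * c * ip g 0 2 + 2 * b * c * ip g 1 2 ∧
    rn (!![a, b, c; d, e, f; p, q, r] * g) 1 = d ^ 2 * rn g 0 + e ^ 2 * rn g 1 + f ^ 2 * rn g 2
      + 2 * d * e * ip g 0 1 + 2 * d * f * ip g 0 2 + 2 * e * f * ip g 1 2 ∧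
    rn (!![a, b, c; d, e, f; p, q, r] * g) 2 = p ^ 2 * rn g 0 + q ^ 2 * rn g 1 + r ^ 2 * rn g 2
      + 2 * p * q * ip g 0 1 + 2 * p * r * ip g 0 2 + 2 * q * r * ip g 1 2 := by
  simp only [rn, ip, Matrix.mul_apply, Fin.sum_univ_three]
  simp
  refine ⟨?_, ?_, ?_⟩ <;> ring

lemma exists_sort (g : M3) : ∃ γ : SLZ, rn (rz γ * g) 0 ≤ rn (rz γ * g) 1 ∧
    rn (rz γ * g) 1 ≤ rn (rz γ * g) 2 ∧ N2 (rz γ * g) = N2 g := by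
  have key : ∀ (a b c d e f p q r : ℤ) (h : Matrix.det !![a, b, c; d, e, f; p, q, r] = 1) (x y z : ℝ),
    rn (rz (sl a b c d e f p q r h) * g) 0 = x → rn (rz (sl a b c d e f p q r h) * g) 1 = y →
    rn (rz (sl a b c d e f p q r h) * g) 2 = z → x ≤ y → y ≤ z → x + y + z = N2 g →
    ∃ γ : SLZ, rn (rz γ * g) 0 ≤ rn (rz γ * g) 1 ∧
    rn (rz γ * g) 1 ≤ rn (rz γ * g) 2 ∧ N2 (rz γ * g) = N2 g := by
    intro a b c d e f p q r h x y z hx hy hz h1 h2 h3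
    refine ⟨sl a b c d e f p q r h, ?_, ?_, ?_⟩
    · rw [hx, hy]; exact h1
    · rw [hy, hz]; exact h2
    · rw [N2, hx, hy, hz]; exact h3
  have hN : N2 g = rn g 0 + rn g 1 + rn g 2 := rfl
  rcases le_total (rn g 0) (rn g 1) with h01 | h01 <;> rcases le_total (rn g 1) (rn g 2) with h12 | h12 <;>
    rcases le_total (rn g 0) (rn g 2) with h02 | h02
  · apply key 1 0 0 0 1 0 0 0 1 (by decide) (rn g 0) (rn g 1) (rn g 2) <;> first | (rw [rz_sl, (rn_mul _ _ _ _ _ _ _ _ _ g).1]; push_cast; ring) | (rw [rz_sl, (rn_mul _ _ _ _ _ _ _ _ _ g).2.1]; push_cast; ring) | (rw [rz_sl, (rn_mul _ _ _ _ _ _ _ _ _ g).2.2]; push_cast; ring) | linarith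
  · apply key 1 0 0 0 1 0 0 0 1 (by decide) (rn g 0) (rn g 1) (rn g 2) <;> first | (rw [rz_sl, (rn_mul _ _ _ _ _ _ _ _ _ g).1]; push_cast; ring) | (rw [rz_sl, (rn_mul _ _ _ _ _ _ _ _ _ g).2.1]; push_cast; ring) | (rw [rz_sl, (rn_mul _ _ _ _ _ _ _ _ _ g).2.2]; push_cast; ring) | linarith
  · apply key 1 0 0 0 0 (-1) 0 1 0 (by decide) (rn g 0) (rn g 2) (rn g 1) <;> first | (rw [rz_sl, (rn_mul _ _ _ _ _ _ _ _ _ g).1]; push_cast; ring) | (rw [rz_sl, (rn_mul _ _ _ _ _ _ _ _ _ g).2.1]; push_cast; ring) | (rw [rz_sl, (rn_mul _ _ _ _ _ _ _ _ _ g).2.2]; push_cast; ring) | linarith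
  · apply key 0 0 1 1 0 0 0 1 0 (by decide) (rn g 2) (rn g 0) (rn g 1) <;> first | (rw [rz_sl, (rn_mul _ _ _ _ _ _ _ _ _ g).1]; push_cast; ring) | (rw [rz_sl, (rn_mul _ _ _ _ _ _ _ _ _ g).2.1]; push_cast; ring) | (rw [rz_sl, (rn_mul _ _ _ _ _ _ _ _ _ g).2.2]; push_cast; ring) | linarith
  · apply key 0 1 0 (-1) 0 0 0 0 1 (by decide) (rn g 1) (rn g 0) (rn g 2) <;> first | (rw [rz_sl, (rn_mul _ _ _ _ _ _ _ _ _ g).1]; push_cast; ring) | (rw [rz_sl, (rn_mul _ _ _ _ _ _ _ _ _ g).2.1]; push_cast; ring) | (rw [rz_sl, (rn_mul _ _ _ _ _ _ _ _ _ g).2.2]; push_cast; ring) | linarith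
  · apply key 0 1 0 0 0 1 1 0 0 (by decide) (rn g 1) (rn g 2) (rn g 0) <;> first | (rw [rz_sl, (rn_mul _ _ _ _ _ _ _ _ _ g).1]; push_cast; ring) | (rw [rz_sl, (rn_mul _ _ _ _ _ _ _ _ _ g).2.1]; push_cast; ring) | (rw [rz_sl, (rn_mul _ _ _ _ _ _ _ _ _ g).2.2]; push_cast; ring) | linarith
  · apply key 0 0 1 0 (-1) 0 1 0 0 (by decide) (rn g 2) (rn g 1) (rn g 0) <;> first | (rw [rz_sl, (rn_mul _ _ _ _ _ _ _ _ _ g).1]; push_cast; ring) | (rw [rz_sl, (rn_mul _ _ _ _ _ _ _ _ _ g).2.1]; push_cast; ring) | (rw [rz_sl, (rn_mul _ _ _ _ _ _ _ _ _ g).2.2]; push_cast; ring) | linarith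
  · apply key 0 0 1 0 (-1) 0 1 0 0 (by decide) (rn g 2) (rn g 1) (rn g 0) <;> first | (rw [rz_sl, (rn_mul _ _ _ _ _ _ _ _ _ g).1]; push_cast; ring) | (rw [rz_sl, (rn_mul _ _ _ _ _ _ _ _ _ g).2.1]; push_cast; ring) | (rw [rz_sl, (rn_mul _ _ _ _ _ _ _ _ _ g).2.2]; push_cast; ring) | linarith

lemma gram_det (g : M3) : g.det ^ 2 = rn g 0 * rn g 1 * rn g 2 + 2 * ip g 0 1 * ip g 0 2 * ip g 1 2
    - rn g 0 * ip g 1 2 ^ 2 - rn g 1 * ip g 0 2 ^ 2 - rn g 2 * ip g 0 1 ^ 2 := by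
  rw [Matrix.det_fin_three]; simp only [rn, ip]; ring

/-- scalar reduction inequality -/
lemma red_scalar (A B C p q s D2 : ℝ) (hA : 0 < A) (hAB : A ≤ B) (hBC : B ≤ C) (hD : 0 < D2)
    (hdet : D2 = A * B * C + 2 * p * q * s - A * s ^ 2 - B * q ^ 2 - C * p ^ 2)
    (h2 : ∀ m : ℤ, 0 ≤ m ^ 2 * A + 2 * m * p)
    (h3 : ∀ m n : ℤ, 0 ≤ m ^ 2 * A + n ^ 2 * B + 2 * m * n * p + 2 * m * q + 2 * n * s) :
    3 * (A * B * C) ≤ 8 * D2 := by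
  have hp : p ^ 2 ≤ A ^ 2 / 4 := by
    have a := h2 1
    have b := h2 (-1)
    push_cast at a b
    nlinarith
  have hE : 3 / 4 * (A * B) ≤ A * B - p ^ 2 := by nlinarith
  obtain ⟨E, hEd⟩ : ∃ E, E = A * B - p ^ 2 := ⟨_, rfl⟩
  rw [← hEd] at hE
  have hE0 : 0 < E := by nlinarith
  -- minimise
  obtain ⟨t, ht⟩ : ∃ t, t = (A * s - p * q) / E := ⟨_, rfl⟩
  obtain ⟨n, hn⟩ : ∃ n : ℤ, n = -round t := ⟨_, rfl⟩
  obtain ⟨u, hu⟩ : ∃ u, u = (n * p + q) / A := ⟨_, rfl⟩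
  obtain ⟨m, hm⟩ : ∃ m : ℤ, m = -round u := ⟨_, rfl⟩
  have hnt : (n + t) ^ 2 ≤ 1 / 4 := by
    have := abs_sub_round t
    rw [hn]; push_cast
    have h' := sq_le_sq' (abs_le.mp this).1 (abs_le.mp this).2
    nlinarith
  have hmu : (m + u) ^ 2 ≤ 1 / 4 := by
    have := abs_sub_round u
    rw [hm]; push_cast
    have h' := sq_le_sq' (abs_le.mp this).1 (abs_le.mp this).2
    nlinarith
  have key := h3 m n
  have hE' : E ≤ A * B := by rw [hEd]; nlinarith [sq_nonneg p]
  have id : C + (m ^ 2 * A + n ^ 2 * B + 2 * m * n * p + 2 * m * q + 2 * n * s)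
      = D2 / E + A * (m + u) ^ 2 + E / A * (n + t) ^ 2 := by
    rw [hu, ht, hdet]; field_simp; rw [hEd]; ring
  have h4 : E / A ≤ B := by rw [div_le_iff₀ hA]; linarith
  have h5 : 0 < E / A := by positivity
  have h6 : C ≤ D2 / E + C / 2 := by nlinarith
  have h7 : C / 2 * E ≤ D2 := by
    rw [← le_div_iff₀ hE0]; linarith
  nlinarith

lemma reduction (g : M3) (hg : g.det ≠ 0) : ∃ γ : SLZ,
    (∀ γ' : SLZ, N2 (rz γ * g) ≤ N2 (rz γ' * g)) ∧
    rn (rz γ * g) 0 ≤ rn (rz γ * g) 1 ∧ rn (rz γ * g) 1 ≤ rn (rz γ * g) 2 ∧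
    3 * (rn (rz γ * g) 0 * rn (rz γ * g) 1 * rn (rz γ * g) 2) ≤ 8 * g.det ^ 2 := by
  obtain ⟨γ0, h0⟩ := exists_min g hg
  obtain ⟨γ1, h1, h2, h3⟩ := exists_sort (rz γ0 * g)
  rw [← mul_assoc, ← rz_mul] at h1 h2 h3
  refine ⟨γ1 * γ0, fun γ' => by rw [h3]; exact h0 γ', h1, h2, ?_⟩
  have hmin : ∀ γ' : SLZ, N2 (rz (γ1 * γ0) * g) ≤ N2 (rz γ' * (rz (γ1 * γ0) * g)) := by
    intro γ'
    rw [← mul_assoc, ← rz_mul, h3]; exact h0 _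
  have hdet : (rz (γ1 * γ0) * g).det = g.det := by rw [Matrix.det_mul, rz_det, one_mul]
  rw [← hdet] at hg ⊢
  generalize rz (γ1 * γ0) * g = k at *
  apply red_scalar _ _ _ (ip k 0 1) (ip k 0 2) (ip k 1 2) _ (rn_pos k hg 0) h1 h2 (by positivity)
    (gram_det k)
  · intro m
    have := hmin (sl 1 0 0 m 1 0 0 0 1 (by rw [Matrix.det_fin_three]; simp))
    rw [rz_sl] at this
    unfold N2 at this
    obtain ⟨e0, e1, e2⟩ := rn_mul ((1:ℤ):ℝ) ((0:ℤ):ℝ) ((0:ℤ):ℝ) (m : ℝ) ((1:ℤ):ℝ) ((0:ℤ):ℝ) ((0:ℤ):ℝ) ((0:ℤ):ℝ) ((1:ℤ):ℝ) k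
    rw [e0, e1, e2] at this
    push_cast at this
    linarith
  · intro m n
    have := hmin (sl 1 0 0 0 1 0 m n 1 (by rw [Matrix.det_fin_three]; simp))
    rw [rz_sl] at this
    unfold N2 at this
    obtain ⟨e0, e1, e2⟩ := rn_mul ((1:ℤ):ℝ) ((0:ℤ):ℝ) ((0:ℤ):ℝ) ((0:ℤ):ℝ) ((1:ℤ):ℝ) ((0:ℤ):ℝ) (m:ℝ) (n:ℝ) ((1:ℤ):ℝ) k
    rw [e0, e1, e2] at this
    push_cast at this
    linarith

end TC


namespace TC
open MeasureTheory Filter Topology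

/-- sums of finitely supported functions over the lattice as integrals of step functions -/
lemma integral_floor {d : ℕ} (G : (Fin d → ℤ) → ℝ) (hG : G.support.Finite) :
    ∫ x : Fin d → ℝ, G (fun i => ⌊x i⌋) = ∑' c, G c := by
  classical
  have hcube : ∀ c : Fin d → ℤ, volume {x : Fin d → ℝ | (fun i => ⌊x i⌋) = c} = 1 ∧
      MeasurableSet {x : Fin d → ℝ | (fun i => ⌊x i⌋) = c} := by
    intro c
    have e : {x : Fin d → ℝ | (fun i => ⌊x i⌋) = c} =
        Set.pi Set.univ (fun i => Set.Ico (c i : ℝ) (c i + 1)) := by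
      ext x
      simp only [Set.mem_ofPred_eq, Set.mem_pi, Set.mem_univ, true_imp_iff, Set.mem_Ico, funext_iff,
        Int.floor_eq_iff]
    rw [e]
    refine ⟨?_, MeasurableSet.univ_pi fun i => measurableSet_Ico⟩
    rw [Real.volume_pi_Ico]
    simp
  have e1 : ∀ x : Fin d → ℝ, G (fun i => ⌊x i⌋) = ∑ c ∈ hG.toFinset,
      Set.indicator {x : Fin d → ℝ | (fun i => ⌊x i⌋) = c} (fun _ => G c) x := by
    intro x
    simp only [Set.indicator_apply, Set.mem_ofPred_eq]
    rw [Finset.sum_ite_eq]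
    split_ifs with h
    · rfl
    · simpa using h
  simp_rw [e1]
  rw [integral_finsetSum]
  · rw [tsum_eq_sum (s := hG.toFinset)]
    · apply Finset.sum_congr rfl
      intro c _
      rw [integral_indicator (hcube c).2, setIntegral_const, Measure.real, (hcube c).1]
      simp
    · intro c hc
      simpa using hc
  · intro c _
    rw [integrable_indicator_iff (hcube c).2]
    exact integrableOn_const (by rw [(hcube c).1]; simp) (by simp)

lemma integral_floor_smul {d : ℕ} (G : (Fin d → ℤ) → ℝ) (hG : G.support.Finite) (t : ℝ) (ht : 0 < t) :
    ∫ x : Fin d → ℝ, G (fun i => ⌊t * x i⌋) = (∑' c, G c) / t ^ d := by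
  have := Measure.integral_comp_smul (volume : Measure (Fin d → ℝ)) (fun x => G (fun i => ⌊x i⌋)) t
  simp only [Pi.smul_apply, smul_eq_mul, Module.finrank_fin_fun, integral_floor G hG] at this
  rw [this, abs_of_pos (by positivity)]
  field_simp

lemma finite_lattice {d : ℕ} (R : ℝ) : {c : Fin d → ℤ | ∀ i, |(c i : ℝ)| ≤ R}.Finite := by
  apply (Set.Finite.pi' (fun _ : Fin d => Set.finite_Icc (-⌈R⌉) ⌈R⌉)).subset
  intro c hc i
  have := abs_le.mp (hc i)
  have hB := Int.le_ceil R
  constructor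
  · have : (-(⌈R⌉ : ℝ)) ≤ c i := by linarith [this.1]
    exact_mod_cast this
  · have : (c i : ℝ) ≤ (⌈R⌉ : ℝ) := by linarith [this.2]
    exact_mod_cast this

/-- bounded, boundedly supported -/
structure Tame {d : ℕ} (ψ : (Fin d → ℝ) → ℝ) (B R : ℝ) : Prop where
  bd : ∀ x, |ψ x| ≤ B
  supp : ∀ x, ψ x ≠ 0 → ∀ i, |x i| ≤ R

lemma Tame.finite {d : ℕ} {ψ : (Fin d → ℝ) → ℝ} {B R : ℝ} (h : Tame ψ B R) (t : ℝ) (ht : 0 < t) :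
    {c : Fin d → ℤ | ψ (fun i => c i / t) ≠ 0}.Finite := by
  apply (finite_lattice (R * t)).subset
  intro c hc i
  have := h.supp _ hc i
  rw [abs_div, abs_of_pos ht, div_le_iff₀ ht] at this
  exact this

lemma riemann_class {d m : ℕ} (hm : 0 < m) (r : Fin d → ℕ) (hr : ∀ i, r i < m) {ψ : (Fin d → ℝ) → ℝ} {B R : ℝ}
    (h : Tame ψ B R) (hc : ∀ᵐ x, ContinuousAt ψ x) :
    Tendsto (fun t : ℝ => (∑' c : Fin d → ℤ, ψ (fun i => ((m * c i + r i : ℤ) : ℝ) / t)) / t ^ d) atTop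
      (𝓝 (1 / m ^ d * ∫ x, ψ x)) := by
  have hm' : (0:ℝ) < m := by exact_mod_cast hm
  have main : Tendsto (fun t : ℝ => ∫ x : Fin d → ℝ, ψ (fun i => ((m * ⌊t / m * x i⌋ + r i : ℤ) : ℝ) / t)) atTop
      (𝓝 (∫ x, ψ x)) := by
    have hclose : ∀ t : ℝ, 0 < t → ∀ x : ℝ, ∀ i, |((m * ⌊t / m * x⌋ + r i : ℤ) : ℝ) / t - x| ≤ m / t := by
      intro t ht x i
      have h1 := Int.floor_le (t / m * x)
      have h2 := Int.lt_floor_add_one (t / m * x)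
      have h3 : ((r i : ℕ) : ℝ) + 1 ≤ m := by exact_mod_cast hr i
      have h4 : (0:ℝ) ≤ ((r i : ℕ) : ℝ) := by positivity
      have e : t / m * x = t * x / m := by ring
      rw [e] at h1 h2 ⊢
      rw [le_div_iff₀ hm'] at h1
      rw [div_lt_iff₀ hm'] at h2
      have e2 : ((m * ⌊t * x / m⌋ + r i : ℤ) : ℝ) / t - x = ((m * ⌊t * x / m⌋ + r i : ℤ) - t * x : ℝ) / t := by
        field_simp
      rw [e2, abs_div, abs_of_pos ht]
      gcongr
      push_cast
      rw [abs_le]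
      constructor <;> nlinarith
    apply tendsto_integral_filter_of_dominated_convergence
      (Set.indicator (Set.Icc (fun _ => -(R + 1)) (fun _ => R + 1)) (fun _ => B))
    · filter_upwards with t
      have m1 : Measurable (fun x : Fin d → ℝ => fun i => ⌊t / m * x i⌋) := by
        apply measurable_pi_lambda
        intro i
        exact Int.measurable_floor.comp ((measurable_pi_apply i).const_mul _)
      have m2 : Measurable (fun c : Fin d → ℤ => ψ (fun i => ((m * c i + r i : ℤ) : ℝ) / t)) :=
        measurable_of_countable _
      exact (m2.comp m1).aestronglyMeasurable
    · filter_upwards [eventually_ge_atTop (m : ℝ)] with t ht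
      have ht0 : 0 < t := hm'.trans_le ht
      filter_upwards with x
      by_cases h0 : ψ (fun i => ((m * ⌊t / m * x i⌋ + r i : ℤ) : ℝ) / t) = 0
      · rw [h0]
        simp only [norm_zero]
        apply Set.indicator_nonneg
        intro _ _
        exact (abs_nonneg _).trans (h.bd 0)
      · rw [Set.indicator_of_mem]
        · exact h.bd _
        · have h1 := h.supp _ h0
          have h2 : (m : ℝ) / t ≤ 1 := by rw [div_le_one ht0]; exact ht
          constructor
          · intro i
            have a := abs_le.mp (h1 i)
            have b := abs_le.mp (hclose t ht0 (x i) i)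
            dsimp only
            linarith [a.1, b.2]
          · intro i
            have a := abs_le.mp (h1 i)
            have b := abs_le.mp (hclose t ht0 (x i) i)
            dsimp only
            linarith [a.2, b.1]
    · rw [integrable_indicator_iff measurableSet_Icc]
      exact integrableOn_const (by rw [Real.volume_Icc_pi]; exact (ENNReal.prod_lt_top (fun _ _ => ENNReal.ofReal_lt_top)).ne) (by simp)
    · filter_upwards [hc] with x hx
      refine hx.tendsto.comp ?_
      rw [tendsto_pi_nhds]
      intro i
      rw [tendsto_iff_norm_sub_tendsto_zero]
      refine squeeze_zero' (Eventually.of_forall fun _ => norm_nonneg _) (g := fun t : ℝ => (m:ℝ) / t) ?_ (tendsto_const_nhds.div_atTop tendsto_id)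
      filter_upwards [eventually_gt_atTop 0] with t ht
      exact hclose t ht (x i) i
  have h2 := main.const_mul (1 / (m:ℝ) ^ d)
  refine h2.congr' ?_
  filter_upwards [eventually_gt_atTop 0] with t ht
  rw [integral_floor_smul (fun c : Fin d → ℤ => ψ (fun i => ((m * c i + r i : ℤ) : ℝ) / t)) _ (t / m) (by positivity)]
  · rw [div_pow]; field_simp
  · have := h.finite t ht
    apply Set.Finite.of_finite_image (f := fun c : Fin d → ℤ => fun i => (m * c i + r i : ℤ))
    · apply this.subset
      rintro _ ⟨c, hc, rfl⟩
      exact hc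
    · intro c _ c' _ hcc
      ext i
      have := congrFun hcc i
      simp only [add_left_inj] at this
      exact mul_left_cancel₀ (by exact_mod_cast hm.ne') this

/-- the lattice decomposed into residue classes -/
def resEquiv (d m : ℕ) [NeZero m] : (Fin d → ℤ) ≃ (Fin d → Fin m) × (Fin d → ℤ) :=
  (Equiv.piCongrRight (fun _ => Int.divModEquiv m)).trans
    ((Equiv.arrowProdEquivProdArrow (Fin d) (fun _ => ℤ) (fun _ => Fin m)).trans (Equiv.prodComm _ _))

lemma resEquiv_symm {d m : ℕ} [NeZero m] (ρ : Fin d → Fin m) (q : Fin d → ℤ) :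
    (resEquiv d m).symm (ρ, q) = fun i => (m * q i + ((ρ i : ℕ) : ℤ) : ℤ) := by
  ext i
  simp [resEquiv, Int.divModEquiv]
  ring

theorem riemann {d m : ℕ} [NeZero m] (Sbar : Set (Fin d → ZMod m)) {ψ : (Fin d → ℝ) → ℝ} {B R : ℝ}
    (h : Tame ψ B R) (hc : ∀ᵐ x, ContinuousAt ψ x) :
    Tendsto (fun t : ℝ => (∑' c : Fin d → ℤ, Set.indicator {c : Fin d → ℤ | (fun i => (c i : ZMod m)) ∈ Sbar}
        (fun c => ψ (fun i => c i / t)) c) / t ^ d) atTop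
      (𝓝 (Sbar.ncard / m ^ d * ∫ x, ψ x)) := by
  classical
  let T : Finset (Fin d → Fin m) := Finset.univ.filter (fun ρ => (fun i => ((ρ i : ℕ) : ZMod m)) ∈ Sbar)
  have hm : 0 < m := Nat.pos_of_ne_zero (NeZero.ne m)
  have hT : (T.card : ℝ) = Sbar.ncard := by
    congr 1
    rw [← Set.ncard_coe_finset]
    apply Set.ncard_congr (fun ρ _ => (fun i => ((ρ i : ℕ) : ZMod m)))
    · intro ρ hρ; simpa [T] using hρ
    · intro ρ ρ' _ _ e
      ext i
      have := congrFun e i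
      rw [ZMod.natCast_eq_natCast_iff'] at this
      rwa [Nat.mod_eq_of_lt (ρ i).2, Nat.mod_eq_of_lt (ρ' i).2] at this
    · intro b hb
      refine ⟨fun i => ⟨(b i).val, ZMod.val_lt _⟩, ?_, ?_⟩
      · simpa [T] using hb
      · ext i; simp
  have key := tendsto_finsetSum T (fun ρ _ => riemann_class hm (fun i => (ρ i : ℕ)) (fun i => (ρ i).2) h hc)
  have e : ∑ ρ ∈ T, (1 / (m:ℝ) ^ d * ∫ x, ψ x) = Sbar.ncard / m ^ d * ∫ x, ψ x := by
    rw [Finset.sum_const, nsmul_eq_mul, hT]; ring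
  rw [e] at key
  refine key.congr' ?_
  filter_upwards [eventually_gt_atTop 0] with t ht
  rw [← Finset.sum_div]
  congr 1
  rw [← (resEquiv d m).symm.tsum_eq]
  have hfin : (Function.support fun p => Set.indicator {c : Fin d → ℤ | (fun i => (c i : ZMod m)) ∈ Sbar}
        (fun c => ψ (fun i => c i / t)) ((resEquiv d m).symm p)).Finite := by
    apply Set.Finite.subset ((h.finite t ht).preimage ((resEquiv d m).symm.injective.injOn))
    intro p hp
    simp only [Function.mem_support, ne_eq, Set.indicator_apply_eq_zero, not_forall] at hp
    exact hp.2
  rw [Summable.tsum_prod (summable_of_hasFiniteSupport hfin), tsum_fintype]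
  have hmem : ∀ (ρ : Fin d → Fin m) q, (resEquiv d m).symm (ρ, q) ∈ {c : Fin d → ℤ | (fun i => (c i : ZMod m)) ∈ Sbar} ↔ ρ ∈ T := by
    intro ρ q
    rw [resEquiv_symm]
    simp [T]
  rw [← Finset.sum_subset (Finset.subset_univ T)]
  · apply Finset.sum_congr rfl
    intro ρ hρ
    apply tsum_congr
    intro q
    rw [Set.indicator_of_mem ((hmem ρ q).mpr hρ), resEquiv_symm]
  · intro ρ _ hρ
    convert tsum_zero with q
    rw [Set.indicator_of_notMem (fun hh => hρ ((hmem ρ q).mp hh))]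

/-- bounded null closed sets contain few lattice points -/
theorem null_count {d : ℕ} (K : Set (Fin d → ℝ)) (hK : IsClosed K) {R : ℝ} (hR : ∀ x ∈ K, ∀ i, |x i| ≤ R)
    (h0 : volume K = 0) (ε : ℝ) (hε : 0 < ε) :
    ∀ᶠ t : ℝ in atTop, {c : Fin d → ℤ | (fun i => (c i : ℝ) / t) ∈ K}.Finite ∧
      ({c : Fin d → ℤ | (fun i => (c i : ℝ) / t) ∈ K}.ncard : ℝ) ≤ ε * t ^ d := by
  classical
  have tame : Tame (K.indicator (fun _ => (1:ℝ))) 1 R := by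
    refine ⟨fun x => ?_, fun x hx => hR x ?_⟩
    · by_cases h : x ∈ K <;> simp [h]
    · by_contra h; simp [h] at hx
  have hc : ∀ᵐ x, ContinuousAt (K.indicator (fun _ => (1:ℝ))) x := by
    have : ∀ᵐ x, x ∈ Kᶜ := measure_eq_zero_iff_ae_notMem.mp h0
    filter_upwards [this] with x hx
    apply ContinuousAt.congr (f := fun _ => (0:ℝ)) continuousAt_const
    filter_upwards [hK.isOpen_compl.mem_nhds hx] with y hy
    rw [Set.indicator_of_notMem hy]
  have key := riemann (m := 1) (Set.univ : Set (Fin d → ZMod 1)) tame hc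
  rw [integral_indicator hK.measurableSet, setIntegral_measure_zero _ h0, mul_zero] at key
  have := key.eventually_le_const hε
  filter_upwards [this, eventually_gt_atTop 0] with t ht ht0
  have hf : {c : Fin d → ℤ | (fun i => (c i : ℝ) / t) ∈ K}.Finite := by
    apply (tame.finite t ht0).subset
    intro c hc
    have : (fun i => (c i : ℝ) / t) ∈ K := hc
    simp [this]
  refine ⟨hf, ?_⟩
  rw [div_le_iff₀ (by positivity)] at ht
  refine le_trans (le_of_eq ?_) ht
  rw [tsum_eq_sum (s := hf.toFinset)]
  · rw [Set.ncard_eq_toFinset_card _ hf, Finset.card_eq_sum_ones]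
    push_cast
    apply Finset.sum_congr rfl
    intro c hc
    have : (fun i => (c i : ℝ) / t) ∈ K := by simpa using hc
    simp [this]
  · intro c hc
    have : (fun i => (c i : ℝ) / t) ∉ K := by simpa using hc
    simp [this]

end TC


namespace TC
open Matrix MeasureTheory Filter Topology

/-- no common zero with the Hessian -/
def NoFlex {K : Type*} [Field K] (c : Fin 10 → K) : Prop :=
  ∀ v : Fin 3 → K, v ≠ 0 → ¬ (ev c v = 0 ∧ ev (hc c) v = 0)

section field
variable {K : Type*} [Field K]

lemma NoFlex.act {c : Fin 10 → K} (h : NoFlex c) (g : Matrix (Fin 3) (Fin 3) K) (hg : g.det ≠ 0) :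
    NoFlex (act g c) := by
  rintro v hv ⟨h1, h2⟩
  rw [hc_act] at h2
  rw [ev_act] at h1
  have h2' : g.det ^ 2 * ev (TC.act g (hc c)) v = 0 := by
    rw [← h2]; simp [ev]; ring
  have h3 : ev (TC.act g (hc c)) v = 0 := by simpa [hg] using h2'
  rw [ev_act] at h3
  refine h _ (fun h0 => hv ?_) ⟨h1, h3⟩
  exact Matrix.eq_zero_of_vecMul_eq_zero hg h0

variable (u : K) (hu : ∀ s : K, s ^ 3 ≠ u)
include hu

lemma nc_ne : u ≠ 0 := fun h => hu 0 (by simp [h])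
lemma nc1 (y z : K) (h : y ^ 3 = u * z ^ 3) : y = 0 ∧ z = 0 := by
  have hz : z = 0 := by
    by_contra hz
    apply hu (y / z)
    rw [div_pow, h]; field_simp
  rw [hz] at h
  exact ⟨by simpa using h, hz⟩
lemma nc2 (y z : K) (h : y ^ 3 = u ^ 2 * z ^ 3) : y = 0 ∧ z = 0 := by
  have hu0 := nc_ne u hu
  have hy : y = 0 := by
    by_contra hy
    apply hu (u * z / y)
    rw [div_pow, mul_pow, h]
    have hz : z ≠ 0 := by rintro rfl; simp [hy] at h
    field_simp
  rw [hy] at h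
  have : u ^ 2 * z ^ 3 = 0 := by rw [← h]; simp
  exact ⟨hy, by simpa [hu0] using this⟩

lemma noFlex_gh (h2 : (2:K) ≠ 0) (δ : K) (hκ : 27 * u ^ 3 + δ ^ 3 ≠ 0) : NoFlex (gh 1 u (u ^ 2) δ) := by
  rintro v hv ⟨h1, h3⟩
  rw [hc_gh, ev_gh] at h3
  rw [ev_gh] at h1
  have hu0 := nc_ne u hu
  have e : 2 ^ 3 * (27 * u ^ 3 + δ ^ 3) * (v 0 * v 1 * v 2) = 0 := by
    linear_combination h3 + 6 * δ ^ 2 * h1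
  have e' : v 0 * v 1 * v 2 = 0 := by
    rcases mul_eq_zero.mp e with h | h
    · exact absurd h (mul_ne_zero (pow_ne_zero _ h2) hκ)
    · exact h
  have hS : v 0 ^ 3 + u * v 1 ^ 3 + u ^ 2 * v 2 ^ 3 = 0 := by linear_combination h1 - δ * e'
  apply hv
  have goal : v 0 = 0 ∧ v 1 = 0 ∧ v 2 = 0 := by
    rcases mul_eq_zero.mp e' with h | h
    · rcases mul_eq_zero.mp h with h | h
      · rw [h] at hS
        have : u * ((- v 1) ^ 3 - u * v 2 ^ 3) = 0 := by linear_combination -hS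
        have := (mul_eq_zero.mp this).resolve_left hu0
        have := nc1 u hu (- v 1) (v 2) (by linear_combination this)
        exact ⟨h, by simpa using this.1, this.2⟩
      · rw [h] at hS
        have := nc2 u hu (- v 0) (v 2) (by linear_combination -hS)
        exact ⟨by simpa using this.1, h, this.2⟩
    · rw [h] at hS
      have := nc1 u hu (- v 0) (v 1) (by linear_combination -hS)
      exact ⟨by simpa using this.1, this.2, h⟩
  ext i; fin_cases i
  exacts [goal.1, goal.2.1, goal.2.2]

lemma stab_gh (h2 : (2:K) ≠ 0) (h3 : (3:K) ≠ 0) (δ δ' : K) (hκ : 27 * u ^ 3 + δ' ^ 3 ≠ 0)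
    (h : Matrix (Fin 3) (Fin 3) K) (hd : h.det ≠ 0) (e : act h (gh 1 u (u ^ 2) δ) = gh 1 u (u ^ 2) δ') :
    (h = Matrix.diagonal (fun i => h i i)) ∧ (∀ i, h i i ^ 3 = 1) ∧ δ' = δ * (h 0 0 * h 1 1 * h 2 2) := by
  have hu0 := nc_ne u hu
  have hp := pencil h 1 u (u ^ 2) δ δ' e
  have hg := grad h hd _ _ _ _ _ hp
  obtain ⟨μ, hμ⟩ : ∃ μ, μ = 6 * (δ' ^ 2 - h.det ^ 2 * δ ^ 2) := ⟨_, rfl⟩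
  obtain ⟨ν, hν⟩ : ∃ ν, ν = h.det ^ 2 * (216 * 1 * u * u ^ 2 + 2 * δ ^ 3) + 6 * δ' ^ 2 * δ := ⟨_, rfl⟩
  rw [← hμ, ← hν] at hg hp
  have hμ0 : μ = 0 := by
    by_contra hμ0
    apply row_ne h hd 0
    obtain ⟨a1, a2, a3⟩ := hg 0
    have q1 : 3 * μ * (h 0 0 ^ 3 - u * h 0 1 ^ 3) = 0 := by
      linear_combination h 0 0 * a1 - h 0 1 * a2
    have q2 : 3 * μ * (h 0 0 ^ 3 - u ^ 2 * h 0 2 ^ 3) = 0 := by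
      linear_combination h 0 0 * a1 - h 0 2 * a3
    have r1 := nc1 u hu _ _ (sub_eq_zero.mp ((mul_eq_zero.mp q1).resolve_left (mul_ne_zero h3 hμ0)))
    have r2 := nc2 u hu _ _ (sub_eq_zero.mp ((mul_eq_zero.mp q2).resolve_left (mul_ne_zero h3 hμ0)))
    ext i; fin_cases i
    exacts [r1.1, r1.2, r2.2]
  have hν0 : ν ≠ 0 := by
    intro h0
    rw [hμ0, h0] at hp
    have := congrFun hp 9
    rw [act_9] at this
    have t : (2:K) ^ 3 * (27 * u ^ 3 + δ' ^ 3) = 0 := by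
      simp [d3, gh] at this
      rcases this with h | h
      · exfalso; apply h2
        have : (2:K) ^ 3 = 0 := by linear_combination h
        simpa using this
      · linear_combination 8 * h
    exact mul_ne_zero (pow_ne_zero _ h2) hκ t
  have hev : ∀ i, h i 0 ^ 3 + u * h i 1 ^ 3 + u ^ 2 * h i 2 ^ 3 + δ * h i 0 * h i 1 * h i 2 = ![1, u, u ^ 2] i := by
    have e0 : ev (gh 1 u (u ^ 2) δ) (h 0) = 1 := congrFun e 0
    have e1 : ev (gh 1 u (u ^ 2) δ) (h 1) = u := congrFun e 1
    have e2 : ev (gh 1 u (u ^ 2) δ) (h 2) = u ^ 2 := congrFun e 2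
    rw [ev_gh] at e0 e1 e2
    intro i
    fin_cases i
    · simpa using e0
    · simpa using e1
    · simpa using e2
  have hpr : ∀ i, h i 0 * h i 1 = 0 ∧ h i 0 * h i 2 = 0 ∧ h i 1 * h i 2 = 0 := by
    intro i
    obtain ⟨a1, a2, a3⟩ := hg i
    rw [hμ0] at a1 a2 a3
    refine ⟨?_, ?_, ?_⟩
    · exact (mul_eq_zero.mp (show ν * (h i 0 * h i 1) = 0 by linear_combination a3)).resolve_left hν0
    · exact (mul_eq_zero.mp (show ν * (h i 0 * h i 2) = 0 by linear_combination a2)).resolve_left hν0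
    · exact (mul_eq_zero.mp (show ν * (h i 1 * h i 2) = 0 by linear_combination a1)).resolve_left hν0
  have r0 : h 0 0 ^ 3 = 1 ∧ h 0 1 = 0 ∧ h 0 2 = 0 := by
    have ee := hev 0
    simp only [Matrix.cons_val_zero] at ee
    obtain ⟨p1, p2, p3⟩ := hpr 0
    rcases row_mono (h 0) (row_ne h hd 0) p1 p2 p3 with ⟨c0, c1, c2⟩ | ⟨c0, c1, c2⟩ | ⟨c0, c1, c2⟩
    · rw [c1, c2] at ee; exact ⟨by linear_combination ee, c1, c2⟩
    · rw [c0, c2] at ee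
      exact absurd (nc1 u hu 1 (h 0 1) (by linear_combination -ee)).1 one_ne_zero
    · rw [c0, c1] at ee
      exact absurd (nc2 u hu 1 (h 0 2) (by linear_combination -ee)).1 one_ne_zero
  have r1 : h 1 1 ^ 3 = 1 ∧ h 1 0 = 0 ∧ h 1 2 = 0 := by
    have ee := hev 1
    simp only [Matrix.cons_val_one, Matrix.cons_val_zero] at ee
    obtain ⟨p1, p2, p3⟩ := hpr 1
    rcases row_mono (h 1) (row_ne h hd 1) p1 p2 p3 with ⟨c0, c1, c2⟩ | ⟨c0, c1, c2⟩ | ⟨c0, c1, c2⟩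
    · rw [c1, c2] at ee
      exact absurd (nc1 u hu (h 1 0) 1 (by linear_combination ee)).2 one_ne_zero
    · rw [c0, c2] at ee
      refine ⟨mul_left_cancel₀ hu0 (by linear_combination ee), c0, c2⟩
    · rw [c0, c1] at ee
      exact absurd (nc1 u hu 1 (h 1 2) (mul_left_cancel₀ hu0 (by linear_combination -ee))).1 one_ne_zero
  have r2 : h 2 2 ^ 3 = 1 ∧ h 2 0 = 0 ∧ h 2 1 = 0 := by
    have ee := hev 2
    simp only [Matrix.cons_val] at ee
    obtain ⟨p1, p2, p3⟩ := hpr 2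
    rcases row_mono (h 2) (row_ne h hd 2) p1 p2 p3 with ⟨c0, c1, c2⟩ | ⟨c0, c1, c2⟩ | ⟨c0, c1, c2⟩
    · rw [c1, c2] at ee
      exact absurd (nc2 u hu (h 2 0) 1 (by linear_combination ee)).2 one_ne_zero
    · rw [c0, c2] at ee
      exact absurd (nc1 u hu (h 2 1) 1 (mul_left_cancel₀ hu0 (by linear_combination ee))).2 one_ne_zero
    · rw [c0, c1] at ee
      refine ⟨mul_left_cancel₀ (pow_ne_zero 2 hu0) (by linear_combination ee), c0, c1⟩
  have hdiag : h = Matrix.diagonal (fun i => h i i) := by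
    ext i j
    fin_cases i <;> fin_cases j
    · simp
    · simpa using r0.2.1
    · simpa using r0.2.2
    · simpa using r1.2.1
    · simp
    · simpa using r1.2.2
    · simpa using r2.2.1
    · simpa using r2.2.2
    · simp
  refine ⟨hdiag, ?_, ?_⟩
  · intro i; fin_cases i
    exacts [r0.1, r1.1, r2.1]
  · have e9 := congrFun e 9
    rw [act_9] at e9
    simp only [d3, gh, r0.2.1, r0.2.2, r1.2.1, r1.2.2, r2.2.1, r2.2.2] at e9
    simp at e9
    linear_combination -e9

end field

section finite
variable {K : Type*} [Field K] [Fintype K] [DecidableEq K]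

lemma card_cube (a : K) : (Finset.univ.filter (fun s : K => s ^ 3 = a)).card ≤ 3 := by
  classical
  refine le_trans (Finset.card_le_card (t := (Polynomial.nthRoots 3 a).toFinset) ?_) ?_
  · intro s hs
    simp only [Finset.mem_filter, Finset.mem_univ, true_and] at hs
    rw [Multiset.mem_toFinset, Polynomial.mem_nthRoots (by norm_num)]
    exact hs
  · exact (Multiset.toFinset_card_le _).trans (Polynomial.card_nthRoots 3 a)

lemma arith_q (q : ℕ) (hq : 7 ≤ q) :
    27 * q ^ 10 ≤ 100 * ((q ^ 3 - 1) * (q ^ 3 - q) * (q ^ 3 - q ^ 2) * (q - 3)) := by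
  have h1 : 1 ≤ q ^ 3 := Nat.one_le_pow _ _ (by omega)
  have h2 : q ≤ q ^ 3 := Nat.le_self_pow (by norm_num) q
  have h3 : q ^ 2 ≤ q ^ 3 := Nat.pow_le_pow_right (by omega) (by norm_num)
  have h4 : 3 ≤ q := by omega
  zify [h1, h2, h3, h4]
  have hq' : (7:ℤ) ≤ q := by exact_mod_cast hq
  obtain ⟨x, hx⟩ : ∃ x : ℤ, x = q := ⟨_, rfl⟩
  rw [← hx] at hq' ⊢
  have b0 : 0 ≤ x ^ 3 := by positivity
  have a3 : 6 * x ^ 3 ≤ 7 * (x ^ 3 - x ^ 2) := by nlinarith [mul_nonneg (sq_nonneg x) (sub_nonneg.mpr hq')]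
  have a2 : 6 * x ^ 3 ≤ 7 * (x ^ 3 - x) := by nlinarith
  have a1 : 6 * x ^ 3 ≤ 7 * (x ^ 3 - 1) := by nlinarith
  have a4 : 4 * x ≤ 7 * (x - 3) := by linarith
  have m1 : (6 * x ^ 3) * (6 * x ^ 3) ≤ (7 * (x ^ 3 - 1)) * (7 * (x ^ 3 - x)) :=
    mul_le_mul a1 a2 (by positivity) (by linarith)
  have m2 : (6 * x ^ 3) * (6 * x ^ 3) * (6 * x ^ 3) ≤ (7 * (x ^ 3 - 1)) * (7 * (x ^ 3 - x)) * (7 * (x ^ 3 - x ^ 2)) :=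
    mul_le_mul m1 a3 (by positivity) (le_trans (by positivity) m1)
  have m3 : (6 * x ^ 3) * (6 * x ^ 3) * (6 * x ^ 3) * (4 * x) ≤ (7 * (x ^ 3 - 1)) * (7 * (x ^ 3 - x)) * (7 * (x ^ 3 - x ^ 2)) * (7 * (x - 3)) :=
    mul_le_mul m2 a4 (by positivity) (le_trans (by positivity) m2)
  have : 0 ≤ x ^ 10 := by positivity
  nlinarith

lemma card_good (h2 : (2:K) ≠ 0) (h3 : (3:K) ≠ 0) (hq : 7 ≤ Fintype.card K) (u : K) (hu : ∀ s : K, s ^ 3 ≠ u)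
    (G : Finset (Fin 10 → K)) (hG : ∀ c, NoFlex c → c ∈ G) : Fintype.card K ^ 10 ≤ 100 * G.card := by
  classical
  let D : Finset K := Finset.univ.filter (fun δ => 27 * u ^ 3 + δ ^ 3 ≠ 0)
  have hD : Fintype.card K - 3 ≤ D.card := by
    have := Finset.card_filter_add_card_filter_not (s := (Finset.univ : Finset K)) (fun δ => 27 * u ^ 3 + δ ^ 3 ≠ 0)
    have h' : (Finset.univ.filter (fun δ : K => ¬ (27 * u ^ 3 + δ ^ 3 ≠ 0))).card ≤ 3 := by
      refine le_trans (Finset.card_le_card ?_) (card_cube (-27 * u ^ 3))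
      intro δ hδ
      simp only [Finset.mem_filter, Finset.mem_univ, true_and, not_not] at hδ ⊢
      linear_combination hδ
    rw [Finset.card_univ] at this
    have e : D = (Finset.univ.filter (fun δ : K => 27 * u ^ 3 + δ ^ 3 ≠ 0)) := rfl
    rw [e]; omega
  let s : Finset (GL (Fin 3) K × K) := Finset.univ ×ˢ D
  let f : GL (Fin 3) K × K → (Fin 10 → K) := fun p => act (p.1 : Matrix (Fin 3) (Fin 3) K) (gh 1 u (u ^ 2) p.2)
  have hdet : ∀ g : GL (Fin 3) K, (g : Matrix (Fin 3) (Fin 3) K).det ≠ 0 := fun g =>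
    ((Matrix.isUnit_iff_isUnit_det _).mp g.isUnit).ne_zero
  have himg : s.image f ⊆ G := by
    intro c hc
    obtain ⟨p, hp, rfl⟩ := Finset.mem_image.mp hc
    simp only [s, D, Finset.mem_product, Finset.mem_filter, Finset.mem_univ, true_and] at hp
    exact hG _ ((noFlex_gh u hu h2 p.2 hp).act _ (hdet _))
  have hfib : ∀ a ∈ s.image f, (s.filter (fun x => f x = a)).card ≤ 27 := by
    intro a ha
    obtain ⟨p0, hp0, rfl⟩ := Finset.mem_image.mp ha
    simp only [s, D, Finset.mem_product, Finset.mem_filter, Finset.mem_univ, true_and] at hp0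
    have hst : ∀ x ∈ s.filter (fun x => f x = f p0), _ := fun x hx => by
      have hx' := Finset.mem_filter.mp hx
      have e1 : act ((p0.1⁻¹ * x.1 : GL (Fin 3) K) : Matrix (Fin 3) (Fin 3) K) (gh 1 u (u ^ 2) x.2) = gh 1 u (u ^ 2) p0.2 := by
        rw [Units.val_mul, act_mul]
        have := hx'.2
        simp only [f] at this
        rw [this, ← act_mul, ← Units.val_mul, inv_mul_cancel, Units.val_one, act_one]
      exact stab_gh u hu h2 h3 _ _ hp0 _ (hdet _) e1
    have hcard : (Fintype.piFinset (fun _ : Fin 3 => Finset.univ.filter (fun s : K => s ^ 3 = 1))).card ≤ 27 := by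
      rw [Fintype.card_piFinset]
      simp only [Finset.prod_const, Finset.card_univ, Fintype.card_fin]
      calc _ ≤ 3 ^ 3 := Nat.pow_le_pow_left (card_cube (1:K)) 3
        _ = 27 := by norm_num
    refine le_trans (Finset.card_le_card_of_injOn
      (fun x => fun i => ((p0.1⁻¹ * x.1 : GL (Fin 3) K) : Matrix (Fin 3) (Fin 3) K) i i) ?_ ?_) hcard
    · intro x hx
      obtain ⟨_, b, _⟩ := hst x hx
      simp only [Finset.mem_coe, Fintype.mem_piFinset, Finset.mem_filter, Finset.mem_univ, true_and]
      exact b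
    · intro x hx y hy hxy
      obtain ⟨a1, b1, c1⟩ := hst x hx
      obtain ⟨a2, b2, c2⟩ := hst y hy
      have hh : ∀ i, ((p0.1⁻¹ * x.1 : GL (Fin 3) K) : Matrix (Fin 3) (Fin 3) K) i i =
        ((p0.1⁻¹ * y.1 : GL (Fin 3) K) : Matrix (Fin 3) (Fin 3) K) i i := fun i => congrFun hxy i
      have e1 : p0.1⁻¹ * x.1 = p0.1⁻¹ * y.1 := by
        apply Units.ext
        rw [a1, a2]
        congr 1
      have e2 : x.1 = y.1 := mul_left_cancel e1
      have e3 : x.2 = y.2 := by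
        rw [c1, hh 0, hh 1, hh 2] at c2
        refine mul_right_cancel₀ ?_ c2
        intro h0
        have := b2 0
        have := b2 1
        have := b2 2
        rcases mul_eq_zero.mp h0 with h | h
        · rcases mul_eq_zero.mp h with h | h
          · have := b2 0; rw [h] at this; simp at this
          · have := b2 1; rw [h] at this; simp at this
        · have := b2 2; rw [h] at this; simp at this
      exact Prod.ext e2 e3
  have hmain := Finset.card_le_mul_card_image s 27 hfib
  have hsc : s.card = Nat.card (GL (Fin 3) K) * D.card := by
    rw [Finset.card_product, Finset.card_univ, Nat.card_eq_fintype_card]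
  rw [Matrix.card_GL_field, Fin.prod_univ_three] at hsc
  have h5 := arith_q (Fintype.card K) hq
  have h6 := Finset.card_le_card himg
  simp only [Fin.val_zero, Fin.val_one, Fin.val_two, pow_zero, pow_one] at hsc
  have h7 : (Fintype.card K ^ 3 - 1) * (Fintype.card K ^ 3 - Fintype.card K) * (Fintype.card K ^ 3 - Fintype.card K ^ 2) * (Fintype.card K - 3) ≤ s.card := by
    rw [hsc]; exact Nat.mul_le_mul_left _ hD
  omega

end finite

lemma exists_noncube (p : ℕ) [Fact p.Prime] (h : p ≡ 1 [MOD 3]) : ∃ u : ZMod p, ∀ s : ZMod p, s ^ 3 ≠ u := by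
  by_contra hcon
  push Not at hcon
  have hsur : Function.Surjective (fun s : ZMod p => s ^ 3) := hcon
  have hinj := Finite.injective_iff_surjective.mpr hsur
  have hdvd : 3 ∣ Nat.card (ZMod p)ˣ := by
    rw [Nat.card_eq_fintype_card, ZMod.card_units]
    exact (Nat.modEq_iff_dvd' (Fact.out (p := p.Prime)).one_le).mp h.symm
  have : Fact (Nat.Prime 3) := ⟨Nat.prime_three⟩
  obtain ⟨ω, hω⟩ := exists_prime_orderOf_dvd_card' 3 hdvd
  have h1 : (ω : ZMod p) ^ 3 = 1 := by
    rw [← Units.val_pow_eq_pow_val, ← hω, pow_orderOf_eq_one]; rfl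
  have h2 : (ω : ZMod p) = 1 := hinj (by simp [h1])
  have h3 : ω = 1 := Units.ext h2
  rw [h3, orderOf_one] at hω
  omega

lemma card_bad (p : ℕ) [Fact p.Prime] (h : p ≡ 1 [MOD 3]) :
    100 * {c : Fin 10 → ZMod p | ¬ NoFlex c}.ncard ≤ 99 * p ^ 10 := by
  classical
  have hp := Fact.out (p := p.Prime)
  have h7 : 7 ≤ p := by
    by_contra hlt
    have : p < 7 := by omega
    have h2 := hp.two_le
    have hh : p % 3 = 1 := h
    have : p = 4 := by omega
    rw [this] at hp; revert hp; decide
  obtain ⟨u, hu⟩ := exists_noncube p h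
  have nz : ∀ n : ℕ, 0 < n → n < 7 → (n : ZMod p) ≠ 0 := by
    intro n hn hn7 h0
    rw [ZMod.natCast_eq_zero_iff] at h0
    have := Nat.le_of_dvd hn h0
    omega
  have key := card_good (K := ZMod p) (by exact_mod_cast nz 2 (by norm_num) (by norm_num))
    (by exact_mod_cast nz 3 (by norm_num) (by norm_num)) (by rw [ZMod.card]; exact h7) u hu
    (Finset.univ.filter NoFlex) (by simp)
  have hs := Finset.card_filter_add_card_filter_not (s := (Finset.univ : Finset (Fin 10 → ZMod p))) NoFlex
  have e : {c : Fin 10 → ZMod p | ¬ NoFlex c}.ncard = (Finset.univ.filter (fun c : Fin 10 → ZMod p => ¬ NoFlex c)).card := by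
    rw [← Set.ncard_coe_finset]; congr 1; ext; simp
  rw [Finset.card_univ, Fintype.card_fun, Fintype.card_fin, ZMod.card] at hs
  rw [ZMod.card] at key
  rw [e]
  omega

end TC


namespace TC
open Matrix MeasureTheory Filter Topology

lemma ev_smul_vec {R : Type*} [CommRing R] (c : Fin 10 → R) (t : R) (v : Fin 3 → R) :
    ev c (fun i => t * v i) = t ^ 3 * ev c v := by
  simp only [ev]; ring

lemma clear_denom (v : Fin 3 → ℚ) (hv : v ≠ 0) : ∃ (w : Fin 3 → ℤ) (t : ℚ), w ≠ 0 ∧ t ≠ 0 ∧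
    (fun i => (w i : ℚ)) = fun i => t * v i := by
  have hd : ∀ i, ((v i).den : ℚ) ≠ 0 := fun i => by exact_mod_cast (v i).den_ne_zero
  have key : (fun i => ((![(v 0).num * (v 1).den * (v 2).den, (v 1).num * (v 0).den * (v 2).den,
      (v 2).num * (v 0).den * (v 1).den] : Fin 3 → ℤ) i : ℚ)) =
      fun i => ((v 0).den * (v 1).den * (v 2).den : ℚ) * v i := by
    ext i
    have h0 := Rat.mul_den_eq_num (v 0)
    have h1 := Rat.mul_den_eq_num (v 1)
    have h2 := Rat.mul_den_eq_num (v 2)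
    fin_cases i
    · simp; rw [← h0]; ring
    · simp; rw [← h1]; ring
    · simp; rw [← h2]; ring
  refine ⟨_, _, ?_, ?_, key⟩
  · intro h0
    rw [h0] at key
    apply hv
    ext i
    have := congrFun key i
    simp only [Pi.zero_apply, Int.cast_zero] at this
    have h' := (mul_eq_zero.mp this.symm).resolve_left (mul_ne_zero (mul_ne_zero (hd 0) (hd 1)) (hd 2))
    simpa using h'
  · exact mul_ne_zero (mul_ne_zero (hd 0) (hd 1)) (hd 2)

/-- an integral form with a rational flex has an integral flex which is nonzero mod `p` -/
lemma flex_mod (c : Fin 10 → ℤ) (hc' : ¬ StronglyIrred c) (p : ℕ) [Fact p.Prime] :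
    ¬ NoFlex (fun i => (c i : ZMod p)) := by
  unfold StronglyIrred at hc'
  rw [not_not] at hc'
  obtain ⟨v, hv, h1, h2⟩ := hc'
  rw [hess_cubic, eval_cubic] at h2
  rw [eval_cubic] at h1
  obtain ⟨w0, t, hw0, ht, hwt⟩ := clear_denom v hv
  have castev : ∀ (d : Fin 10 → ℤ) (w : Fin 3 → ℤ), ((ev d w : ℤ) : ℚ) = ev (fun i => (d i : ℚ)) (fun i => (w i : ℚ)) := by
    intro d w; simp [ev]
  have casthc : hc (fun i => (c i : ℚ)) = fun i => ((hc c i : ℤ) : ℚ) := by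
    have := hc_map (Int.castRingHom ℚ) c
    simpa using this
  have hex : ∃ n : ℕ, ∃ w : Fin 3 → ℤ, w ≠ 0 ∧ ev c w = 0 ∧ ev (hc c) w = 0 ∧
      n = (w 0).natAbs + (w 1).natAbs + (w 2).natAbs := by
    refine ⟨_, w0, hw0, ?_, ?_, rfl⟩
    · have : ((ev c w0 : ℤ) : ℚ) = 0 := by rw [castev, hwt, ev_smul_vec, h1, mul_zero]
      exact_mod_cast this
    · have : ((ev (hc c) w0 : ℤ) : ℚ) = 0 := by rw [castev, hwt, ev_smul_vec, ← casthc, h2, mul_zero]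
      exact_mod_cast this
  classical
  obtain ⟨w, hw, e1, e2, hn⟩ := Nat.find_spec hex
  intro hno
  have castp : ∀ (d : Fin 10 → ℤ) (w : Fin 3 → ℤ), ((ev d w : ℤ) : ZMod p) = ev (fun i => (d i : ZMod p)) (fun i => (w i : ZMod p)) := by
    intro d w; simp [ev]
  have castph : hc (fun i => (c i : ZMod p)) = fun i => ((hc c i : ℤ) : ZMod p) := by
    have := hc_map (Int.castRingHom (ZMod p)) c
    simpa using this
  refine hno (fun i => (w i : ZMod p)) ?_ ⟨?_, ?_⟩
  · intro h0
    have hdv : ∀ i, (p : ℤ) ∣ w i := by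
      intro i
      rw [← ZMod.intCast_zmod_eq_zero_iff_dvd]
      exact congrFun h0 i
    choose z hz using hdv
    have hp := Fact.out (p := p.Prime)
    have hp0 : (p : ℤ) ≠ 0 := by exact_mod_cast hp.ne_zero
    have hz' : w = fun i => (p : ℤ) * z i := funext hz
    have hz0 : z ≠ 0 := by
      rintro rfl; apply hw; rw [hz']; ext i; simp
    have := Nat.find_min' hex ⟨z, hz0, by
      rw [hz', ev_smul_vec] at e1
      exact (mul_eq_zero.mp e1).resolve_left (pow_ne_zero _ hp0), by
      rw [hz', ev_smul_vec] at e2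
      exact (mul_eq_zero.mp e2).resolve_left (pow_ne_zero _ hp0), rfl⟩
    rw [hn, hz 0, hz 1, hz 2, Int.natAbs_mul, Int.natAbs_mul, Int.natAbs_mul, Int.natAbs_natCast] at this
    have hpos : 0 < (z 0).natAbs + (z 1).natAbs + (z 2).natAbs := by
      by_contra hh
      apply hz0
      ext i; fin_cases i <;> simp <;> omega
    have h2 := hp.two_le
    nlinarith
  · rw [← castp, e1]; simp
  · rw [castph, ← castp, e2]; simp

/-- CRT bound for residue classes bad modulo many primes -/
lemma exists_modulus (n : ℕ) : ∃ (m : ℕ) (_ : NeZero m) (Sb : Set (Fin 10 → ZMod m)),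
    (∀ c : Fin 10 → ℤ, ¬ StronglyIrred c → (fun i => (c i : ZMod m)) ∈ Sb) ∧
    (Sb.ncard : ℝ) / m ^ 10 ≤ (99 / 100 : ℝ) ^ n := by
  classical
  obtain ⟨T, hT, hcard⟩ := (Nat.infinite_setOfPred_prime_modEq_one (k := 3) (by norm_num)).exists_subset_card_eq n
  have hpr : ∀ p : T, Nat.Prime p := fun p => (hT p.2).1
  have hmod : ∀ p : T, (p : ℕ) ≡ 1 [MOD 3] := fun p => (hT p.2).2
  have hcop : Pairwise (Function.onFun Nat.Coprime (fun p : T => (p : ℕ))) := by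
    intro p q hpq
    exact (Nat.coprime_primes (hpr p) (hpr q)).mpr (fun h => hpq (Subtype.ext h))
  have : ∀ p : T, Fact (Nat.Prime p) := fun p => ⟨hpr p⟩
  let m := ∏ p : T, (p : ℕ)
  have hm0 : m ≠ 0 := Finset.prod_ne_zero_iff.mpr (fun p _ => (hpr p).ne_zero)
  let φ := ZMod.prodEquivPi (fun p : T => (p : ℕ)) hcop
  have : NeZero m := ⟨hm0⟩
  refine ⟨m, ⟨hm0⟩, {x | ∀ p : T, ¬ NoFlex (fun i => φ (x i) p)}, ?_, ?_⟩
  · intro c hc p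
    have := flex_mod c hc p
    have e : (fun i => φ ((c i : ℤ) : ZMod m) p) = fun i => ((c i : ℤ) : ZMod (p : ℕ)) := by
      ext i
      have := congrFun (map_intCast φ (c i)) p
      rw [this]; rfl
    rw [e]; exact this
  · have hle : {x : Fin 10 → ZMod m | ∀ p : T, ¬ NoFlex (fun i => φ (x i) p)}.ncard ≤
        ∏ p : T, {c : Fin 10 → ZMod (p : ℕ) | ¬ NoFlex c}.ncard := by
      have e : ∀ p : T, {c : Fin 10 → ZMod (p : ℕ) | ¬ NoFlex c}.ncard =
          (Finset.univ.filter (fun c : Fin 10 → ZMod (p : ℕ) => ¬ NoFlex c)).card := by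
        intro p
        rw [← Set.ncard_coe_finset]; congr 1; ext; simp
      simp_rw [e]
      rw [← Fintype.card_piFinset, ← Set.ncard_coe_finset]
      apply Set.ncard_le_ncard_of_injOn (fun x => fun p => fun i => φ (x i) p)
      · intro x hx
        simp only [Finset.mem_coe, Fintype.mem_piFinset, Finset.mem_filter, Finset.mem_univ, true_and]
        exact hx
      · intro x _ y _ hxy
        ext i
        apply φ.injective
        ext p
        exact congrFun (congrFun hxy p) i
    rw [div_le_iff₀ (by positivity)]
    calc (({x : Fin 10 → ZMod m | ∀ p : T, ¬ NoFlex (fun i => φ (x i) p)}.ncard : ℕ) : ℝ)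
        ≤ ((∏ p : T, {c : Fin 10 → ZMod (p : ℕ) | ¬ NoFlex c}.ncard : ℕ) : ℝ) := by exact_mod_cast hle
      _ = ∏ p : T, ({c : Fin 10 → ZMod (p : ℕ) | ¬ NoFlex c}.ncard : ℝ) := by push_cast; rfl
      _ ≤ ∏ p : T, ((99 / 100 : ℝ) * ((p : ℕ) : ℝ) ^ 10) := by
          apply Finset.prod_le_prod
          · intro p _; positivity
          · intro p _
            have := card_bad p (hmod p)
            have h' : (100:ℝ) * ({c : Fin 10 → ZMod (p : ℕ) | ¬ NoFlex c}.ncard : ℝ) ≤ 99 * ((p : ℕ) : ℝ) ^ 10 := by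
              exact_mod_cast this
            linarith
      _ = (99 / 100 : ℝ) ^ n * (m : ℝ) ^ 10 := by
          rw [Finset.prod_mul_distrib, Finset.prod_pow, Finset.prod_const, Finset.card_univ, Fintype.card_coe, hcard]
          congr 2
          simp [m]

/-- few integral forms in a bounded region fail to be strongly irreducible -/
theorem reducible_count (R : ℝ) (hR : 0 < R) (ε : ℝ) (hε : 0 < ε) :
    ∀ᶠ t : ℝ in atTop, ({c : Fin 10 → ℤ | ¬ StronglyIrred c ∧ ∀ i, |(c i : ℝ)| ≤ R * t}.ncard : ℝ) ≤ ε * t ^ 10 := by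
  classical
  obtain ⟨n, hn⟩ : ∃ n : ℕ, (99 / 100 : ℝ) ^ n * (2 * R) ^ 10 < ε := by
    have := (tendsto_pow_atTop_nhds_zero_of_lt_one (r := (99 / 100 : ℝ)) (by norm_num) (by norm_num)).mul_const ((2 * R) ^ 10)
    rw [zero_mul] at this
    exact (this.eventually_lt_const hε).exists
  obtain ⟨m, hm, Sb, hSb, hcard⟩ := exists_modulus n
  let K : Set (Fin 10 → ℝ) := Set.Icc (fun _ => -R) (fun _ => R)
  have tame : Tame (K.indicator (fun _ => (1:ℝ))) 1 R := by
    refine ⟨fun x => ?_, fun x hx i => ?_⟩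
    · by_cases h : x ∈ K <;> simp [h]
    · have : x ∈ K := by by_contra h; simp [h] at hx
      exact abs_le.mpr ⟨this.1 i, this.2 i⟩
  have hfr : volume (frontier K) = 0 := (convex_Icc _ _).addHaar_frontier volume
  have hcont : ∀ᵐ x, ContinuousAt (K.indicator (fun _ => (1:ℝ))) x := by
    filter_upwards [measure_eq_zero_iff_ae_notMem.mp hfr] with x hx
    by_contra hcon
    exact hx (by
      by_contra hx2
      apply hcon
      rw [frontier_eq_closure_inter_closure, Set.mem_inter_iff, not_and_or] at hx2
      rcases hx2 with h | h
      · apply ContinuousAt.congr (f := fun _ => (0:ℝ)) continuousAt_const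
        filter_upwards [isClosed_closure.isOpen_compl.mem_nhds h] with y hy
        rw [Set.indicator_of_notMem (fun hh => hy (subset_closure hh))]
      · apply ContinuousAt.congr (f := fun _ => (1:ℝ)) continuousAt_const
        filter_upwards [isClosed_closure.isOpen_compl.mem_nhds h] with y hy
        rw [Set.indicator_of_mem (by by_contra hh; exact hy (subset_closure hh))])
  have key := riemann Sb tame hcont
  have hint : ∫ x, K.indicator (fun _ => (1:ℝ)) x = (2 * R) ^ 10 := by
    rw [integral_indicator measurableSet_Icc, setIntegral_const, Measure.real, Real.volume_Icc_pi]
    simp only [sub_neg_eq_add, Finset.prod_const, Finset.card_univ, Fintype.card_fin, smul_eq_mul, mul_one]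
    rw [ENNReal.toReal_pow, ENNReal.toReal_ofReal (by linarith)]
    ring
  rw [hint] at key
  have hlt : (Sb.ncard : ℝ) / m ^ 10 * (2 * R) ^ 10 < ε :=
    lt_of_le_of_lt (mul_le_mul_of_nonneg_right hcard (by positivity)) hn
  filter_upwards [key.eventually_lt_const hlt, eventually_gt_atTop 0] with t ht ht0
  rw [div_lt_iff₀ (by positivity)] at ht
  refine le_trans ?_ ht.le
  have hf : {c : Fin 10 → ℤ | ¬ StronglyIrred c ∧ ∀ i, |(c i : ℝ)| ≤ R * t}.Finite :=
    (finite_lattice (R * t)).subset (fun c hc => hc.2)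
  have hsum : Summable (fun c : Fin 10 → ℤ => Set.indicator {c : Fin 10 → ℤ | (fun i => (c i : ZMod m)) ∈ Sb}
        (fun c => K.indicator (fun _ => (1:ℝ)) (fun i => c i / t)) c) := by
    apply summable_of_hasFiniteSupport
    apply (tame.finite t ht0).subset
    intro c hc
    simp only [Function.mem_support, ne_eq, Set.indicator_apply_eq_zero, not_forall] at hc
    obtain ⟨_, h1, h2⟩ := hc
    simp [h1]
  refine le_trans ?_ (hsum.sum_le_tsum hf.toFinset (fun c _ => Set.indicator_nonneg (fun c _ => Set.indicator_nonneg (fun _ _ => zero_le_one) _) _))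
  rw [Set.ncard_eq_toFinset_card _ hf, Finset.card_eq_sum_ones]
  push_cast
  apply Finset.sum_le_sum
  intro c hc
  rw [Set.Finite.mem_toFinset] at hc
  rw [Set.indicator_of_mem (by exact hSb c hc.1), Set.indicator_of_mem]
  constructor
  · intro i
    have := (abs_le.mp (hc.2 i)).1
    dsimp only
    rw [le_div_iff₀ ht0]; linarith
  · intro i
    have := (abs_le.mp (hc.2 i)).2
    dsimp only
    rw [div_le_iff₀ ht0]; linarith

end TC


namespace TC
open Matrix Filter Topology

abbrev MZ := Matrix (Fin 3) (Fin 3) ℤ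

/-- Hermite normal forms -/
def HN : Set MZ := {h | h 1 0 = 0 ∧ h 2 0 = 0 ∧ h 2 1 = 0 ∧ 0 < h 0 0 ∧ 0 < h 1 1 ∧ 0 < h 2 2 ∧
  0 ≤ h 0 1 ∧ h 0 1 < h 1 1 ∧ 0 ≤ h 0 2 ∧ h 0 2 < h 2 2 ∧ 0 ≤ h 1 2 ∧ h 1 2 < h 2 2}

lemma HN_det {h : MZ} (hh : h ∈ HN) : h.det = h 0 0 * h 1 1 * h 2 2 := by
  obtain ⟨h1, h2, h3, _⟩ := hh
  rw [Matrix.det_fin_three, h1, h2, h3]; ring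

lemma HN_det_pos {h : MZ} (hh : h ∈ HN) : 0 < h.det := by
  rw [HN_det hh]
  obtain ⟨_, _, _, h1, h2, h3, _⟩ := hh
  positivity

lemma HN_unique {γ : SLZ} {h h' : MZ} (hh : h ∈ HN) (hh' : h' ∈ HN) (e : (γ : MZ) * h = h') : γ = 1 ∧ h = h' := by
  have d := γ.2
  obtain ⟨a1, a2, a3, a4, a5, a6, a7, a8, a9, a10, a11, a12⟩ := hh
  obtain ⟨b1, b2, b3, b4, b5, b6, b7, b8, b9, b10, b11, b12⟩ := hh'
  have ee : ∀ i j, (γ : MZ) i 0 * h 0 j + (γ : MZ) i 1 * h 1 j + (γ : MZ) i 2 * h 2 j = h' i j := by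
    intro i j
    rw [← e, Matrix.mul_apply, Fin.sum_univ_three]
  have e10 := ee 1 0
  have e20 := ee 2 0
  have e00 := ee 0 0
  rw [a1, a2] at e00
  rw [a1, a2, b1] at e10
  rw [a1, a2, b2] at e20
  have g10 : (γ : MZ) 1 0 = 0 := by
    have : (γ : MZ) 1 0 * h 0 0 = 0 := by linarith
    exact (mul_eq_zero.mp this).resolve_right a4.ne'
  have g20 : (γ : MZ) 2 0 = 0 := by
    have : (γ : MZ) 2 0 * h 0 0 = 0 := by linarith
    exact (mul_eq_zero.mp this).resolve_right a4.ne'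
  have e21 := ee 2 1
  rw [g20, a3, b3] at e21
  have g21 : (γ : MZ) 2 1 = 0 := by
    have : (γ : MZ) 2 1 * h 1 1 = 0 := by linarith
    exact (mul_eq_zero.mp this).resolve_right a5.ne'
  have e11 := ee 1 1
  rw [g10, a3] at e11
  have e22 := ee 2 2
  rw [g20, g21] at e22
  have p0 : 0 < (γ : MZ) 0 0 := by
    have : 0 < (γ : MZ) 0 0 * h 0 0 := by linarith
    exact pos_of_mul_pos_left this a4.le
  have p1 : 0 < (γ : MZ) 1 1 := by
    have : 0 < (γ : MZ) 1 1 * h 1 1 := by linarith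
    exact pos_of_mul_pos_left this a5.le
  have p2 : 0 < (γ : MZ) 2 2 := by
    have : 0 < (γ : MZ) 2 2 * h 2 2 := by linarith
    exact pos_of_mul_pos_left this a6.le
  have dd : (γ : MZ) 0 0 * ((γ : MZ) 1 1 * (γ : MZ) 2 2) = 1 := by
    rw [Matrix.det_fin_three, g10, g20, g21] at d; linarith
  have u0 : (γ : MZ) 0 0 = 1 := by
    rcases Int.mul_eq_one_iff_eq_one_or_neg_one.mp dd with h | h
    · exact h.1
    · omega
  rw [u0, one_mul] at dd
  have u1 : (γ : MZ) 1 1 = 1 := by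
    rcases Int.mul_eq_one_iff_eq_one_or_neg_one.mp dd with h | h
    · exact h.1
    · omega
  have u2 : (γ : MZ) 2 2 = 1 := by rw [u1] at dd; linarith
  have small : ∀ (k b x x' : ℤ), 0 < b → 0 ≤ x → x < b → 0 ≤ x' → x' < b → x + k * b = x' → k = 0 := by
    intro k b x x' hb h1 h2 h3 h4 h5
    by_contra hk
    rcases lt_or_gt_of_ne hk with h | h
    · have : k ≤ -1 := by omega
      nlinarith
    · have : 1 ≤ k := by omega
      nlinarith
  have e01 := ee 0 1
  have e12 := ee 1 2
  have e02 := ee 0 2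
  have eb : h' 1 1 = h 1 1 := by rw [u1] at e11; linarith
  have ec : h' 2 2 = h 2 2 := by rw [u2] at e22; linarith
  rw [eb] at b8
  rw [ec] at b10 b12
  have g01 : (γ : MZ) 0 1 = 0 := by
    rw [u0, a3] at e01
    exact small _ (h 1 1) (h 0 1) (h' 0 1) a5 a7 a8 b7 b8 (by linarith)
  have g12 : (γ : MZ) 1 2 = 0 := by
    rw [g10, u1] at e12
    exact small _ (h 2 2) (h 1 2) (h' 1 2) a6 a11 a12 b11 b12 (by linarith)
  have g02 : (γ : MZ) 0 2 = 0 := by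
    rw [u0, g01] at e02
    exact small _ (h 2 2) (h 0 2) (h' 0 2) a6 a9 a10 b9 b10 (by linarith)
  have h1 : γ = 1 := by
    ext i j
    fin_cases i <;> fin_cases j <;> simp [g01, g02, g10, g12, g20, g21, u0, u1, u2]
  refine ⟨h1, ?_⟩
  rw [← e, h1]; simp

lemma bez (p q : ℤ) : ∃ u v s t : ℤ, u * t - v * s = 1 ∧ s * p + t * q = 0 := by
  by_cases h : p = 0 ∧ q = 0
  · exact ⟨1, 0, 0, 1, by norm_num, by rw [h.1, h.2]; norm_num⟩
  · have hd : Int.gcd p q ≠ 0 := by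
      rw [Ne, Int.gcd_eq_zero_iff]; exact h
    obtain ⟨p', hp⟩ := Int.gcd_dvd_left p q
    obtain ⟨q', hq⟩ := Int.gcd_dvd_right p q
    have hb := Int.gcd_eq_gcd_ab p q
    refine ⟨Int.gcdA p q, Int.gcdB p q, -q', p', ?_, ?_⟩
    · have hd' : (Int.gcd p q : ℤ) ≠ 0 := by exact_mod_cast hd
      apply mul_left_cancel₀ hd'
      linear_combination (-1:ℤ) * hb - Int.gcdA p q * hp - Int.gcdB p q * hq
    · linear_combination (-q') * hp + p' * hq

lemma mul3 (a b c d e f p q r : ℤ) (h : Matrix.det !![a, b, c; d, e, f; p, q, r] = 1) (M : MZ) (j : Fin 3) :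
    (((sl a b c d e f p q r h : SLZ) : MZ) * M) 0 j = a * M 0 j + b * M 1 j + c * M 2 j ∧
    (((sl a b c d e f p q r h : SLZ) : MZ) * M) 1 j = d * M 0 j + e * M 1 j + f * M 2 j ∧
    (((sl a b c d e f p q r h : SLZ) : MZ) * M) 2 j = p * M 0 j + q * M 1 j + r * M 2 j := by
  simp [sl, Matrix.mul_apply, Fin.sum_univ_three]

lemma HN_exists (M : MZ) (hM : 0 < M.det) : ∃ γ : SLZ, (γ : MZ) * M ∈ HN := by
  -- chain of reductions
  have step : ∀ (γ : SLZ) (M : MZ), (∃ γ' : SLZ, (γ' : MZ) * ((γ : MZ) * M) ∈ HN) → ∃ γ : SLZ, (γ : MZ) * M ∈ HN := by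
    rintro γ M ⟨γ', h⟩
    refine ⟨γ' * γ, ?_⟩
    rw [Matrix.SpecialLinearGroup.coe_mul, mul_assoc]; exact h
  have hdet : ∀ (γ : SLZ) (M : MZ), ((γ : MZ) * M).det = M.det := by
    intro γ M; rw [Matrix.det_mul, γ.2, one_mul]
  -- final step: reduce off-diagonal entries
  have s5 : ∀ M : MZ, 0 < M.det → M 1 0 = 0 → M 2 0 = 0 → M 2 1 = 0 → 0 < M 0 0 → 0 < M 1 1 →
      ∃ γ : SLZ, (γ : MZ) * M ∈ HN := by
    intro M hM h1 h2 h3 h4 h5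
    have h6 : 0 < M 2 2 := by
      have e : M.det = M 0 0 * M 1 1 * M 2 2 := by rw [Matrix.det_fin_three, h1, h2, h3]; ring
      rw [e] at hM
      exact pos_of_mul_pos_right hM (by positivity)
    have hmain : ∃ s t r : ℤ, 0 ≤ M 0 1 + s * M 1 1 ∧ M 0 1 + s * M 1 1 < M 1 1 ∧
        0 ≤ M 1 2 + t * M 2 2 ∧ M 1 2 + t * M 2 2 < M 2 2 ∧
        0 ≤ M 0 2 + s * M 1 2 + r * M 2 2 ∧ M 0 2 + s * M 1 2 + r * M 2 2 < M 2 2 := by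
      have md : ∀ x b : ℤ, 0 < b → ∃ s : ℤ, 0 ≤ x + s * b ∧ x + s * b < b := by
        intro x b hb
        refine ⟨-(x / b), ?_, ?_⟩
        · have := Int.emod_nonneg x hb.ne'
          have h' := Int.emod_def x b
          linarith
        · have := Int.emod_lt_of_pos x hb
          have h' := Int.emod_def x b
          linarith
      obtain ⟨s, s1, s2⟩ := md (M 0 1) _ h5
      obtain ⟨t, t1, t2⟩ := md (M 1 2) _ h6
      obtain ⟨r, r1, r2⟩ := md (M 0 2 + s * M 1 2) _ h6
      exact ⟨s, t, r, s1, s2, t1, t2, r1, r2⟩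
    obtain ⟨s, t, r, s1, s2, t1, t2, r1, r2⟩ := hmain
    refine ⟨sl 1 s r 0 1 t 0 0 1 (by rw [Matrix.det_fin_three]; simp), ?_⟩
    have e := mul3 1 s r 0 1 t 0 0 1 (by rw [Matrix.det_fin_three]; simp) M
    obtain ⟨e00, e10, e20⟩ := e 0
    obtain ⟨e01, e11, e21⟩ := e 1
    obtain ⟨e02, e12, e22⟩ := e 2
    rw [h1, h2] at e00 e10 e20
    rw [h3] at e01 e11 e21
    refine ⟨by linarith, by linarith, by linarith, by linarith, by linarith, by linarith,
      by linarith, by linarith, by linarith, by linarith, by linarith, by linarith⟩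
  -- signs
  have s4 : ∀ M : MZ, 0 < M.det → M 1 0 = 0 → M 2 0 = 0 → M 2 1 = 0 → ∃ γ : SLZ, (γ : MZ) * M ∈ HN := by
    intro M hM h1 h2 h3
    have e : M.det = M 0 0 * M 1 1 * M 2 2 := by rw [Matrix.det_fin_three, h1, h2, h3]; ring
    have n0 : M 0 0 ≠ 0 := by intro h; rw [e, h] at hM; simp at hM
    have n1 : M 1 1 ≠ 0 := by intro h; rw [e, h] at hM; simp at hM
    have sg : ∀ x : ℤ, x ≠ 0 → ∃ s : ℤ, s * s = 1 ∧ 0 < s * x := by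
      intro x hx
      rcases lt_or_gt_of_ne hx with h | h
      · exact ⟨-1, by norm_num, by linarith⟩
      · exact ⟨1, by norm_num, by linarith⟩
    obtain ⟨s, hs, hs'⟩ := sg _ n0
    obtain ⟨t, ht, ht'⟩ := sg _ n1
    have hd : Matrix.det !![s, 0, 0; 0, t, 0; 0, 0, s * t] = 1 := by
      rw [Matrix.det_fin_three]; simp; linear_combination ht + (t * t) * hs
    refine step (sl s 0 0 0 t 0 0 0 (s * t) hd) M ?_
    have e := mul3 s 0 0 0 t 0 0 0 (s * t) hd M
    obtain ⟨e00, e10, e20⟩ := e 0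
    obtain ⟨e01, e11, e21⟩ := e 1
    rw [h1, h2] at e00 e10 e20
    rw [h3] at e01 e11 e21
    apply s5 _ (by rw [hdet]; exact hM)
    · rw [e10]; ring
    · rw [e20]; ring
    · rw [e21]; ring
    · linarith
    · linarith
  -- kill (2,1)
  have s3 : ∀ M : MZ, 0 < M.det → M 1 0 = 0 → M 2 0 = 0 → ∃ γ : SLZ, (γ : MZ) * M ∈ HN := by
    intro M hM h1 h2
    obtain ⟨u, v, s, t, h, h'⟩ := bez (M 1 1) (M 2 1)
    have hd : Matrix.det !![1, 0, 0; 0, u, v; 0, s, t] = 1 := by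
      rw [Matrix.det_fin_three]; simp; linarith
    refine step (sl 1 0 0 0 u v 0 s t hd) M ?_
    have e := mul3 1 0 0 0 u v 0 s t hd M
    obtain ⟨e00, e10, e20⟩ := e 0
    obtain ⟨e01, e11, e21⟩ := e 1
    rw [h1, h2] at e10 e20
    apply s4 _ (by rw [hdet]; exact hM)
    · rw [e10]; ring
    · rw [e20]; ring
    · rw [e21]; linarith
  have s2 : ∀ M : MZ, 0 < M.det → M 1 0 = 0 → ∃ γ : SLZ, (γ : MZ) * M ∈ HN := by
    intro M hM h1
    obtain ⟨u, v, s, t, h, h'⟩ := bez (M 0 0) (M 2 0)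
    have hd : Matrix.det !![u, 0, v; 0, 1, 0; s, 0, t] = 1 := by
      rw [Matrix.det_fin_three]; simp; linarith
    refine step (sl u 0 v 0 1 0 s 0 t hd) M ?_
    obtain ⟨e00, e10, e20⟩ := mul3 u 0 v 0 1 0 s 0 t hd M 0
    apply s3 _ (by rw [hdet]; exact hM)
    · rw [e10, h1]; ring
    · rw [e20]; linarith
  obtain ⟨u, v, s, t, h, h'⟩ := bez (M 0 0) (M 1 0)
  have hd : Matrix.det !![u, v, 0; s, t, 0; 0, 0, 1] = 1 := by
    rw [Matrix.det_fin_three]; simp; linarith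
  refine step (sl u v 0 s t 0 0 0 1 hd) M ?_
  obtain ⟨e00, e10, e20⟩ := mul3 u v 0 s t 0 0 0 1 hd M 0
  apply s2 _ (by rw [hdet]; exact hM)
  rw [e10]; linarith

/-- `SL₃(ℤ) × HN ≃ {det > 0}` -/
noncomputable def hnEquiv : SLZ × HN ≃ {M : MZ // 0 < M.det} :=
  Equiv.ofBijective (fun p => ⟨(p.1 : MZ) * (p.2 : MZ), by
      rw [Matrix.det_mul, p.1.2, one_mul]; exact HN_det_pos p.2.2⟩) (by
    constructor
    · rintro ⟨γ, h⟩ ⟨γ', h'⟩ e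
      have e' : (γ : MZ) * (h : MZ) = (γ' : MZ) * (h' : MZ) := congrArg Subtype.val e
      have e2 : ((γ'⁻¹ * γ : SLZ) : MZ) * (h : MZ) = h' := by
        rw [Matrix.SpecialLinearGroup.coe_mul, mul_assoc, e', ← mul_assoc, ← Matrix.SpecialLinearGroup.coe_mul]
        simp
      obtain ⟨h1, h2⟩ := HN_unique h.2 h'.2 e2
      refine Prod.ext ?_ (Subtype.ext h2)
      exact (inv_mul_eq_one.mp h1).symm
    · rintro ⟨M, hM⟩
      obtain ⟨γ, hγ⟩ := HN_exists M hM
      refine ⟨(γ⁻¹, ⟨_, hγ⟩), Subtype.ext ?_⟩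
      change ((γ⁻¹ : SLZ) : MZ) * ((γ : MZ) * M) = M
      rw [← mul_assoc, ← Matrix.SpecialLinearGroup.coe_mul]; simp)

lemma hnEquiv_val (γ : SLZ) (h : HN) : (hnEquiv (γ, h) : MZ) = (γ : MZ) * (h : MZ) := rfl

end TC


namespace TC
open Matrix Filter Topology

/-- power sum -/
noncomputable def Gam (Y : ℝ) : ℝ := ∑' c : ℕ, if ((c : ℝ) + 1) < Y then ((c : ℝ) + 1) ^ 9 else 0

lemma Gam_eq (Y : ℝ) : Gam Y = ∑ n ∈ Finset.range (⌈Y⌉₊ - 1), ((n : ℝ) + 1) ^ 9 := by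
  unfold Gam
  rw [tsum_eq_sum (s := Finset.range (⌈Y⌉₊ - 1))]
  · refine Finset.sum_congr rfl fun n hn => ?_
    rw [Finset.mem_range] at hn
    rw [if_pos]
    have : n + 1 < ⌈Y⌉₊ := by omega
    have := Nat.lt_ceil.mp this
    push_cast at this; exact this
  · intro n hn
    rw [Finset.mem_range] at hn
    rw [if_neg]
    intro h
    apply hn
    have : n + 1 < ⌈Y⌉₊ := Nat.lt_ceil.mpr (by push_cast; exact h)
    omega

lemma Gam_summable (Y : ℝ) : Summable fun c : ℕ => if ((c : ℝ) + 1) < Y then ((c : ℝ) + 1) ^ 9 else 0 := by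
  apply summable_of_ne_finset_zero (s := Finset.range (⌈Y⌉₊ - 1))
  intro n hn
  rw [Finset.mem_range] at hn
  rw [if_neg]
  intro h
  apply hn
  have : n + 1 < ⌈Y⌉₊ := Nat.lt_ceil.mpr (by push_cast; exact h)
  omega

lemma Gam_nonneg (Y : ℝ) : 0 ≤ Gam Y := by
  rw [Gam_eq]; exact Finset.sum_nonneg fun n _ => by positivity

lemma Gam_le (Y : ℝ) (hY : 0 < Y) : Gam Y ≤ Y ^ 10 := by
  rw [Gam_eq]
  obtain ⟨M, hM⟩ : ∃ M, M = ⌈Y⌉₊ - 1 := ⟨_, rfl⟩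
  have hMY : (M : ℝ) ≤ Y := by
    have h0 : 0 < ⌈Y⌉₊ := Nat.ceil_pos.mpr hY
    have : M < ⌈Y⌉₊ := by omega
    exact (Nat.lt_ceil.mp this).le
  rw [← hM]
  calc ∑ n ∈ Finset.range M, ((n : ℝ) + 1) ^ 9 ≤ ∑ n ∈ Finset.range M, Y ^ 9 := by
        refine Finset.sum_le_sum fun n hn => ?_
        rw [Finset.mem_range] at hn
        have : (n : ℝ) + 1 ≤ M := by exact_mod_cast hn
        gcongr; linarith
    _ = M * Y ^ 9 := by simp
    _ ≤ Y * Y ^ 9 := by gcongr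
    _ = Y ^ 10 := by ring

lemma psum_lower (M : ℕ) : (M : ℝ) ^ 10 ≤ 10 * ∑ n ∈ Finset.range M, ((n : ℝ) + 1) ^ 9 := by
  induction M with
  | zero => simp
  | succ k ih =>
    rw [Finset.sum_range_succ, mul_add]
    push_cast
    have h : ((k : ℝ) + 1) ^ 10 - (k : ℝ) ^ 10 ≤ 10 * ((k : ℝ) + 1) ^ 9 := by
      have hk : (0 : ℝ) ≤ k := Nat.cast_nonneg k
      have e : 10 * ((k : ℝ) + 1) ^ 9 - (((k : ℝ) + 1) ^ 10 - (k : ℝ) ^ 10) =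
        45 * (k:ℝ)^8+240 * (k:ℝ)^7+630 * (k:ℝ)^6+1008 * (k:ℝ)^5+1050 * (k:ℝ)^4+720 * (k:ℝ)^3+315 * (k:ℝ)^2+80 * (k:ℝ)+9 := by ring
      have : 0 ≤ 10 * ((k : ℝ) + 1) ^ 9 - (((k : ℝ) + 1) ^ 10 - (k : ℝ) ^ 10) := by rw [e]; positivity
      linarith
    linarith

lemma psum_upper (M : ℕ) : 10 * ∑ n ∈ Finset.range M, ((n : ℝ) + 1) ^ 9 ≤ ((M : ℝ) + 1) ^ 10 := by
  induction M with
  | zero => simp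
  | succ k ih =>
    rw [Finset.sum_range_succ, mul_add]
    push_cast
    have hk : (0 : ℝ) ≤ (k : ℝ) + 1 := by positivity
    obtain ⟨x, hx⟩ : ∃ x, x = (k : ℝ) + 1 := ⟨_, rfl⟩
    rw [← hx] at hk ih ⊢
    have e : (x + 1) ^ 10 - x ^ 10 - 10 * x ^ 9 =
      45 * x ^ 8 + 120 * x ^ 7 + 210 * x ^ 6 + 252 * x ^ 5 + 210 * x ^ 4 + 120 * x ^ 3 + 45 * x ^ 2 + 10 * x + 1 := by ring
    have : 0 ≤ (x + 1) ^ 10 - x ^ 10 - 10 * x ^ 9 := by rw [e]; positivity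
    linarith

lemma Gam_tendsto : Tendsto (fun Y => Gam Y / Y ^ 10) atTop (𝓝 (1 / 10)) := by
  have l1 : Tendsto (fun Y : ℝ => (1 - 1 / Y) ^ 10 / 10) atTop (𝓝 (1 / 10)) := by
    have : Tendsto (fun Y : ℝ => (1 - 1 / Y) ^ 10 / 10) atTop (𝓝 ((1 - 0) ^ 10 / 10)) := by
      refine ((tendsto_const_nhds.sub ?_).pow 10).div_const _
      exact (tendsto_inv_atTop_zero (𝕜 := ℝ)).congr (fun x => (one_div x).symm)
    simpa using this
  have l2 : Tendsto (fun Y : ℝ => (1 + 1 / Y) ^ 10 / 10) atTop (𝓝 (1 / 10)) := by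
    have : Tendsto (fun Y : ℝ => (1 + 1 / Y) ^ 10 / 10) atTop (𝓝 ((1 + 0) ^ 10 / 10)) := by
      refine ((tendsto_const_nhds.add ?_).pow 10).div_const _
      exact (tendsto_inv_atTop_zero (𝕜 := ℝ)).congr (fun x => (one_div x).symm)
    simpa using this
  refine tendsto_of_tendsto_of_tendsto_of_le_of_le' l1 l2 ?_ ?_
  all_goals
    filter_upwards [eventually_gt_atTop (1 : ℝ)] with Y hY
    have hY0 : 0 < Y := by linarith
    rw [Gam_eq]
    have h0 : 0 < ⌈Y⌉₊ := Nat.ceil_pos.mpr hY0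
    have hc1 : Y ≤ ⌈Y⌉₊ := Nat.le_ceil Y
    have hc2 : (⌈Y⌉₊ : ℝ) < Y + 1 := Nat.ceil_lt_add_one hY0.le
    obtain ⟨M, hM⟩ : ∃ M, ⌈Y⌉₊ = M + 1 := ⟨_, (Nat.succ_pred_eq_of_pos h0).symm⟩
    rw [hM] at hc1 hc2 ⊢
    push_cast at hc1 hc2
    have u := psum_upper M
    have l := psum_lower M
    simp only [Nat.add_sub_cancel]
  · rw [le_div_iff₀ (by positivity)]
    have : (1 - 1 / Y) ^ 10 / 10 * Y ^ 10 = (Y - 1) ^ 10 / 10 := by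
      rw [div_mul_eq_mul_div, ← mul_pow]; congr 2; field_simp
    rw [this]
    have : (Y - 1) ^ 10 ≤ (M : ℝ) ^ 10 := pow_le_pow_left₀ (by linarith) (by linarith) 10
    linarith
  · rw [div_le_iff₀ (by positivity)]
    have : (1 + 1 / Y) ^ 10 / 10 * Y ^ 10 = (Y + 1) ^ 10 / 10 := by
      rw [div_mul_eq_mul_div, ← mul_pow]; congr 2; field_simp
    rw [this]
    have : ((M : ℝ) + 1) ^ 10 ≤ (Y + 1) ^ 10 := by gcongr
    linarith

lemma zeta_summ (k : ℕ) (hk : 2 ≤ k) : Summable fun n : ℕ => (1 : ℝ) / ((n : ℝ) + 1) ^ k := by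
  have := (summable_nat_add_iff 1).mpr (Real.summable_one_div_nat_pow.mpr (show 1 < k by omega))
  simpa using this

/-- the parametrized sum -/
lemma ab_tendsto : Tendsto (fun N : ℝ => (∑' p : ℕ × ℕ, ((p.1 : ℝ) + 1) ^ 7 * ((p.2 : ℝ) + 1) ^ 8 *
    Gam (N / (((p.1 : ℝ) + 1) * ((p.2 : ℝ) + 1)))) / N ^ 10) atTop (𝓝 (zeta2 * zeta3 / 10)) := by
  have s3 := zeta_summ 3 (by norm_num)
  have s2 := zeta_summ 2 (by norm_num)
  have s := s3.mul_of_nonneg s2 (fun n => by positivity) (fun n => by positivity)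
  have e : zeta2 * zeta3 / 10 = ∑' p : ℕ × ℕ, 1 / ((p.1 : ℝ) + 1) ^ 3 * (1 / ((p.2 : ℝ) + 1) ^ 2) * (1 / 10) := by
    rw [tsum_mul_right]
    have := s3.tsum_mul_tsum s2 s
    rw [← this]
    unfold zeta2 zeta3; ring
  rw [e]
  have := tendsto_tsum_of_dominated_convergence (𝓕 := atTop) (f := fun (N : ℝ) (p : ℕ × ℕ) =>
    1 / ((p.1 : ℝ) + 1) ^ 3 * (1 / ((p.2 : ℝ) + 1) ^ 2) * (Gam (N / (((p.1 : ℝ) + 1) * ((p.2 : ℝ) + 1))) /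
      (N / (((p.1 : ℝ) + 1) * ((p.2 : ℝ) + 1))) ^ 10)) (g := fun p : ℕ × ℕ => 1 / ((p.1 : ℝ) + 1) ^ 3 * (1 / ((p.2 : ℝ) + 1) ^ 2) * (1 / 10))
    (bound := fun p => 1 / ((p.1 : ℝ) + 1) ^ 3 * (1 / ((p.2 : ℝ) + 1) ^ 2)) s ?_ ?_
  · refine this.congr' ?_
    filter_upwards [eventually_gt_atTop (0 : ℝ)] with N hN
    rw [← tsum_div_const]
    refine tsum_congr fun p => ?_
    have h1 : (0 : ℝ) < (p.1 : ℝ) + 1 := by positivity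
    have h2 : (0 : ℝ) < (p.2 : ℝ) + 1 := by positivity
    field_simp
  · intro p
    refine Tendsto.const_mul _ ?_
    refine Gam_tendsto.comp ?_
    exact tendsto_id.atTop_div_const (by positivity)
  · filter_upwards [eventually_gt_atTop (0 : ℝ)] with N hN p
    have h1 : (0 : ℝ) < (p.1 : ℝ) + 1 := by positivity
    have h2 : (0 : ℝ) < (p.2 : ℝ) + 1 := by positivity
    have hY : 0 < N / (((p.1 : ℝ) + 1) * ((p.2 : ℝ) + 1)) := by positivity
    have := Gam_le _ hY
    have g0 := Gam_nonneg (N / (((p.1 : ℝ) + 1) * ((p.2 : ℝ) + 1)))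
    rw [Real.norm_of_nonneg (by positivity)]
    have : Gam (N / (((p.1 : ℝ) + 1) * ((p.2 : ℝ) + 1))) / (N / (((p.1 : ℝ) + 1) * ((p.2 : ℝ) + 1))) ^ 10 ≤ 1 := by
      rw [div_le_one (by positivity)]; exact this
    exact mul_le_of_le_one_right (by positivity) this

/-- parametrization of Hermite forms -/
def HPar := Σ p : (ℕ × ℕ) × ℕ, Fin (p.1.2 + 1) × Fin (p.2 + 1) × Fin (p.2 + 1)

def hparFun (q : HPar) : HN := ⟨!![(q.1.1.1 : ℤ) + 1, (q.2.1 : ℕ), (q.2.2.1 : ℕ); 0, (q.1.1.2 : ℤ) + 1, (q.2.2.2 : ℕ); 0, 0, (q.1.2 : ℤ) + 1], by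
  obtain ⟨⟨⟨a, b⟩, c⟩, x, y, z⟩ := q
  have h1 : (x : ℕ) < b + 1 := x.2
  have h2 : (y : ℕ) < c + 1 := y.2
  have h3 : (z : ℕ) < c + 1 := z.2
  simp [HN]
  omega⟩

lemma hpar_bij : Function.Bijective hparFun := by
  constructor
  · rintro ⟨⟨⟨a, b⟩, c⟩, x, y, z⟩ ⟨⟨⟨a', b'⟩, c'⟩, x', y', z'⟩ h
    have h := congrArg Subtype.val h
    have h00 := congrFun (congrFun h 0) 0
    have h11 := congrFun (congrFun h 1) 1
    have h22 := congrFun (congrFun h 2) 2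
    have h01 := congrFun (congrFun h 0) 1
    have h02 := congrFun (congrFun h 0) 2
    have h12 := congrFun (congrFun h 1) 2
    simp [hparFun] at h00 h11 h22 h01 h02 h12
    subst h00 h11 h22
    have e1 : x = x' := Fin.ext h01
    have e2 : y = y' := Fin.ext h02
    have e3 : z = z' := Fin.ext h12
    rw [e1, e2, e3]
  · rintro ⟨h, a1, a2, a3, a4, a5, a6, a7, a8, a9, a10, a11, a12⟩
    refine ⟨⟨⟨⟨(h 0 0 - 1).toNat, (h 1 1 - 1).toNat⟩, (h 2 2 - 1).toNat⟩, ⟨(h 0 1).toNat, ?_⟩, ⟨(h 0 2).toNat, ?_⟩, ⟨(h 1 2).toNat, ?_⟩⟩, ?_⟩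
    · simp; omega
    · simp; omega
    · simp; omega
    · apply Subtype.ext
      ext i j
      fin_cases i <;> fin_cases j <;> simp [hparFun] <;> omega

noncomputable def hparEquiv : HPar ≃ HN := Equiv.ofBijective _ hpar_bij

lemma hpar_det (q : HPar) : ((hparFun q : MZ).det : ℝ) = ((q.1.1.1 : ℝ) + 1) * ((q.1.1.2 : ℝ) + 1) * ((q.1.2 : ℝ) + 1) := by
  rw [HN_det (hparFun q).2]
  simp [hparFun]

lemma HN_finite (N : ℝ) : {h : HN | ((h : MZ).det : ℝ) < N}.Finite := by
  have hf : ((fun h : HN => (h : MZ)) '' {h : HN | ((h : MZ).det : ℝ) < N}).Finite := by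
    have hb : {M : MZ | ∀ i j, M i j ∈ Set.Icc 0 ⌈N⌉}.Finite := by
      have := Set.Finite.pi (ι := Fin 3) (fun _ => Set.Finite.pi (ι := Fin 3) (fun _ => Set.finite_Icc (0 : ℤ) ⌈N⌉))
      refine this.subset ?_
      intro M hM i _ j _
      exact hM i j
    refine hb.subset ?_
    rintro _ ⟨⟨h, hh⟩, hN, rfl⟩
    have hN : ((h.det : ℤ) : ℝ) < N := hN
    have hd : h.det < ⌈N⌉ := Int.lt_ceil.mpr hN
    rw [HN_det hh] at hd
    obtain ⟨a1, a2, a3, a4, a5, a6, a7, a8, a9, a10, a11, a12⟩ := hh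
    have b1 : h 0 0 ≤ h 0 0 * h 1 1 * h 2 2 := by nlinarith [mul_pos a4 a5, mul_pos a5 a6]
    have b2 : h 1 1 ≤ h 0 0 * h 1 1 * h 2 2 := by nlinarith [mul_pos a4 a5, mul_pos a5 a6]
    have b3 : h 2 2 ≤ h 0 0 * h 1 1 * h 2 2 := by nlinarith [mul_pos a4 a5, mul_pos a5 a6]
    intro i j
    rw [Set.mem_Icc]
    fin_cases i <;> fin_cases j <;> simp <;> omega
  exact hf.of_finite_image (Subtype.val_injective.injOn)

theorem HN_count : Tendsto (fun N : ℝ => (∑' h : HN, if ((h : MZ).det : ℝ) < N then ((h : MZ).det : ℝ) ^ 7 else 0) / N ^ 10)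
    atTop (𝓝 (zeta2 * zeta3 / 10)) := by
  refine ab_tendsto.congr ?_
  intro N
  congr 1
  have hs : Summable fun h : HN => if ((h : MZ).det : ℝ) < N then ((h : MZ).det : ℝ) ^ 7 else 0 := by
    apply summable_of_hasFiniteSupport
    refine (HN_finite N).subset ?_
    intro h hh
    by_contra hc
    apply hh
    exact if_neg hc
  rw [← hparEquiv.tsum_eq (fun h : HN => if ((h : MZ).det : ℝ) < N then ((h : MZ).det : ℝ) ^ 7 else 0)]
  have hs' := (hparEquiv.summable_iff).mpr hs
  have e1 : ∀ q : HPar, (if ((hparEquiv q : MZ).det : ℝ) < N then ((hparEquiv q : MZ).det : ℝ) ^ 7 else 0) =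
    (fun p : (ℕ × ℕ) × ℕ => if ((p.1.1 : ℝ) + 1) * ((p.1.2 : ℝ) + 1) * ((p.2 : ℝ) + 1) < N then
      (((p.1.1 : ℝ) + 1) * ((p.1.2 : ℝ) + 1) * ((p.2 : ℝ) + 1)) ^ 7 else 0) q.1 := by
    intro q
    show (if ((hparFun q : MZ).det : ℝ) < N then ((hparFun q : MZ).det : ℝ) ^ 7 else 0) = _
    rw [hpar_det]
  have hs2 : Summable fun q : HPar => (fun p : (ℕ × ℕ) × ℕ => if ((p.1.1 : ℝ) + 1) * ((p.1.2 : ℝ) + 1) * ((p.2 : ℝ) + 1) < N then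
      (((p.1.1 : ℝ) + 1) * ((p.1.2 : ℝ) + 1) * ((p.2 : ℝ) + 1)) ^ 7 else 0) q.1 := hs'.congr (fun q => (e1 q))
  rw [tsum_congr e1]
  have t1 := hs2.tsum_sigma
  have hs3 := hs2.sigma
  unfold HPar
  rw [t1]
  simp only [tsum_fintype, Finset.sum_const, Finset.card_univ, Fintype.card_prod, Fintype.card_fin, nsmul_eq_mul] at hs3 ⊢
  rw [hs3.tsum_prod]
  refine tsum_congr fun p => ?_
  unfold Gam
  rw [← tsum_mul_left]
  refine tsum_congr fun c => ?_
  have h1 : (0 : ℝ) < (p.1 : ℝ) + 1 := by positivity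
  have h2 : (0 : ℝ) < (p.2 : ℝ) + 1 := by positivity
  have : (c : ℝ) + 1 < N / (((p.1 : ℝ) + 1) * ((p.2 : ℝ) + 1)) ↔ ((p.1 : ℝ) + 1) * ((p.2 : ℝ) + 1) * ((c : ℝ) + 1) < N := by
    rw [lt_div_iff₀ (by positivity)]; constructor <;> intro h <;> linarith
  simp only [this]
  split_ifs with h
  · push_cast; ring
  · simp
end TC


namespace TC
open Matrix Filter Topology

lemma box_card {ι : Type*} [Fintype ι] (B : ι → ℝ) (hB : ∀ i, 0 ≤ B i) :
    {x : ι → ℤ | ∀ i, |(x i : ℝ)| ≤ B i}.Finite ∧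
    ({x : ι → ℤ | ∀ i, |(x i : ℝ)| ≤ B i}.ncard : ℝ) ≤ ∏ i, (2 * B i + 1) := by
  classical
  have hsub : {x : ι → ℤ | ∀ i, |(x i : ℝ)| ≤ B i} ⊆ ((Fintype.piFinset fun i => Finset.Icc (-⌊B i⌋) ⌊B i⌋ : Finset (ι → ℤ)) : Set (ι → ℤ)) := by
    intro x hx
    rw [Finset.mem_coe, Fintype.mem_piFinset]
    intro i
    have h := abs_le.mp (hx i)
    rw [Finset.mem_Icc]
    constructor
    · have : (-(x i) : ℤ) ≤ ⌊B i⌋ := Int.le_floor.mpr (by push_cast; linarith [h.1])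
      linarith
    · exact Int.le_floor.mpr h.2
  refine ⟨(Finset.finite_toSet _).subset hsub, ?_⟩
  have h1 := Set.ncard_le_ncard hsub (Finset.finite_toSet _)
  rw [Set.ncard_coe_finset, Fintype.card_piFinset] at h1
  calc _ ≤ ((∏ i, (Finset.Icc (-⌊B i⌋) ⌊B i⌋).card : ℕ) : ℝ) := by exact_mod_cast h1
    _ = ∏ i, ((Finset.Icc (-⌊B i⌋) ⌊B i⌋).card : ℝ) := by push_cast; rfl
    _ ≤ _ := by
      refine Finset.prod_le_prod (fun i _ => by positivity) fun i _ => ?_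
      rw [Int.card_Icc]
      have h0 : 0 ≤ ⌊B i⌋ := Int.floor_nonneg.mpr (hB i)
      have e : ((⌊B i⌋ + 1 - -⌊B i⌋).toNat : ℤ) = 2 * ⌊B i⌋ + 1 := by omega
      have e2 : ((⌊B i⌋ + 1 - -⌊B i⌋).toNat : ℝ) = 2 * (⌊B i⌋ : ℝ) + 1 := by exact_mod_cast e
      rw [e2]
      have := Int.floor_le (B i)
      linarith

/-- abstract tail bound -/
lemma tail_abs {ι Y : Type*} (O : Set ι) (orb : ι → Set Y)
    (hdisj : ∀ T ∈ O, ∀ T' ∈ O, T ≠ T' → Disjoint (orb T) (orb T'))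
    (Box : ℕ → ℕ → Set Y) (hfin : ∀ a b, (Box a b).Finite) (K p : ℝ) (hK0 : 0 ≤ K) (hp0 : 0 < p) (hp1 : p < 1)
    (hK : ∀ a b, ((Box a b).ncard : ℝ) ≤ K * 4 ^ (a + b) * (p ^ 2) ^ (a + b)) (κ : ℕ)
    (h : ∀ T ∈ O, ∃ a b : ℕ, κ ≤ a + b ∧ ∃ s : Finset Y, (s : Set Y) ⊆ orb T ∧ (s : Set Y) ⊆ Box a b ∧ 4 ^ (a + b) ≤ s.card) :
    O.Finite ∧ (O.ncard : ℝ) ≤ K * p ^ κ / (1 - p) ^ 2 := by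
  classical
  have key : ∀ F : Finset ι, (F : Set ι) ⊆ O → (F.card : ℝ) ≤ K * p ^ κ / (1 - p) ^ 2 := by
    intro F hF
    have hex : ∀ T : F, ∃ (ab : ℕ × ℕ) (s : Finset Y), κ ≤ ab.1 + ab.2 ∧ (s : Set Y) ⊆ orb T ∧ (s : Set Y) ⊆ Box ab.1 ab.2 ∧ 4 ^ (ab.1 + ab.2) ≤ s.card := by
      intro T
      obtain ⟨a, b, h1, s, h2⟩ := h T (hF T.2)
      exact ⟨(a, b), s, h1, h2⟩
    choose ab s h1 h2 h3 h4 using hex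
    have hcell : ∀ x : ℕ × ℕ, (((Finset.univ.filter fun T : F => ab T = x).card : ℕ) : ℝ) ≤ K * p ^ κ * (p ^ x.1 * p ^ x.2) := by
      intro x
      by_cases hne : (Finset.univ.filter fun T : F => ab T = x).Nonempty
      · obtain ⟨T0, hT0⟩ := hne
        have hκ : κ ≤ x.1 + x.2 := by
          rw [Finset.mem_filter] at hT0
          rw [← hT0.2]; exact h1 T0
        have hcard : 4 ^ (x.1 + x.2) * (Finset.univ.filter fun T : F => ab T = x).card ≤ (Box x.1 x.2).ncard := by
          have hd : ((Finset.univ.filter fun T : F => ab T = x) : Set F).PairwiseDisjoint s := by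
            intro T _ T' _ hTT
            have := hdisj T (hF T.2) T' (hF T'.2) (fun e => hTT (Subtype.ext e))
            rw [Function.onFun, ← Finset.disjoint_coe]
            exact this.mono (h2 T) (h2 T')
          have hb := Finset.card_biUnion hd
          have hsub : (((Finset.univ.filter fun T : F => ab T = x).biUnion s : Finset Y) : Set Y) ⊆ Box x.1 x.2 := by
            intro y hy
            rw [Finset.mem_coe, Finset.mem_biUnion] at hy
            obtain ⟨T, hT, hyT⟩ := hy
            rw [Finset.mem_filter] at hT
            rw [← hT.2]
            exact h3 T hyT
          have := Set.ncard_le_ncard hsub (hfin _ _)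
          rw [Set.ncard_coe_finset, hb] at this
          refine le_trans ?_ this
          rw [mul_comm, ← smul_eq_mul]
          refine Finset.card_nsmul_le_sum _ _ _ ?_
          intro T hT
          rw [Finset.mem_filter] at hT
          rw [← hT.2]; exact h4 T
        have hc : (4 : ℝ) ^ (x.1 + x.2) * ((Finset.univ.filter fun T : F => ab T = x).card : ℝ) ≤ K * 4 ^ (x.1 + x.2) * (p ^ 2) ^ (x.1 + x.2) := by
          refine le_trans ?_ (hK _ _)
          exact_mod_cast hcard
        have h4p : (0 : ℝ) < 4 ^ (x.1 + x.2) := by positivity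
        have hc2 : ((Finset.univ.filter fun T : F => ab T = x).card : ℝ) ≤ K * (p ^ 2) ^ (x.1 + x.2) := by
          by_contra hcon
          push Not at hcon
          have := mul_lt_mul_of_pos_left hcon h4p
          linarith
        refine hc2.trans ?_
        have : (p ^ 2) ^ (x.1 + x.2) ≤ p ^ κ * (p ^ x.1 * p ^ x.2) := by
          rw [← pow_add p, ← pow_mul, mul_comm 2, mul_two, pow_add p]
          have := pow_le_pow_of_le_one hp0.le hp1.le hκ
          gcongr
        rw [mul_assoc]
        gcongr
      · rw [Finset.not_nonempty_iff_eq_empty] at hne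
        rw [hne]
        simp only [Finset.card_empty, Nat.cast_zero]
        positivity
    have hsum : F.card = ∑ x ∈ Finset.univ.image ab, (Finset.univ.filter fun T : F => ab T = x).card := by
      rw [← Finset.card_eq_sum_card_image]
      simp
    rw [hsum]
    push_cast
    have sp := summable_geometric_of_lt_one hp0.le hp1
    have spp := sp.mul_of_nonneg sp (fun n => by positivity) (fun n => by positivity)
    have tpp := sp.tsum_mul_tsum sp spp
    rw [tsum_geometric_of_lt_one hp0.le hp1] at tpp
    calc _ ≤ ∑ x ∈ Finset.univ.image ab, K * p ^ κ * (p ^ x.1 * p ^ x.2) := Finset.sum_le_sum fun x _ => hcell x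
      _ = K * p ^ κ * ∑ x ∈ Finset.univ.image ab, (p ^ x.1 * p ^ x.2) := by rw [Finset.mul_sum]
      _ ≤ K * p ^ κ * ((1 - p)⁻¹ * (1 - p)⁻¹) := by
        gcongr
        rw [tpp]
        exact spp.sum_le_tsum _ (fun x _ => by positivity)
      _ = _ := by
        have : 1 - p ≠ 0 := by linarith
        field_simp
  have hOfin : O.Finite := by
    by_contra hinf
    have hinf : O.Infinite := hinf
    obtain ⟨n, hn⟩ := exists_nat_gt (K * p ^ κ / (1 - p) ^ 2)
    obtain ⟨F, hF, hc⟩ := hinf.exists_subset_card_eq n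
    have := key F hF
    rw [hc] at this
    linarith
  refine ⟨hOfin, ?_⟩
  have := key hOfin.toFinset (by simp)
  rwa [← Set.ncard_eq_toFinset_card O hOfin] at this

/-- cell sizes -/
noncomputable def th : ℝ := (2 : ℝ) ^ ((1 : ℝ) / 3)
lemma th_pos : 0 < th := by unfold th; positivity
lemma th3 : th ^ 3 = 2 := by
  unfold th
  rw [← Real.rpow_natCast, ← Real.rpow_mul (by norm_num)]; norm_num
lemma th1 : 1 ≤ th := by
  unfold th; exact Real.one_le_rpow (by norm_num) (by norm_num)

noncomputable def r1 (a b : ℕ) : ℝ := 1 / th ^ (2 * a + b)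
noncomputable def r2 (a b : ℕ) : ℝ := 2 ^ a * r1 a b
noncomputable def r3 (a b : ℕ) : ℝ := 2 ^ b * r2 a b

lemma r1_pos (a b : ℕ) : 0 < r1 a b := by unfold r1; have := th_pos; positivity
lemma r2_pos (a b : ℕ) : 0 < r2 a b := by unfold r2; have := r1_pos a b; positivity
lemma r3_pos (a b : ℕ) : 0 < r3 a b := by unfold r3; have := r2_pos a b; positivity
lemma r12 (a b : ℕ) : r1 a b ≤ r2 a b := by
  unfold r2
  have := r1_pos a b
  have h : (1 : ℝ) ≤ 2 ^ a := one_le_pow₀ (by norm_num)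
  nlinarith
lemma r23 (a b : ℕ) : r2 a b ≤ r3 a b := by
  unfold r3
  have := r2_pos a b
  have h : (1 : ℝ) ≤ 2 ^ b := one_le_pow₀ (by norm_num)
  nlinarith
lemma r1_cube (a b : ℕ) : r1 a b ^ 3 * (4 ^ a * 2 ^ b) = 1 := by
  unfold r1
  have h := th_pos
  have e : (th ^ (2 * a + b)) ^ 3 = 4 ^ a * 2 ^ b := by
    rw [← pow_mul, mul_comm, pow_mul, th3, pow_add, pow_mul]; norm_num
  rw [div_pow, e]; field_simp
lemma r123 (a b : ℕ) : r1 a b * r2 a b * r3 a b = 1 := by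
  rw [← r1_cube a b]
  unfold r3 r2
  have : (4 : ℝ) ^ a = 2 ^ a * 2 ^ a := by rw [← mul_pow]; norm_num
  rw [this]; ring
lemma r1_le (a b : ℕ) : r1 a b ≤ 1 := by
  unfold r1
  have : 1 ≤ th ^ (2 * a + b) := one_le_pow₀ th1
  rw [div_le_one (by linarith)]; exact this

lemma exists_quad (x y : ℝ) (hx : 0 < x) (hxy : x ≤ y) : ∃ a : ℕ, 4 ^ a * x ≤ y ∧ y ≤ 4 * 4 ^ a * x := by
  have h1 : 1 ≤ y / x := by rw [le_div_iff₀ hx]; linarith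
  obtain ⟨n, hn1, hn2⟩ := exists_nat_pow_near h1 (show (1 : ℝ) < 4 by norm_num)
  refine ⟨n, (le_div_iff₀ hx).mp hn1, ?_⟩
  have := (div_lt_iff₀ hx).mp hn2
  rw [pow_succ] at this
  linarith

lemma cell (g : M3) (hd : g.det ≠ 0) (h1 : rn g 0 ≤ rn g 1) (h2 : rn g 1 ≤ rn g 2)
    (h3 : 3 * (rn g 0 * rn g 1 * rn g 2) ≤ 8) : ∃ a b : ℕ, (∀ j, |g 0 j| ≤ 2 * r1 a b) ∧
    (∀ j, |g 1 j| ≤ 3 * r2 a b) ∧ (∀ j, |g 2 j| ≤ 6 * r3 a b) ∧ N2 g ≤ 96 * 4 ^ (a + b) := by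
  obtain ⟨a, ha1, ha2⟩ := exists_quad _ _ (rn_pos g hd 0) h1
  obtain ⟨b, hb1, hb2⟩ := exists_quad _ _ (rn_pos g hd 1) h2
  have p0 := rn_pos g hd 0
  have p1 := rn_pos g hd 1
  have p2 := rn_pos g hd 2
  have q1 := r1_pos a b
  have q2 := r2_pos a b
  have q3 := r3_pos a b
  have e4 : (4 : ℝ) ^ a = 2 ^ a * 2 ^ a := by rw [← mul_pow]; norm_num
  have e4' : (4 : ℝ) ^ b = 2 ^ b * 2 ^ b := by rw [← mul_pow]; norm_num
  have hA : (0 : ℝ) < 4 ^ a := by positivity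
  have hB : (0 : ℝ) < 4 ^ b := by positivity
  have b0 : rn g 0 ≤ 2 * r1 a b ^ 2 := by
    have hc : rn g 0 ^ 3 * (4 ^ a * 4 ^ a * 4 ^ b) ≤ 8 := by
      have s1 : (4 ^ a * rn g 0) * (4 ^ b * (4 ^ a * rn g 0)) ≤ rn g 1 * rn g 2 := by
        refine mul_le_mul ha1 ?_ (by positivity) p1.le
        exact le_trans (by gcongr) hb1
      have s2 := mul_le_mul_of_nonneg_left s1 p0.le
      nlinarith [mul_pos (mul_pos p0 p1) p2]
    have hr : (2 * r1 a b ^ 2) ^ 3 * (4 ^ a * 4 ^ a * 4 ^ b) = 8 := by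
      have := r1_cube a b
      have t : (2 * r1 a b ^ 2) ^ 3 * (4 ^ a * 4 ^ a * 4 ^ b) = 8 * (r1 a b ^ 3 * (4 ^ a * 2 ^ b)) ^ 2 := by
        rw [e4']; ring
      rw [t, this]; norm_num
    rw [← hr] at hc
    have := le_of_mul_le_mul_right hc (by positivity)
    exact le_of_pow_le_pow_left₀ (by norm_num) (by positivity) this
  have b1 : rn g 1 ≤ 8 * r2 a b ^ 2 := by
    have : r2 a b ^ 2 = 4 ^ a * r1 a b ^ 2 := by unfold r2; rw [e4]; ring
    rw [this]
    nlinarith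
  have b2 : rn g 2 ≤ 32 * r3 a b ^ 2 := by
    have : r3 a b ^ 2 = 4 ^ b * r2 a b ^ 2 := by unfold r3; rw [e4']; ring
    rw [this]
    nlinarith
  refine ⟨a, b, fun j => ?_, fun j => ?_, fun j => ?_, ?_⟩
  · apply abs_le_of_sq_le_sq _ (by positivity)
    have := entry_le g 0 j
    nlinarith
  · apply abs_le_of_sq_le_sq _ (by positivity)
    have := entry_le g 1 j
    nlinarith
  · apply abs_le_of_sq_le_sq _ (by positivity)
    have := entry_le g 2 j
    nlinarith
  · have hr : r3 a b ^ 2 ≤ 4 ^ (a + b) := by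
      have : r3 a b ^ 2 = 4 ^ (a + b) * r1 a b ^ 2 := by unfold r3 r2; rw [pow_add, e4', e4]; ring
      rw [this]
      have l := r1_le a b
      have : r1 a b ^ 2 ≤ 1 := by nlinarith
      have h4 : (0 : ℝ) < 4 ^ (a + b) := by positivity
      nlinarith
    unfold N2; linarith

/-- lower unipotents -/
def un (x : ℤ × ℤ × ℤ) : SLZ := sl 1 0 0 x.1 1 0 x.2.1 x.2.2 1 (by rw [Matrix.det_fin_three]; simp)

lemma un_inj : Function.Injective un := by
  rintro ⟨α, β, γ⟩ ⟨α', β', γ'⟩ h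
  have h := congrArg (fun u : SLZ => (u : MZ)) h
  have h1 := congrFun (congrFun h 1) 0
  have h2 := congrFun (congrFun h 2) 0
  have h3 := congrFun (congrFun h 2) 1
  simp [un, sl] at h1 h2 h3
  simp [h1, h2, h3]

def unF (a b : ℕ) : Finset (ℤ × ℤ × ℤ) := (Finset.range (2 ^ a) ×ˢ Finset.range (2 ^ (a + b)) ×ˢ Finset.range (2 ^ b)).map
  ⟨fun x => ((x.1 : ℤ), (x.2.1 : ℤ), (x.2.2 : ℤ)), by rintro ⟨a, b, c⟩ ⟨a', b', c'⟩ h; simpa using h⟩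

lemma unF_card (a b : ℕ) : (unF a b).card = 4 ^ (a + b) := by
  simp only [unF, Finset.card_map, Finset.card_product, Finset.card_range]
  rw [show 4 = 2 * 2 by norm_num, mul_pow, pow_add]; ring

lemma unF_mem {a b : ℕ} {x : ℤ × ℤ × ℤ} (hx : x ∈ unF a b) : |(x.1 : ℝ)| ≤ 2 ^ a ∧ |(x.2.1 : ℝ)| ≤ 2 ^ (a + b) ∧ |(x.2.2 : ℝ)| ≤ 2 ^ b := by
  simp only [unF, Finset.mem_map, Finset.mem_product, Finset.mem_range] at hx
  obtain ⟨⟨p, q, r⟩, ⟨h1, h2, h3⟩, rfl⟩ := hx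
  show |((p : ℤ) : ℝ)| ≤ 2 ^ a ∧ |((q : ℤ) : ℝ)| ≤ 2 ^ (a + b) ∧ |((r : ℤ) : ℝ)| ≤ 2 ^ b
  simp only [Int.cast_natCast, Nat.abs_cast]
  refine ⟨?_, ?_, ?_⟩
  · exact_mod_cast h1.le
  · exact_mod_cast h2.le
  · exact_mod_cast h3.le

lemma un_rows (x : ℤ × ℤ × ℤ) (g : M3) : (∀ j, (rz (un x) * g) 0 j = g 0 j) ∧ (∀ j, (rz (un x) * g) 1 j = x.1 * g 0 j + g 1 j) ∧
    (∀ j, (rz (un x) * g) 2 j = x.2.1 * g 0 j + x.2.2 * g 1 j + g 2 j) := by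
  unfold un
  rw [rz_sl]
  refine ⟨fun j => ?_, fun j => ?_, fun j => ?_⟩ <;> rw [Matrix.mul_apply, Fin.sum_univ_three] <;> simp

/-- row bounds in a cell -/
noncomputable def rr (a b : ℕ) : Fin 3 → ℝ := ![r1 a b, r2 a b, r3 a b]

lemma un_bound (g : M3) (a b : ℕ) (h0 : ∀ j, |g 0 j| ≤ 2 * r1 a b) (h1 : ∀ j, |g 1 j| ≤ 3 * r2 a b)
    (h2 : ∀ j, |g 2 j| ≤ 6 * r3 a b) (x : ℤ × ℤ × ℤ) (hx : x ∈ unF a b) (i j : Fin 3) :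
    |(rz (un x) * g) i j| ≤ 11 * rr a b i := by
  obtain ⟨e0, e1, e2⟩ := un_rows x g
  obtain ⟨x0, x1, x2⟩ := unF_mem hx
  have q1 := r1_pos a b
  have q2 := r2_pos a b
  have q3 := r3_pos a b
  have a0 : |(rz (un x) * g) 0 j| ≤ 11 * r1 a b := by
    rw [e0]; linarith [h0 j]
  have a1 : |(rz (un x) * g) 1 j| ≤ 11 * r2 a b := by
    rw [e1]
    refine (abs_add_le _ _).trans ?_
    rw [abs_mul]
    have : |(x.1 : ℝ)| * |g 0 j| ≤ 2 ^ a * (2 * r1 a b) := mul_le_mul x0 (h0 j) (abs_nonneg _) (by positivity)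
    have e : (2 : ℝ) ^ a * (2 * r1 a b) = 2 * r2 a b := by unfold r2; ring
    linarith [h1 j]
  have a2 : |(rz (un x) * g) 2 j| ≤ 11 * r3 a b := by
    rw [e2]
    refine (abs_add_three _ _ _).trans ?_
    rw [abs_mul, abs_mul]
    have t1 : |(x.2.1 : ℝ)| * |g 0 j| ≤ 2 ^ (a + b) * (2 * r1 a b) := mul_le_mul x1 (h0 j) (abs_nonneg _) (by positivity)
    have t2 : |(x.2.2 : ℝ)| * |g 1 j| ≤ 2 ^ b * (3 * r2 a b) := mul_le_mul x2 (h1 j) (abs_nonneg _) (by positivity)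
    have e : (2 : ℝ) ^ (a + b) * (2 * r1 a b) = 2 * r3 a b := by unfold r3 r2; rw [pow_add]; ring
    have e' : (2 : ℝ) ^ b * (3 * r2 a b) = 3 * r3 a b := by unfold r3; ring
    linarith [h2 j]
  fin_cases i
  · exact a0
  · exact a1
  · exact a2

lemma exists_p : ∃ p : ℝ, 0 < p ∧ p < 1 ∧ p ^ 4 = 1 / 2 := by
  refine ⟨(1 / 2 : ℝ) ^ ((1 : ℝ) / 4), by positivity, Real.rpow_lt_one (by norm_num) (by norm_num) (by norm_num), ?_⟩
  rw [← Real.rpow_natCast, ← Real.rpow_mul (by norm_num)]; norm_num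

end TC


namespace TC
open Matrix Filter Topology

/-- real cast of an integral form -/
def rc (c : Fin 10 → ℤ) : Fin 10 → ℝ := fun i => (c i : ℝ)

lemma rc_inj {c c' : Fin 10 → ℤ} (h : rc c = rc c') : c = c' := by
  funext i
  have h1 : (c i : ℝ) = (c' i : ℝ) := congrFun h i
  exact_mod_cast h1

lemma rc_act (γ : SLZ) (c : Fin 10 → ℤ) : rc (act (γ : MZ) c) = act (rz γ) (rc c) :=
  (act_map (Int.castRingHom ℝ) (γ : MZ) c).symm

lemma orbitZ_eq (c : Fin 10 → ℤ) : orbitZ c = Set.range (fun γ : SLZ => act (γ : MZ) c) := by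
  ext c'
  unfold orbitZ
  constructor
  · rintro ⟨γ, h⟩
    rw [actGL_cubic] at h
    exact ⟨γ, cubic_inj h⟩
  · rintro ⟨γ, h⟩
    refine ⟨γ, ?_⟩
    rw [actGL_cubic]; exact congrArg cubic h

lemma act_SLZ_mul (γ γ' : SLZ) (c : Fin 10 → ℤ) : act ((γ * γ' : SLZ) : MZ) c = act (γ : MZ) (act (γ' : MZ) c) := by
  rw [Matrix.SpecialLinearGroup.coe_mul, act_mul]

lemma orbitZ_act (γ : SLZ) (c : Fin 10 → ℤ) : orbitZ (act (γ : MZ) c) = orbitZ c := by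
  rw [orbitZ_eq, orbitZ_eq]
  ext c'
  constructor
  · rintro ⟨γ', rfl⟩
    exact ⟨γ' * γ, act_SLZ_mul _ _ _⟩
  · rintro ⟨γ', rfl⟩
    refine ⟨γ' * γ⁻¹, ?_⟩
    show act ((γ' * γ⁻¹ : SLZ) : MZ) (act (γ : MZ) c) = _
    rw [← act_SLZ_mul, inv_mul_cancel_right]

lemma mem_orbitZ (c : Fin 10 → ℤ) : c ∈ orbitZ c := by
  rw [orbitZ_eq]; exact ⟨1, by simp [act_one]⟩

lemma orbitZ_of_mem {c c' : Fin 10 → ℤ} (h : c' ∈ orbitZ c) : orbitZ c' = orbitZ c := by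
  rw [orbitZ_eq] at h
  obtain ⟨γ, rfl⟩ := h
  exact orbitZ_act γ c

lemma SI_act (γ : SLZ) (c : Fin 10 → ℤ) (h : StronglyIrred c) : StronglyIrred (act (γ : MZ) c) := by
  rintro ⟨v, hv, h1, h2⟩
  apply h
  have e : (fun k => ((act (γ : MZ) c k : ℤ) : ℚ)) = act ((γ : MZ).map (Int.castRingHom ℚ)) (fun k => (c k : ℚ)) :=
    (act_map (Int.castRingHom ℚ) (γ : MZ) c).symm
  have hdet : ((γ : MZ).map (Int.castRingHom ℚ)).det = 1 := by
    have := RingHom.map_det (Int.castRingHom ℚ) (γ : MZ)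
    rw [γ.2] at this
    simpa using this.symm
  rw [e] at h1 h2
  rw [eval_cubic, ev_act] at h1
  rw [hess_cubic, eval_cubic, hc_act, hdet, one_pow, one_smul, ev_act] at h2
  refine ⟨v ᵥ* ((γ : MZ).map (Int.castRingHom ℚ)), ?_, ?_, ?_⟩
  · intro h0
    apply hv
    have := congrArg (fun u => u ᵥ* ((γ : MZ).map (Int.castRingHom ℚ))⁻¹) h0
    simp only [Matrix.vecMul_vecMul, Matrix.zero_vecMul] at this
    rw [Matrix.mul_nonsing_inv _ (by rw [hdet]; exact isUnit_one), Matrix.vecMul_one] at this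
    exact this
  · rw [eval_cubic]; exact h1
  · rw [hess_cubic, eval_cubic]; exact h2

/-- the leading coefficients of a strongly irreducible form -/
lemma SI_lead (c : Fin 10 → ℤ) (h : StronglyIrred c) : c 0 ≠ 0 ∨ c 3 ≠ 0 ∨ (c 4 ≠ 0 ∧ c 5 ≠ 0) := by
  by_contra hcon
  push Not at hcon
  obtain ⟨h0, h3, h45⟩ := hcon
  apply h
  refine ⟨![1, 0, 0], ?_, ?_, ?_⟩
  · intro e
    have := congrFun e 0
    simp at this
  · rw [eval_cubic]; simp [ev, h0]
  · rw [hess_cubic, eval_cubic]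
    simp only [ev, hc_0]
    simp [h0, h3]
    by_cases h4 : c 4 = 0
    · left; exact h4
    · right; exact h45 h4

lemma d3_bound (c : Fin 10 → ℝ) (u v w : Fin 3 → ℝ) (V U' V' W' : ℝ) (hc : ∀ i, |c i| ≤ V) (hu : ∀ i, |u i| ≤ U')
    (hv : ∀ i, |v i| ≤ V') (hw : ∀ i, |w i| ≤ W') : |d3 c u v w| ≤ 60 * (V * (U' * V' * W')) := by
  have key : ∀ k i j l, -(V * (U' * V' * W')) ≤ c k * u i * v j * w l ∧ c k * u i * v j * w l ≤ V * (U' * V' * W') := by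
    intro k i j l
    rw [← abs_le, abs_mul, abs_mul, abs_mul]
    have h1 : |c k| * |u i| ≤ V * U' := mul_le_mul (hc k) (hu i) (abs_nonneg _) ((abs_nonneg _).trans (hc k))
    have h2 : |c k| * |u i| * |v j| ≤ V * U' * V' := mul_le_mul h1 (hv j) (abs_nonneg _) ((by positivity : (0:ℝ) ≤ |c k| * |u i|).trans h1)
    have h3 : |c k| * |u i| * |v j| * |w l| ≤ V * U' * V' * W' := mul_le_mul h2 (hw l) (abs_nonneg _) ((by positivity : (0:ℝ) ≤ |c k| * |u i| * |v j|).trans h2)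
    calc _ ≤ _ := h3
      _ = _ := by ring
  obtain ⟨Z, hZ⟩ : ∃ Z, Z = V * (U' * V' * W') := ⟨_, rfl⟩
  rw [← hZ] at key ⊢
  have e : d3 c u v w = 6 * (c 0 * u 0 * v 0 * w 0) + 6 * (c 1 * u 1 * v 1 * w 1) + 6 * (c 2 * u 2 * v 2 * w 2)
    + (2 * (c 3 * u 0 * v 0 * w 1) + 2 * (c 3 * u 0 * v 1 * w 0) + 2 * (c 3 * u 1 * v 0 * w 0))
    + (2 * (c 4 * u 0 * v 0 * w 2) + 2 * (c 4 * u 0 * v 2 * w 0) + 2 * (c 4 * u 2 * v 0 * w 0))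
    + (2 * (c 5 * u 0 * v 1 * w 1) + 2 * (c 5 * u 1 * v 0 * w 1) + 2 * (c 5 * u 1 * v 1 * w 0))
    + (2 * (c 6 * u 1 * v 1 * w 2) + 2 * (c 6 * u 1 * v 2 * w 1) + 2 * (c 6 * u 2 * v 1 * w 1))
    + (2 * (c 7 * u 0 * v 2 * w 2) + 2 * (c 7 * u 2 * v 0 * w 2) + 2 * (c 7 * u 2 * v 2 * w 0))
    + (2 * (c 8 * u 1 * v 2 * w 2) + 2 * (c 8 * u 2 * v 1 * w 2) + 2 * (c 8 * u 2 * v 2 * w 1))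
    + (c 9 * u 0 * v 1 * w 2 + c 9 * u 0 * v 2 * w 1 + c 9 * u 1 * v 0 * w 2 + c 9 * u 1 * v 2 * w 0
      + c 9 * u 2 * v 0 * w 1 + c 9 * u 2 * v 1 * w 0) := by unfold d3; ring
  rw [e, abs_le]
  constructor
  · linarith [(key 0 0 0 0).1, (key 1 1 1 1).1, (key 2 2 2 2).1, (key 3 0 0 1).1, (key 3 0 1 0).1, (key 3 1 0 0).1,
      (key 4 0 0 2).1, (key 4 0 2 0).1, (key 4 2 0 0).1, (key 5 0 1 1).1, (key 5 1 0 1).1, (key 5 1 1 0).1,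
      (key 6 1 1 2).1, (key 6 1 2 1).1, (key 6 2 1 1).1, (key 7 0 2 2).1, (key 7 2 0 2).1, (key 7 2 2 0).1,
      (key 8 1 2 2).1, (key 8 2 1 2).1, (key 8 2 2 1).1, (key 9 0 1 2).1, (key 9 0 2 1).1, (key 9 1 0 2).1,
      (key 9 1 2 0).1, (key 9 2 0 1).1, (key 9 2 1 0).1]
  · linarith [(key 0 0 0 0).2, (key 1 1 1 1).2, (key 2 2 2 2).2, (key 3 0 0 1).2, (key 3 0 1 0).2, (key 3 1 0 0).2,
      (key 4 0 0 2).2, (key 4 0 2 0).2, (key 4 2 0 0).2, (key 5 0 1 1).2, (key 5 1 0 1).2, (key 5 1 1 0).2,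
      (key 6 1 1 2).2, (key 6 1 2 1).2, (key 6 2 1 1).2, (key 7 0 2 2).2, (key 7 2 0 2).2, (key 7 2 2 0).2,
      (key 8 1 2 2).2, (key 8 2 1 2).2, (key 8 2 2 1).2, (key 9 0 1 2).2, (key 9 0 2 1).2, (key 9 1 0 2).2,
      (key 9 1 2 0).2, (key 9 2 0 1).2, (key 9 2 1 0).2]

/-- monomials -/
def mo (r : Fin 3 → ℝ) : Fin 10 → ℝ :=
  ![r 0 * r 0 * r 0, r 1 * r 1 * r 1, r 2 * r 2 * r 2, r 0 * r 0 * r 1, r 0 * r 0 * r 2, r 1 * r 1 * r 0,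
    r 1 * r 1 * r 2, r 2 * r 2 * r 0, r 2 * r 2 * r 1, r 0 * r 1 * r 2]

lemma act_bound (g : M3) (c : Fin 10 → ℝ) (V : ℝ) (r : Fin 3 → ℝ) (hc : ∀ i, |c i| ≤ V) (hg : ∀ i j, |g i j| ≤ r i) (k : Fin 10) :
    |act g c k| ≤ 60 * V * mo r k := by
  have hV : 0 ≤ V := (abs_nonneg _).trans (hc 0)
  have hr : ∀ i, 0 ≤ r i := fun i => (abs_nonneg _).trans (hg i 0)
  have eE : ∀ i, |ev c (g i)| ≤ 60 * V * (r i * r i * r i) := by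
    intro i
    have h := d3_bound c (g i) (g i) (g i) V (r i) (r i) (r i) hc (hg i) (hg i) (hg i)
    have e : d3 c (g i) (g i) (g i) = 6 * ev c (g i) := by unfold d3 ev; ring
    rw [e, abs_mul, abs_of_pos (by norm_num : (0:ℝ) < 6)] at h
    have := abs_nonneg (ev c (g i))
    linarith
  have eD : ∀ i j, |d1 c (g i) (g j)| ≤ 60 * V * (r i * r i * r j) := by
    intro i j
    have h := d3_bound c (g i) (g i) (g j) V (r i) (r i) (r j) hc (hg i) (hg i) (hg j)
    have e : d3 c (g i) (g i) (g j) = 2 * d1 c (g i) (g j) := by unfold d3 d1; ring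
    rw [e, abs_mul, abs_of_pos (by norm_num : (0:ℝ) < 2)] at h
    have := abs_nonneg (d1 c (g i) (g j))
    linarith
  have e3 : |d3 c (g 0) (g 1) (g 2)| ≤ 60 * V * (r 0 * r 1 * r 2) := by
    have h := d3_bound c (g 0) (g 1) (g 2) V (r 0) (r 1) (r 2) hc (hg 0) (hg 1) (hg 2)
    linarith
  fin_cases k
  · exact eE 0
  · exact eE 1
  · exact eE 2
  · exact eD 0 1
  · exact eD 0 2
  · exact eD 1 0
  · exact eD 1 2
  · exact eD 2 0
  · exact eD 2 1
  · exact e3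

/-- existence of a reduced cell for a bad matrix -/
lemma red_cell (g : M3) (s : ℝ) (hs : 0 < s) (hg : g.det = s ^ 3) (κ : ℕ)
    (hbad : ∀ γ : SLZ, (10 * 2 ^ κ) ^ 2 * s ^ 2 < N2 (rz γ * g)) :
    ∃ (γ : SLZ) (a b : ℕ), κ ≤ a + b ∧ ∀ x ∈ unF a b, ∀ i j, |(rz (un x * γ) * (s⁻¹ • g)) i j| ≤ 11 * rr a b i := by
  have hd : (s⁻¹ • g).det = 1 := by
    rw [Matrix.det_smul, hg]; simp [hs.ne']
  obtain ⟨γ, _, h1, h2, h3⟩ := reduction (s⁻¹ • g) (by rw [hd]; norm_num)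
  rw [hd] at h3
  obtain ⟨a, b, b0, b1, b2, hN⟩ := cell (rz γ * (s⁻¹ • g)) (by rw [Matrix.det_mul, rz_det, hd]; norm_num) h1 h2 (by linarith)
  refine ⟨γ, a, b, ?_, ?_⟩
  · have hN' : N2 (rz γ * (s⁻¹ • g)) = s⁻¹ ^ 2 * N2 (rz γ * g) := by
      rw [Matrix.mul_smul]
      simp only [N2, rn, Matrix.smul_apply, smul_eq_mul]; ring
    have hb := hbad γ
    rw [hN'] at hN
    have hh : (10 * 2 ^ κ : ℝ) ^ 2 < 96 * 4 ^ (a + b) := by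
      refine lt_of_lt_of_le ?_ hN
      rw [inv_pow, ← div_eq_inv_mul, lt_div_iff₀ (by positivity)]
      exact hb
    by_contra hlt
    push Not at hlt
    have : (4 : ℝ) ^ (a + b) ≤ 4 ^ κ := pow_le_pow_right₀ (by norm_num) hlt.le
    have e : (10 * 2 ^ κ : ℝ) ^ 2 = 100 * 4 ^ κ := by
      rw [mul_pow, ← pow_mul, mul_comm κ, pow_mul]; norm_num
    rw [e] at hh
    have : (0 : ℝ) < 4 ^ κ := by positivity
    linarith
  · intro x hx i j
    rw [rz_mul, mul_assoc]
    exact un_bound _ a b b0 b1 b2 x hx i j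

lemma exists_kappa (K p ε : ℝ) (hp0 : 0 < p) (hp1 : p < 1) (hε : 0 < ε) : ∃ κ : ℕ, K * p ^ κ / (1 - p) ^ 2 ≤ ε := by
  have h := ((tendsto_pow_atTop_nhds_zero_of_lt_one hp0.le hp1).const_mul K).div_const ((1 - p) ^ 2)
  rw [mul_zero, zero_div] at h
  obtain ⟨κ, hκ⟩ := (h.eventually_lt_const hε).exists
  exact ⟨κ, hκ.le⟩

/-- matrix tail -/
theorem matrix_tail (ε : ℝ) (hε : 0 < ε) : ∃ T : ℝ, 0 < T ∧ ∀ T' ≥ T, ∀ t : ℝ, 0 < t →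
    ({h : HN | ((h : MZ).det : ℝ) < t ^ 3 ∧ ∀ s : ℝ, 0 < s → ((h : MZ).det : ℝ) = s ^ 3 →
      ∀ γ : SLZ, T' ^ 2 * s ^ 2 < N2 (rz γ * (h : MZ).map (Int.castRingHom ℝ))}.ncard : ℝ) ≤ ε * t ^ 9 := by
  obtain ⟨p, hp0, hp1, hp4⟩ := exists_p
  obtain ⟨κ, hκ⟩ := exists_kappa (33 ^ 9) p ε hp0 hp1 hε
  refine ⟨10 * 2 ^ κ, by positivity, fun T' hT' t ht => ?_⟩
  have hq : (1 : ℝ) ≤ 4 * p ^ 2 := by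
    nlinarith [sq_nonneg (p ^ 2 - 1 / 2), sq_nonneg p]
  let Box : ℕ → ℕ → Set MZ := fun a b => {M | M.det ≠ 0 ∧ ∀ i j, |((M i j : ℤ) : ℝ)| ≤ 11 * t * rr a b i}
  have hbox : ∀ a b, (Box a b).Finite ∧ ((Box a b).ncard : ℝ) ≤ 33 ^ 9 * t ^ 9 * 4 ^ (a + b) * (p ^ 2) ^ (a + b) := by
    intro a b
    have q1 := r1_pos a b
    have q2 := r2_pos a b
    have q3 := r3_pos a b
    have q12 := r12 a b
    have q23 := r23 a b
    have hrr : ∀ i, 0 ≤ 11 * t * rr a b i := by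
      intro i; fin_cases i <;> simp [rr] <;> positivity
    obtain ⟨hf, hc⟩ := box_card (ι := Fin 3 × Fin 3) (fun x => 11 * t * rr a b x.1) (fun x => hrr x.1)
    let e : MZ ≃ (Fin 3 × Fin 3 → ℤ) := (Equiv.curry (Fin 3) (Fin 3) ℤ).symm
    have hsub : e '' (Box a b) ⊆ {x : Fin 3 × Fin 3 → ℤ | ∀ i, |(x i : ℝ)| ≤ 11 * t * rr a b i.1} := by
      rintro _ ⟨M, hM, rfl⟩ i
      exact hM.2 i.1 i.2
    have hfin : (Box a b).Finite := (hf.subset hsub).of_finite_image e.injective.injOn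
    refine ⟨hfin, ?_⟩
    rcases Set.eq_empty_or_nonempty (Box a b) with hemp | ⟨M, hM⟩
    · rw [hemp, Set.ncard_empty, Nat.cast_zero]; positivity
    · have h1 : 1 ≤ 11 * t * r1 a b := by
        have : ∃ j, M 0 j ≠ 0 := by
          by_contra hcon
          push Not at hcon
          exact hM.1 (Matrix.det_eq_zero_of_row_eq_zero 0 hcon)
        obtain ⟨j, hj⟩ := this
        have h := hM.2 0 j
        have h1 : (1 : ℝ) ≤ |((M 0 j : ℤ) : ℝ)| := by exact_mod_cast Int.one_le_abs hj
        exact h1.trans h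
      have hcard := Set.ncard_le_ncard hsub hf
      rw [Set.ncard_image_of_injective _ e.injective] at hcard
      calc ((Box a b).ncard : ℝ) ≤ _ := by exact_mod_cast hcard
        _ ≤ _ := hc
        _ ≤ ∏ x : Fin 3 × Fin 3, (33 * t * rr a b x.1) := by
          refine Finset.prod_le_prod (fun x _ => by linarith [hrr x.1]) fun x _ => ?_
          have : ∀ i, 1 ≤ 11 * t * rr a b i := by
            intro i
            fin_cases i
            · exact h1
            · exact h1.trans (by show 11 * t * r1 a b ≤ 11 * t * r2 a b; gcongr)
            · exact h1.trans (by show 11 * t * r1 a b ≤ 11 * t * r3 a b; gcongr; linarith)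
          linarith [this x.1]
        _ = 33 ^ 9 * t ^ 9 * (r1 a b * r2 a b * r3 a b) ^ 3 := by
          rw [Fintype.prod_prod_type]
          simp [Fin.prod_univ_three, rr]
          ring
        _ = 33 ^ 9 * t ^ 9 * 1 := by rw [r123]; norm_num
        _ ≤ 33 ^ 9 * t ^ 9 * (4 * p ^ 2) ^ (a + b) := by
          gcongr
          exact one_le_pow₀ hq
        _ = _ := by rw [mul_pow]; ring
  have main := tail_abs (O := {h : HN | ((h : MZ).det : ℝ) < t ^ 3 ∧ ∀ s : ℝ, 0 < s → ((h : MZ).det : ℝ) = s ^ 3 →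
      ∀ γ : SLZ, T' ^ 2 * s ^ 2 < N2 (rz γ * (h : MZ).map (Int.castRingHom ℝ))})
    (fun h => Set.range fun γ : SLZ => (γ : MZ) * (h : MZ)) ?_ Box (fun a b => (hbox a b).1) (33 ^ 9 * t ^ 9) p
    (by positivity) hp0 hp1 (fun a b => (hbox a b).2) κ ?_
  · refine main.2.trans ?_
    calc 33 ^ 9 * t ^ 9 * p ^ κ / (1 - p) ^ 2 = (33 ^ 9 * p ^ κ / (1 - p) ^ 2) * t ^ 9 := by ring
      _ ≤ _ := by gcongr
  · intro h _ h' _ hne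
    rw [Set.disjoint_left]
    rintro _ ⟨γ, rfl⟩ ⟨γ', e⟩
    have e : (γ' : MZ) * (h' : MZ) = (γ : MZ) * (h : MZ) := e
    apply hne
    have e2 : ((γ'⁻¹ * γ : SLZ) : MZ) * (h : MZ) = h' := by
      rw [Matrix.SpecialLinearGroup.coe_mul, mul_assoc, ← e, ← mul_assoc, ← Matrix.SpecialLinearGroup.coe_mul, inv_mul_cancel,
        Matrix.SpecialLinearGroup.coe_one, one_mul]
    exact Subtype.ext (HN_unique h.2 h'.2 e2).2
  · rintro h ⟨hlt, hbad⟩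
    have hpos : (0 : ℝ) < ((h : MZ).det : ℝ) := by exact_mod_cast HN_det_pos h.2
    obtain ⟨s, hs3⟩ := cbrt ((h : MZ).det : ℝ)
    have hs : 0 < s := by
      by_contra hcon
      push Not at hcon
      have : s ^ 3 ≤ 0 := by nlinarith [sq_nonneg s]
      linarith
    have hst : s < t := by
      rw [← hs3] at hlt
      exact lt_of_pow_lt_pow_left₀ 3 ht.le hlt
    have hdet : ((h : MZ).map (Int.castRingHom ℝ)).det = s ^ 3 := by
      rw [hs3]
      exact (RingHom.map_det (Int.castRingHom ℝ) (h : MZ)).symm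
    obtain ⟨γ, a, b, hab, hx⟩ := red_cell _ s hs hdet κ (fun γ => by
      refine lt_of_le_of_lt ?_ (hbad s hs hs3.symm γ)
      gcongr)
    classical
    refine ⟨a, b, hab, (unF a b).image (fun x => ((un x * γ : SLZ) : MZ) * (h : MZ)), ?_, ?_, ?_⟩
    · intro M hM
      rw [Finset.mem_coe, Finset.mem_image] at hM
      obtain ⟨x, _, rfl⟩ := hM
      exact ⟨_, rfl⟩
    · intro M hM
      rw [Finset.mem_coe, Finset.mem_image] at hM
      obtain ⟨x, hxm, rfl⟩ := hM
      refine ⟨?_, fun i j => ?_⟩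
      · rw [Matrix.det_mul, Matrix.SpecialLinearGroup.det_coe, one_mul]; exact (HN_det_pos h.2).ne'
      · have h1 := hx x hxm i j
        rw [Matrix.mul_smul, Matrix.smul_apply, smul_eq_mul, abs_mul, abs_of_pos (inv_pos.mpr hs), ← div_eq_inv_mul,
          div_le_iff₀ hs] at h1
        have e : (((((un x * γ : SLZ) : MZ) * (h : MZ)) i j : ℤ) : ℝ) = (rz (un x * γ) * (h : MZ).map (Int.castRingHom ℝ)) i j := by
          unfold rz
          rw [← Matrix.map_mul]; rfl
        rw [e]
        refine h1.trans ?_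
        have : 0 ≤ rr a b i := by
          have q1 := r1_pos a b
          have q2 := r2_pos a b
          have q3 := r3_pos a b
          fin_cases i
          · exact q1.le
          · exact q2.le
          · exact q3.le
        nlinarith
    · rw [Finset.card_image_of_injective, unF_card]
      intro x y hxy
      have hxy : ((un x * γ : SLZ) : MZ) * (h : MZ) = ((un y * γ : SLZ) : MZ) * (h : MZ) := hxy
      have hu : IsUnit ((h : MZ).map (Int.castRingHom ℝ)).det := by rw [hdet]; exact (pow_pos hs 3).ne'.isUnit
      have e : rz (un x * γ) * (h : MZ).map (Int.castRingHom ℝ) = rz (un y * γ) * (h : MZ).map (Int.castRingHom ℝ) := by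
        unfold rz
        rw [← Matrix.map_mul, ← Matrix.map_mul, hxy]
      have e2 := congrArg (fun A => A * ((h : MZ).map (Int.castRingHom ℝ))⁻¹) e
      simp only [Matrix.mul_nonsing_inv_cancel_right _ _ hu] at e2
      exact un_inj (mul_right_cancel (rz_inj e2))

end TC


namespace TC
open Matrix Filter Topology

lemma box_vec (D E : Fin 10 → ℝ) (hD : ∀ i, 0 ≤ D i) (hDE : ∀ i, 2 * D i + 1 ≤ E i) (A : Set (Fin 10 → ℤ))
    (hA : ∀ c ∈ A, ∀ i, |(c i : ℝ)| ≤ D i) : A.Finite ∧ (A.ncard : ℝ) ≤ ∏ i, E i := by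
  obtain ⟨hf, hc⟩ := box_card D hD
  have hsub : A ⊆ {x : Fin 10 → ℤ | ∀ i, |(x i : ℝ)| ≤ D i} := fun c hc => hA c hc
  refine ⟨hf.subset hsub, ?_⟩
  refine (Nat.cast_le.mpr (Set.ncard_le_ncard hsub hf)).trans (hc.trans (Finset.prod_le_prod (fun i _ => by linarith [hD i]) fun i _ => hDE i))

lemma mo_pos (r : Fin 3 → ℝ) (hr : ∀ i, 0 < r i) (k : Fin 10) : 0 < mo r k := by
  have h0 := hr 0
  have h1 := hr 1
  have h2 := hr 2
  fin_cases k <;> simp [mo] <;> positivity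

/-- class with nonvanishing first coefficient -/
lemma box_one (L x y z : ℝ) (hL : 0 < L) (hx : 0 < x) (hxy : x ≤ y) (hyz : y ≤ z) (h1 : x * y * z = 1)
    (A : Set (Fin 10 → ℤ)) (hA : ∀ c ∈ A, c 0 ≠ 0 ∧ ∀ i, |(c i : ℝ)| ≤ L * mo ![x, y, z] i) :
    A.Finite ∧ (A.ncard : ℝ) ≤ 3 ^ 10 * L ^ 10 := by
  have hy : 0 < y := hx.trans_le hxy
  have hz : 0 < z := hy.trans_le hyz
  rcases Set.eq_empty_or_nonempty A with rfl | ⟨c, hc⟩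
  · exact ⟨Set.finite_empty, by rw [Set.ncard_empty, Nat.cast_zero]; positivity⟩
  have hB : 1 ≤ L * (x * x * x) := by
    have h := (hA c hc).2 0
    have h1 : (1 : ℝ) ≤ |((c 0 : ℤ) : ℝ)| := by exact_mod_cast Int.one_le_abs (hA c hc).1
    exact h1.trans h
  have hxz := hxy.trans hyz
  have hge : ∀ i, 1 ≤ L * mo ![x, y, z] i := by
    intro i
    refine hB.trans (mul_le_mul_of_nonneg_left ?_ hL.le)
    fin_cases i <;> simp [mo] <;> gcongr
  obtain ⟨hf, hcard⟩ := box_vec (fun i => L * mo ![x, y, z] i) (fun i => 3 * (L * mo ![x, y, z] i)) (fun i => by linarith [hge i])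
    (fun i => by linarith [hge i]) A (fun c hc => (hA c hc).2)
  refine ⟨hf, hcard.trans (le_of_eq ?_)⟩
  calc _ = 3 ^ 10 * L ^ 10 * (x * y * z) ^ 10 := by
        simp [Fin.prod_univ_succ, mo]; ring
    _ = _ := by rw [h1]; ring

lemma box_two (L x y z : ℝ) (hL : 0 < L) (hx : 0 < x) (hxy : x ≤ y) (hyz : y ≤ z) (h1 : x * y * z = 1)
    (A : Set (Fin 10 → ℤ)) (hA : ∀ c ∈ A, c 0 = 0 ∧ c 3 ≠ 0 ∧ ∀ i, |(c i : ℝ)| ≤ L * mo ![x, y, z] i) :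
    A.Finite ∧ (A.ncard : ℝ) ≤ 3 ^ 9 * L ^ 10 * (y / x) := by
  have hy : 0 < y := hx.trans_le hxy
  have hz : 0 < z := hy.trans_le hyz
  rcases Set.eq_empty_or_nonempty A with rfl | ⟨c, hc⟩
  · exact ⟨Set.finite_empty, by rw [Set.ncard_empty, Nat.cast_zero]; positivity⟩
  have hB : 1 ≤ L * (x * x * y) := by
    have h := (hA c hc).2.2 3
    have h1 : (1 : ℝ) ≤ |((c 3 : ℤ) : ℝ)| := by exact_mod_cast Int.one_le_abs (hA c hc).2.1
    exact h1.trans h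
  have hxz := hxy.trans hyz
  let D : Fin 10 → ℝ := fun i => if i = 0 then 0 else L * mo ![x, y, z] i
  let F : Fin 10 → ℝ := fun i => if i = 0 then 1 else 3 * (L * mo ![x, y, z] i)
  have hge : ∀ i, i ≠ 0 → 1 ≤ L * mo ![x, y, z] i := by
    intro i hi
    refine hB.trans (mul_le_mul_of_nonneg_left ?_ hL.le)
    fin_cases i
    · exact absurd rfl hi
    · show x * x * y ≤ y * y * y; gcongr
    · show x * x * y ≤ z * z * z; gcongr
    · exact le_refl _
    · show x * x * y ≤ x * x * z; gcongr
    · show x * x * y ≤ y * y * x; nlinarith [mul_pos hx hy]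
    · show x * x * y ≤ y * y * z; gcongr
    · show x * x * y ≤ z * z * x; nlinarith [mul_le_mul hxz hyz hy.le hz.le]
    · show x * x * y ≤ z * z * y; gcongr
    · show x * x * y ≤ x * y * z; nlinarith [mul_pos hx hy]
  obtain ⟨hf, hcard⟩ := box_vec D F (fun i => by
      by_cases hi : i = 0
      · simp [D, hi]
      · simp only [D, hi, if_false]; linarith [hge i hi])
    (fun i => by
      by_cases hi : i = 0
      · simp [D, F, hi]
      · simp only [D, F, hi, if_false]; linarith [hge i hi]) A (fun c hc i => by
      by_cases hi : i = 0
      · subst hi; simp [D, (hA c hc).1]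
      · simp only [D, hi, if_false]; exact (hA c hc).2.2 i)
  refine ⟨hf, hcard.trans ?_⟩
  have e : ∏ i, F i = 3 ^ 9 * L ^ 9 * (x * y * z) ^ 10 / x ^ 3 := by
    rw [Fin.prod_univ_succ]
    simp only [F, if_true, Fin.succ_ne_zero, if_false]
    rw [eq_div_iff (by positivity)]
    simp [Fin.prod_univ_succ, mo]; ring
  rw [e, h1]
  calc 3 ^ 9 * L ^ 9 * 1 ^ 10 / x ^ 3 = 3 ^ 9 * L ^ 9 / x ^ 3 * 1 := by ring
    _ ≤ 3 ^ 9 * L ^ 9 / x ^ 3 * (L * (x * x * y)) := by gcongr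
    _ = _ := by field_simp

lemma box_three (L x y z : ℝ) (hL : 0 < L) (hx : 0 < x) (hxy : x ≤ y) (hyz : y ≤ z) (h1 : x * y * z = 1)
    (A : Set (Fin 10 → ℤ)) (hA : ∀ c ∈ A, c 0 = 0 ∧ c 3 = 0 ∧ c 4 ≠ 0 ∧ c 5 ≠ 0 ∧ ∀ i, |(c i : ℝ)| ≤ L * mo ![x, y, z] i) :
    A.Finite ∧ (A.ncard : ℝ) ≤ 3 ^ 8 * L ^ 10 * (z ^ 2 / (x * y)) ∧ (A.ncard : ℝ) ≤ 3 ^ 8 * L ^ 10 * (y * z / x ^ 2) := by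
  have hy : 0 < y := hx.trans_le hxy
  have hz : 0 < z := hy.trans_le hyz
  rcases Set.eq_empty_or_nonempty A with rfl | ⟨c, hc⟩
  · exact ⟨Set.finite_empty, by rw [Set.ncard_empty, Nat.cast_zero]; positivity, by rw [Set.ncard_empty, Nat.cast_zero]; positivity⟩
  have hB4 : 1 ≤ L * (x * x * z) := by
    have h := (hA c hc).2.2.2.2 4
    have h1 : (1 : ℝ) ≤ |((c 4 : ℤ) : ℝ)| := by exact_mod_cast Int.one_le_abs (hA c hc).2.2.1
    exact h1.trans h
  have hB5 : 1 ≤ L * (y * y * x) := by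
    have h := (hA c hc).2.2.2.2 5
    have h1 : (1 : ℝ) ≤ |((c 5 : ℤ) : ℝ)| := by exact_mod_cast Int.one_le_abs (hA c hc).2.2.2.1
    exact h1.trans h
  have hxz := hxy.trans hyz
  let D : Fin 10 → ℝ := fun i => if i = 0 ∨ i = 3 then 0 else L * mo ![x, y, z] i
  let F : Fin 10 → ℝ := fun i => if i = 0 ∨ i = 3 then 1 else 3 * (L * mo ![x, y, z] i)
  have hge : ∀ i, ¬ (i = 0 ∨ i = 3) → 1 ≤ L * mo ![x, y, z] i := by
    intro i hi
    have a4 : ∀ w, x * x * z ≤ w → 1 ≤ L * w := fun w hw => hB4.trans (mul_le_mul_of_nonneg_left hw hL.le)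
    have a5 : ∀ w, y * y * x ≤ w → 1 ≤ L * w := fun w hw => hB5.trans (mul_le_mul_of_nonneg_left hw hL.le)
    fin_cases i
    · exact absurd (Or.inl rfl) hi
    · exact a5 (y * y * y) (by gcongr)
    · exact a4 (z * z * z) (by gcongr)
    · exact absurd (Or.inr rfl) hi
    · exact hB4
    · exact hB5
    · exact a5 (y * y * z) (by gcongr)
    · exact a4 (z * z * x) (by nlinarith [mul_pos hx hz])
    · exact a4 (z * z * y) (by nlinarith [mul_pos hx hz, mul_le_mul hxz hxy hx.le hz.le])
    · exact a4 (x * y * z) (by gcongr)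
  obtain ⟨hf, hcard⟩ := box_vec D F (fun i => by
      by_cases hi : i = 0 ∨ i = 3
      · simp only [D, hi, if_true]; exact le_refl _
      · simp only [D, hi, if_false]; linarith [hge i hi])
    (fun i => by
      by_cases hi : i = 0 ∨ i = 3
      · simp only [D, F, hi, if_true]; norm_num
      · simp only [D, F, hi, if_false]; linarith [hge i hi]) A (fun c hc i => by
      by_cases hi : i = 0 ∨ i = 3
      · simp only [D, hi, if_true]
        rcases hi with rfl | rfl
        · simp [(hA c hc).1]
        · simp [(hA c hc).2.1]
      · simp only [D, hi, if_false]; exact (hA c hc).2.2.2.2 i)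
  have e : ∏ i, F i = 3 ^ 8 * L ^ 8 * (x * y * z) ^ 10 / (x ^ 5 * y) := by
    rw [eq_div_iff (by positivity)]
    have hF : F = ![1, 3 * (L * (y * y * y)), 3 * (L * (z * z * z)), 1, 3 * (L * (x * x * z)), 3 * (L * (y * y * x)),
        3 * (L * (y * y * z)), 3 * (L * (z * z * x)), 3 * (L * (z * z * y)), 3 * (L * (x * y * z))] := by
      funext i
      fin_cases i <;> simp [F, mo]
    rw [hF]
    simp [Fin.prod_univ_succ]; ring
  rw [e, h1] at hcard
  refine ⟨hf, hcard.trans ?_, hcard.trans ?_⟩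
  · calc 3 ^ 8 * L ^ 8 * 1 ^ 10 / (x ^ 5 * y) = 3 ^ 8 * L ^ 8 / (x ^ 5 * y) * (1 * 1) := by ring
      _ ≤ 3 ^ 8 * L ^ 8 / (x ^ 5 * y) * ((L * (x * x * z)) * (L * (x * x * z))) := by gcongr
      _ = _ := by field_simp
  · calc 3 ^ 8 * L ^ 8 * 1 ^ 10 / (x ^ 5 * y) = 3 ^ 8 * L ^ 8 / (x ^ 5 * y) * (1 * 1) := by ring
      _ ≤ 3 ^ 8 * L ^ 8 / (x ^ 5 * y) * ((L * (x * x * z)) * (L * (y * y * x))) := by gcongr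
      _ = _ := by field_simp

lemma form_box (L p : ℝ) (hL : 0 < L) (hp0 : 0 < p) (hp4 : p ^ 4 = 1 / 2) (a b : ℕ) :
    {c : Fin 10 → ℤ | StronglyIrred c ∧ ∀ i, |(c i : ℝ)| ≤ L * mo (rr a b) i}.Finite ∧
    ({c : Fin 10 → ℤ | StronglyIrred c ∧ ∀ i, |(c i : ℝ)| ≤ L * mo (rr a b) i}.ncard : ℝ) ≤
      3 ^ 11 * L ^ 10 * 4 ^ (a + b) * (p ^ 2) ^ (a + b) := by
  have q1 := r1_pos a b
  have q2 := r2_pos a b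
  have q3 := r3_pos a b
  have q12 := r12 a b
  have q23 := r23 a b
  have q := r123 a b
  have hq : (2 : ℝ) ≤ 4 * p ^ 2 := by
    nlinarith [sq_nonneg (p ^ 2 - 1 / 2), sq_nonneg p]
  have hq8 : (4 * p ^ 2) ^ 2 = 8 := by
    have : (4 * p ^ 2) ^ 2 = 16 * p ^ 4 := by ring
    rw [this, hp4]; norm_num
  obtain ⟨A, hA⟩ : ∃ A : Set (Fin 10 → ℤ), A = {c | StronglyIrred c ∧ ∀ i, |(c i : ℝ)| ≤ L * mo (rr a b) i} := ⟨_, rfl⟩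
  rw [← hA]
  obtain ⟨f1, k1⟩ := box_one L _ _ _ hL q1 q12 q23 q {c | c ∈ A ∧ c 0 ≠ 0} (by
    rintro c ⟨hc, h0⟩; rw [hA] at hc; exact ⟨h0, hc.2⟩)
  obtain ⟨f2, k2⟩ := box_two L _ _ _ hL q1 q12 q23 q {c | c ∈ A ∧ c 0 = 0 ∧ c 3 ≠ 0} (by
    rintro c ⟨hc, h0, h3⟩; rw [hA] at hc; exact ⟨h0, h3, hc.2⟩)
  obtain ⟨f3, k3, k3'⟩ := box_three L _ _ _ hL q1 q12 q23 q {c | c ∈ A ∧ c 0 = 0 ∧ c 3 = 0} (by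
    rintro c ⟨hc, h0, h3⟩; rw [hA] at hc
    rcases SI_lead c hc.1 with h | h | h
    · exact absurd h0 h
    · exact absurd h3 h
    · exact ⟨h0, h3, h.1, h.2, hc.2⟩)
  have hun : A ⊆ {c | c ∈ A ∧ c 0 ≠ 0} ∪ ({c | c ∈ A ∧ c 0 = 0 ∧ c 3 ≠ 0} ∪ {c | c ∈ A ∧ c 0 = 0 ∧ c 3 = 0}) := by
    intro c hc
    by_cases h0 : c 0 = 0
    · right
      by_cases h3 : c 3 = 0
      · right; exact ⟨hc, h0, h3⟩
      · left; exact ⟨hc, h0, h3⟩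
    · left; exact ⟨hc, h0⟩
  have hfin := f1.union (f2.union f3)
  refine ⟨hfin.subset hun, ?_⟩
  have hcard : (A.ncard : ℝ) ≤ ({c | c ∈ A ∧ c 0 ≠ 0}.ncard : ℝ) + (({c | c ∈ A ∧ c 0 = 0 ∧ c 3 ≠ 0}.ncard : ℝ)
      + ({c | c ∈ A ∧ c 0 = 0 ∧ c 3 = 0}.ncard : ℝ)) := by
    have h1 := Set.ncard_le_ncard hun hfin
    have h2 := Set.ncard_union_le {c | c ∈ A ∧ c 0 ≠ 0} ({c | c ∈ A ∧ c 0 = 0 ∧ c 3 ≠ 0} ∪ {c | c ∈ A ∧ c 0 = 0 ∧ c 3 = 0})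
    have h3 := Set.ncard_union_le {c | c ∈ A ∧ c 0 = 0 ∧ c 3 ≠ 0} {c | c ∈ A ∧ c 0 = 0 ∧ c 3 = 0}
    have h4 := h1.trans (h2.trans (Nat.add_le_add_left h3 _))
    rw [← Nat.cast_add, ← Nat.cast_add]
    exact Nat.cast_le.mpr h4
  obtain ⟨Q, hQ⟩ : ∃ Q, Q = (4 * p ^ 2) ^ (a + b) := ⟨_, rfl⟩
  have hQ0 : 0 < Q := by rw [hQ]; positivity
  have hQ1 : 1 ≤ Q := by rw [hQ]; exact one_le_pow₀ (by linarith)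
  have hQ2 : (2 : ℝ) ^ a ≤ Q := by
    rw [hQ]
    calc (2 : ℝ) ^ a ≤ 2 ^ (a + b) := pow_le_pow_right₀ (by norm_num) (by omega)
      _ ≤ _ := by gcongr
  have hQ8 : Q ^ 2 = 8 ^ (a + b) := by rw [hQ, ← pow_mul, Nat.mul_comm, pow_mul, hq8]
  have e2 : r2 a b / r1 a b = 2 ^ a := by unfold r2; field_simp
  have e3 : r3 a b ^ 2 / (r1 a b * r2 a b) * (r2 a b * r3 a b / r1 a b ^ 2) = Q ^ 2 := by
    rw [hQ8]
    unfold r3 r2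
    have : (8 : ℝ) ^ (a + b) = (2 ^ a) ^ 3 * (2 ^ b) ^ 3 := by
      rw [← mul_pow, ← pow_add, ← pow_mul, Nat.mul_comm, pow_mul]; norm_num
    rw [this]
    field_simp
  have h3 : ({c | c ∈ A ∧ c 0 = 0 ∧ c 3 = 0}.ncard : ℝ) ≤ 3 ^ 8 * L ^ 10 * Q := by
    have n0 : (0 : ℝ) ≤ ({c | c ∈ A ∧ c 0 = 0 ∧ c 3 = 0}.ncard : ℝ) := Nat.cast_nonneg _
    refine le_of_pow_le_pow_left₀ two_ne_zero (by positivity) ?_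
    rw [sq]
    refine (mul_le_mul k3 k3' n0 (by positivity)).trans (le_of_eq ?_)
    rw [mul_pow, ← e3]; ring
  rw [e2] at k2
  have hL10 : 0 < L ^ 10 := by positivity
  have g1 : 3 ^ 10 * L ^ 10 ≤ 3 ^ 10 * L ^ 10 * Q := le_mul_of_one_le_right (by positivity) hQ1
  have g2 : 3 ^ 9 * L ^ 10 * 2 ^ a ≤ 3 ^ 9 * L ^ 10 * Q := by gcongr
  have g3 : 3 ^ 11 * L ^ 10 * 4 ^ (a + b) * (p ^ 2) ^ (a + b) = 3 ^ 11 * (L ^ 10 * Q) := by rw [hQ, mul_pow]; ring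
  rw [g3]
  have : 0 < L ^ 10 * Q := by positivity
  linarith

/-- the stabilizer of a form contains no nontrivial unipotent of this shape -/
lemma un_free (g : M3) (hg : 0 < g.det) (δ : ℝ) (hδ : δ ≠ -3) (γ : SLZ) (x y : ℤ × ℤ × ℤ)
    (e : act (rz (un x * γ) * g) (hes δ) = act (rz (un y * γ) * g) (hes δ)) : x = y := by
  have hd : ∀ γ : SLZ, 0 < (rz γ * g).det := fun γ => by rw [Matrix.det_mul, rz_det, one_mul]; exact hg
  have hu : IsUnit g.det := hg.ne'.isUnit
  obtain ⟨_, h⟩ := hes_unique _ _ (hd _) (hd _) δ δ hδ e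
  obtain ⟨N, hN⟩ : ∃ N : M3, N = rz γ * g := ⟨_, rfl⟩
  have hNd : N.det ≠ 0 := by rw [hN]; exact (hd γ).ne'
  have key : ∀ σ : M3, rz (un y * γ) * g = rz (un x * γ) * g * σ → σ.trace = 3 := by
    intro σ hσ
    rw [rz_mul, rz_mul, mul_assoc (rz (un y)), mul_assoc (rz (un x)), ← hN, mul_assoc (rz (un x))] at hσ
    obtain ⟨z, hz⟩ : ∃ z, un x * un z = un y := by
      refine ⟨(y.1 - x.1, y.2.1 - x.2.1 - x.2.2 * (y.1 - x.1), y.2.2 - x.2.2), ?_⟩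
      apply Subtype.ext
      show ((un x : SLZ) : MZ) * _ = _
      ext i j
      rw [Matrix.mul_apply, Fin.sum_univ_three]
      fin_cases i <;> fin_cases j <;> simp [un, sl]
    rw [← hz, rz_mul, mul_assoc (rz (un x))] at hσ
    have hxu : IsUnit (rz (un x)).det := by rw [rz_det]; exact isUnit_one
    have hσ' : rz (un z) * N = N * σ := by
      have := congrArg (fun M => (rz (un x))⁻¹ * M) hσ
      simpa only [Matrix.nonsing_inv_mul_cancel_left _ _ hxu] using this
    have hNu : IsUnit N.det := hNd.isUnit
    have : σ = N⁻¹ * (rz (un z) * N) := by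
      rw [hσ', Matrix.nonsing_inv_mul_cancel_left _ _ hNu]
    rw [this, Matrix.trace_mul_comm, Matrix.mul_nonsing_inv_cancel_right _ _ hNu]
    unfold un
    rw [rz_sl, Matrix.trace_fin_three]
    simp; norm_num
  rcases h with h | h | h
  · have e2 := congrArg (fun A => A * g⁻¹) h
    simp only [Matrix.mul_nonsing_inv_cancel_right _ _ hu] at e2
    exact (un_inj (mul_right_cancel (rz_inj e2))).symm
  · exfalso
    have := key _ h
    rw [Matrix.trace_fin_three] at this
    simp [cyc1] at this
  · exfalso
    have := key _ h
    rw [Matrix.trace_fin_three] at this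
    simp [cyc2] at this

/-- form tail -/
theorem form_tail (C ε : ℝ) (hC : 0 < C) (hε : 0 < ε) : ∃ T : ℝ, 0 < T ∧ ∀ T' ≥ T, ∀ t : ℝ, 0 < t →
    {o : Set (Fin 10 → ℤ) | ∃ (c : Fin 10 → ℤ) (g : M3) (δ s : ℝ), o = orbitZ c ∧ StronglyIrred c ∧ 0 < s ∧ g.det = s ^ 3 ∧
      δ ≠ -3 ∧ rc c = act g (hes δ) ∧ g.det * (1 + |δ|) ≤ C * t ∧ ∀ γ : SLZ, T' ^ 2 * s ^ 2 < N2 (rz γ * g)}.Finite ∧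
    ({o : Set (Fin 10 → ℤ) | ∃ (c : Fin 10 → ℤ) (g : M3) (δ s : ℝ), o = orbitZ c ∧ StronglyIrred c ∧ 0 < s ∧ g.det = s ^ 3 ∧
      δ ≠ -3 ∧ rc c = act g (hes δ) ∧ g.det * (1 + |δ|) ≤ C * t ∧ ∀ γ : SLZ, T' ^ 2 * s ^ 2 < N2 (rz γ * g)}.ncard : ℝ)
      ≤ ε * t ^ 10 := by
  obtain ⟨p, hp0, hp1, hp4⟩ := exists_p
  obtain ⟨κ, hκ⟩ := exists_kappa (3 ^ 11 * (79860 * C) ^ 10) p ε hp0 hp1 hε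
  refine ⟨10 * 2 ^ κ, by positivity, fun T' hT' t ht => ?_⟩
  obtain ⟨O, hO⟩ : ∃ O : Set (Set (Fin 10 → ℤ)), O = {o : Set (Fin 10 → ℤ) | ∃ (c : Fin 10 → ℤ) (g : M3) (δ s : ℝ), o = orbitZ c ∧ StronglyIrred c ∧ 0 < s ∧ g.det = s ^ 3 ∧
      δ ≠ -3 ∧ rc c = act g (hes δ) ∧ g.det * (1 + |δ|) ≤ C * t ∧ ∀ γ : SLZ, T' ^ 2 * s ^ 2 < N2 (rz γ * g)} := ⟨_, rfl⟩
  rw [← hO]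
  have hL : 0 < 79860 * (C * t) := by positivity
  have main := tail_abs (O := O) (fun o => o) ?_
    (fun a b => {c : Fin 10 → ℤ | StronglyIrred c ∧ ∀ i, |(c i : ℝ)| ≤ 79860 * (C * t) * mo (rr a b) i})
    (fun a b => (form_box _ p hL hp0 hp4 a b).1) (3 ^ 11 * (79860 * (C * t)) ^ 10) p
    (by positivity) hp0 hp1 (fun a b => (form_box _ p hL hp0 hp4 a b).2) κ ?_
  · refine ⟨main.1, main.2.trans ?_⟩
    calc 3 ^ 11 * (79860 * (C * t)) ^ 10 * p ^ κ / (1 - p) ^ 2 = (3 ^ 11 * (79860 * C) ^ 10 * p ^ κ / (1 - p) ^ 2) * t ^ 10 := by ring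
      _ ≤ _ := by gcongr
  · intro o ho o' ho' hne
    rw [hO] at ho ho'
    obtain ⟨c, _, _, _, h, _⟩ := ho
    obtain ⟨c', _, _, _, h', _⟩ := ho'
    rw [Set.disjoint_left]
    intro u hu hu'
    apply hne
    have hu : u ∈ o := hu
    have hu' : u ∈ o' := hu'
    rw [h] at hu ⊢
    rw [h'] at hu' ⊢
    rw [← orbitZ_of_mem hu, ← orbitZ_of_mem hu']
  · intro o ho
    rw [hO] at ho
    obtain ⟨c, g, δ, s, rfl, hSI, hs, hdet, hδ, hcg, hbd, hbad⟩ := ho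
    have hg : 0 < g.det := by rw [hdet]; positivity
    obtain ⟨γ, a, b, hab, hx⟩ := red_cell g s hs hdet κ (fun γ => by
      refine lt_of_le_of_lt ?_ (hbad γ)
      gcongr)
    classical
    have hrc : ∀ γ : SLZ, rc (act (γ : MZ) c) = act (rz γ * g) (hes δ) := by
      intro γ; rw [rc_act, hcg, ← act_mul]
    refine ⟨a, b, hab, (unF a b).image (fun x => act ((un x * γ : SLZ) : MZ) c), ?_, ?_, ?_⟩
    · intro M hM
      rw [Finset.mem_coe, Finset.mem_image] at hM
      obtain ⟨x, _, rfl⟩ := hM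
      show _ ∈ orbitZ c
      rw [orbitZ_eq]
      exact ⟨_, rfl⟩
    · intro M hM
      rw [Finset.mem_coe, Finset.mem_image] at hM
      obtain ⟨x, hxm, rfl⟩ := hM
      refine ⟨SI_act _ _ hSI, fun i => ?_⟩
      have e : ((act ((un x * γ : SLZ) : MZ) c i : ℤ) : ℝ) = s ^ 3 * act (rz (un x * γ) * (s⁻¹ • g)) (hes δ) i := by
        have h1 := congrFun (hrc (un x * γ)) i
        have h2 : rz (un x * γ) * g = s • (rz (un x * γ) * (s⁻¹ • g)) := by
          rw [Matrix.mul_smul, smul_smul, mul_inv_cancel₀ hs.ne', one_smul]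
        rw [h2, act_scalar] at h1
        exact h1
      rw [e, abs_mul, abs_of_pos (pow_pos hs 3)]
      have hV : ∀ i, |hes δ i| ≤ 1 + |δ| := by
        intro i
        have := abs_nonneg δ
        fin_cases i <;> simp [hes] <;> linarith
      have hb := act_bound (rz (un x * γ) * (s⁻¹ • g)) (hes δ) (1 + |δ|) (fun i => 11 * rr a b i) hV (hx x hxm) i
      have hm : mo (fun i => 11 * rr a b i) i = 1331 * mo (rr a b) i := by
        fin_cases i <;> simp [mo] <;> ring
      rw [hm] at hb
      have hmp : 0 < mo (rr a b) i := by
        apply mo_pos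
        have q1 := r1_pos a b
        have q2 := r2_pos a b
        have q3 := r3_pos a b
        intro i
        fin_cases i
        · exact q1
        · exact q2
        · exact q3
      rw [hdet] at hbd
      calc s ^ 3 * |act (rz (un x * γ) * (s⁻¹ • g)) (hes δ) i| ≤ s ^ 3 * (60 * (1 + |δ|) * (1331 * mo (rr a b) i)) := by gcongr
        _ = 79860 * (s ^ 3 * (1 + |δ|)) * mo (rr a b) i := by ring
        _ ≤ _ := by gcongr
    · rw [Finset.card_image_of_injective, unF_card]
      intro x y hxy
      have hxy : act ((un x * γ : SLZ) : MZ) c = act ((un y * γ : SLZ) : MZ) c := hxy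
      have e := congrArg rc hxy
      rw [hrc, hrc] at e
      exact un_free g hg δ hδ γ x y e

end TC


namespace TC
open Matrix Filter Topology

lemma N2_mul_le (A B : M3) : N2 (A * B) ≤ N2 A * N2 B := by
  have key : ∀ i j, (A * B) i j ^ 2 ≤ rn A i * (B 0 j ^ 2 + B 1 j ^ 2 + B 2 j ^ 2) := by
    intro i j
    rw [Matrix.mul_apply, Fin.sum_univ_three]
    unfold rn
    nlinarith [sq_nonneg (A i 0 * B 1 j - A i 1 * B 0 j), sq_nonneg (A i 0 * B 2 j - A i 2 * B 0 j),
      sq_nonneg (A i 1 * B 2 j - A i 2 * B 1 j)]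
  have hrow : ∀ i, rn (A * B) i ≤ rn A i * N2 B := by
    intro i
    have e : rn A i * N2 B = rn A i * (B 0 0 ^ 2 + B 1 0 ^ 2 + B 2 0 ^ 2) + rn A i * (B 0 1 ^ 2 + B 1 1 ^ 2 + B 2 1 ^ 2)
      + rn A i * (B 0 2 ^ 2 + B 1 2 ^ 2 + B 2 2 ^ 2) := by unfold N2; simp only [rn]; ring
    rw [e]
    show (A * B) i 0 ^ 2 + (A * B) i 1 ^ 2 + (A * B) i 2 ^ 2 ≤ _
    linarith [key i 0, key i 1, key i 2]
  have e : N2 A * N2 B = rn A 0 * N2 B + rn A 1 * N2 B + rn A 2 * N2 B := by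
    rw [← add_mul, ← add_mul]; rfl
  rw [e]
  unfold N2 at hrow ⊢
  linarith [hrow 0, hrow 1, hrow 2]

lemma N2_smul (t : ℝ) (g : M3) : N2 (t • g) = t ^ 2 * N2 g := by
  simp only [N2, rn, Matrix.smul_apply, smul_eq_mul]; ring

lemma N2_continuous : Continuous N2 := by
  unfold N2 rn
  fun_prop

/-- real cube root -/
noncomputable def cb (x : ℝ) : ℝ := x ^ ((1 : ℝ) / 3)

lemma cb_pos {x : ℝ} (hx : 0 < x) : 0 < cb x := Real.rpow_pos_of_pos hx _
lemma cb_cube {x : ℝ} (hx : 0 ≤ x) : cb x ^ 3 = x := by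
  unfold cb; rw [← Real.rpow_natCast, ← Real.rpow_mul hx]; norm_num
lemma cb_of_cube {x : ℝ} (hx : 0 ≤ x) : cb (x ^ 3) = x := by
  unfold cb; rw [← Real.rpow_natCast, ← Real.rpow_mul hx]; norm_num
lemma cb_mul {x y : ℝ} (hx : 0 ≤ x) (hy : 0 ≤ y) : cb (x * y) = cb x * cb y := by
  unfold cb; exact Real.mul_rpow hx hy
lemma cb_continuous : Continuous cb := by
  unfold cb
  exact continuous_id.rpow_const (fun _ => Or.inr (by norm_num))

/-- normalized squared norm -/
noncomputable def nn (g : M3) : ℝ := N2 g / cb g.det ^ 2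

/-- bump function -/
noncomputable def et (T : ℝ) (g : M3) : ℝ := if 0 < g.det then max 0 (2 - nn g / T ^ 2) else 0

lemma et_nonneg (T : ℝ) (g : M3) : 0 ≤ et T g := by
  unfold et; split_ifs
  · exact le_max_left _ _
  · exact le_refl _

lemma nn_nonneg (g : M3) : 0 ≤ nn g := div_nonneg (N2_nonneg g) (sq_nonneg _)

lemma nn_smul (t : ℝ) (ht : 0 < t) (g : M3) (hg : 0 < g.det) : nn (t • g) = nn g := by
  unfold nn
  rw [N2_smul, Matrix.det_smul, Fintype.card_fin, cb_mul (by positivity) hg.le, cb_of_cube ht.le]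
  have := cb_pos hg
  field_simp

lemma et_smul (T t : ℝ) (ht : 0 < t) (g : M3) : et T (t • g) = et T g := by
  unfold et
  have e : (t • g).det = t ^ 3 * g.det := by rw [Matrix.det_smul, Fintype.card_fin]
  by_cases hg : 0 < g.det
  · rw [if_pos hg, if_pos (by rw [e]; positivity), nn_smul t ht g hg]
  · rw [if_neg hg, if_neg]
    rw [e]; push Not at hg ⊢
    exact mul_nonpos_of_nonneg_of_nonpos (by positivity) hg

lemma N2_cyc (g : M3) : N2 (g * cyc1) = N2 g ∧ N2 (g * cyc2) = N2 g := by
  constructor <;>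
  · simp only [N2, rn, cyc1, cyc2, Matrix.mul_apply, Fin.sum_univ_three]
    simp
    ring

lemma et_cyc (T : ℝ) (g : M3) : et T (g * cyc1) = et T g ∧ et T (g * cyc2) = et T g := by
  unfold et nn
  rw [(N2_cyc g).1, (N2_cyc g).2, Matrix.det_mul, Matrix.det_mul, det_cyc1, det_cyc2, mul_one]
  exact ⟨rfl, rfl⟩

lemma et_ne {T : ℝ} (hT : 0 < T) {g : M3} (h : et T g ≠ 0) : 0 < g.det ∧ N2 g ≤ 2 * T ^ 2 * cb g.det ^ 2 := by
  unfold et at h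
  by_cases hg : 0 < g.det
  · refine ⟨hg, ?_⟩
    rw [if_pos hg] at h
    have h2 : 0 < 2 - nn g / T ^ 2 := by
      by_contra hcon
      exact h (max_eq_left (not_lt.mp hcon))
    have h3 : nn g < 2 * T ^ 2 := by
      have : nn g / T ^ 2 < 2 := by linarith
      rwa [div_lt_iff₀ (by positivity)] at this
    unfold nn at h3
    have := cb_pos hg
    rw [div_lt_iff₀ (by positivity)] at h3
    exact h3.le
  · rw [if_neg hg] at h; exact absurd rfl h

lemma et_ge {T : ℝ} (hT : 0 < T) {g : M3} (hg : 0 < g.det) (h : N2 g ≤ T ^ 2 * cb g.det ^ 2) : 1 ≤ et T g := by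
  unfold et
  rw [if_pos hg]
  apply le_max_of_le_right
  have := cb_pos hg
  have : nn g ≤ T ^ 2 := by unfold nn; rw [div_le_iff₀ (by positivity)]; exact h
  have : nn g / T ^ 2 ≤ 1 := by rw [div_le_one (by positivity)]; exact this
  linarith

lemma rz_mul_det (γ : SLZ) (g : M3) : (rz γ * g).det = g.det := by rw [Matrix.det_mul, rz_det, one_mul]

lemma det_continuous : Continuous (fun g : M3 => g.det) := Continuous.matrix_det continuous_id

/-- local finiteness -/
lemma et_locfin (T : ℝ) (hT : 0 < T) (g0 : M3) (h0 : 0 < g0.det) :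
    ∃ F : Finset SLZ, ∀ᶠ g in 𝓝 g0, 0 < g.det ∧ ∀ γ ∉ F, et T (rz γ * g) = 0 := by
  have hf := finite_N2 g0 h0.ne' ((2 * T ^ 2 * (cb g0.det ^ 2 + 1)) * 4)
  refine ⟨hf.toFinset, ?_⟩
  have e1 : ∀ᶠ g : M3 in 𝓝 g0, 0 < g.det := det_continuous.continuousAt.eventually_const_lt h0
  have e2 : ∀ᶠ g : M3 in 𝓝 g0, cb g.det ^ 2 < cb g0.det ^ 2 + 1 :=
    (((cb_continuous.comp det_continuous).pow 2).continuousAt (x := g0)).eventually_lt_const (by show cb g0.det ^ 2 < _; linarith)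
  have c3 : Continuous (fun g : M3 => N2 (g.adjugate * g0) - 4 * g.det ^ 2) :=
    (N2_continuous.comp ((Continuous.matrix_adjugate continuous_id).matrix_mul continuous_const)).sub
      (continuous_const.mul (det_continuous.pow 2))
  have e3 : ∀ᶠ g : M3 in 𝓝 g0, N2 (g.adjugate * g0) - 4 * g.det ^ 2 < 0 := by
    refine c3.continuousAt.eventually_lt_const ?_
    show N2 (g0.adjugate * g0) - 4 * g0.det ^ 2 < 0
    have hn1 : N2 (1 : M3) = 3 := by simp [N2, rn]; norm_num
    rw [Matrix.adjugate_mul, N2_smul, hn1]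
    nlinarith
  filter_upwards [e1, e2, e3] with g h1 h2 h3
  refine ⟨h1, fun γ hγ => ?_⟩
  by_contra hne
  apply hγ
  rw [Set.Finite.mem_toFinset]
  obtain ⟨_, hN⟩ := et_ne hT hne
  rw [rz_mul_det] at hN
  have eq : g.det • (rz γ * g0) = (rz γ * g) * (g.adjugate * g0) := by
    rw [Matrix.mul_assoc, ← Matrix.mul_assoc g, Matrix.mul_adjugate, Matrix.smul_mul, Matrix.one_mul, Matrix.mul_smul]
  have h4 := N2_mul_le (rz γ * g) (g.adjugate * g0)
  rw [← eq, N2_smul] at h4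
  have h5 : g.det ^ 2 * N2 (rz γ * g0) ≤ g.det ^ 2 * (N2 (rz γ * g) * 4) := by
    refine h4.trans ?_
    have := N2_nonneg (rz γ * g)
    nlinarith
  have h6 : N2 (rz γ * g0) ≤ N2 (rz γ * g) * 4 := le_of_mul_le_mul_left h5 (by positivity)
  show N2 (rz γ * g0) ≤ _
  refine h6.trans ?_
  have : 2 * T ^ 2 * cb g.det ^ 2 ≤ 2 * T ^ 2 * (cb g0.det ^ 2 + 1) := by gcongr
  linarith

lemma et_support (T : ℝ) (hT : 0 < T) (g : M3) : (Function.support fun γ : SLZ => et T (rz γ * g)).Finite := by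
  by_cases hg : 0 < g.det
  · obtain ⟨F, hF⟩ := et_locfin T hT g hg
    have := hF.self_of_nhds.2
    apply F.finite_toSet.subset
    intro γ hγ
    by_contra h
    exact hγ (this γ h)
  · have : (Function.support fun γ : SLZ => et T (rz γ * g)) = ∅ := by
      ext γ
      simp only [Function.mem_support, Set.mem_empty_iff_false, iff_false, not_not]
      unfold et
      rw [rz_mul_det, if_neg hg]
    rw [this]; exact Set.finite_empty

lemma et_summable (T : ℝ) (hT : 0 < T) (g : M3) : Summable fun γ : SLZ => et T (rz γ * g) :=
  summable_of_hasFiniteSupport (et_support T hT g)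

noncomputable def WW (T : ℝ) (g : M3) : ℝ := ∑' γ : SLZ, et T (rz γ * g)

/-- normalized weight -/
noncomputable def ww (T : ℝ) (g : M3) : ℝ := et T g / max 1 (WW T g)

lemma WW_rz (T : ℝ) (γ : SLZ) (g : M3) : WW T (rz γ * g) = WW T g := by
  unfold WW
  rw [← (Equiv.mulRight γ).tsum_eq (fun γ' : SLZ => et T (rz γ' * g))]
  congr 1
  funext γ'
  show _ = et T (rz (γ' * γ) * g)
  rw [rz_mul, Matrix.mul_assoc]

lemma WW_smul (T t : ℝ) (ht : 0 < t) (g : M3) : WW T (t • g) = WW T g := by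
  unfold WW
  congr 1
  funext γ
  rw [Matrix.mul_smul, et_smul T t ht]

lemma WW_cyc (T : ℝ) (g : M3) : WW T (g * cyc1) = WW T g ∧ WW T (g * cyc2) = WW T g := by
  unfold WW
  constructor
  · congr 1; funext γ; rw [← Matrix.mul_assoc, (et_cyc T _).1]
  · congr 1; funext γ; rw [← Matrix.mul_assoc, (et_cyc T _).2]

lemma et_le_WW (T : ℝ) (hT : 0 < T) (g : M3) : et T g ≤ WW T g := by
  have := (et_summable T hT g).le_tsum 1 (fun γ _ => et_nonneg T _)
  rwa [rz_one, Matrix.one_mul] at this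

lemma ww_nonneg (T : ℝ) (g : M3) : 0 ≤ ww T g := div_nonneg (et_nonneg T g) (le_max_of_le_left zero_le_one)

lemma ww_le_one (T : ℝ) (hT : 0 < T) (g : M3) : ww T g ≤ 1 := by
  unfold ww
  rw [div_le_one (lt_max_of_lt_left one_pos)]
  exact (et_le_WW T hT g).trans (le_max_right _ _)

lemma ww_smul (T t : ℝ) (ht : 0 < t) (g : M3) : ww T (t • g) = ww T g := by
  unfold ww; rw [et_smul T t ht, WW_smul T t ht]

lemma ww_cyc (T : ℝ) (g : M3) : ww T (g * cyc1) = ww T g ∧ ww T (g * cyc2) = ww T g := by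
  unfold ww; rw [(et_cyc T g).1, (et_cyc T g).2, (WW_cyc T g).1, (WW_cyc T g).2]; exact ⟨rfl, rfl⟩

lemma ww_ne {T : ℝ} (hT : 0 < T) {g : M3} (h : ww T g ≠ 0) : 0 < g.det ∧ N2 g ≤ 2 * T ^ 2 * cb g.det ^ 2 := by
  apply et_ne hT
  intro h0
  apply h
  unfold ww; rw [h0, zero_div]

lemma ww_eq (T : ℝ) (g : M3) (γ : SLZ) : ww T (rz γ * g) = et T (rz γ * g) / max 1 (WW T g) := by
  unfold ww; rw [WW_rz]

lemma ww_support (T : ℝ) (hT : 0 < T) (g : M3) : (Function.support fun γ : SLZ => ww T (rz γ * g)).Finite := by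
  apply (et_support T hT g).subset
  intro γ hγ h0
  apply hγ
  show ww T (rz γ * g) = 0
  have h0 : et T (rz γ * g) = 0 := h0
  rw [ww_eq, h0, zero_div]

lemma ww_summable (T : ℝ) (hT : 0 < T) (g : M3) : Summable fun γ : SLZ => ww T (rz γ * g) :=
  summable_of_hasFiniteSupport (ww_support T hT g)

noncomputable def TH (T : ℝ) (g : M3) : ℝ := ∑' γ : SLZ, ww T (rz γ * g)

lemma TH_eq (T : ℝ) (g : M3) : TH T g = WW T g / max 1 (WW T g) := by
  unfold TH
  simp_rw [ww_eq]
  rw [tsum_div_const]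
  rfl

lemma TH_le_one (T : ℝ) (g : M3) : TH T g ≤ 1 := by
  rw [TH_eq, div_le_one (lt_max_of_lt_left one_pos)]
  exact le_max_right _ _

lemma TH_nonneg (T : ℝ) (g : M3) : 0 ≤ TH T g := tsum_nonneg fun _ => ww_nonneg T _

lemma TH_eq_one (T : ℝ) (hT : 0 < T) (g : M3) (hg : 0 < g.det) (γ : SLZ) (h : N2 (rz γ * g) ≤ T ^ 2 * cb g.det ^ 2) :
    TH T g = 1 := by
  have h1 : 1 ≤ et T (rz γ * g) := et_ge hT (by rw [rz_mul_det]; exact hg) (by rw [rz_mul_det]; exact h)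
  have h2 := h1.trans (et_le_WW T hT (rz γ * g))
  rw [WW_rz] at h2
  rw [TH_eq, max_eq_right h2, div_self (by linarith)]

lemma et_cont (T : ℝ) (g : M3) (hg : 0 < g.det) : ContinuousAt (et T) g := by
  have h1 : ContinuousAt (fun g : M3 => max 0 (2 - nn g / T ^ 2)) g := by
    refine continuousAt_const.max (continuousAt_const.sub (ContinuousAt.div_const ?_ _))
    refine N2_continuous.continuousAt.div ((cb_continuous.comp det_continuous).pow 2).continuousAt ?_
    exact (pow_pos (cb_pos hg) 2).ne'
  refine h1.congr ?_
  filter_upwards [det_continuous.continuousAt.eventually_const_lt hg] with g' hg'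
  unfold et; rw [if_pos hg']

lemma ww_cont (T : ℝ) (hT : 0 < T) (g : M3) (hg : 0 < g.det) : ContinuousAt (ww T) g := by
  refine (et_cont T g hg).div (continuousAt_const.max ?_) (lt_max_of_lt_left one_pos).ne'
  obtain ⟨F, hF⟩ := et_locfin T hT g hg
  have h1 : ContinuousAt (fun g' : M3 => ∑ γ ∈ F, et T (rz γ * g')) g := by
    refine tendsto_finsetSum F fun γ _ => ?_
    have hc : ContinuousAt (fun g' : M3 => rz γ * g') g := (continuous_const.matrix_mul continuous_id).continuousAt
    exact ContinuousAt.comp (f := fun g' : M3 => rz γ * g') (et_cont T (rz γ * g) (by rw [rz_mul_det]; exact hg)) hc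
  refine h1.congr ?_
  filter_upwards [hF] with g' hg'
  unfold WW
  rw [tsum_eq_sum hg'.2]

end TC


namespace TC
open Matrix Filter Topology MeasureTheory

/-- the zero set of a nonzero polynomial is a null set -/
lemma poly_null : ∀ (n : ℕ) (p : MvPolynomial (Fin n) ℝ), p ≠ 0 → ∀ᵐ x : Fin n → ℝ, MvPolynomial.eval x p ≠ 0 := by
  intro n
  induction n with
  | zero =>
    intro p hp
    obtain ⟨r, rfl⟩ := MvPolynomial.C_surjective (R := ℝ) (Fin 0) p
    refine ae_of_all _ fun x => ?_
    rw [MvPolynomial.eval_C]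
    rintro rfl
    exact hp (map_zero _)
  | succ n ih =>
    intro p hp
    let f := MvPolynomial.finSuccEquiv ℝ n p
    have hf : f ≠ 0 := by
      intro h
      exact hp ((MvPolynomial.finSuccEquiv ℝ n).injective (by rw [map_zero]; exact h))
    have hlc : f.leadingCoeff ≠ 0 := Polynomial.leadingCoeff_ne_zero.mpr hf
    have h1 := ih _ hlc
    have hmp := (volume_preserving_piFinSuccAbove (fun _ : Fin (n + 1) => ℝ) 0)
    have hmeas : MeasurableSet {z : (Fin n → ℝ) × ℝ | ¬ MvPolynomial.eval (Fin.cons z.2 z.1 : Fin (n + 1) → ℝ) p ≠ 0} := by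
      have hc : Continuous fun z : (Fin n → ℝ) × ℝ => MvPolynomial.eval (Fin.cons z.2 z.1 : Fin (n + 1) → ℝ) p := by
        refine (MvPolynomial.continuous_eval p).comp (continuous_pi fun i => ?_)
        refine Fin.cases ?_ (fun j => ?_) i
        · exact continuous_snd
        · exact (continuous_apply j).comp continuous_fst
      have : {z : (Fin n → ℝ) × ℝ | ¬ MvPolynomial.eval (Fin.cons z.2 z.1 : Fin (n + 1) → ℝ) p ≠ 0} =
        (fun z : (Fin n → ℝ) × ℝ => MvPolynomial.eval (Fin.cons z.2 z.1 : Fin (n + 1) → ℝ) p) ⁻¹' {0} := by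
        ext z; simp
      rw [this]
      exact (isClosed_singleton.preimage hc).measurableSet
    have h2 : ∀ᵐ z : (Fin n → ℝ) × ℝ ∂(volume.prod volume), MvPolynomial.eval (Fin.cons z.2 z.1 : Fin (n + 1) → ℝ) p ≠ 0 := by
      rw [ae_iff, Measure.measure_prod_null hmeas]
      filter_upwards [h1] with x hx
      have hfx : f.map (MvPolynomial.eval x) ≠ 0 := by
        intro h
        apply hx
        have := congrArg (fun q => Polynomial.coeff q f.natDegree) h
        simpa [Polynomial.coeff_map] using this
      have : (Prod.mk x ⁻¹' {z : (Fin n → ℝ) × ℝ | ¬ MvPolynomial.eval (Fin.cons z.2 z.1 : Fin (n + 1) → ℝ) p ≠ 0}) ⊆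
          {y | (f.map (MvPolynomial.eval x)).IsRoot y} := by
        intro y hy
        have hy : ¬ MvPolynomial.eval (Fin.cons y x : Fin (n + 1) → ℝ) p ≠ 0 := hy
        push Not at hy
        rw [MvPolynomial.eval_eq_eval_mv_eval'] at hy
        exact hy
      exact measure_mono_null this (Set.Finite.measure_zero (Polynomial.finite_setOfPred_isRoot hfx) _)
    have h3 := (Measure.measurePreserving_swap (μ := (volume : Measure ℝ)) (ν := (volume : Measure (Fin n → ℝ)))).quasiMeasurePreserving.ae h2
    have h4 := hmp.quasiMeasurePreserving.ae h3
    filter_upwards [h4] with x hx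
    convert hx using 3
    exact (Fin.cons_self_tail x).symm

lemma poly_ae {n : ℕ} (f : (Fin n → ℝ) → ℝ) (p : MvPolynomial (Fin n) ℝ) (hf : ∀ x, MvPolynomial.eval x p = f x)
    (x0 : Fin n → ℝ) (h0 : f x0 ≠ 0) : ∀ᵐ x : Fin n → ℝ, f x ≠ 0 := by
  have hp : p ≠ 0 := by
    rintro rfl
    apply h0
    rw [← hf, map_zero]
  filter_upwards [poly_null n p hp] with x hx
  rwa [← hf]

/-- a vector of length nine as a matrix -/
def m9 {R : Type*} (y : Fin 9 → R) : Matrix (Fin 3) (Fin 3) R := !![y 0, y 1, y 2; y 3, y 4, y 5; y 6, y 7, y 8]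

lemma m9_continuous : Continuous (m9 : (Fin 9 → ℝ) → M3) := by
  refine continuous_matrix fun i j => ?_
  fin_cases i <;> fin_cases j <;> exact continuous_apply _

lemma m9_smul (t : ℝ) (y : Fin 9 → ℝ) : m9 (t • y) = t • m9 y := by
  ext i j; fin_cases i <;> fin_cases j <;> rfl

def m9E : (Fin 9 → ℤ) ≃ MZ where
  toFun := m9
  invFun M := ![M 0 0, M 0 1, M 0 2, M 1 0, M 1 1, M 1 2, M 2 0, M 2 1, M 2 2]
  left_inv y := by funext i; fin_cases i <;> rfl
  right_inv M := by ext i j; fin_cases i <;> fin_cases j <;> rfl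

lemma m9_entry (y : Fin 9 → ℝ) {R : ℝ} (h : ∀ i j, |m9 y i j| ≤ R) (k : Fin 9) : |y k| ≤ R := by
  fin_cases k
  · exact h 0 0
  · exact h 0 1
  · exact h 0 2
  · exact h 1 0
  · exact h 1 1
  · exact h 1 2
  · exact h 2 0
  · exact h 2 1
  · exact h 2 2

lemma m9_det (y : Fin 9 → ℝ) : (m9 y).det = y 0 * y 4 * y 8 - y 0 * y 5 * y 7 - y 1 * y 3 * y 8 + y 1 * y 5 * y 6
    + y 2 * y 3 * y 7 - y 2 * y 4 * y 6 := by
  rw [Matrix.det_fin_three]; rfl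

lemma det_ae (c : ℝ) : ∀ᵐ y : Fin 9 → ℝ, (m9 y).det ≠ c := by
  have h := poly_ae (n := 9) (fun y => (m9 y).det - c)
    (.X 0 * .X 4 * .X 8 - .X 0 * .X 5 * .X 7 - .X 1 * .X 3 * .X 8 + .X 1 * .X 5 * .X 6 + .X 2 * .X 3 * .X 7 - .X 2 * .X 4 * .X 6 - .C c)
    (fun y => by rw [m9_det]; simp)
  by_cases hc : c = 0
  · filter_upwards [h ![1, 0, 0, 0, 1, 0, 0, 0, 1] (by rw [m9_det, hc]; simp)] with y hy
    exact sub_ne_zero.mp hy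
  · filter_upwards [h 0 (by rw [m9_det]; simpa using hc)] with y hy
    exact sub_ne_zero.mp hy

/-- test function on matrices -/
noncomputable def psM (T : ℝ) (y : Fin 9 → ℝ) : ℝ := if (m9 y).det < 1 then ww T (m9 y) * (m9 y).det ^ 7 else 0

lemma psM_tame (T : ℝ) (hT : 0 < T) : Tame (psM T) 1 (2 * T) := by
  constructor
  · intro y
    unfold psM
    split_ifs with h
    · by_cases h0 : ww T (m9 y) = 0
      · rw [h0]; simp
      · obtain ⟨hd, _⟩ := ww_ne hT h0
        rw [abs_of_nonneg (mul_nonneg (ww_nonneg T _) (by positivity))]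
        have h1 := ww_le_one T hT (m9 y)
        have h2 : (m9 y).det ^ 7 ≤ 1 := pow_le_one₀ hd.le h.le
        exact mul_le_one₀ h1 (by positivity) h2
    · simp
  · intro y hy
    unfold psM at hy
    split_ifs at hy with h
    · have h0 : ww T (m9 y) ≠ 0 := left_ne_zero_of_mul hy
      obtain ⟨hd, hN⟩ := ww_ne hT h0
      apply m9_entry
      intro i j
      apply N2_entry _ i j _ (by positivity)
      have h3 : cb (m9 y).det ≤ 1 := by
        unfold cb; exact Real.rpow_le_one hd.le h.le (by norm_num)
      have h4 : cb (m9 y).det ^ 2 ≤ 1 := pow_le_one₀ (cb_pos hd).le h3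
      nlinarith [sq_nonneg T]
    · exact absurd rfl hy

lemma psM_cont (T : ℝ) (hT : 0 < T) : ∀ᵐ y, ContinuousAt (psM T) y := by
  filter_upwards [det_ae 0, det_ae 1] with y h0 h1
  have hcd : Continuous fun y : Fin 9 → ℝ => (m9 y).det := det_continuous.comp m9_continuous
  rcases lt_or_gt_of_ne h0 with h | h
  · refine (continuousAt_const (y := (0 : ℝ))).congr ?_
    filter_upwards [hcd.continuousAt.eventually_lt_const h] with y' hy'
    symm
    by_contra hne
    have : ww T (m9 y') ≠ 0 := by
      intro h'; apply hne; unfold psM; rw [h', zero_mul, ite_self]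
    exact absurd (ww_ne hT this).1 (not_lt.mpr (le_of_lt hy'))
  · rcases lt_or_gt_of_ne h1 with h' | h'
    · have hw : ContinuousAt (fun y => ww T (m9 y) * (m9 y).det ^ 7) y :=
        (ContinuousAt.comp (f := m9) (ww_cont T hT _ h) m9_continuous.continuousAt).mul (hcd.pow 7).continuousAt
      refine hw.congr ?_
      filter_upwards [hcd.continuousAt.eventually_lt_const h'] with y' hy'
      unfold psM; rw [if_pos hy']
    · refine (continuousAt_const (y := (0 : ℝ))).congr ?_
      filter_upwards [hcd.continuousAt.eventually_const_lt h'] with y' hy'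
      unfold psM; rw [if_neg (not_lt.mpr (le_of_lt hy'))]

noncomputable def mu7 (T : ℝ) : ℝ := ∫ y, psM T y

end TC


namespace TC
open Matrix Filter Topology MeasureTheory

def rM (M : MZ) : M3 := M.map (Int.castRingHom ℝ)

lemma rM_det (M : MZ) : (rM M).det = (M.det : ℝ) := (RingHom.map_det (Int.castRingHom ℝ) M).symm

lemma rM_mul (γ : SLZ) (M : MZ) : rM ((γ : MZ) * M) = rz γ * rM M := by
  unfold rM rz; rw [← Matrix.map_mul]

/-- the summand on integral matrices -/
noncomputable def FM (T t : ℝ) (M : MZ) : ℝ := if (M.det : ℝ) < t ^ 3 then ww T (rM M) * ((M.det : ℝ) / t ^ 3) ^ 7 else 0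

lemma psM_scale (T t : ℝ) (ht : 0 < t) (c : Fin 9 → ℤ) : psM T (fun i => (c i : ℝ) / t) = FM T t (m9E c) := by
  have e : m9 (fun i => (c i : ℝ) / t) = t⁻¹ • rM (m9E c) := by
    ext i j
    fin_cases i <;> fin_cases j <;> exact div_eq_inv_mul _ _
  have ed : (m9 (fun i => (c i : ℝ) / t)).det = ((m9E c).det : ℝ) / t ^ 3 := by
    rw [e, Matrix.det_smul, Fintype.card_fin, rM_det, inv_pow, ← div_eq_inv_mul]
  unfold psM FM
  rw [ed, e, ww_smul T _ (inv_pos.mpr ht)]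
  simp only [div_lt_one (pow_pos ht 3)]

lemma FM_sum (T t : ℝ) (hT : 0 < T) (ht : 0 < t) :
    ∑' c : Fin 9 → ℤ, psM T (fun i => (c i : ℝ) / t) =
    (∑' h : HN, if ((h : MZ).det : ℝ) < t ^ 3 then TH T (rM h) * ((h : MZ).det : ℝ) ^ 7 else 0) / t ^ 21 := by
  have hfin := (psM_tame T hT).finite t ht
  have hs : Summable fun c : Fin 9 → ℤ => psM T (fun i => (c i : ℝ) / t) := summable_of_hasFiniteSupport hfin
  have e1 : (fun c : Fin 9 → ℤ => psM T (fun i => (c i : ℝ) / t)) = (FM T t) ∘ m9E := by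
    funext c; exact psM_scale T t ht c
  rw [e1] at hs ⊢
  have hs2 : Summable (FM T t) := (m9E.summable_iff).mp hs
  have e2 : ∑' c, (FM T t ∘ m9E) c = ∑' M, FM T t M := m9E.tsum_eq (FM T t)
  have e3 : ∑' M : {M : MZ // 0 < M.det}, FM T t M = ∑' M, FM T t M := by
    apply tsum_subtype_eq_of_support_subset (s := {M : MZ | 0 < M.det})
    intro M hM
    have : ww T (rM M) ≠ 0 := by
      intro h0; apply hM; unfold FM; rw [h0, zero_mul, ite_self]
    have := (ww_ne hT this).1
    rw [rM_det] at this
    exact_mod_cast this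
  have hs3 : Summable fun M : {M : MZ // 0 < M.det} => FM T t M := hs2.subtype _
  obtain ⟨f, hf⟩ : ∃ f : {M : MZ // 0 < M.det} → ℝ, f = (fun M : {M : MZ // 0 < M.det} => FM T t M.1) := ⟨_, rfl⟩
  rw [← hf] at hs3
  have hs4 : Summable (f ∘ hnEquiv) := hnEquiv.summable_iff.mpr hs3
  obtain ⟨k, hk⟩ : ∃ k : SLZ × HN → ℝ, k = f ∘ hnEquiv := ⟨_, rfl⟩
  rw [← hk] at hs4
  have hs5 : Summable (k ∘ Equiv.prodComm HN SLZ) := (Equiv.prodComm HN SLZ).summable_iff.mpr hs4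
  have e4 : ∑' p : HN × SLZ, (k ∘ Equiv.prodComm HN SLZ) p = ∑' M : {M : MZ // 0 < M.det}, f M := by
    rw [← hnEquiv.tsum_eq f]
    have := (Equiv.prodComm HN SLZ).tsum_eq k
    rw [hk] at this ⊢
    exact this
  have e5 : ∀ (γ : SLZ) (h : HN), (k ∘ Equiv.prodComm HN SLZ) (h, γ) = FM T t ((γ : MZ) * (h : MZ)) := by
    intro γ h
    show k (γ, h) = _
    rw [hk, hf]
    show FM T t (hnEquiv (γ, h) : MZ) = _
    rw [hnEquiv_val]
  have e6 : ∑' M : {M : MZ // 0 < M.det}, f M = ∑' M : {M : MZ // 0 < M.det}, FM T t M := by rw [hf]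
  rw [e2, ← e3, ← e6, ← e4, hs5.tsum_prod, ← tsum_div_const]
  simp only [e5]
  congr 1
  funext h
  have hd : ∀ γ : SLZ, ((γ : MZ) * (h : MZ)).det = (h : MZ).det := fun γ => by
    rw [Matrix.det_mul, γ.2, one_mul]
  simp only [FM, hd, rM_mul]
  split_ifs with hlt
  · rw [tsum_mul_right]
    unfold TH
    rw [div_pow, ← pow_mul]; ring
  · simp

theorem mu7_lim (ε : ℝ) (hε : 0 < ε) : ∃ T0 : ℝ, 0 < T0 ∧ ∀ T ≥ T0, |mu7 T - zeta2 * zeta3 / 10| ≤ ε := by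
  obtain ⟨T0, hT0, htail⟩ := matrix_tail ε hε
  refine ⟨T0, hT0, fun T hT => ?_⟩
  have hTpos : 0 < T := hT0.trans_le hT
  have h1 : Tendsto (fun t : ℝ => (∑' c : Fin 9 → ℤ, psM T (fun i => (c i : ℝ) / t)) / t ^ 9) atTop (𝓝 (mu7 T)) := by
    have h := riemann (m := 1) (Set.univ : Set (Fin 9 → ZMod 1)) (psM_tame T hTpos) (psM_cont T hTpos)
    have hn : (Set.univ : Set (Fin 9 → ZMod 1)).ncard = 1 := by
      rw [Set.ncard_univ]; simp
    rw [hn] at h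
    simpa [mu7] using h
  have h2 : Tendsto (fun t : ℝ => (∑' h : HN, if ((h : MZ).det : ℝ) < t ^ 3 then ((h : MZ).det : ℝ) ^ 7 else 0) / (t ^ 3) ^ 10)
      atTop (𝓝 (zeta2 * zeta3 / 10)) := HN_count.comp (tendsto_pow_atTop (by norm_num))
  have h3 := ((h1.sub h2).abs)
  refine le_of_tendsto h3 ?_
  filter_upwards [eventually_gt_atTop 0] with t ht
  rw [FM_sum T t hTpos ht]
  have hf := HN_finite (t ^ 3)
  obtain ⟨F, hF⟩ : ∃ F : Finset HN, F = hf.toFinset := ⟨_, rfl⟩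
  have memF : ∀ h : HN, h ∈ F ↔ ((h : MZ).det : ℝ) < t ^ 3 := fun h => by rw [hF, Set.Finite.mem_toFinset]; rfl
  have s1 : (∑' h : HN, if ((h : MZ).det : ℝ) < t ^ 3 then TH T (rM h) * ((h : MZ).det : ℝ) ^ 7 else 0)
      = ∑ h ∈ F, TH T (rM h) * ((h : MZ).det : ℝ) ^ 7 := by
    rw [tsum_eq_sum (s := F) (fun h hh => by rw [if_neg]; rwa [← memF])]
    exact Finset.sum_congr rfl fun h hh => by rw [if_pos]; rwa [← memF]
  have s2 : (∑' h : HN, if ((h : MZ).det : ℝ) < t ^ 3 then ((h : MZ).det : ℝ) ^ 7 else 0)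
      = ∑ h ∈ F, ((h : MZ).det : ℝ) ^ 7 := by
    rw [tsum_eq_sum (s := F) (fun h hh => by rw [if_neg]; rwa [← memF])]
    exact Finset.sum_congr rfl fun h hh => by rw [if_pos]; rwa [← memF]
  rw [s1, s2]
  have hpos : ∀ h : HN, (0 : ℝ) < ((h : MZ).det : ℝ) := fun h => by exact_mod_cast HN_det_pos h.2
  have hd : ∑ h ∈ F, ((h : MZ).det : ℝ) ^ 7 - ∑ h ∈ F, TH T (rM h) * ((h : MZ).det : ℝ) ^ 7 =
      ∑ h ∈ F, (1 - TH T (rM h)) * ((h : MZ).det : ℝ) ^ 7 := by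
    rw [← Finset.sum_sub_distrib]
    exact Finset.sum_congr rfl fun h _ => by ring
  have hd0 : 0 ≤ ∑ h ∈ F, (1 - TH T (rM h)) * ((h : MZ).det : ℝ) ^ 7 :=
    Finset.sum_nonneg fun h _ => mul_nonneg (by linarith [TH_le_one T (rM h)]) (pow_nonneg (hpos h).le _)
  classical
  have hd1 : ∑ h ∈ F, (1 - TH T (rM h)) * ((h : MZ).det : ℝ) ^ 7 ≤ ε * t ^ 9 * (t ^ 3) ^ 7 := by
    have hb := htail T hT t ht
    have hG : {h : HN | ((h : MZ).det : ℝ) < t ^ 3 ∧ ∀ s : ℝ, 0 < s → ((h : MZ).det : ℝ) = s ^ 3 →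
      ∀ γ : SLZ, T ^ 2 * s ^ 2 < N2 (rz γ * (h : MZ).map (Int.castRingHom ℝ))}.Finite := hf.subset fun h hh => hh.1
    rw [Set.ncard_eq_toFinset_card _ hG] at hb
    obtain ⟨G, hGe⟩ : ∃ G, G = hG.toFinset := ⟨_, rfl⟩
    rw [← hGe] at hb
    have hGF : G ⊆ F := by
      intro h hh
      rw [hGe, Set.Finite.mem_toFinset] at hh
      rw [memF]; exact hh.1
    have hz : ∀ h ∈ F, h ∉ G → (1 - TH T (rM h)) * ((h : MZ).det : ℝ) ^ 7 = 0 := by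
      intro h hh hn
      rw [hGe, Set.Finite.mem_toFinset] at hn
      have hlt := (memF h).mp hh
      have : ∃ s : ℝ, 0 < s ∧ ((h : MZ).det : ℝ) = s ^ 3 ∧ ∃ γ : SLZ, N2 (rz γ * rM h) ≤ T ^ 2 * s ^ 2 := by
        by_contra hcon
        push Not at hcon
        exact hn ⟨hlt, hcon⟩
      obtain ⟨s, hs, hs3, γ, hγ⟩ := this
      have hr : (rM (h : MZ)).det = s ^ 3 := by rw [rM_det, hs3]
      rw [TH_eq_one T hTpos (rM h) (by rw [hr]; positivity) γ (by rw [hr, cb_of_cube hs.le]; exact hγ)]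
      ring
    rw [← Finset.sum_subset hGF hz]
    calc ∑ h ∈ G, (1 - TH T (rM h)) * ((h : MZ).det : ℝ) ^ 7 ≤ ∑ h ∈ G, (t ^ 3) ^ 7 := by
          refine Finset.sum_le_sum fun h hh => ?_
          have hlt := (memF h).mp (hGF hh)
          have h1 : ((h : MZ).det : ℝ) ^ 7 ≤ (t ^ 3) ^ 7 := pow_le_pow_left₀ (hpos h).le hlt.le 7
          have h0 : 0 ≤ ((h : MZ).det : ℝ) ^ 7 := pow_nonneg (hpos h).le _
          nlinarith [TH_nonneg T (rM h), TH_le_one T (rM h)]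
      _ = G.card * (t ^ 3) ^ 7 := by rw [Finset.sum_const, nsmul_eq_mul]
      _ ≤ _ := by gcongr
  have e : (∑ h ∈ F, TH T (rM h) * ((h : MZ).det : ℝ) ^ 7) / t ^ 21 / t ^ 9 - (∑ h ∈ F, ((h : MZ).det : ℝ) ^ 7) / (t ^ 3) ^ 10
      = -((∑ h ∈ F, (1 - TH T (rM h)) * ((h : MZ).det : ℝ) ^ 7) / t ^ 30) := by
    rw [← hd]; field_simp; ring
  rw [e, abs_neg, abs_of_nonneg (by positivity), div_le_iff₀ (by positivity)]
  calc _ ≤ _ := hd1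
    _ = _ := by ring

end TC


namespace TC
open Matrix Filter Topology MeasureTheory

/-- a multiplicative function on matrices is determined by its values on diagonal matrices -/
lemma mult_det (φ : M3 → ℝ) (h1 : φ 1 = 1) (hm : ∀ a b, φ (a * b) = φ a * φ b) (n : ℕ)
    (hd : ∀ v : Fin 3 → ℝ, φ (Matrix.diagonal v) = (v 0 * v 1 * v 2) ^ n) (g : M3) (hg : g.det ≠ 0) :
    φ g = g.det ^ n := by
  refine Matrix.diagonal_transvection_induction_of_det_ne_zero (fun g => φ g = g.det ^ n) g hg ?_ ?_ ?_
  · intro v _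
    rw [hd, Matrix.det_diagonal, Fin.prod_univ_three]
  · intro t
    obtain ⟨i, j, hij, c⟩ := t
    change φ (Matrix.transvection i j c) = (Matrix.transvection i j c).det ^ n
    rw [Matrix.det_transvection_of_ne i j hij, one_pow]
    obtain ⟨D, hD⟩ : ∃ D : Fin 3 → ℝ, D = fun a => if a = i then 2 else 1 := ⟨_, rfl⟩
    have e1 : Matrix.diagonal D * Matrix.transvection i j c = Matrix.transvection i j (2 * c) * Matrix.diagonal D := by
      subst hD
      ext a b
      rw [Matrix.diagonal_mul, Matrix.mul_diagonal]
      fin_cases i <;> fin_cases j <;> first | exact absurd rfl hij | skip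
      all_goals fin_cases a <;> fin_cases b <;>
        simp [Matrix.transvection, Matrix.single]
    have e2 : Matrix.transvection i j (2 * c) = Matrix.transvection i j c * Matrix.transvection i j c := by
      rw [Matrix.transvection_mul_transvection_same i j hij, two_mul]
    have hDn : φ (Matrix.diagonal D) ≠ 0 := by
      rw [hd]
      apply pow_ne_zero
      subst hD
      fin_cases i <;> simp
    have e4 : Matrix.transvection i j c * Matrix.transvection i j (-c) = 1 := by
      rw [Matrix.transvection_mul_transvection_same i j hij, add_neg_cancel, Matrix.transvection_zero]
    have h4 : φ (Matrix.transvection i j c) * φ (Matrix.transvection i j (-c)) = 1 := by rw [← hm, e4, h1]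
    have h5 : φ (Matrix.transvection i j c) ≠ 0 := left_ne_zero_of_mul (by rw [h4]; exact one_ne_zero)
    have h6 := congrArg φ e1
    rw [hm, hm, e2, hm] at h6
    have h7 : φ (Matrix.diagonal D) * φ (Matrix.transvection i j c) * (φ (Matrix.transvection i j c) - 1) = 0 := by
      linear_combination -h6
    rcases mul_eq_zero.mp h7 with h | h
    · rcases mul_eq_zero.mp h with h | h
      · exact absurd h hDn
      · exact absurd h h5
    · linarith
  · intro a b _ _ ha hb
    rw [hm, ha, hb, Matrix.det_mul, mul_pow]

abbrev V10 := Fin 10 → ℝ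

/-- action as a linear map -/
noncomputable def actL (g : M3) : V10 →ₗ[ℝ] V10 where
  toFun := act g
  map_add' := act_add g
  map_smul' t c := act_smul g t c

lemma actL_det (g : M3) (hg : g.det ≠ 0) : LinearMap.det (actL g) = g.det ^ 10 := by
  refine mult_det (fun g => LinearMap.det (actL g)) ?_ ?_ 10 ?_ g hg
  · have : actL 1 = LinearMap.id := LinearMap.ext fun c => act_one c
    change LinearMap.det (actL 1) = 1
    rw [this, LinearMap.det_id]
  · intro a b
    have : actL (a * b) = actL a ∘ₗ actL b := LinearMap.ext fun c => act_mul a b c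
    change LinearMap.det (actL (a * b)) = _
    rw [this, LinearMap.det_comp]
  · intro v
    have : actL (Matrix.diagonal v) = Matrix.toLin' (Matrix.diagonal (![v 0 ^ 3, v 1 ^ 3, v 2 ^ 3, v 0 ^ 2 * v 1, v 0 ^ 2 * v 2,
        v 0 * v 1 ^ 2, v 1 ^ 2 * v 2, v 0 * v 2 ^ 2, v 1 * v 2 ^ 2, v 0 * v 1 * v 2] : V10)) := by
      refine LinearMap.ext fun c => ?_
      rw [Matrix.toLin'_apply]
      change act (Matrix.diagonal v) c = _
      funext k
      rw [Matrix.mulVec_diagonal]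
      fin_cases k <;> simp [act, ev, d1, d3, Matrix.diagonal] <;> ring
    change LinearMap.det (actL (Matrix.diagonal v)) = _
    rw [this, LinearMap.det_toLin', Matrix.det_diagonal]
    simp [Fin.prod_univ_succ]
    ring

/-- the matrix part of the coordinates -/
def mt (x : V10) : M3 := !![x 1, x 2, x 3; x 4, x 5, x 6; x 7, x 8, x 9]

/-- coordinates from a parameter and a matrix -/
def co (δ : ℝ) (g : M3) : V10 := ![δ, g 0 0, g 0 1, g 0 2, g 1 0, g 1 1, g 1 2, g 2 0, g 2 1, g 2 2]

lemma mt_co (δ : ℝ) (g : M3) : mt (co δ g) = g := by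
  ext i j; fin_cases i <;> fin_cases j <;> rfl

lemma co_mt (x : V10) : co (x 0) (mt x) = x := by
  funext k; fin_cases k <;> rfl

lemma mt_tail (x : V10) : mt x = m9 (Fin.tail x) := rfl

lemma mt_add (x y : V10) : mt (x + y) = mt x + mt y := by
  ext i j; fin_cases i <;> fin_cases j <;> rfl
lemma mt_smul (t : ℝ) (y : V10) : mt (t • y) = t • mt y := by
  ext i j; fin_cases i <;> fin_cases j <;> rfl

noncomputable def leftL (g : M3) : V10 →ₗ[ℝ] V10 where
  toFun x := co (x 0) (g * mt x)
  map_add' x y := by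
    rw [mt_add, Matrix.mul_add]
    funext k; fin_cases k <;> rfl
  map_smul' t x := by
    rw [mt_smul, Matrix.mul_smul]
    funext k; fin_cases k <;> rfl

lemma leftL_det (g : M3) (hg : g.det ≠ 0) : LinearMap.det (leftL g) = g.det ^ 3 := by
  refine mult_det (fun g => LinearMap.det (leftL g)) ?_ ?_ 3 ?_ g hg
  · have : leftL 1 = LinearMap.id := LinearMap.ext fun c => by
      change co (c 0) (1 * mt c) = c
      rw [Matrix.one_mul, co_mt]
    change LinearMap.det (leftL 1) = 1
    rw [this, LinearMap.det_id]
  · intro a b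
    have : leftL (a * b) = leftL a ∘ₗ leftL b := LinearMap.ext fun c => by
      change co (c 0) (a * b * mt c) = co (c 0) (a * mt (co (c 0) (b * mt c)))
      rw [mt_co, Matrix.mul_assoc]
    change LinearMap.det (leftL (a * b)) = _
    rw [this, LinearMap.det_comp]
  · intro v
    have : leftL (Matrix.diagonal v) = Matrix.toLin' (Matrix.diagonal (![1, v 0, v 0, v 0, v 1, v 1, v 1, v 2, v 2, v 2] : V10)) := by
      refine LinearMap.ext fun c => ?_
      rw [Matrix.toLin'_apply]
      change co (c 0) (Matrix.diagonal v * mt c) = _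
      funext k
      rw [Matrix.mulVec_diagonal]
      fin_cases k <;> simp [co, mt, Matrix.diagonal_mul]
    change LinearMap.det (leftL (Matrix.diagonal v)) = _
    rw [this, LinearMap.det_toLin', Matrix.det_diagonal]
    simp [Fin.prod_univ_succ]
    ring

/-- the parametrisation -/
def Ph (x : V10) : V10 := act (mt x) (hes (x 0))

lemma ev_hes (δ : ℝ) (u : Fin 3 → ℝ) : ev (hes δ) u = u 0 ^ 3 + u 1 ^ 3 + u 2 ^ 3 + δ * (u 0 * u 1 * u 2) := by
  simp [ev, hes]; ring
lemma d1_hes (δ : ℝ) (u v : Fin 3 → ℝ) : d1 (hes δ) u v = 3 * (u 0 ^ 2 * v 0) + 3 * (u 1 ^ 2 * v 1) + 3 * (u 2 ^ 2 * v 2)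
    + δ * (v 0 * u 1 * u 2 + u 0 * v 1 * u 2 + u 0 * u 1 * v 2) := by
  simp [d1, hes]; ring
lemma d3_hes (δ : ℝ) (u v w : Fin 3 → ℝ) : d3 (hes δ) u v w = 6 * (u 0 * v 0 * w 0) + 6 * (u 1 * v 1 * w 1) + 6 * (u 2 * v 2 * w 2)
    + δ * (u 0 * v 1 * w 2 + u 0 * v 2 * w 1 + u 1 * v 0 * w 2 + u 1 * v 2 * w 0 + u 2 * v 0 * w 1 + u 2 * v 1 * w 0) := by
  simp [d3, hes]; ring

lemma mt_cd (i j : Fin 3) : ContDiff ℝ 2 fun x => mt x i j := by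
  fin_cases i <;> fin_cases j <;> exact contDiff_apply _ _ _

lemma ev_cd (i : Fin 3) : ContDiff ℝ 2 fun x : V10 => ev (hes (x 0)) (mt x i) := by
  simp only [ev_hes]
  have h0 := mt_cd i 0
  have h1 := mt_cd i 1
  have h2 := mt_cd i 2
  have h : ContDiff ℝ 2 fun x : V10 => x 0 := contDiff_apply _ _ _
  exact (((h0.pow 3).add (h1.pow 3)).add (h2.pow 3)).add (h.mul ((h0.mul h1).mul h2))

lemma d1_cd (i k : Fin 3) : ContDiff ℝ 2 fun x : V10 => d1 (hes (x 0)) (mt x i) (mt x k) := by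
  simp only [d1_hes]
  have h0 := mt_cd i 0
  have h1 := mt_cd i 1
  have h2 := mt_cd i 2
  have k0 := mt_cd k 0
  have k1 := mt_cd k 1
  have k2 := mt_cd k 2
  have h : ContDiff ℝ 2 fun x : V10 => x 0 := contDiff_apply _ _ _
  exact (((contDiff_const.mul ((h0.pow 2).mul k0)).add (contDiff_const.mul ((h1.pow 2).mul k1))).add
    (contDiff_const.mul ((h2.pow 2).mul k2))).add
    (h.mul ((((k0.mul h1).mul h2).add ((h0.mul k1).mul h2)).add ((h0.mul h1).mul k2)))

lemma d3_cd : ContDiff ℝ 2 fun x : V10 => d3 (hes (x 0)) (mt x 0) (mt x 1) (mt x 2) := by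
  simp only [d3_hes]
  have m (a b c : Fin 3) : ContDiff ℝ 2 fun x : V10 => mt x 0 a * mt x 1 b * mt x 2 c :=
    ((mt_cd 0 a).mul (mt_cd 1 b)).mul (mt_cd 2 c)
  have h : ContDiff ℝ 2 fun x : V10 => x 0 := contDiff_apply _ _ _
  exact (((contDiff_const.mul (m 0 0 0)).add (contDiff_const.mul (m 1 1 1))).add (contDiff_const.mul (m 2 2 2))).add
    (h.mul ((((((m 0 1 2).add (m 0 2 1)).add (m 1 0 2)).add (m 1 2 0)).add (m 2 0 1)).add (m 2 1 0)))

lemma Ph_contDiff : ContDiff ℝ 2 Ph := by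
  rw [contDiff_pi]
  intro k
  fin_cases k
  · exact ev_cd 0
  · exact ev_cd 1
  · exact ev_cd 2
  · exact d1_cd 0 1
  · exact d1_cd 0 2
  · exact d1_cd 1 0
  · exact d1_cd 1 2
  · exact d1_cd 2 0
  · exact d1_cd 2 1
  · exact d3_cd

lemma Ph_diff (x : V10) : HasStrictFDerivAt Ph (fderiv ℝ Ph x) x :=
  Ph_contDiff.contDiffAt.hasStrictFDerivAt (by norm_num)

lemma Ph_left (g : M3) (x : V10) : Ph (leftL g x) = actL g (Ph x) := by
  change act (mt (co (x 0) (g * mt x))) (hes (x 0)) = act g (act (mt x) (hes (x 0)))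
  rw [mt_co, act_mul]

/-- the derivative of the parametrisation at the identity matrix -/
def j0 (δ : ℝ) : Matrix (Fin 10) (Fin 10) ℝ :=
  !![0, 3, 0, 0, 0, 0, 0, 0, 0, 0;
     0, 0, 0, 0, 0, 3, 0, 0, 0, 0;
     0, 0, 0, 0, 0, 0, 0, 0, 0, 3;
     0, 0, 0, δ, 3, 0, 0, 0, 0, 0;
     0, 0, δ, 0, 0, 0, 0, 3, 0, 0;
     0, 0, 3, 0, 0, 0, δ, 0, 0, 0;
     0, 0, 0, 0, δ, 0, 0, 0, 3, 0;
     0, 0, 0, 3, 0, 0, 0, 0, δ, 0;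
     0, 0, 0, 0, 0, 0, 3, δ, 0, 0;
     1, δ, 0, 0, 0, δ, 0, 0, 0, δ]

end TC


namespace TC
open Matrix Filter Topology MeasureTheory

section jac
variable (δ : ℝ) (v : V10)

lemma cur (i j : Fin 3) : HasDerivAt (fun t : ℝ => mt (co δ 1 + t • v) i j) (mt v i j) 0 := by
  have h : ∀ t : ℝ, mt (co δ 1 + t • v) i j = (1 : M3) i j + t * mt v i j := fun t => by
    rw [mt_add, mt_smul, mt_co]; rfl
  simp only [h]
  simpa using ((hasDerivAt_id (0 : ℝ)).mul_const (mt v i j)).const_add ((1 : M3) i j)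

lemma cur0 : HasDerivAt (fun t : ℝ => (co δ 1 + t • v) 0) (v 0) 0 := by
  have h : ∀ t : ℝ, (co δ 1 + t • v) 0 = δ + t * v 0 := fun t => rfl
  simp only [h]
  simpa using ((hasDerivAt_id (0 : ℝ)).mul_const (v 0)).const_add δ

lemma cv (i j : Fin 3) : mt (co δ 1 + (0 : ℝ) • v) i j = (1 : M3) i j := by
  rw [zero_smul, add_zero, mt_co]
lemma cv0 : (co δ 1 + (0 : ℝ) • v) 0 = δ := by
  rw [zero_smul, add_zero]; rfl

lemma ev_cur (i : Fin 3) (d : ℝ)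
    (hd : d = 3 * ((1 : M3) i 0 ^ 2 * mt v i 0 + (1 : M3) i 1 ^ 2 * mt v i 1 + (1 : M3) i 2 ^ 2 * mt v i 2)
      + v 0 * ((1 : M3) i 0 * (1 : M3) i 1 * (1 : M3) i 2)
      + δ * (mt v i 0 * (1 : M3) i 1 * (1 : M3) i 2 + (1 : M3) i 0 * mt v i 1 * (1 : M3) i 2
        + (1 : M3) i 0 * (1 : M3) i 1 * mt v i 2)) :
    HasDerivAt (fun t : ℝ => ev (hes ((co δ 1 + t • v) 0)) (mt (co δ 1 + t • v) i)) d 0 := by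
  simp only [ev_hes]
  have h0 := cur δ v i 0
  have h1 := cur δ v i 1
  have h2 := cur δ v i 2
  have h := cur0 δ v
  have := (((h0.pow 3).add (h1.pow 3)).add (h2.pow 3)).add (h.mul ((h0.mul h1).mul h2))
  refine this.congr_deriv ?_
  simp only [cv, cv0, Pi.mul_apply]
  rw [hd]
  push_cast
  ring

lemma d1_cur (i k : Fin 3) (d : ℝ)
    (hd : d = 3 * (2 * (1 : M3) i 0 * mt v i 0 * (1 : M3) k 0 + (1 : M3) i 0 ^ 2 * mt v k 0
        + 2 * (1 : M3) i 1 * mt v i 1 * (1 : M3) k 1 + (1 : M3) i 1 ^ 2 * mt v k 1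
        + 2 * (1 : M3) i 2 * mt v i 2 * (1 : M3) k 2 + (1 : M3) i 2 ^ 2 * mt v k 2)
      + v 0 * ((1 : M3) k 0 * (1 : M3) i 1 * (1 : M3) i 2 + (1 : M3) i 0 * (1 : M3) k 1 * (1 : M3) i 2
        + (1 : M3) i 0 * (1 : M3) i 1 * (1 : M3) k 2)
      + δ * ((mt v k 0 * (1 : M3) i 1 * (1 : M3) i 2 + (1 : M3) k 0 * mt v i 1 * (1 : M3) i 2
          + (1 : M3) k 0 * (1 : M3) i 1 * mt v i 2)
        + (mt v i 0 * (1 : M3) k 1 * (1 : M3) i 2 + (1 : M3) i 0 * mt v k 1 * (1 : M3) i 2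
          + (1 : M3) i 0 * (1 : M3) k 1 * mt v i 2)
        + (mt v i 0 * (1 : M3) i 1 * (1 : M3) k 2 + (1 : M3) i 0 * mt v i 1 * (1 : M3) k 2
          + (1 : M3) i 0 * (1 : M3) i 1 * mt v k 2))) :
    HasDerivAt (fun t : ℝ => d1 (hes ((co δ 1 + t • v) 0)) (mt (co δ 1 + t • v) i) (mt (co δ 1 + t • v) k)) d 0 := by
  simp only [d1_hes]
  have h0 := cur δ v i 0
  have h1 := cur δ v i 1
  have h2 := cur δ v i 2
  have k0 := cur δ v k 0
  have k1 := cur δ v k 1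
  have k2 := cur δ v k 2
  have h := cur0 δ v
  have := ((((((h0.pow 2).mul k0)).const_mul 3).add ((((h1.pow 2).mul k1)).const_mul 3)).add
    ((((h2.pow 2).mul k2)).const_mul 3)).add
    (h.mul ((((k0.mul h1).mul h2).add ((h0.mul k1).mul h2)).add ((h0.mul h1).mul k2)))
  refine this.congr_deriv ?_
  simp only [cv, cv0]
  simp only [Pi.mul_apply, Pi.add_apply, Pi.pow_apply, cv]
  rw [hd]
  push_cast
  ring

lemma d3_cur : HasDerivAt (fun t : ℝ => d3 (hes ((co δ 1 + t • v) 0)) (mt (co δ 1 + t • v) 0) (mt (co δ 1 + t • v) 1)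
    (mt (co δ 1 + t • v) 2)) (v 0 + δ * (mt v 0 0 + mt v 1 1 + mt v 2 2)) 0 := by
  simp only [d3_hes]
  have m (a b c : Fin 3) := ((cur δ v 0 a).mul (cur δ v 1 b)).mul (cur δ v 2 c)
  have h := cur0 δ v
  have := ((((m 0 0 0).const_mul 6).add ((m 1 1 1).const_mul 6)).add ((m 2 2 2).const_mul 6)).add
    (h.mul ((((((m 0 1 2).add (m 0 2 1)).add (m 1 0 2)).add (m 1 2 0)).add (m 2 0 1)).add (m 2 1 0)))
  refine this.congr_deriv ?_
  simp only [cv, cv0]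
  simp only [Pi.mul_apply, Pi.add_apply, cv]
  simp

lemma j0_mulVec : j0 δ *ᵥ v = ![3 * v 1, 3 * v 5, 3 * v 9, δ * v 3 + 3 * v 4, δ * v 2 + 3 * v 7, 3 * v 2 + δ * v 6,
    δ * v 4 + 3 * v 8, 3 * v 3 + δ * v 8, 3 * v 6 + δ * v 7, v 0 + δ * (v 1 + v 5 + v 9)] := by
  funext k
  fin_cases k <;> simp [j0, Matrix.mulVec, dotProduct, Fin.sum_univ_succ, Fin.succ] <;> ring

lemma Ph_cur : HasDerivAt (fun t : ℝ => Ph (co δ 1 + t • v)) (j0 δ *ᵥ v) 0 := by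
  rw [j0_mulVec, hasDerivAt_pi]
  intro k
  fin_cases k
  · exact ev_cur δ v 0 _ (by simp [mt])
  · exact ev_cur δ v 1 _ (by simp [mt])
  · exact ev_cur δ v 2 _ (by simp [mt])
  · exact d1_cur δ v 0 1 _ (by simp [mt]; ring)
  · exact d1_cur δ v 0 2 _ (by simp [mt]; ring)
  · exact d1_cur δ v 1 0 _ (by simp [mt])
  · exact d1_cur δ v 1 2 _ (by simp [mt]; ring)
  · exact d1_cur δ v 2 0 _ (by simp [mt])
  · exact d1_cur δ v 2 1 _ (by simp [mt])
  · exact d3_cur δ v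

lemma fderiv_one : fderiv ℝ Ph (co δ 1) v = j0 δ *ᵥ v := by
  have h1 : HasLineDerivAt ℝ Ph (fderiv ℝ Ph (co δ 1) v) (co δ 1) v := (Ph_diff (co δ 1)).hasFDerivAt.hasLineDerivAt v
  have h2 : HasLineDerivAt ℝ Ph (j0 δ *ᵥ v) (co δ 1) v := Ph_cur δ v
  exact h1.unique h2
end jac

/-- reindexing of rows -/
def eR : Fin 4 ⊕ (Fin 3 ⊕ Fin 3) → Fin 10 := Sum.elim ![0, 1, 2, 9] (Sum.elim ![3, 6, 7] ![4, 5, 8])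
def eC : Fin 4 ⊕ (Fin 3 ⊕ Fin 3) → Fin 10 := Sum.elim ![1, 5, 9, 0] (Sum.elim ![3, 4, 8] ![2, 6, 7])

lemma eR_bij : Function.Bijective eR := by decide
lemma eC_bij : Function.Bijective eC := by decide

lemma j0_det (δ : ℝ) : |(j0 δ).det| = 27 * (27 + δ ^ 3) ^ 2 := by
  rw [← Matrix.abs_det_submatrix_equiv_equiv (Equiv.ofBijective eR eR_bij) (Equiv.ofBijective eC eC_bij)]
  have e : (j0 δ).submatrix (Equiv.ofBijective eR eR_bij) (Equiv.ofBijective eC eC_bij) =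
      Matrix.fromBlocks !![3, 0, 0, 0; 0, 3, 0, 0; 0, 0, 3, 0; δ, δ, δ, 1] 0 0
        (Matrix.fromBlocks !![δ, 3, 0; 0, δ, 3; 3, 0, δ] 0 0 !![δ, 0, 3; 3, δ, 0; 0, 3, δ]) := by
    ext i j
    rcases i with i | i | i <;> rcases j with j | j | j <;> fin_cases i <;> fin_cases j <;> rfl
  have h4 : (!![3, 0, 0, 0; 0, 3, 0, 0; 0, 0, 3, 0; δ, δ, δ, 1] : Matrix (Fin 4) (Fin 4) ℝ).det = 27 := by
    rw [Matrix.det_of_isLowerTriangular]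
    · simp [Fin.prod_univ_succ]; norm_num
    · intro i j h
      fin_cases i <;> fin_cases j <;> first | rfl | exact absurd h (by decide)
  rw [e, Matrix.det_fromBlocks_zero₂₁, Matrix.det_fromBlocks_zero₂₁, h4, Matrix.det_fin_three, Matrix.det_fin_three]
  simp
  have : (δ * δ * δ + 3 * 3 * 3 : ℝ) = 27 + δ ^ 3 := by ring
  rw [this, ← sq]

lemma jac (x : V10) (hx : (mt x).det ≠ 0) : |(fderiv ℝ Ph x).det| = |(mt x).det| ^ 7 * (27 * (27 + x 0 ^ 3) ^ 2) := by
  obtain ⟨g, hg⟩ : ∃ g, g = mt x := ⟨_, rfl⟩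
  rw [← hg] at hx ⊢
  have hx1 : leftL g (co (x 0) 1) = x := by
    change co (x 0) (g * mt (co (x 0) 1)) = x
    rw [mt_co, Matrix.mul_one, hg, co_mt]
  have h1 : (fderiv ℝ Ph x : V10 →ₗ[ℝ] V10) ∘ₗ leftL g = actL g ∘ₗ Matrix.toLin' (j0 (x 0)) := by
    refine LinearMap.ext fun v => ?_
    have a1 : HasFDerivAt (fun y => Ph (leftL g y)) ((fderiv ℝ Ph x).comp (LinearMap.toContinuousLinearMap (leftL g))) (co (x 0) 1) := by
      have b1 : HasFDerivAt Ph (fderiv ℝ Ph x) ((LinearMap.toContinuousLinearMap (leftL g)) (co (x 0) 1)) := by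
        change HasFDerivAt Ph (fderiv ℝ Ph x) (leftL g (co (x 0) 1))
        rw [hx1]
        exact (Ph_diff x).hasFDerivAt
      exact b1.comp (co (x 0) 1) (LinearMap.toContinuousLinearMap (leftL g)).hasFDerivAt
    have a2 : HasFDerivAt (fun y => actL g (Ph y)) ((LinearMap.toContinuousLinearMap (actL g)).comp (fderiv ℝ Ph (co (x 0) 1))) (co (x 0) 1) :=
      (LinearMap.toContinuousLinearMap (actL g)).hasFDerivAt.comp (co (x 0) 1) (Ph_diff _).hasFDerivAt
    have a3 : (fun y => Ph (leftL g y)) = fun y => actL g (Ph y) := funext fun y => Ph_left g y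
    rw [a3] at a1
    have a4 := DFunLike.congr_fun (a1.unique a2) v
    change fderiv ℝ Ph x (leftL g v) = actL g (fderiv ℝ Ph (co (x 0) 1) v) at a4
    rw [fderiv_one] at a4
    exact a4
  have h2 := congrArg LinearMap.det h1
  rw [LinearMap.det_comp, LinearMap.det_comp, leftL_det g hx, actL_det g hx, LinearMap.det_toLin'] at h2
  have h3 : (fderiv ℝ Ph x).det = g.det ^ 7 * (j0 (x 0)).det := by
    have : g.det ^ 3 ≠ 0 := pow_ne_zero _ hx
    apply mul_right_cancel₀ this
    rw [ContinuousLinearMap.det, h2]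
    ring
  rw [h3, abs_mul, abs_pow, j0_det]

end TC


namespace TC
open Matrix Filter Topology MeasureTheory

/-- height of the Hesse form -/
noncomputable def hh0 (δ : ℝ) : ℝ := max (|Ih δ| ^ 3) (Jh δ ^ 2 / 4)

noncomputable def kk (δ : ℝ) : ℝ := (27 + δ ^ 3) ^ 2 * hh0 δ ^ (-(5 / 6) : ℝ)

lemma Ih_der (δ : ℝ) : HasDerivAt Ih ((4 * δ ^ 3 - 216) / 16) δ := by
  have h := ((hasDerivAt_id δ).mul (((hasDerivAt_id δ).pow 3).sub_const 216)).div_const 16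
  refine h.congr_deriv ?_
  simp
  ring

lemma Jh_der (δ : ℝ) : HasDerivAt Jh (-(6 * δ ^ 5 + 1620 * δ ^ 2) / 32) δ := by
  have h := ((((((hasDerivAt_id δ).pow 6).add (((hasDerivAt_id δ).pow 3).const_mul 540)).sub_const 5832).neg).div_const 32)
  refine h.congr_deriv ?_
  simp
  ring

lemma derI (s δ : ℝ) (h : 0 < s * Ih δ) : HasDerivAt (fun δ => Jh δ * (s * Ih δ) ^ (-(3 / 2) : ℝ))
    (s * (81 / 16 * (27 + δ ^ 3) ^ 2) * (s * Ih δ) ^ (-(5 / 2) : ℝ)) δ := by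
  have h1 := (Jh_der δ).mul (((Ih_der δ).const_mul s).rpow_const (p := -(3 / 2)) (Or.inl h.ne'))
  refine h1.congr_deriv ?_
  have e : (s * Ih δ) ^ (-(3 / 2) : ℝ) = (s * Ih δ) ^ (-(5 / 2) : ℝ) * (s * Ih δ) := by
    rw [← Real.rpow_add_one h.ne']; norm_num
  have e2 : (-(3 / 2) - 1 : ℝ) = -(5 / 2) := by norm_num
  rw [e, e2]
  unfold Ih Jh
  ring

lemma derJ (s δ : ℝ) (h : 0 < s * Jh δ) : HasDerivAt (fun δ => Ih δ * (s * Jh δ) ^ (-(2 / 3) : ℝ))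
    (-(2 / 3) * s * (81 / 16 * (27 + δ ^ 3) ^ 2) * (s * Jh δ) ^ (-(5 / 3) : ℝ)) δ := by
  have h1 := (Ih_der δ).mul (((Jh_der δ).const_mul s).rpow_const (p := -(2 / 3)) (Or.inl h.ne'))
  refine h1.congr_deriv ?_
  have e : (s * Jh δ) ^ (-(2 / 3) : ℝ) = (s * Jh δ) ^ (-(5 / 3) : ℝ) * (s * Jh δ) := by
    rw [← Real.rpow_add_one h.ne']; norm_num
  have e2 : (-(2 / 3) - 1 : ℝ) = -(5 / 3) := by norm_num
  rw [e, e2]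
  unfold Ih Jh
  ring

/-- the constant `4 ^ (1/3)` -/
noncomputable def kap : ℝ := 4 ^ (1 / 3 : ℝ)

lemma kap_pos : 0 < kap := Real.rpow_pos_of_pos (by norm_num) _
lemma kap_cube : kap ^ 3 = 4 := by
  unfold kap
  rw [← Real.rpow_natCast, ← Real.rpow_mul (by norm_num)]; norm_num

lemma kk_I (s δ : ℝ) (hs : |s| = 1) (h : 0 < s * Ih δ) (hd : Jh δ ^ 2 / 4 ≤ (s * Ih δ) ^ 3) :
    kk δ = (27 + δ ^ 3) ^ 2 * (s * Ih δ) ^ (-(5 / 2) : ℝ) := by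
  have e : |Ih δ| = s * Ih δ := by rw [← abs_of_pos h, abs_mul, hs, one_mul]
  unfold kk hh0
  rw [e, max_eq_left hd, ← Real.rpow_natCast (s * Ih δ), ← Real.rpow_mul h.le]
  norm_num

lemma kk_J (s δ : ℝ) (hs : |s| = 1) (h : 0 < s * Jh δ) (hd : |Ih δ| ^ 3 ≤ Jh δ ^ 2 / 4) :
    kk δ = 2 * kap * ((27 + δ ^ 3) ^ 2 * (s * Jh δ) ^ (-(5 / 3) : ℝ)) := by
  have e : |Jh δ| = s * Jh δ := by rw [← abs_of_pos h, abs_mul, hs, one_mul]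
  unfold kk hh0
  rw [max_eq_right hd, ← sq_abs (Jh δ), e, div_eq_mul_inv, Real.mul_rpow (by positivity) (by norm_num), ← Real.rpow_natCast (s * Jh δ),
    ← Real.rpow_mul h.le]
  have e2 : ((4 : ℝ)⁻¹) ^ (-(5 / 6) : ℝ) = 2 * kap := by
    rw [Real.inv_rpow (by norm_num), ← Real.rpow_neg (by norm_num)]
    have : (4 : ℝ) ^ (1 / 2 : ℝ) = 2 := by
      rw [← Real.sqrt_eq_rpow, show (4 : ℝ) = 2 ^ 2 by norm_num, Real.sqrt_sq (by norm_num)]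
    rw [← this, kap, ← Real.rpow_add (by norm_num)]
    norm_num
  rw [e2]
  norm_num
  ring

lemma val_I (s δ b : ℝ) (h : 0 < s * Ih δ) (hb : 0 < b * Jh δ) (hb1 : b ^ 2 = 1) (hd : Jh δ ^ 2 = 4 * (s * Ih δ) ^ 3) :
    Jh δ * (s * Ih δ) ^ (-(3 / 2) : ℝ) = 2 * b := by
  obtain ⟨r, hr⟩ : ∃ r, r = (s * Ih δ) ^ (-(3 / 2) : ℝ) := ⟨_, rfl⟩
  have hr0 : 0 < r := by rw [hr]; exact Real.rpow_pos_of_pos h _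
  have hr2 : r ^ 2 * (s * Ih δ) ^ 3 = 1 := by
    rw [hr, ← Real.rpow_natCast, ← Real.rpow_natCast, ← Real.rpow_mul h.le, ← Real.rpow_add h]
    norm_num
  rw [← hr]
  have h1 : (b * Jh δ * r) ^ 2 = 2 ^ 2 := by
    have : (b * Jh δ * r) ^ 2 = b ^ 2 * Jh δ ^ 2 * r ^ 2 := by ring
    rw [this, hb1, hd]; linear_combination 4 * hr2
  have h2 : b * Jh δ * r = 2 := by
    have := (pow_left_inj₀ (mul_pos hb hr0).le (by norm_num) two_ne_zero).mp h1
    exact this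
  linear_combination b * h2 - Jh δ * r * hb1

lemma val_J (s δ b : ℝ) (h : 0 < s * Jh δ) (hs : s ^ 2 = 1) (hb1 : b ^ 3 = b) (hd : 4 * Ih δ ^ 3 = b * Jh δ ^ 2) :
    Ih δ * (s * Jh δ) ^ (-(2 / 3) : ℝ) = b / kap := by
  obtain ⟨r, hr⟩ : ∃ r, r = (s * Jh δ) ^ (-(2 / 3) : ℝ) := ⟨_, rfl⟩
  have hr2 : r ^ 3 * (s * Jh δ) ^ 2 = 1 := by
    rw [hr, ← Real.rpow_natCast, ← Real.rpow_natCast, ← Real.rpow_mul h.le, ← Real.rpow_add h]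
    norm_num
  rw [← hr]
  rw [eq_div_iff kap_pos.ne']
  have h1 : (Ih δ * r * kap) ^ 3 = b ^ 3 := by
    have : (Ih δ * r * kap) ^ 3 = Ih δ ^ 3 * r ^ 3 * kap ^ 3 := by ring
    rw [this, kap_cube, hb1]
    have h3 : r ^ 3 * Jh δ ^ 2 = 1 := by rw [← hr2]; linear_combination (-(r ^ 3) * Jh δ ^ 2) * hs
    linear_combination r ^ 3 * hd + b * h3
  exact (Odd.strictMono_pow (by decide : Odd 3)).injective h1

lemma lint_Ioi (F f : ℝ → ℝ) (a l : ℝ) (hd : ∀ x ∈ Set.Ici a, HasDerivAt F (f x) x) (h0 : ∀ x ∈ Set.Ioi a, 0 ≤ f x)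
    (hl : Tendsto F atTop (𝓝 l)) : ∫⁻ x in Set.Ioi a, ENNReal.ofReal (f x) = ENNReal.ofReal (l - F a) := by
  rw [← integral_Ioi_of_hasDerivAt_of_nonneg' hd h0 hl]
  symm
  apply ofReal_integral_eq_lintegral_ofReal (integrableOn_Ioi_deriv_of_nonneg' hd h0 hl)
  exact (ae_restrict_iff' measurableSet_Ioi).mpr (ae_of_all _ h0)

lemma lint_Ioc (F f : ℝ → ℝ) (a b : ℝ) (hab : a ≤ b) (hd : ∀ x ∈ Set.Icc a b, HasDerivAt F (f x) x)
    (h0 : ∀ x ∈ Set.Icc a b, 0 ≤ f x) : ∫⁻ x in Set.Ioc a b, ENNReal.ofReal (f x) = ENNReal.ofReal (F b - F a) := by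
  have hc : ContinuousOn F (Set.Icc a b) := fun x hx => (hd x hx).continuousAt.continuousWithinAt
  have hi := intervalIntegral.integrableOn_deriv_of_nonneg hc (fun x hx => hd x (Set.Ioo_subset_Icc_self hx))
    (fun x hx => h0 x (Set.Ioo_subset_Icc_self hx))
  have h := intervalIntegral.integral_eq_sub_of_hasDerivAt_of_le hab hc (fun x hx => hd x (Set.Ioo_subset_Icc_self hx))
    ((intervalIntegrable_iff_integrableOn_Ioc_of_le hab).mpr hi)
  rw [← h, intervalIntegral.integral_of_le hab]
  symm
  apply ofReal_integral_eq_lintegral_ofReal hi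
  exact (ae_restrict_iff' measurableSet_Ioc).mpr (ae_of_all _ fun x hx => h0 x (Set.Ioc_subset_Icc_self hx))

lemma inv_cube_tendsto : Tendsto (fun x : ℝ => (x ^ 3)⁻¹) atTop (𝓝 0) :=
  tendsto_inv_atTop_zero.comp (tendsto_pow_atTop (by norm_num))

lemma lim_I : Tendsto (fun x : ℝ => -(Jh (-x) * (1 * Ih (-x)) ^ (-(3 / 2) : ℝ))) atTop (𝓝 2) := by
  have hc : ContinuousAt (fun y : ℝ => 2 * (1 - 540 * y - 5832 * y ^ 2) * (1 + 216 * y) ^ (-(3 / 2) : ℝ)) 0 := by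
    apply ContinuousAt.mul (by fun_prop)
    apply ContinuousAt.rpow_const (by fun_prop)
    left; norm_num
  have h := hc.tendsto.comp inv_cube_tendsto
  norm_num at h
  refine h.congr' ?_
  filter_upwards [eventually_gt_atTop 0] with x hx
  have e : 1 * Ih (-x) = (x ^ 2 / 4) ^ 2 * (1 + 216 * (x ^ 3)⁻¹) := by
    unfold Ih; field_simp; ring
  have e2 : ((x ^ 2 / 4) ^ 2) ^ (-(3 / 2) : ℝ) = 64 * (x ^ 6)⁻¹ := by
    rw [← Real.rpow_natCast, ← Real.rpow_mul (by positivity)]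
    have : ((2 : ℕ) : ℝ) * (-(3 / 2)) = -((3 : ℕ) : ℝ) := by norm_num
    rw [this, Real.rpow_neg (by positivity), Real.rpow_natCast]
    field_simp
    ring
  rw [e, Real.mul_rpow (by positivity) (by positivity), e2]
  simp only [Function.comp_apply]
  obtain ⟨r, hr⟩ : ∃ r, r = (1 + 216 * (x ^ 3)⁻¹) ^ (-(3 / 2) : ℝ) := ⟨_, rfl⟩
  rw [← hr]
  unfold Jh
  field_simp
  ring

lemma lim_J : Tendsto (fun x : ℝ => (Ih x * ((-1) * Jh x) ^ (-(2 / 3) : ℝ))) atTop (𝓝 (1 / kap)) := by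
  have hc : ContinuousAt (fun y : ℝ => 1 / kap * (1 - 216 * y) * (1 + 540 * y - 5832 * y ^ 2) ^ (-(2 / 3) : ℝ)) 0 := by
    apply ContinuousAt.mul (by fun_prop)
    apply ContinuousAt.rpow_const (by fun_prop)
    left; norm_num
  have h := hc.tendsto.comp inv_cube_tendsto
  norm_num at h
  rw [one_div]
  refine h.congr' ?_
  filter_upwards [eventually_gt_atTop 216] with x hx
  have hx0 : 0 < x := by linarith
  have e : (-1) * Jh x = (x ^ 2 * (kap / 8) ) ^ 3 * 2 ^ 2 * (1 + 540 * (x ^ 3)⁻¹ - 5832 * (x ^ 3)⁻¹ ^ 2) := by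
    have : (x ^ 2 * (kap / 8)) ^ 3 = x ^ 6 * kap ^ 3 / 512 := by ring
    rw [this, kap_cube]
    unfold Jh; field_simp; ring
  have hp : 0 ≤ 1 + 540 * (x ^ 3)⁻¹ - 5832 * (x ^ 3)⁻¹ ^ 2 := by
    have : (x ^ 3)⁻¹ ≤ 216⁻¹ := by
      apply inv_anti₀ (by norm_num)
      nlinarith [sq_nonneg x, sq_nonneg (x - 216)]
    have h3 : 0 < (x ^ 3)⁻¹ := by positivity
    nlinarith
  have hk := kap_pos
  have e2 : ((x ^ 2 * (kap / 8)) ^ 3 * 2 ^ 2) ^ (-(2 / 3) : ℝ) = 16 / (x ^ 4 * kap) := by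
    have a : (x ^ 2 * (kap / 8)) ^ 3 * 2 ^ 2 = (x ^ 2 * kap ^ 2 / 8) ^ 3 := by
      linear_combination (-(x ^ 6 * kap ^ 3 / 512)) * kap_cube
    rw [a, ← Real.rpow_natCast, ← Real.rpow_mul (by positivity)]
    have : ((3 : ℕ) : ℝ) * (-(2 / 3)) = -((2 : ℕ) : ℝ) := by norm_num
    rw [this, Real.rpow_neg (by positivity), Real.rpow_natCast]
    have : (x ^ 2 * kap ^ 2 / 8) ^ 2 = x ^ 4 * kap / 16 := by
      linear_combination (x ^ 4 * kap / 64) * kap_cube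
    rw [this, inv_div]
  rw [e, Real.mul_rpow (by positivity) hp, e2]
  simp only [Function.comp_apply]
  obtain ⟨r, hr⟩ : ∃ r, r = (1 + 540 * (x ^ 3)⁻¹ - 5832 * (x ^ 3)⁻¹ ^ 2) ^ (-(2 / 3) : ℝ) := ⟨_, rfl⟩
  rw [← hr]
  unfold Ih
  field_simp

lemma hd_neg (δ : ℝ) (h : δ ≤ -3) : Jh δ ^ 2 ≤ 4 * Ih δ ^ 3 ∧ 0 < Ih δ := by
  have h3 : δ ^ 3 ≤ (-3) ^ 3 := (Odd.strictMono_pow (by decide : Odd 3)).monotone h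
  norm_num at h3
  constructor
  · have := disc_h δ
    have h4 : (δ ^ 3 + 27) ^ 3 ≤ 0 := Odd.pow_nonpos (by decide) (by linarith)
    linarith
  · unfold Ih
    have : 0 < δ * (δ ^ 3 - 216) := mul_pos_of_neg_of_neg (by linarith) (by linarith)
    linarith

/-- value of the first one-dimensional integral -/
lemma K_pos : ∫⁻ x in Set.Iio (-3 : ℝ), ENNReal.ofReal (kk x) = ENNReal.ofReal (64 / 81) := by
  have e1 : ∫⁻ x in Set.Iio (-3 : ℝ), ENNReal.ofReal (kk x) = ∫⁻ x in Set.Ioi (3 : ℝ), ENNReal.ofReal (kk (-x)) := by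
    rw [← (Measure.measurePreserving_neg (volume : Measure ℝ)).setLIntegral_comp_preimage_emb (MeasurableEquiv.neg ℝ).measurableEmbedding]
    congr 2
    simp
  have e2 : ∫⁻ x in Set.Ioi (3 : ℝ), ENNReal.ofReal (kk (-x)) =
      ∫⁻ x in Set.Ioi (3 : ℝ), ENNReal.ofReal (16 / 81 * (1 * (81 / 16 * (27 + (-x) ^ 3) ^ 2) * (1 * Ih (-x)) ^ (-(5 / 2) : ℝ))) := by
    refine setLIntegral_congr_fun measurableSet_Ioi fun x hx => ?_
    have hx : 3 < x := hx
    obtain ⟨h1, h2⟩ := hd_neg (-x) (by linarith)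
    rw [kk_I 1 (-x) (by simp) (by linarith) (by rw [one_mul]; linarith)]
    congr 1
    ring
  rw [e1, e2, lint_Ioi (fun x => 16 / 81 * (-(Jh (-x) * (1 * Ih (-x)) ^ (-(3 / 2) : ℝ)))) _ 3 (16 / 81 * 2)]
  · obtain ⟨h1, h2⟩ := hd_neg (-3) le_rfl
    rw [val_I 1 (-3) 1 (by linarith) (by unfold Jh; norm_num) (by norm_num) (by unfold Ih Jh; norm_num)]
    norm_num
  · intro x hx
    have hx : 3 ≤ x := hx
    obtain ⟨h1, h2⟩ := hd_neg (-x) (by linarith)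
    have h3 := (derI 1 (-x) (by linarith)).comp x (hasDerivAt_neg x)
    refine ((h3.neg).const_mul (16 / 81)).congr_deriv ?_
    ring
  · intro x hx
    have hx : 3 < x := hx
    obtain ⟨h1, h2⟩ := hd_neg (-x) (by linarith)
    have : 0 ≤ 1 * Ih (-x) := by linarith
    positivity
  · exact lim_I.const_mul _

def pp (D : ℝ) : ℝ := D ^ 4 + 216 * D ^ 3 + 209952 * D ^ 2 - 8188128 * D + 17006112

lemma pp_eq (δ : ℝ) : 4 * Ih δ ^ 3 + Jh δ ^ 2 = pp (δ ^ 3) / 512 := by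
  unfold Ih Jh pp; ring

lemma pp_roots : ∃ a b : ℝ, 0 < a ∧ a < 10 ∧ 11 < b ∧ pp a = 0 ∧ pp b = 0 ∧ (∀ D, D ≤ a → 0 ≤ pp D) ∧
    (∀ D, a ≤ D → D ≤ b → pp D ≤ 0) ∧ ∀ D, b ≤ D → 0 ≤ pp D := by
  have hc : Continuous pp := by unfold pp; fun_prop
  obtain ⟨a, ⟨ha0, ha1⟩, hpa⟩ := intermediate_value_Ioo' (f := pp) (by norm_num : (0 : ℝ) ≤ 10) hc.continuousOn
    (show (0 : ℝ) ∈ Set.Ioo (pp 10) (pp 0) by unfold pp; norm_num)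
  obtain ⟨b, ⟨hb0, hb1⟩, hpb⟩ := intermediate_value_Ioo (f := pp) (by norm_num : (11 : ℝ) ≤ 100) hc.continuousOn
    (show (0 : ℝ) ∈ Set.Ioo (pp 11) (pp 100) by unfold pp; norm_num)
  have hr : ∀ D, 0 < D ^ 2 + (216 + (a + b)) * D + (209952 - a * b + (a + b) * (216 + (a + b))) := by
    intro D
    nlinarith [sq_nonneg (2 * D + (216 + (a + b))), sq_nonneg (a - b), mul_pos ha0 (by linarith : 0 < b)]
  have key : ∀ D, pp D = (D - a) * (D - b) * (D ^ 2 + (216 + (a + b)) * D + (209952 - a * b + (a + b) * (216 + (a + b)))) := by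
    intro D
    have h : b - a ≠ 0 := by linarith
    apply mul_left_cancel₀ h
    have h1 : (b - D) * pp a + (D - a) * pp b = 0 := by rw [hpa, hpb]; ring
    rw [← sub_eq_zero, ← h1]
    unfold pp
    ring
  refine ⟨a, b, ha0, ha1, hb0, hpa, hpb, ?_, ?_, ?_⟩
  · intro D hD
    rw [key]
    exact mul_nonneg (mul_nonneg_of_nonpos_of_nonpos (by linarith) (by linarith)) (hr D).le
  · intro D hD hD'
    rw [key]
    exact mul_nonpos_of_nonpos_of_nonneg (mul_nonpos_of_nonneg_of_nonpos (by linarith) (by linarith)) (hr D).le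
  · intro D hD
    rw [key]
    exact mul_nonneg (mul_nonneg (by linarith) (by linarith)) (hr D).le

lemma absI_le (δ : ℝ) (h : -3 ≤ δ) (hp : 0 ≤ pp (δ ^ 3)) : |Ih δ| ^ 3 ≤ Jh δ ^ 2 / 4 := by
  have h3 : (-3) ^ 3 ≤ δ ^ 3 := (Odd.strictMono_pow (by decide : Odd 3)).monotone h
  have h4 : 0 ≤ (δ ^ 3 + 27) ^ 3 := pow_nonneg (by linarith) 3
  have h1 := disc_h δ
  have h2 := pp_eq δ
  rcases abs_cases (Ih δ) with ⟨e, _⟩ | ⟨e, _⟩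
  · rw [e]; linarith
  · rw [e]
    have : (-Ih δ) ^ 3 = -Ih δ ^ 3 := by ring
    rw [this]
    linarith

lemma K_neg : ∫⁻ x in Set.Ioi (-3 : ℝ), ENNReal.ofReal (kk x) = ENNReal.ofReal (256 / 81) := by
  obtain ⟨a3, b3, ha0, ha1, hb0, hpa, hpb, hp1, hp2, hp3⟩ := pp_roots
  obtain ⟨a, rfl⟩ := cbrt a3
  obtain ⟨b, rfl⟩ := cbrt b3
  have hmono := (Odd.strictMono_pow (R := ℝ) (by decide : Odd 3))
  have hab : a < b := hmono.lt_iff_lt.mp (show a ^ 3 < b ^ 3 by linarith)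
  have ha : 0 < a := hmono.lt_iff_lt.mp (show 0 ^ 3 < a ^ 3 by linarith)
  have hb : b < 6 := by
    by_contra hcon
    have : 6 ^ 3 ≤ b ^ 3 := hmono.monotone (not_lt.mp hcon)
    have h6 := hp2 216 (by linarith) (by norm_num at this; linarith)
    unfold pp at h6
    norm_num at h6
  have hk := kap_pos
  have J1 : ∀ x, -3 ≤ x → x ≤ a → 0 < 1 * Jh x := by
    intro x h1 h2
    have e1 : (-3) ^ 3 ≤ x ^ 3 := hmono.monotone h1
    have e2 : x ^ 3 ≤ a ^ 3 := hmono.monotone h2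
    have e3 : Jh x = -((x ^ 3) ^ 2 + 540 * x ^ 3 - 5832) / 32 := by unfold Jh; ring
    rw [e3]
    have : (x ^ 3 + 550) * (x ^ 3 - 10) ≤ 0 := mul_nonpos_of_nonneg_of_nonpos (by linarith) (by linarith)
    nlinarith
  have J2 : ∀ x, b ≤ x → 0 < (-1) * Jh x := by
    intro x h1
    have e1 : b ^ 3 ≤ x ^ 3 := hmono.monotone h1
    have e3 : Jh x = -((x ^ 3) ^ 2 + 540 * x ^ 3 - 5832) / 32 := by unfold Jh; ring
    rw [e3]
    nlinarith
  have I1 : ∀ x, a ≤ x → x ≤ b → 0 < (-1) * Ih x := by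
    intro x h1 h2
    have : x ^ 3 < 216 := by
      have : x ^ 3 < 6 ^ 3 := hmono (lt_of_le_of_lt h2 hb)
      linarith
    unfold Ih
    have := mul_pos (lt_of_lt_of_le ha h1) (sub_pos.mpr this)
    linarith
  have pa := pp_eq a
  rw [hpa] at pa
  have pb := pp_eq b
  rw [hpb] at pb
  have p1 : ∫⁻ x in Set.Ioc (-3 : ℝ) a, ENNReal.ofReal (kk x) = ENNReal.ofReal (96 / 81) := by
    have e2 : ∫⁻ x in Set.Ioc (-3 : ℝ) a, ENNReal.ofReal (kk x) = ∫⁻ x in Set.Ioc (-3 : ℝ) a,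
        ENNReal.ofReal (-(48 / 81 * kap) * (-(2 / 3) * 1 * (81 / 16 * (27 + x ^ 3) ^ 2) * (1 * Jh x) ^ (-(5 / 3) : ℝ))) := by
      refine setLIntegral_congr_fun measurableSet_Ioc fun x hx => ?_
      rw [kk_J 1 x (by simp) (J1 x hx.1.le hx.2) (absI_le x hx.1.le (hp1 _ (hmono.monotone hx.2)))]
      congr 1
      ring
    rw [e2, lint_Ioc (fun x => -(48 / 81 * kap) * (Ih x * (1 * Jh x) ^ (-(2 / 3) : ℝ))) _ _ _ (by linarith)]
    · rw [val_J 1 a (-1) (J1 a (by linarith) le_rfl) (by norm_num) (by norm_num) (by linarith),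
        val_J 1 (-3) 1 (J1 (-3) le_rfl (by linarith)) (by norm_num) (by norm_num) (by unfold Ih Jh; norm_num)]
      congr 1
      field_simp
      norm_num
    · intro x hx
      exact (derJ 1 x (J1 x hx.1 hx.2)).const_mul _
    · intro x hx
      have h1 := Real.rpow_nonneg (J1 x hx.1 hx.2).le (-(5 / 3))
      have h2 : 0 ≤ kap * ((27 + x ^ 3) ^ 2 * (1 * Jh x) ^ (-(5 / 3) : ℝ)) := by positivity
      nlinarith
  have p2 : ∫⁻ x in Set.Ioc a b, ENNReal.ofReal (kk x) = ENNReal.ofReal (64 / 81) := by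
    have e2 : ∫⁻ x in Set.Ioc a b, ENNReal.ofReal (kk x) = ∫⁻ x in Set.Ioc a b,
        ENNReal.ofReal (-(16 / 81) * ((-1) * (81 / 16 * (27 + x ^ 3) ^ 2) * ((-1) * Ih x) ^ (-(5 / 2) : ℝ))) := by
      refine setLIntegral_congr_fun measurableSet_Ioc fun x hx => ?_
      have hq := hp2 (x ^ 3) (hmono.monotone hx.1.le) (hmono.monotone hx.2)
      have hq2 := pp_eq x
      rw [kk_I (-1) x (by simp) (I1 x hx.1.le hx.2) (by
        have : (-1 * Ih x) ^ 3 = - Ih x ^ 3 := by ring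
        rw [this]; linarith)]
      congr 1
      ring
    rw [e2, lint_Ioc (fun x => -(16 / 81) * (Jh x * ((-1) * Ih x) ^ (-(3 / 2) : ℝ))) _ _ _ (by linarith)]
    · rw [val_I (-1) a 1 (I1 a le_rfl hab.le) (J1 a (by linarith) le_rfl) (by norm_num) (by
          have : (-1 * Ih a) ^ 3 = - Ih a ^ 3 := by ring
          rw [this]; linarith),
        val_I (-1) b (-1) (I1 b hab.le le_rfl) (J2 b le_rfl) (by norm_num) (by
          have : (-1 * Ih b) ^ 3 = - Ih b ^ 3 := by ring
          rw [this]; linarith)]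
      norm_num
    · intro x hx
      exact (derI (-1) x (I1 x hx.1 hx.2)).const_mul _
    · intro x hx
      have h1 := Real.rpow_nonneg (I1 x hx.1 hx.2).le (-(5 / 2))
      have h2 : 0 ≤ ((27 + x ^ 3) ^ 2 * ((-1) * Ih x) ^ (-(5 / 2) : ℝ)) := by positivity
      nlinarith
  have p3 : ∫⁻ x in Set.Ioi b, ENNReal.ofReal (kk x) = ENNReal.ofReal (96 / 81) := by
    have e2 : ∫⁻ x in Set.Ioi b, ENNReal.ofReal (kk x) = ∫⁻ x in Set.Ioi b,
        ENNReal.ofReal ((48 / 81 * kap) * (-(2 / 3) * (-1) * (81 / 16 * (27 + x ^ 3) ^ 2) * ((-1) * Jh x) ^ (-(5 / 3) : ℝ))) := by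
      refine setLIntegral_congr_fun measurableSet_Ioi fun x hx => ?_
      have hx : b < x := hx
      rw [kk_J (-1) x (by simp) (J2 x hx.le) (absI_le x (by linarith) (hp3 _ (hmono.monotone hx.le)))]
      congr 1
      ring
    rw [e2, lint_Ioi (fun x => (48 / 81 * kap) * (Ih x * ((-1) * Jh x) ^ (-(2 / 3) : ℝ))) _ _ (48 / 81 * kap * (1 / kap))]
    · rw [val_J (-1) b (-1) (J2 b le_rfl) (by norm_num) (by norm_num) (by linarith)]
      congr 1
      field_simp
      norm_num
    · intro x hx
      exact (derJ (-1) x (J2 x hx)).const_mul _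
    · intro x hx
      have h1 := Real.rpow_nonneg (J2 x (le_of_lt hx)).le (-(5 / 3))
      have h2 : 0 ≤ kap * ((27 + x ^ 3) ^ 2 * ((-1) * Jh x) ^ (-(5 / 3) : ℝ)) := by positivity
      nlinarith
    · exact lim_J.const_mul _
  rw [← Set.Ioc_union_Ioi_eq_Ioi (by linarith : (-3 : ℝ) ≤ a), lintegral_union measurableSet_Ioi (Set.Ioc_disjoint_Ioi le_rfl),
    ← Set.Ioc_union_Ioi_eq_Ioi hab.le, lintegral_union measurableSet_Ioi (Set.Ioc_disjoint_Ioi le_rfl), p1, p2, p3,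
    ← ENNReal.ofReal_add (by norm_num) (by norm_num), ← ENNReal.ofReal_add (by norm_num) (by norm_num)]
  norm_num

end TC


namespace TC
open Matrix Filter Topology MeasureTheory

variable {P Q : MvPolynomial (Fin 10) ℚ}

noncomputable def hv (P Q : MvPolynomial (Fin 10) ℚ) (c : Fin 10 → ℝ) : ℝ := max (|iv P c| ^ 3) (iv Q c ^ 2 / 4)
noncomputable def dv (P Q : MvPolynomial (Fin 10) ℚ) (c : Fin 10 → ℝ) : ℝ := 4 * iv P c ^ 3 - iv Q c ^ 2

open Classical in
/-- the weight on forms -/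
noncomputable def WV (T : ℝ) (c : Fin 10 → ℝ) : ℝ :=
  if h : ∃ (g : M3) (δ : ℝ), 0 < g.det ∧ δ ≠ -3 ∧ c = act g (hes δ) then ww T h.choose else 0

open Classical in
noncomputable def psi (P Q : MvPolynomial (Fin 10) ℚ) (s T : ℝ) (c : Fin 10 → ℝ) : ℝ :=
  if hv P Q c < 1 ∧ 0 < s * dv P Q c then WV T c else 0

lemma WV_eq (T : ℝ) (g : M3) (δ : ℝ) (hg : 0 < g.det) (hδ : δ ≠ -3) : WV T (act g (hes δ)) = ww T g := by
  have h : ∃ (g' : M3) (δ' : ℝ), 0 < g'.det ∧ δ' ≠ -3 ∧ act g (hes δ) = act g' (hes δ') := ⟨g, δ, hg, hδ, rfl⟩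
  unfold WV
  rw [dif_pos h]
  obtain ⟨g', hg'⟩ : ∃ g', g' = h.choose := ⟨_, rfl⟩
  obtain ⟨δ', h1, h2, h3⟩ := h.choose_spec
  rw [← hg'] at h1 h3 ⊢
  rcases (hes_unique g g' hg h1 δ δ' hδ h3).2 with e | e | e
  · rw [e]
  · rw [e, (ww_cyc T g).1]
  · rw [e, (ww_cyc T g).2]

lemma WV_nonneg (T : ℝ) (c : Fin 10 → ℝ) : 0 ≤ WV T c := by
  unfold WV
  split_ifs
  · exact ww_nonneg T _
  · exact le_rfl

lemma WV_le_one (T : ℝ) (hT : 0 < T) (c : Fin 10 → ℝ) : WV T c ≤ 1 := by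
  unfold WV
  split_ifs
  · exact ww_le_one T hT _
  · exact zero_le_one

lemma psi_nonneg (s T : ℝ) (c : Fin 10 → ℝ) : 0 ≤ psi P Q s T c := by
  unfold psi
  split_ifs
  · exact WV_nonneg T c
  · exact le_rfl

lemma hv_continuous : Continuous (hv P Q) := by
  have := iv_continuous P
  have := iv_continuous Q
  unfold hv; fun_prop

lemma dv_continuous : Continuous (dv P Q) := by
  have := iv_continuous P
  have := iv_continuous Q
  unfold dv; fun_prop

lemma cbd (d δ : ℝ) (hd : 0 < d) (h1 : |d ^ 4 * Ih δ| ≤ 1) (h2 : |d ^ 6 * Jh δ| ≤ 2) : d * (1 + |δ|) ≤ 26 := by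
  rw [abs_mul, abs_of_pos (by positivity)] at h1 h2
  rcases le_total 12 |δ| with h | h
  · have h3 : (12 : ℝ) ^ 3 ≤ |δ| ^ 3 := pow_le_pow_left₀ (by norm_num) h 3
    have h4 : |δ| ^ 3 / 2 ≤ |δ ^ 3 - 216| := by
      have := abs_sub_abs_le_abs_sub (δ ^ 3) 216
      rw [abs_pow, abs_of_pos (by norm_num : (0 : ℝ) < 216)] at this
      linarith
    have h5 : |Ih δ| = |δ| * |δ ^ 3 - 216| / 16 := by
      unfold Ih; rw [abs_div, abs_mul, abs_of_pos (by norm_num : (0 : ℝ) < 16)]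
    have h6 : |δ| ^ 4 / 32 ≤ |Ih δ| := by
      rw [h5]
      have := mul_le_mul_of_nonneg_left h4 (abs_nonneg δ)
      nlinarith
    have h7 : (d * |δ|) ^ 4 ≤ 3 ^ 4 := by
      rw [mul_pow]
      have := mul_le_mul_of_nonneg_left h6 (by positivity : 0 ≤ d ^ 4)
      linarith
    have h8 : d * |δ| ≤ 3 := le_of_pow_le_pow_left₀ (by norm_num) (by norm_num) h7
    nlinarith
  · have hd2 : d ≤ 2 := by
      by_cases hJ : 1 ≤ |Jh δ|
      · have : d ^ 6 ≤ 2 ^ 6 := by nlinarith [pow_pos hd 6]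
        exact le_of_pow_le_pow_left₀ (by norm_num) (by norm_num) this
      · push Not at hJ
        have hI : 1 / 16 ≤ |Ih δ| := by
          obtain ⟨D, hD⟩ : ∃ D, D = δ ^ 3 := ⟨_, rfl⟩
          have eJ : Jh δ = -(D ^ 2 + 540 * D - 5832) / 32 := by unfold Jh; rw [hD]; ring
          rw [eJ, abs_lt] at hJ
          have hD5 : 5 ≤ |D| := by
            by_contra hc
            push Not at hc
            rw [abs_lt] at hc
            nlinarith
          have h216 : 1 ≤ |D - 216| := by
            by_contra hc
            push Not at hc
            rw [abs_lt] at hc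
            nlinarith
          have h1 : 1 ≤ |δ| := by
            by_contra hc
            push Not at hc
            have : |δ| ^ 3 ≤ 1 := pow_le_one₀ (abs_nonneg _) hc.le
            rw [← abs_pow, ← hD] at this
            linarith
          have h5 : |Ih δ| = |δ| * |D - 216| / 16 := by
            unfold Ih; rw [abs_div, abs_mul, abs_of_pos (by norm_num : (0 : ℝ) < 16), hD]
          rw [h5]
          nlinarith
        have : d ^ 4 ≤ 2 ^ 4 := by nlinarith [pow_pos hd 4]
        exact le_of_pow_le_pow_left₀ (by norm_num) (by norm_num) this
    nlinarith [abs_nonneg δ]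

lemma hv_lt {c : Fin 10 → ℝ} (h : hv P Q c < 1) : |iv P c| ≤ 1 ∧ |iv Q c| ≤ 2 := by
  unfold hv at h
  rw [max_lt_iff] at h
  constructor
  · exact le_of_pow_le_pow_left₀ (n := 3) (by norm_num) (by norm_num) (by linarith)
  · apply abs_le_of_sq_le_sq (by linarith) (by norm_num)

lemma surj_of_det (f : V10 →L[ℝ] V10) (h : f.det ≠ 0) : f.range = ⊤ := by
  have : IsUnit (f : V10 →ₗ[ℝ] V10) := by
    rw [LinearMap.isUnit_iff_isUnit_det]
    exact isUnit_iff_ne_zero.mpr h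
  exact LinearMap.range_eq_top.mpr ((Module.End.isUnit_iff _).mp this).2

lemma jac_ne (x : V10) (hx : (mt x).det ≠ 0) (hδ : x 0 ≠ -3) : (fderiv ℝ Ph x).det ≠ 0 := by
  have h := jac x hx
  intro h0
  rw [h0, abs_zero] at h
  have h1 : 0 < |(mt x).det| ^ 7 := by positivity
  have h2 : 27 + x 0 ^ 3 ≠ 0 := by
    intro hh
    apply hδ
    apply cube_inj
    linarith
  have h3 : 0 < (27 + x 0 ^ 3) ^ 2 := by positivity
  nlinarith [mul_pos h1 h3]

lemma Ph_nhds (x : V10) (hx : (mt x).det ≠ 0) (hδ : x 0 ≠ -3) : Filter.map Ph (𝓝 x) = 𝓝 (Ph x) :=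
  (Ph_diff x).map_nhds_eq_of_surj (surj_of_det _ (jac_ne x hx hδ))

lemma mt_continuous : Continuous mt := by
  refine continuous_matrix fun i j => ?_
  fin_cases i <;> fin_cases j <;> exact continuous_apply _

lemma mtdet_continuous : Continuous fun x : V10 => (mt x).det := det_continuous.comp mt_continuous

lemma WV_cont (T : ℝ) (hT : 0 < T) (g : M3) (δ : ℝ) (hg : 0 < g.det) (hδ : δ ≠ -3) :
    ContinuousAt (WV T) (act g (hes δ)) := by
  obtain ⟨x, hx⟩ : ∃ x, x = co δ g := ⟨_, rfl⟩
  have h1 : mt x = g := by rw [hx, mt_co]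
  have h2 : x 0 = δ := by rw [hx]; rfl
  have e : act g (hes δ) = Ph x := by unfold Ph; rw [h1, h2]
  rw [← h1] at hg
  rw [← h2] at hδ
  unfold ContinuousAt
  rw [e, ← Ph_nhds x hg.ne' hδ, tendsto_map'_iff]
  have e3 : WV T (Ph x) = ww T (mt x) := WV_eq T _ _ hg hδ
  rw [e3]
  have ht : Tendsto (fun x => ww T (mt x)) (𝓝 x) (𝓝 (ww T (mt x))) :=
    (ww_cont T hT _ hg).tendsto.comp mt_continuous.continuousAt
  refine ht.congr' ?_
  filter_upwards [mtdet_continuous.continuousAt.eventually_const_lt hg, (continuous_apply 0).continuousAt.eventually_ne hδ] with y hy hy'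
  exact (WV_eq T _ _ hy hy').symm

lemma iv_poly (P : MvPolynomial (Fin 10) ℚ) (c : Fin 10 → ℝ) : MvPolynomial.eval c (MvPolynomial.map (algebraMap ℚ ℝ) P) = iv P c := by
  simp [iv, MvPolynomial.aeval_def, MvPolynomial.eval_map]

variable (h : IsInvariantPair ℚ P Q)
include h

lemma WV_cont' (T : ℝ) (hT : 0 < T) (c : Fin 10 → ℝ) (hd : dv P Q c ≠ 0) : ContinuousAt (WV T) c := by
  obtain ⟨g, δ, hg, hδ, rfl⟩ := exists_hesse h c (sub_ne_zero.mp hd)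
  exact WV_cont T hT g δ hg hδ

lemma iv_zero : iv P 0 = 0 ∧ iv Q 0 = 0 := by
  have := iv_smul h 0 0
  simpa using this

lemma dv_ae : ∀ᵐ c, dv P Q c ≠ 0 := by
  refine poly_ae (dv P Q) (4 * (MvPolynomial.map (algebraMap ℚ ℝ) P) ^ 3 - (MvPolynomial.map (algebraMap ℚ ℝ) Q) ^ 2)
    (fun c => ?_) (hes 0) ?_
  · rw [map_sub, map_mul, map_pow, map_pow, iv_poly, iv_poly]; simp [dv]
  · unfold dv
    rw [(hes_inv h 0).1, (hes_inv h 0).2]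
    norm_num

lemma hv_ae : ∀ᵐ c, hv P Q c ≠ 1 := by
  have h1 := poly_ae (fun c => iv P c ^ 2 - 1) ((MvPolynomial.map (algebraMap ℚ ℝ) P) ^ 2 - 1)
    (fun c => by rw [map_sub, map_pow, iv_poly]; simp) 0 (by simp [(iv_zero h).1])
  have h2 := poly_ae (fun c => iv Q c ^ 2 - 4) ((MvPolynomial.map (algebraMap ℚ ℝ) Q) ^ 2 - 4)
    (fun c => by rw [map_sub, map_pow, iv_poly]; simp) 0 (by simp [(iv_zero h).2])
  filter_upwards [h1, h2] with c h1 h2 h3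
  unfold hv at h3
  rcases max_choice (|iv P c| ^ 3) (iv Q c ^ 2 / 4) with e | e
  · rw [e] at h3
    apply h1
    have : |iv P c| = 1 := by
      apply cube_inj; rw [h3]; norm_num
    rw [← sq_abs, this]; norm_num
  · rw [e] at h3
    apply h2; linarith

lemma psi_cont (s T : ℝ) (hs : s ≠ 0) (hT : 0 < T) : ∀ᵐ c, ContinuousAt (psi P Q s T) c := by
  filter_upwards [dv_ae h, hv_ae h] with c hd hh
  have hc1 : ContinuousAt (hv P Q) c := hv_continuous.continuousAt
  have hc2 : ContinuousAt (fun c => s * dv P Q c) c := (continuous_const.mul dv_continuous).continuousAt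
  have hd' : s * dv P Q c ≠ 0 := mul_ne_zero hs hd
  by_cases hE : hv P Q c < 1 ∧ 0 < s * dv P Q c
  · refine (WV_cont' h T hT c hd).congr ?_
    filter_upwards [hc1.eventually_lt_const hE.1, hc2.eventually_const_lt hE.2] with y h1 h2
    unfold psi
    rw [if_pos ⟨h1, h2⟩]
  · refine (continuousAt_const (y := (0 : ℝ))).congr ?_
    have : ∀ᶠ y in 𝓝 c, ¬(hv P Q y < 1 ∧ 0 < s * dv P Q y) := by
      rw [not_and_or, not_lt, not_lt] at hE
      rcases hE with hE | hE
      · filter_upwards [hc1.eventually_const_lt (lt_of_le_of_ne hE (Ne.symm hh))] with y h1 h2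
        linarith [h2.1]
      · filter_upwards [hc2.eventually_lt_const (lt_of_le_of_ne hE hd')] with y h1 h2
        linarith [h2.2]
    filter_upwards [this] with y hy
    unfold psi
    rw [if_neg hy]

lemma psi_meas (s T : ℝ) (hT : 0 < T) : AEStronglyMeasurable (psi P Q s T) volume := by
  have hE : IsOpen {c | hv P Q c < 1 ∧ 0 < s * dv P Q c} :=
    (isOpen_lt hv_continuous continuous_const).inter (isOpen_lt continuous_const (continuous_const.mul dv_continuous))
  have e : psi P Q s T = Set.indicator {c | hv P Q c < 1 ∧ 0 < s * dv P Q c} (WV T) := by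
    funext c
    unfold psi
    rw [Set.indicator_apply]
    congr
  rw [e, aestronglyMeasurable_indicator_iff hE.measurableSet]
  apply ContinuousOn.aestronglyMeasurable _ hE.measurableSet
  intro c hc
  apply (WV_cont' h T hT c _).continuousWithinAt
  intro h0
  have := hc.2
  rw [h0] at this
  simp at this

/-- determinant bound for a form of bounded height -/
lemma hes_bd {g : M3} {δ : ℝ} (hg : 0 < g.det) (hh : hv P Q (act g (hes δ)) < 1) : g.det * (1 + |δ|) ≤ 26 := by
  have := hv_lt hh
  rw [(iv_hes h g δ).1, (iv_hes h g δ).2] at this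
  exact cbd _ _ hg this.1 this.2

lemma hes_box {g : M3} {δ T : ℝ} (hg : 0 < g.det) (hT : 0 < T) (hh : hv P Q (act g (hes δ)) < 1)
    (hN : N2 g ≤ 2 * T ^ 2 * cb g.det ^ 2) (i : Fin 10) : |act g (hes δ) i| ≤ 60 * 26 * (2 * T) ^ 3 := by
  have hd := hes_bd h hg hh
  obtain ⟨u, hu⟩ : ∃ u, u = cb g.det := ⟨_, rfl⟩
  have hu0 : 0 < u := by rw [hu]; exact cb_pos hg
  have hu3 : u ^ 3 = g.det := by rw [hu]; exact cb_cube hg.le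
  have hent : ∀ i j, |g i j| ≤ 2 * T * u := by
    intro i j
    apply N2_entry g i j _ (by positivity)
    rw [← hu] at hN
    nlinarith [sq_nonneg (T * u)]
  have hV : ∀ i, |hes δ i| ≤ 1 + |δ| := by
    intro i
    have := abs_nonneg δ
    fin_cases i <;> simp [hes] <;> linarith
  have hb := act_bound g (hes δ) (1 + |δ|) (fun _ => 2 * T * u) hV (fun i j => hent i j) i
  have hmo : mo (fun _ => 2 * T * u) i = (2 * T) ^ 3 * u ^ 3 := by
    fin_cases i <;> simp [mo] <;> ring
  rw [hmo, hu3] at hb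
  calc |act g (hes δ) i| ≤ _ := hb
    _ = 60 * (g.det * (1 + |δ|)) * (2 * T) ^ 3 := by ring
    _ ≤ _ := by gcongr

lemma psi_tame (s T : ℝ) (hT : 0 < T) : Tame (psi P Q s T) 1 (60 * 26 * (2 * T) ^ 3) := by
  constructor
  · intro x
    rw [abs_of_nonneg (psi_nonneg s T x)]
    unfold psi
    split_ifs
    · exact WV_le_one T hT x
    · exact zero_le_one
  · intro x hx i
    unfold psi at hx
    split_ifs at hx with hE
    · have hd : dv P Q x ≠ 0 := by
        intro h0
        have := hE.2
        rw [h0] at this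
        simp at this
      obtain ⟨g, δ, hg, hδ, rfl⟩ := exists_hesse h x (sub_ne_zero.mp hd)
      rw [WV_eq T g δ hg hδ] at hx
      exact hes_box h hg hT hE.1 (ww_ne hT hx).2 i
    · exact absurd rfl hx

end TC


namespace TC
open Matrix Filter Topology MeasureTheory

open Classical in
/-- the pulled back integrand -/
noncomputable def GG' (A : Set ℝ) (T : ℝ) (x : V10) : ℝ :=
  if 0 < (mt x).det ∧ x 0 ∈ A ∧ (mt x).det ^ 12 * hh0 (x 0) < 1
    then ww T (mt x) * (mt x).det ^ 7 * (27 * (27 + x 0 ^ 3) ^ 2) else 0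

lemma hh0_continuous : Continuous hh0 := by
  unfold hh0 Ih Jh; fun_prop

lemma hh0_pos (δ : ℝ) (hδ : δ ≠ -3) : 0 < hh0 δ := by
  by_contra hc
  push Not at hc
  unfold hh0 at hc
  rw [max_le_iff] at hc
  have hI : Ih δ = 0 := by
    have : |Ih δ| ^ 3 = 0 := le_antisymm hc.1 (by positivity)
    exact abs_eq_zero.mp (pow_eq_zero_iff (by norm_num) |>.mp this)
  have hJ : Jh δ = 0 := by
    have : Jh δ ^ 2 = 0 := le_antisymm (by linarith [hc.2]) (by positivity)
    exact pow_eq_zero_iff (by norm_num) |>.mp this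
  have := disc_h δ
  rw [hI, hJ] at this
  have h3 : (δ ^ 3 + 27) ^ 3 = 0 := by linarith
  have h4 : δ ^ 3 + 27 = 0 := pow_eq_zero_iff (by norm_num) |>.mp h3
  apply hδ
  apply cube_inj
  linarith

lemma GG'_meas (A : Set ℝ) (hA : MeasurableSet A) (T : ℝ) (hT : 0 < T) : Measurable (GG' A T) := by
  have hO : MeasurableSet {x : V10 | 0 < (mt x).det} := (isOpen_lt continuous_const mtdet_continuous).measurableSet
  have hw : Measurable (Set.indicator {x : V10 | 0 < (mt x).det} (fun x => ww T (mt x))) := by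
    classical
    rw [← Set.piecewise_eq_indicator]
    apply ContinuousOn.measurable_piecewise _ continuousOn_const hO
    intro x hx
    exact ((ww_cont T hT _ hx).comp mt_continuous.continuousAt).continuousWithinAt
  have hE : MeasurableSet {x : V10 | 0 < (mt x).det ∧ x 0 ∈ A ∧ (mt x).det ^ 12 * hh0 (x 0) < 1} := by
    refine hO.inter (((measurable_pi_apply (0 : Fin 10)) hA).inter ?_)
    exact (isOpen_lt ((mtdet_continuous.pow 12).mul (hh0_continuous.comp (continuous_apply 0))) continuous_const).measurableSet
  have e : GG' A T = Set.indicator {x : V10 | 0 < (mt x).det ∧ x 0 ∈ A ∧ (mt x).det ^ 12 * hh0 (x 0) < 1}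
      (fun x => Set.indicator {x : V10 | 0 < (mt x).det} (fun x => ww T (mt x)) x * (mt x).det ^ 7 * (27 * (27 + x 0 ^ 3) ^ 2)) := by
    funext x
    unfold GG'
    by_cases h : 0 < (mt x).det ∧ x 0 ∈ A ∧ (mt x).det ^ 12 * hh0 (x 0) < 1
    · rw [if_pos h, Set.indicator_of_mem (show x ∈ {x : V10 | 0 < (mt x).det ∧ x 0 ∈ A ∧ (mt x).det ^ 12 * hh0 (x 0) < 1} from h),
        Set.indicator_of_mem (show x ∈ {x : V10 | 0 < (mt x).det} from h.1)]
    · rw [if_neg h, Set.indicator_of_notMem (show ¬ x ∈ {x : V10 | 0 < (mt x).det ∧ x 0 ∈ A ∧ (mt x).det ^ 12 * hh0 (x 0) < 1} from h)]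
  rw [e]
  refine Measurable.indicator ?_ hE
  refine (hw.mul (mtdet_continuous.pow 7).measurable).mul ?_
  exact (continuous_const.mul ((continuous_const.add ((continuous_apply 0).pow 3)).pow 2)).measurable

lemma psM_integrable (T : ℝ) (hT : 0 < T) : Integrable (psM T) := by
  have hcd : Continuous fun y : Fin 9 → ℝ => (m9 y).det := det_continuous.comp m9_continuous
  have hO : MeasurableSet {y : Fin 9 → ℝ | 0 < (m9 y).det ∧ (m9 y).det < 1} :=
    ((isOpen_lt continuous_const hcd).inter (isOpen_lt hcd continuous_const)).measurableSet
  have e : psM T = Set.indicator {y : Fin 9 → ℝ | 0 < (m9 y).det ∧ (m9 y).det < 1} (fun y => ww T (m9 y) * (m9 y).det ^ 7) := by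
    funext y
    unfold psM
    by_cases h0 : 0 < (m9 y).det
    · by_cases h1 : (m9 y).det < 1
      · rw [if_pos h1, Set.indicator_of_mem (show y ∈ {y : Fin 9 → ℝ | 0 < (m9 y).det ∧ (m9 y).det < 1} from ⟨h0, h1⟩)]
      · rw [if_neg h1, Set.indicator_of_notMem (fun h => h1 h.2)]
    · rw [Set.indicator_of_notMem (fun h => h0 h.1)]
      have : ww T (m9 y) = 0 := by
        by_contra hc
        exact h0 (ww_ne hT hc).1
      rw [this]; simp
  have hm : AEStronglyMeasurable (psM T) volume := by
    rw [e, aestronglyMeasurable_indicator_iff hO]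
    apply ContinuousOn.aestronglyMeasurable _ hO
    intro y hy
    exact (((ww_cont T hT _ hy.1).comp m9_continuous.continuousAt).mul (hcd.continuousAt.pow 7)).continuousWithinAt
  have ht := psM_tame T hT
  have hi : Integrable (Set.indicator (Set.Icc (fun _ : Fin 9 => -(2 * T)) (fun _ => 2 * T)) (fun _ => (1 : ℝ))) := by
    rw [integrable_indicator_iff measurableSet_Icc]
    exact integrableOn_const (by rw [Real.volume_Icc_pi]; exact (ENNReal.prod_lt_top (fun _ _ => ENNReal.ofReal_lt_top)).ne) (by simp)
  refine hi.mono' hm (ae_of_all _ fun y => ?_)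
  rw [Real.norm_eq_abs]
  by_cases h0 : psM T y = 0
  · rw [h0, abs_zero]
    exact Set.indicator_nonneg (fun _ _ => zero_le_one) _
  · rw [Set.indicator_of_mem]
    · exact ht.bd y
    · exact ⟨fun i => (abs_le.mp (ht.supp y h0 i)).1, fun i => (abs_le.mp (ht.supp y h0 i)).2⟩

lemma psM_nonneg (T : ℝ) (hT : 0 < T) (y : Fin 9 → ℝ) : 0 ≤ psM T y := by
  unfold psM
  split_ifs
  · by_cases h0 : ww T (m9 y) = 0
    · rw [h0]; simp
    · exact mul_nonneg (ww_nonneg T _) (pow_nonneg (ww_ne hT h0).1.le 7)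
  · exact le_rfl

lemma mu7_nonneg (T : ℝ) (hT : 0 < T) : 0 ≤ mu7 T := integral_nonneg (psM_nonneg T hT)

open Classical in
lemma inner_int (A : Set ℝ) (T : ℝ) (hT : 0 < T) (δ : ℝ) (hδ : δ ≠ -3) :
    ∫⁻ y : Fin 9 → ℝ, ENNReal.ofReal (GG' A T (Fin.cons δ y)) =
      Set.indicator A (fun δ => ENNReal.ofReal (27 * mu7 T) * ENNReal.ofReal (kk δ)) δ := by
  by_cases hA : δ ∈ A
  · rw [Set.indicator_of_mem hA]
    have hp := hh0_pos δ hδ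
    obtain ⟨r, hr, hr36⟩ := exists_root_pos 36 (by norm_num) _ hp
    have hr0 : r ^ 21 ≠ 0 := by positivity
    have e : ∀ y : Fin 9 → ℝ, GG' A T (Fin.cons δ y) = (27 * (27 + δ ^ 3) ^ 2 * (r ^ 21)⁻¹) * psM T (r • y) := by
      intro y
      have e1 : mt (Fin.cons δ y) = m9 y := rfl
      have e2 : (Fin.cons δ y : V10) 0 = δ := rfl
      have hdet : (m9 (r • y)).det = r ^ 3 * (m9 y).det := by
        rw [m9_smul, Matrix.det_smul, Fintype.card_fin]
      unfold GG' psM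
      rw [e1, e2, hdet, m9_smul, ww_smul T r hr]
      by_cases h0 : 0 < (m9 y).det
      · have hiff : (m9 y).det ^ 12 * hh0 δ < 1 ↔ r ^ 3 * (m9 y).det < 1 := by
          rw [← hr36]
          have : (m9 y).det ^ 12 * r ^ 36 = (r ^ 3 * (m9 y).det) ^ 12 := by ring
          rw [this]
          exact pow_lt_one_iff_of_nonneg (by positivity) (by norm_num)
        by_cases h1 : r ^ 3 * (m9 y).det < 1
        · rw [if_pos ⟨h0, hA, hiff.mpr h1⟩, if_pos h1]
          field_simp
        · rw [if_neg (fun h => h1 (hiff.mp h.2.2)), if_neg h1, mul_zero]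
      · rw [if_neg (fun h => h0 h.1)]
        have : ww T (m9 y) = 0 := by
          by_contra hc
          exact h0 (ww_ne hT hc).1
        rw [this]; simp
    simp_rw [e]
    have hi : Integrable fun y : Fin 9 → ℝ => (27 * (27 + δ ^ 3) ^ 2 * (r ^ 21)⁻¹) * psM T (r • y) :=
      ((psM_integrable T hT).comp_smul hr.ne').const_mul _
    rw [← ofReal_integral_eq_lintegral_ofReal hi (ae_of_all _ fun y => by
      have := psM_nonneg T hT (r • y)
      positivity), integral_const_mul, Measure.integral_comp_smul_of_nonneg volume (psM T) r (hR := hr.le), ← ENNReal.ofReal_mul (by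
        have := mu7_nonneg T hT
        positivity)]
    congr 1
    have hk : hh0 δ ^ (-(5 / 6) : ℝ) = (r ^ 30)⁻¹ := by
      rw [← hr36, ← Real.rpow_natCast r 36, ← Real.rpow_mul hr.le, ← Real.rpow_natCast r 30, ← Real.rpow_neg hr.le]
      norm_num
    unfold kk
    rw [hk]
    simp only [Module.finrank_fin_fun, smul_eq_mul]
    unfold mu7
    field_simp
  · rw [Set.indicator_of_notMem hA]
    have : ∀ y : Fin 9 → ℝ, GG' A T (Fin.cons δ y) = 0 := by
      intro y
      unfold GG'
      rw [if_neg]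
      rintro ⟨_, h, _⟩
      exact hA h
    simp_rw [this]
    simp

lemma GG'_int (A : Set ℝ) (hA : MeasurableSet A) (T : ℝ) (hT : 0 < T) :
    ∫⁻ x, ENNReal.ofReal (GG' A T x) = ENNReal.ofReal (27 * mu7 T) * ∫⁻ δ in A, ENNReal.ofReal (kk δ) := by
  have hm := (GG'_meas A hA T hT).ennreal_ofReal
  have hmp := (volume_preserving_piFinSuccAbove (fun _ : Fin (9 + 1) => ℝ) 0).symm
  have hk : Measurable kk := by
    unfold kk
    exact ((continuous_const.add (continuous_id.pow 3)).pow 2).measurable.mul (hh0_continuous.measurable.pow_const _)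
  rw [← hmp.lintegral_comp_emb (MeasurableEquiv.measurableEmbedding _)]
  have hm2 := hm.comp hmp.measurable
  rw [Measure.volume_eq_prod, lintegral_prod (fun z => ENNReal.ofReal (GG' A T ((MeasurableEquiv.piFinSuccAbove (fun _ => ℝ) 0).symm z))) hm2.aemeasurable, ← lintegral_const_mul _ hk.ennreal_ofReal, ← lintegral_indicator hA]
  apply lintegral_congr_ae
  have h3 : ∀ᵐ δ : ℝ, δ ≠ -3 := by
    rw [ae_iff]; simp
  filter_upwards [h3] with δ hδ
  rw [← inner_int A T hT δ hδ]
  apply lintegral_congr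
  intro y
  congr 2
  exact Fin.insertNth_zero (α := fun _ : Fin 10 => ℝ) δ y

end TC


namespace TC
open Matrix Filter Topology MeasureTheory

/-- column rotation -/
def sg : Equiv.Perm (Fin 10) where
  toFun := ![0, 2, 3, 1, 5, 6, 4, 8, 9, 7]
  invFun := ![0, 3, 1, 2, 6, 4, 5, 9, 7, 8]
  left_inv := by decide
  right_inv := by decide

noncomputable def rot : V10 ≃ᵐ V10 := MeasurableEquiv.piCongrLeft (fun _ => ℝ) sg

lemma rot_apply (x : V10) (i : Fin 10) : rot x (sg i) = x i :=
  Equiv.piCongrLeft_apply_apply (fun _ : Fin 10 => ℝ) sg x i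

lemma rot_vec (x : V10) : rot x = ![x 0, x 3, x 1, x 2, x 6, x 4, x 5, x 9, x 7, x 8] := by
  apply ext10
  · exact rot_apply x 0
  · exact rot_apply x 3
  · exact rot_apply x 1
  · exact rot_apply x 2
  · exact rot_apply x 6
  · exact rot_apply x 4
  · exact rot_apply x 5
  · exact rot_apply x 9
  · exact rot_apply x 7
  · exact rot_apply x 8

lemma rot_mp : MeasurePreserving rot := volume_measurePreserving_piCongrLeft (fun _ => ℝ) sg

lemma mul_cyc1 (g : M3) : g * cyc1 = !![g 0 2, g 0 0, g 0 1; g 1 2, g 1 0, g 1 1; g 2 2, g 2 0, g 2 1] := by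
  ext i j; fin_cases i <;> fin_cases j <;> simp [cyc1, Matrix.mul_apply, Fin.sum_univ_three]

lemma mul_cyc2 (g : M3) : g * cyc2 = !![g 0 1, g 0 2, g 0 0; g 1 1, g 1 2, g 1 0; g 2 1, g 2 2, g 2 0] := by
  ext i j; fin_cases i <;> fin_cases j <;> simp [cyc2, Matrix.mul_apply, Fin.sum_univ_three]

lemma mt_rot (x : V10) : mt (rot x) = mt x * cyc1 := by
  rw [mul_cyc1, rot_vec]; rfl

lemma GG'_rot (A : Set ℝ) (T : ℝ) (x : V10) : GG' A T (rot x) = GG' A T x := by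
  have e0 : rot x 0 = x 0 := by rw [rot_vec]; rfl
  unfold GG'
  rw [mt_rot, e0, (ww_cyc T _).1, Matrix.det_mul, det_cyc1, mul_one]

lemma cube_lt {a b : ℝ} : a ^ 3 < b ^ 3 ↔ a < b := (Odd.strictMono_pow (by decide : Odd 3)).lt_iff_lt

def U0 : Set V10 := {x | x 2 < x 1 ∧ x 3 < x 1}
def U1 : Set V10 := {x | x 1 < x 2 ∧ x 3 < x 2}
def U2 : Set V10 := {x | x 1 < x 3 ∧ x 2 < x 3}

lemma lt_open (i j : Fin 10) : IsOpen {x : V10 | x i < x j} := isOpen_lt (continuous_apply i) (continuous_apply j)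

lemma tie_ae : ∀ᵐ x : V10, x 1 ≠ x 2 ∧ x 1 ≠ x 3 ∧ x 2 ≠ x 3 := by
  have := poly_ae (n := 10) (fun x => (x 1 - x 2) * (x 1 - x 3) * (x 2 - x 3))
    ((.X 1 - .X 2) * (.X 1 - .X 3) * (.X 2 - .X 3)) (fun x => by simp) ![0, 1, 2, 3, 0, 0, 0, 0, 0, 0]
    (by simp; norm_num)
  filter_upwards [this] with x hx
  refine ⟨fun h => ?_, fun h => ?_, fun h => ?_⟩ <;> exact hx (by rw [h]; ring)

lemma third (A : Set ℝ) (hA : MeasurableSet A) (T : ℝ) (hT : 0 < T) :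
    ∫⁻ x, ENNReal.ofReal (GG' A T x) = 3 * ∫⁻ x in U0, ENNReal.ofReal (GG' A T x) := by
  have m0 : MeasurableSet U0 := ((lt_open 2 1).inter (lt_open 3 1)).measurableSet
  have m1 : MeasurableSet U1 := ((lt_open 1 2).inter (lt_open 3 2)).measurableSet
  have m2 : MeasurableSet U2 := ((lt_open 1 3).inter (lt_open 2 3)).measurableSet
  have hm := (GG'_meas A hA T hT).ennreal_ofReal
  have p2 : rot ⁻¹' U0 = U2 := by
    ext x; show rot x ∈ U0 ↔ _
    rw [rot_vec]; rfl
  have p1 : rot ⁻¹' U2 = U1 := by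
    ext x; show rot x ∈ U2 ↔ _
    rw [rot_vec]; unfold U1 U2; exact and_comm
  have i2 : ∫⁻ x in U2, ENNReal.ofReal (GG' A T x) = ∫⁻ x in U0, ENNReal.ofReal (GG' A T x) := by
    rw [← rot_mp.setLIntegral_comp_preimage_emb rot.measurableEmbedding _ U0, p2]
    simp_rw [GG'_rot]
  have i1 : ∫⁻ x in U1, ENNReal.ofReal (GG' A T x) = ∫⁻ x in U2, ENNReal.ofReal (GG' A T x) := by
    rw [← rot_mp.setLIntegral_comp_preimage_emb rot.measurableEmbedding _ U2, p1]
    simp_rw [GG'_rot]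
  have e : ∫⁻ x, ENNReal.ofReal (GG' A T x) = ∫⁻ x, (U0.indicator (fun x => ENNReal.ofReal (GG' A T x)) x +
      (U1.indicator (fun x => ENNReal.ofReal (GG' A T x)) x + U2.indicator (fun x => ENNReal.ofReal (GG' A T x)) x)) := by
    apply lintegral_congr_ae
    filter_upwards [tie_ae] with x hx
    by_cases h0 : x ∈ U0
    · have h1 : x ∉ U1 := fun h => absurd (h.1.trans h0.1) (lt_irrefl _)
      have h2 : x ∉ U2 := fun h => absurd (h.1.trans h0.2) (lt_irrefl _)
      rw [Set.indicator_of_mem h0, Set.indicator_of_notMem h1, Set.indicator_of_notMem h2]; simp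
    · rw [Set.indicator_of_notMem h0]
      by_cases h1 : x ∈ U1
      · have h2 : x ∉ U2 := fun h => absurd (h.2.trans h1.2) (lt_irrefl _)
        rw [Set.indicator_of_mem h1, Set.indicator_of_notMem h2]; simp
      · have h2 : x ∈ U2 := by
          by_contra h2
          unfold U0 U1 U2 at *
          simp only [Set.mem_ofPred_eq, not_and_or, not_lt] at h0 h1 h2
          obtain ⟨a, b, c⟩ := hx
          rcases lt_or_gt_of_ne a with a | a <;> rcases lt_or_gt_of_ne b with b | b <;> rcases lt_or_gt_of_ne c with c | c <;>
            rcases h0 with h0 | h0 <;> rcases h1 with h1 | h1 <;> rcases h2 with h2 | h2 <;> linarith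
        rw [Set.indicator_of_notMem h1, Set.indicator_of_mem h2]; simp
  rw [e, lintegral_add_left (hm.indicator m0), lintegral_add_left (hm.indicator m1), lintegral_indicator m0,
    lintegral_indicator m1, lintegral_indicator m2, i1, i2]
  ring

def UU : Set V10 := {x | 0 < (mt x).det ∧ x 0 ≠ -3 ∧ x ∈ U0}

lemma UU_open : IsOpen UU :=
  (isOpen_lt continuous_const mtdet_continuous).inter
    ((isOpen_ne_fun (continuous_apply 0) continuous_const).inter ((lt_open 2 1).inter (lt_open 3 1)))

lemma UU_inj : Set.InjOn Ph UU := by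
  intro x hx y hy e
  obtain ⟨e0, e1⟩ := hes_unique _ _ hx.1 hy.1 _ _ hx.2.1 e
  have h1 : mt y = mt x := by
    rcases e1 with e1 | e1 | e1
    · exact e1
    · exfalso
      rw [mul_cyc1] at e1
      have a := congrFun (congrFun e1 0) 0
      have b := congrFun (congrFun e1 0) 1
      have a' : y 1 = x 3 := a
      have b' : y 2 = x 1 := b
      have := hx.2.2.2
      have := hy.2.2.1
      linarith
    · exfalso
      rw [mul_cyc2] at e1
      have a := congrFun (congrFun e1 0) 0
      have b := congrFun (congrFun e1 0) 2
      have a' : y 1 = x 2 := a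
      have b' : y 3 = x 1 := b
      have := hx.2.2.1
      have := hy.2.2.2
      linarith
  rw [← co_mt x, ← co_mt y, h1, e0]

lemma UU_image : IsOpen (Ph '' UU) := by
  rw [isOpen_iff_mem_nhds]
  rintro _ ⟨x, hx, rfl⟩
  rw [← Ph_nhds x hx.1.ne' hx.2.1]
  exact Filter.image_mem_map (UU_open.mem_nhds hx)

variable {P Q : MvPolynomial (Fin 10) ℚ} (h : IsInvariantPair ℚ P Q)
include h

lemma hv_Ph (x : V10) : hv P Q (Ph x) = (mt x).det ^ 12 * hh0 (x 0) ∧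
    dv P Q (Ph x) = (mt x).det ^ 12 * (4 * Ih (x 0) ^ 3 - Jh (x 0) ^ 2) := by
  unfold hv dv hh0 Ph
  rw [(iv_hes h _ _).1, (iv_hes h _ _).2]
  constructor
  · rw [mul_max_of_nonneg _ _ (by positivity), abs_mul, abs_of_nonneg (by positivity : 0 ≤ (mt x).det ^ 4)]
    congr 1 <;> ring
  · ring

lemma off_image : ∀ᵐ c, dv P Q c ≠ 0 → c ∈ Ph '' UU := by
  have h0 : volume (Ph '' {x : V10 | ¬(x 1 ≠ x 2 ∧ x 1 ≠ x 3 ∧ x 2 ≠ x 3)}) = 0 := by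
    apply addHaar_image_eq_zero_of_differentiableOn_of_addHaar_eq_zero
    · intro x _
      exact (Ph_diff x).hasFDerivAt.differentiableAt.differentiableWithinAt
    · exact tie_ae
  filter_upwards [measure_eq_zero_iff_ae_notMem.mp h0] with c hc hd
  obtain ⟨g, δ, hg, hδ, rfl⟩ := exists_hesse h c (sub_ne_zero.mp hd)
  have key : ∀ g' : M3, act g' (hes δ) = act g (hes δ) → 0 < g'.det → g' 0 1 < g' 0 0 → g' 0 2 < g' 0 0 →
      act g (hes δ) ∈ Ph '' UU := by
    intro g' e hd' h1 h2
    refine ⟨co δ g', ⟨by rw [mt_co]; exact hd', hδ, h1, h2⟩, ?_⟩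
    unfold Ph
    rw [mt_co]
    exact e
  have ht : g 0 0 ≠ g 0 1 ∧ g 0 0 ≠ g 0 2 ∧ g 0 1 ≠ g 0 2 := by
    by_contra hn
    apply hc
    refine ⟨co δ g, hn, ?_⟩
    unfold Ph
    rw [mt_co]
    rfl
  have k0 := key g rfl hg
  have k1 := key (g * cyc1) (by rw [act_mul, act_cyc1]) (by rw [Matrix.det_mul, det_cyc1, mul_one]; exact hg)
  have k2 := key (g * cyc2) (by rw [act_mul, act_cyc2]) (by rw [Matrix.det_mul, det_cyc2, mul_one]; exact hg)
  rw [mul_cyc1] at k1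
  rw [mul_cyc2] at k2
  obtain ⟨a, b, c⟩ := ht
  rcases lt_or_gt_of_ne a with a | a
  · rcases lt_or_gt_of_ne c with c | c
    · exact k1 (a.trans c) c
    · exact k2 c a
  · rcases lt_or_gt_of_ne b with b | b
    · exact k1 b (a.trans b)
    · exact k0 a b

theorem psi_int (A : Set ℝ) (hA : MeasurableSet A) (s T : ℝ) (hT : 0 < T) (hA3 : (-3 : ℝ) ∉ A)
    (hs : ∀ δ, δ ≠ -3 → (0 < s * (4 * Ih δ ^ 3 - Jh δ ^ 2) ↔ δ ∈ A)) (K : ℝ) (hK0 : 0 ≤ K)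
    (hK : ∫⁻ δ in A, ENNReal.ofReal (kk δ) = ENNReal.ofReal K) :
    ∫ c, psi P Q s T c = 9 * mu7 T * K := by
  rw [integral_eq_lintegral_of_nonneg_ae (ae_of_all _ (psi_nonneg s T)) (psi_meas h s T hT)]
  have e1 : ∫⁻ c, ENNReal.ofReal (psi P Q s T c) = ∫⁻ c in Ph '' UU, ENNReal.ofReal (psi P Q s T c) := by
    rw [← lintegral_indicator UU_image.measurableSet]
    apply lintegral_congr_ae
    filter_upwards [off_image h] with c hc
    by_cases hm : c ∈ Ph '' UU
    · rw [Set.indicator_of_mem hm]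
    · rw [Set.indicator_of_notMem hm]
      have hd : dv P Q c = 0 := by
        by_contra hd
        exact hm (hc hd)
      unfold psi
      rw [if_neg, ENNReal.ofReal_zero]
      rintro ⟨_, h2⟩
      rw [hd] at h2
      simp at h2
  have e2 : ∫⁻ c in Ph '' UU, ENNReal.ofReal (psi P Q s T c) = ∫⁻ x in U0, ENNReal.ofReal (GG' A T x) := by
    rw [lintegral_image_eq_lintegral_abs_det_fderiv_mul volume UU_open.measurableSet
      (fun x _ => (Ph_diff x).hasFDerivAt.hasFDerivWithinAt) UU_inj,
      ← lintegral_indicator UU_open.measurableSet, ← lintegral_indicator (show MeasurableSet U0 from ((lt_open 2 1).inter (lt_open 3 1)).measurableSet)]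
    apply lintegral_congr
    intro x
    by_cases hx : x ∈ UU
    · rw [Set.indicator_of_mem hx, Set.indicator_of_mem (show x ∈ _ from hx.2.2), ← ENNReal.ofReal_mul (abs_nonneg _),
        jac x hx.1.ne', abs_of_pos hx.1]
      congr 1
      unfold psi GG'
      rw [(hv_Ph h x).1, (hv_Ph h x).2]
      have hWV : WV T (Ph x) = ww T (mt x) := WV_eq T _ _ hx.1 hx.2.1
      rw [hWV]
      have hiff : 0 < s * ((mt x).det ^ 12 * (4 * Ih (x 0) ^ 3 - Jh (x 0) ^ 2)) ↔ x 0 ∈ A := by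
        rw [← hs _ hx.2.1, mul_left_comm]
        exact mul_pos_iff_of_pos_left (pow_pos hx.1 12)
      by_cases hE : x 0 ∈ A ∧ (mt x).det ^ 12 * hh0 (x 0) < 1
      · rw [if_pos ⟨hE.2, hiff.mpr hE.1⟩, if_pos ⟨hx.1, hE⟩]
        ring
      · rw [if_neg (fun hh => hE ⟨hiff.mp hh.2, hh.1⟩), if_neg (fun hh => hE hh.2), mul_zero]
    · rw [Set.indicator_of_notMem hx]
      by_cases hx0 : x ∈ U0
      · rw [Set.indicator_of_mem (show x ∈ _ from hx0)]
        unfold GG'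
        rw [if_neg, ENNReal.ofReal_zero]
        rintro ⟨a, b, _⟩
        exact hx ⟨a, fun h3 => hA3 (h3 ▸ b), hx0⟩
      · rw [Set.indicator_of_notMem (show x ∉ _ from hx0)]
  have e3 := third A hA T hT
  rw [GG'_int A hA T hT, hK] at e3
  have h7 := mu7_nonneg T hT
  rw [← ENNReal.ofReal_mul (by positivity)] at e3
  rw [e1, e2]
  have := congrArg ENNReal.toReal e3
  rw [ENNReal.toReal_ofReal (by positivity), ENNReal.toReal_mul] at this
  norm_num at this
  linarith

theorem psi_int_pos (T : ℝ) (hT : 0 < T) : ∫ c, psi P Q 1 T c = 9 * mu7 T * (64 / 81) := by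
  refine psi_int h (Set.Iio (-3)) measurableSet_Iio 1 T hT (by simp) (fun δ hδ => ?_) _ (by norm_num) K_pos
  rw [disc_h, one_mul, Set.mem_Iio]
  rw [show (0 : ℝ) < -(27 / 16) * (δ ^ 3 + 27) ^ 3 ↔ (δ ^ 3 + 27) ^ 3 < 0 ^ 3 by constructor <;> intro hh <;> linarith,
    cube_lt, ← cube_lt (a := δ)]
  constructor <;> intro hh <;> norm_num at * <;> linarith

theorem psi_int_neg (T : ℝ) (hT : 0 < T) : ∫ c, psi P Q (-1) T c = 9 * mu7 T * (256 / 81) := by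
  refine psi_int h (Set.Ioi (-3)) measurableSet_Ioi (-1) T hT (by simp) (fun δ hδ => ?_) _ (by norm_num) K_neg
  rw [disc_h, Set.mem_Ioi]
  rw [show (0 : ℝ) < (-1) * (-(27 / 16) * (δ ^ 3 + 27) ^ 3) ↔ 0 ^ 3 < (δ ^ 3 + 27) ^ 3 by constructor <;> intro hh <;> linarith,
    cube_lt, ← cube_lt (a := -3)]
  constructor <;> intro hh <;> norm_num at * <;> linarith

end TC


namespace TC
open Matrix Filter Topology MeasureTheory

lemma fix_null (u : M3) (hu : u ≠ 1) : volume {v : V10 | act u v = v} = 0 := by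
  have hne : LinearMap.ker (actL u - LinearMap.id) ≠ ⊤ := by
    intro ht
    apply hu
    have hall : ∀ v : V10, act u v = v := by
      intro v
      have : v ∈ LinearMap.ker (actL u - LinearMap.id) := by rw [ht]; trivial
      rw [LinearMap.mem_ker] at this
      exact sub_eq_zero.mp this
    have key : ∀ (i j : Fin 3) , (Pi.single i 1 ᵥ* u) j = (Pi.single i 1 : Fin 3 → ℝ) j := by
      intro i j
      apply cube_inj
      have h : ∀ v : V10, ev v (Pi.single i 1 ᵥ* u) = ev v (Pi.single i 1) := by
        intro v
        rw [← ev_act, hall]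
      fin_cases j
      · have := h ![1, 0, 0, 0, 0, 0, 0, 0, 0, 0]
        simpa [ev] using this
      · have := h ![0, 1, 0, 0, 0, 0, 0, 0, 0, 0]
        simpa [ev] using this
      · have := h ![0, 0, 1, 0, 0, 0, 0, 0, 0, 0]
        simpa [ev] using this
    ext i j
    have := key i j
    rw [Matrix.single_one_vecMul] at this
    rw [Matrix.one_apply]
    rw [Pi.single_apply] at this
    simpa [eq_comm] using this
  have := Measure.addHaar_submodule (volume : Measure V10) _ hne
  convert this using 2
  ext v
  rw [SetLike.mem_coe, LinearMap.mem_ker]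
  exact sub_eq_zero.symm

lemma cyc_entry (σ : M3) (h : σ = 1 ∨ σ = cyc1 ∨ σ = cyc2) (i j : Fin 3) : |σ i j| ≤ 1 := by
  rcases h with rfl | rfl | rfl <;> fin_cases i <;> fin_cases j <;> simp [cyc1, cyc2]

lemma adj_entry (g : M3) (T : ℝ) (h : ∀ i j, |g i j| ≤ T) (i j : Fin 3) : |g.adjugate i j| ≤ 2 * T ^ 2 := by
  have hT : 0 ≤ T := (abs_nonneg _).trans (h 0 0)
  have key : ∀ a b c d : ℝ, |a| ≤ T → |b| ≤ T → |c| ≤ T → |d| ≤ T → |a * b - c * d| ≤ 2 * T ^ 2 := by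
    intro a b c d ha hb hc hd
    have h1 : |a * b| ≤ T * T := by rw [abs_mul]; exact mul_le_mul ha hb (abs_nonneg _) hT
    have h2 : |c * d| ≤ T * T := by rw [abs_mul]; exact mul_le_mul hc hd (abs_nonneg _) hT
    have := abs_sub (a * b) (c * d)
    nlinarith
  have key2 : ∀ a b c d : ℝ, |a| ≤ T → |b| ≤ T → |c| ≤ T → |d| ≤ T → |-(a * b) + c * d| ≤ 2 * T ^ 2 := by
    intro a b c d ha hb hc hd
    have := key c d a b hc hd ha hb
    rwa [show -(a * b) + c * d = c * d - a * b by ring]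
  rw [Matrix.adjugate_fin_three]
  fin_cases i <;> fin_cases j <;>
    first
    | exact key _ _ _ _ (h _ _) (h _ _) (h _ _) (h _ _)
    | exact key2 _ _ _ _ (h _ _) (h _ _) (h _ _) (h _ _)

lemma stab_bd (T : ℝ) (hT : 0 < T) (g : M3) (hg : 0 < g.det) (hN : N2 g ≤ T ^ 2 * cb g.det ^ 2) (δ : ℝ) (hδ : δ ≠ -3)
    (u : SLZ) (e : act (rz u) (act g (hes δ)) = act g (hes δ)) (i j : Fin 3) : |rz u i j| ≤ 18 * T ^ 3 := by
  obtain ⟨σ, hσ, hu⟩ : ∃ σ : M3, (σ = 1 ∨ σ = cyc1 ∨ σ = cyc2) ∧ rz u * g = g * σ := by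
    rw [← act_mul] at e
    rcases (hes_unique g (rz u * g) hg (by rw [rz_mul_det]; exact hg) δ δ hδ e.symm).2 with h | h | h
    · exact ⟨1, Or.inl rfl, by rw [h, mul_one]⟩
    · exact ⟨cyc1, Or.inr (Or.inl rfl), h⟩
    · exact ⟨cyc2, Or.inr (Or.inr rfl), h⟩
  have hc := cb_pos hg
  obtain ⟨g1, hg1⟩ : ∃ g1 : M3, g1 = (cb g.det)⁻¹ • g := ⟨_, rfl⟩
  have hd1 : g1.det = 1 := by
    rw [hg1, Matrix.det_smul, Fintype.card_fin, inv_pow, cb_cube hg.le, inv_mul_cancel₀ hg.ne']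
  have hN1 : N2 g1 ≤ T ^ 2 := by
    rw [hg1, N2_smul, inv_pow]
    rw [inv_mul_le_iff₀ (by positivity)]
    linarith
  have hent : ∀ i j, |g1 i j| ≤ T := fun i j => N2_entry g1 i j hN1 hT.le
  have e1 : rz u = g1 * σ * g1.adjugate := by
    have : rz u * g1 = g1 * σ := by
      rw [hg1, Matrix.mul_smul, Matrix.smul_mul, hu]
    rw [← this, Matrix.mul_assoc, Matrix.mul_adjugate, hd1, one_smul, Matrix.mul_one]
  rw [e1]
  have := mul_entry_le (g1 * σ) g1.adjugate _ _ (mul_entry_le g1 σ T 1 hent (cyc_entry σ hσ)) (adj_entry g1 T hent) i j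
  linarith

variable {P Q : MvPolynomial (Fin 10) ℚ} (h : IsInvariantPair ℚ P Q)
include h

lemma hv_smul (t : ℝ) (c : V10) : hv P Q (t • c) = t ^ 12 * hv P Q c ∧ dv P Q (t • c) = t ^ 12 * dv P Q c := by
  unfold hv dv
  rw [(iv_smul h _ _).1, (iv_smul h _ _).2]
  constructor
  · rw [mul_max_of_nonneg _ _ (by positivity), abs_mul, abs_of_nonneg (by positivity : 0 ≤ t ^ 4)]
    congr 1 <;> ring
  · ring

lemma hv_act1 (g : M3) (hg : g.det = 1) (c : V10) : hv P Q (act g c) = hv P Q c ∧ dv P Q (act g c) = dv P Q c := by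
  unfold hv dv
  rw [(iv_act h _ _).1, (iv_act h _ _).2, hg]
  simp

omit h in
/-- admissible forms -/
def Adm (P Q : MvPolynomial (Fin 10) ℚ) (s t : ℝ) (c : Fin 10 → ℤ) : Prop := hv P Q (rc c) < t ^ 12 ∧ 0 < s * dv P Q (rc c)

lemma Adm_act (s t : ℝ) (γ : SLZ) (c : Fin 10 → ℤ) (hc : Adm P Q s t c) : Adm P Q s t (act (γ : MZ) c) := by
  unfold Adm at *
  rw [rc_act, (hv_act1 h _ (rz_det γ) _).1, (hv_act1 h _ (rz_det γ) _).2]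
  exact hc

lemma Adm_iff (s t : ℝ) (ht : 0 < t) (c : Fin 10 → ℤ) : Adm P Q s t c ↔
    (hv P Q (fun i => (c i : ℝ) / t) < 1 ∧ 0 < s * dv P Q (fun i => (c i : ℝ) / t)) := by
  have e : (fun i => (c i : ℝ) / t) = t⁻¹ • rc c := by
    funext i
    simp only [Pi.smul_apply, smul_eq_mul, rc]
    rw [div_eq_inv_mul]
  have hp : 0 < t ^ 12 := by positivity
  unfold Adm
  rw [e, (hv_smul h _ _).1, (hv_smul h _ _).2, inv_pow, inv_mul_lt_iff₀ hp, mul_one, mul_left_comm,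
    mul_pos_iff_of_pos_left (inv_pos.mpr hp)]

omit h in
lemma scale_form (t : ℝ) (ht : 0 < t) (c : Fin 10 → ℤ) (g : M3) (δ : ℝ) (e : rc c = act g (hes δ)) :
    ∃ r : ℝ, 0 < r ∧ r ^ 3 = t⁻¹ ∧ (fun i => (c i : ℝ) / t) = act (r • g) (hes δ) := by
  obtain ⟨r, hr, hr3⟩ := exists_root_pos 3 (by norm_num) t⁻¹ (inv_pos.mpr ht)
  refine ⟨r, hr, hr3, ?_⟩
  rw [act_scalar, hr3, ← e]
  funext i
  simp only [Pi.smul_apply, smul_eq_mul, rc]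
  rw [div_eq_inv_mul]

lemma psi_Adm (s T t : ℝ) (ht : 0 < t) (c : Fin 10 → ℤ) (hA : Adm P Q s t c) (g : M3) (δ : ℝ) (hg : 0 < g.det) (hδ : δ ≠ -3)
    (e : rc c = act g (hes δ)) : psi P Q s T (fun i => (c i : ℝ) / t) = ww T g := by
  unfold psi
  rw [if_pos ((Adm_iff h s t ht c).mp hA)]
  obtain ⟨r, hr, hr3, e2⟩ := scale_form t ht c g δ e
  rw [e2, WV_eq T _ _ _ hδ, ww_smul T r hr]
  rw [Matrix.det_smul, Fintype.card_fin]
  positivity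

lemma psi_ne (s T t : ℝ) (ht : 0 < t) (c : Fin 10 → ℤ) (hp : psi P Q s T (fun i => (c i : ℝ) / t) ≠ 0) : Adm P Q s t c := by
  rw [Adm_iff h s t ht]
  unfold psi at hp
  by_contra hc
  rw [if_neg hc] at hp
  exact hp rfl

lemma Adm_hes (s t : ℝ) (c : Fin 10 → ℤ) (hA : Adm P Q s t c) : ∃ (g : M3) (δ : ℝ), 0 < g.det ∧ δ ≠ -3 ∧ rc c = act g (hes δ) := by
  apply exists_hesse h
  intro h0
  have := hA.2
  unfold dv at this
  rw [h0] at this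
  simp at this

lemma Adm_bd (s t : ℝ) (ht : 0 < t) (c : Fin 10 → ℤ) (hA : Adm P Q s t c) (g : M3) (δ : ℝ) (hg : 0 < g.det)
    (e : rc c = act g (hes δ)) : g.det * (1 + |δ|) ≤ 26 * t := by
  obtain ⟨r, hr, hr3, e2⟩ := scale_form t ht c g δ e
  have h1 := ((Adm_iff h s t ht c).mp hA).1
  have hd : (r • g).det = t⁻¹ * g.det := by rw [Matrix.det_smul, Fintype.card_fin, hr3]
  rw [e2] at h1
  have := hes_bd h (by rw [hd]; positivity) h1
  rw [hd, mul_assoc, inv_mul_le_iff₀ ht] at this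
  linarith

lemma Adm_box (s t T : ℝ) (ht : 0 < t) (hT : 0 < T) (c : Fin 10 → ℤ) (hA : Adm P Q s t c) (g : M3) (δ : ℝ) (hg : 0 < g.det)
    (e : rc c = act g (hes δ)) (hN : N2 g ≤ T ^ 2 * cb g.det ^ 2) (i : Fin 10) : |(c i : ℝ) / t| ≤ 60 * 26 * (2 * T) ^ 3 := by
  obtain ⟨r, hr, hr3, e2⟩ := scale_form t ht c g δ e
  have h1 := ((Adm_iff h s t ht c).mp hA).1
  have hd : (r • g).det = r ^ 3 * g.det := by rw [Matrix.det_smul, Fintype.card_fin]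
  rw [e2] at h1
  have := hes_box h (T := T) (by rw [hd]; positivity) hT h1 (by
    rw [hd, cb_mul (by positivity) hg.le, cb_of_cube hr.le, N2_smul]
    have := mul_le_mul_of_nonneg_left hN (sq_nonneg r)
    nlinarith [sq_nonneg (T * r * cb g.det)]) i
  rw [← e2] at this
  exact this

end TC


namespace TC
open Matrix Filter Topology MeasureTheory

section
variable {P Q : MvPolynomial (Fin 10) ℚ}

def Om (P Q : MvPolynomial (Fin 10) ℚ) (S : Set (Fin 10 → ℤ)) (s t : ℝ) : Set (Set (Fin 10 → ℤ)) :=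
  {o | ∃ c ∈ S, StronglyIrred c ∧ Adm P Q s t c ∧ o = orbitZ c}

def Tail (T t : ℝ) : Set (Set (Fin 10 → ℤ)) :=
  {o | ∃ (c : Fin 10 → ℤ) (g : M3) (δ s : ℝ), o = orbitZ c ∧ StronglyIrred c ∧ 0 < s ∧ g.det = s ^ 3 ∧
      δ ≠ -3 ∧ rc c = act g (hes δ) ∧ g.det * (1 + |δ|) ≤ 26 * t ∧ ∀ γ : SLZ, T ^ 2 * s ^ 2 < N2 (rz γ * g)}

/-- the closed null set of bounded forms with a bounded integral stabilizer -/
def KK (T : ℝ) : Set V10 :=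
  {v | (∀ i, |v i| ≤ 60 * 26 * (2 * T) ^ 3) ∧ ∃ u : SLZ, u ≠ 1 ∧ (∀ i j, |rz u i j| ≤ 18 * T ^ 3) ∧ act (rz u) v = v}

lemma KK_eq (T : ℝ) : KK T = {v | ∀ i, |v i| ≤ 60 * 26 * (2 * T) ^ 3} ∩
    ⋃ u ∈ {u : SLZ | u ≠ 1 ∧ ∀ i j, |rz u i j| ≤ 18 * T ^ 3}, {v : V10 | act (rz u) v = v} := by
  ext v
  simp only [KK, Set.mem_ofPred_eq, Set.mem_inter_iff, Set.mem_iUnion, exists_prop, and_assoc]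

lemma KK_fin (T : ℝ) : {u : SLZ | u ≠ 1 ∧ ∀ i j, |rz u i j| ≤ 18 * T ^ 3}.Finite :=
  (finite_bdd (18 * T ^ 3)).subset fun _ hu => hu.2

lemma KK_closed (T : ℝ) : IsClosed (KK T) := by
  rw [KK_eq]
  apply IsClosed.inter
  · have : {v : V10 | ∀ i, |v i| ≤ 60 * 26 * (2 * T) ^ 3} = ⋂ i, {v : V10 | |v i| ≤ 60 * 26 * (2 * T) ^ 3} := by
      ext v; simp
    rw [this]
    exact isClosed_iInter fun i => isClosed_le (by fun_prop) continuous_const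
  · refine (KK_fin T).isClosed_biUnion fun u _ => ?_
    have : Continuous (fun v : V10 => act (rz u) v) := (actL (rz u)).continuous_of_finiteDimensional
    exact isClosed_eq this continuous_id

lemma KK_null (T : ℝ) : volume (KK T) = 0 := by
  rw [KK_eq]
  refine measure_mono_null Set.inter_subset_right ?_
  rw [measure_biUnion_null_iff (KK_fin T).countable]
  intro u hu
  apply fix_null
  intro h1
  exact hu.1 (rz_inj (h1.trans rz_one.symm))

variable (h : IsInvariantPair ℚ P Q)
include h

lemma orb_val (s T t : ℝ) (ht : 0 < t) (c : Fin 10 → ℤ) (hA : Adm P Q s t c) (g : M3) (δ : ℝ) (hg : 0 < g.det) (hδ : δ ≠ -3)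
    (e : rc c = act g (hes δ)) (γ : SLZ) : psi P Q s T (fun i => ((act (γ : MZ) c i : ℤ) : ℝ) / t) = ww T (rz γ * g) := by
  refine psi_Adm h s T t ht _ (Adm_act h s t γ c hA) (rz γ * g) δ (by rw [rz_mul_det]; exact hg) hδ ?_
  rw [rc_act, e, act_mul]

lemma orb_le (s T t : ℝ) (hT : 0 < T) (ht : 0 < t) (c : Fin 10 → ℤ) (hA : Adm P Q s t c) (F : Finset (Fin 10 → ℤ))
    (hF : ∀ c' ∈ F, c' ∈ orbitZ c) : ∑ c' ∈ F, psi P Q s T (fun i => (c' i : ℝ) / t) ≤ 1 := by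
  classical
  obtain ⟨g, δ, hg, hδ, e⟩ := Adm_hes h s t c hA
  have hex : ∀ c' ∈ F, ∃ γ : SLZ, act (γ : MZ) c = c' := by
    intro c' hc'
    have := hF c' hc'
    rw [orbitZ_eq] at this
    exact this
  have hex2 : ∀ c', ∃ γ : SLZ, c' ∈ F → act (γ : MZ) c = c' := by
    intro c'
    by_cases hc : c' ∈ F
    · obtain ⟨γ, hγ⟩ := hex c' hc
      exact ⟨γ, fun _ => hγ⟩
    · exact ⟨1, fun hh => absurd hh hc⟩
  choose φ hφ using hex2
  have e1 : ∑ c' ∈ F, psi P Q s T (fun i => (c' i : ℝ) / t) = ∑ c' ∈ F, ww T (rz (φ c') * g) := by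
    refine Finset.sum_congr rfl fun c' hc' => ?_
    rw [← orb_val h s T t ht c hA g δ hg hδ e, hφ c' hc']
  rw [e1]
  have e2 : ∑ c' ∈ F, ww T (rz (φ c') * g) = ∑ γ ∈ F.image φ, ww T (rz γ * g) := by
    rw [Finset.sum_image]
    intro a ha b hb hab
    rw [← hφ a ha, ← hφ b hb, hab]
  rw [e2]
  exact ((ww_summable T hT g).sum_le_tsum _ (fun _ _ => ww_nonneg T _)).trans (TH_le_one T g)

lemma orb_ge (s T t : ℝ) (hT : 0 < T) (ht : 0 < t) (c : Fin 10 → ℤ) (hA : Adm P Q s t c) (g : M3) (δ : ℝ) (hg : 0 < g.det)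
    (hδ : δ ≠ -3) (e : rc c = act g (hes δ)) (γ0 : SLZ) (hN : N2 (rz γ0 * g) ≤ T ^ 2 * cb g.det ^ 2)
    (hst : ∀ u : SLZ, act (u : MZ) c = c → u = 1) (F : Finset (Fin 10 → ℤ))
    (hF : ∀ γ : SLZ, psi P Q s T (fun i => ((act (γ : MZ) c i : ℤ) : ℝ) / t) ≠ 0 → act (γ : MZ) c ∈ F) :
    1 ≤ ∑ c' ∈ F, psi P Q s T (fun i => (c' i : ℝ) / t) := by
  classical
  have h1 := TH_eq_one T hT g hg γ0 hN
  unfold TH at h1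
  rw [tsum_eq_sum (s := (ww_support T hT g).toFinset)] at h1
  swap
  · intro γ hγ
    by_contra h0
    exact hγ ((ww_support T hT g).mem_toFinset.mpr h0)
  rw [← h1]
  have e1 : ∀ γ : SLZ, ww T (rz γ * g) = psi P Q s T (fun i => ((act (γ : MZ) c i : ℤ) : ℝ) / t) := fun γ =>
    (orb_val h s T t ht c hA g δ hg hδ e γ).symm
  have e2 : ∑ γ ∈ (ww_support T hT g).toFinset, ww T (rz γ * g) =
      ∑ c' ∈ (ww_support T hT g).toFinset.image (fun γ : SLZ => act (γ : MZ) c), psi P Q s T (fun i => (c' i : ℝ) / t) := by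
    rw [Finset.sum_image]
    · exact Finset.sum_congr rfl fun γ _ => e1 γ
    · intro a _ b _ hab
      have : act ((b⁻¹ * a : SLZ) : MZ) c = c := by
        rw [act_SLZ_mul]
        change act (a : MZ) c = act (b : MZ) c at hab
        rw [hab, ← act_SLZ_mul, inv_mul_cancel, Matrix.SpecialLinearGroup.coe_one, act_one]
      have := hst _ this
      exact (inv_mul_eq_one.mp this).symm
  rw [e2]
  refine Finset.sum_le_sum_of_subset_of_nonneg ?_ fun c' _ _ => psi_nonneg s T _
  intro c' hc'
  obtain ⟨γ, hγ, rfl⟩ := Finset.mem_image.mp hc'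
  refine hF γ ?_
  rw [← e1]
  exact (ww_support T hT g).mem_toFinset.mp hγ

lemma not_tail (s T t : ℝ) (ht : 0 < t) (c : Fin 10 → ℤ) (hSI : StronglyIrred c) (hA : Adm P Q s t c) (g : M3) (δ : ℝ)
    (hg : 0 < g.det) (hδ : δ ≠ -3) (e : rc c = act g (hes δ)) (hn : orbitZ c ∉ Tail T t) :
    ∃ γ : SLZ, N2 (rz γ * g) ≤ T ^ 2 * cb g.det ^ 2 := by
  by_contra hc
  push Not at hc
  exact hn ⟨c, g, δ, cb g.det, rfl, hSI, cb_pos hg, (cb_cube hg.le).symm, hδ, e, Adm_bd h s t ht c hA g δ hg e, hc⟩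

lemma box_rep (s T t : ℝ) (hT : 0 < T) (ht : 0 < t) (c : Fin 10 → ℤ) (hA : Adm P Q s t c) (g : M3) (δ : ℝ) (hg : 0 < g.det)
    (e : rc c = act g (hes δ)) (γ : SLZ) (hN : N2 (rz γ * g) ≤ T ^ 2 * cb g.det ^ 2) (i : Fin 10) :
    |((act (γ : MZ) c i : ℤ) : ℝ) / t| ≤ 60 * 26 * (2 * T) ^ 3 := by
  refine Adm_box h s t T ht hT _ (Adm_act h s t γ c hA) (rz γ * g) δ (by rw [rz_mul_det]; exact hg) ?_
    (by rw [rz_mul_det]; exact hN) i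
  rw [rc_act, e, act_mul]

lemma Om_finite (S : Set (Fin 10 → ℤ)) (s T t : ℝ) (hT : 0 < T) (ht : 0 < t) (hfin : (Tail T t).Finite) :
    (Om P Q S s t).Finite := by
  refine (hfin.union ((finite_lattice (d := 10) (60 * 26 * (2 * T) ^ 3 * t)).image orbitZ)).subset ?_
  rintro o ⟨c, hcS, hSI, hA, rfl⟩
  by_cases hn : orbitZ c ∈ Tail T t
  · exact Or.inl hn
  right
  obtain ⟨g, δ, hg, hδ, e⟩ := Adm_hes h s t c hA
  obtain ⟨γ, hγ⟩ := not_tail h s T t ht c hSI hA g δ hg hδ e hn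
  refine ⟨act (γ : MZ) c, fun i => ?_, orbitZ_act γ c⟩
  have := box_rep h s T t hT ht c hA g δ hg e γ hγ i
  rwa [abs_div, abs_of_pos ht, div_le_iff₀ ht] at this

/-- the two-sided bound for the number of orbits by weighted lattice points -/
lemma sandwich (S : Set (Fin 10 → ℤ)) (hS : ∀ c ∈ S, ∀ γ : SLZ, act (γ : MZ) c ∈ S) (s T t : ℝ) (hT : 0 < T) (ht : 0 < t)
    (hfin : (Tail T t).Finite) (hK : {c : Fin 10 → ℤ | (fun i => (c i : ℝ) / t) ∈ KK T}.Finite)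
    (F : Finset (Fin 10 → ℤ))
    (hF : ∀ c, c ∈ F ↔ psi P Q s T (fun i => (c i : ℝ) / t) ≠ 0 ∧ c ∈ S ∧ StronglyIrred c) :
    ∑ c ∈ F, psi P Q s T (fun i => (c i : ℝ) / t) ≤ (Om P Q S s t).ncard ∧
    ((Om P Q S s t).ncard : ℝ) ≤ (Tail T t).ncard + {c : Fin 10 → ℤ | (fun i => (c i : ℝ) / t) ∈ KK T}.ncard +
      ∑ c ∈ F, psi P Q s T (fun i => (c i : ℝ) / t) := by
  classical
  have hO := Om_finite h S s T t hT ht hfin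
  have hmap : ∀ c ∈ F, orbitZ c ∈ hO.toFinset := by
    intro c hc
    obtain ⟨h1, h2, h3⟩ := (hF c).mp hc
    exact hO.mem_toFinset.mpr ⟨c, h2, h3, psi_ne h s T t ht c h1, rfl⟩
  have hsum := Finset.sum_fiberwise_of_maps_to hmap (fun c => psi P Q s T (fun i => (c i : ℝ) / t))
  rw [Set.ncard_eq_toFinset_card _ hO, ← hsum]
  constructor
  · refine (Finset.sum_le_card_nsmul _ _ 1 ?_).trans (by simp)
    intro o ho
    obtain ⟨c, hc, hSI, hA, rfl⟩ := hO.mem_toFinset.mp ho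
    refine orb_le h s T t hT ht c hA _ ?_
    intro c' hc'
    rw [← (Finset.mem_filter.mp hc').2]
    exact mem_orbitZ c'
  · have hsub : hO.toFinset ⊆ (hfin.toFinset ∪ hK.toFinset.image orbitZ) ∪
        hO.toFinset.filter (fun o => 1 ≤ ∑ c ∈ F with orbitZ c = o, psi P Q s T (fun i => (c i : ℝ) / t)) := by
      intro o ho
      rw [Finset.mem_union, Finset.mem_union, Finset.mem_filter]
      obtain ⟨c, hc, hSI, hA, rfl⟩ := hO.mem_toFinset.mp ho
      by_cases hn : orbitZ c ∈ Tail T t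
      · exact Or.inl (Or.inl (hfin.mem_toFinset.mpr hn))
      obtain ⟨g, δ, hg, hδ, e⟩ := Adm_hes h s t c hA
      obtain ⟨γ, hγ⟩ := not_tail h s T t ht c hSI hA g δ hg hδ e hn
      by_cases hst : ∀ u : SLZ, act (u : MZ) c = c → u = 1
      · refine Or.inr ⟨ho, orb_ge h s T t hT ht c hA g δ hg hδ e γ hγ hst _ ?_⟩
        intro γ' hγ'
        rw [Finset.mem_filter, hF]
        exact ⟨⟨hγ', hS c hc γ', SI_act γ' c hSI⟩, orbitZ_act γ' c⟩
      · push Not at hst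
        obtain ⟨u, hu, hu1⟩ := hst
        refine Or.inl (Or.inr (Finset.mem_image.mpr ⟨act (γ : MZ) c, hK.mem_toFinset.mpr ?_, orbitZ_act γ c⟩))
        have hfix : act ((γ * u * γ⁻¹ : SLZ) : MZ) (act (γ : MZ) c) = act (γ : MZ) c := by
          rw [← act_SLZ_mul, inv_mul_cancel_right, act_SLZ_mul, hu]
        have hfix2 : act (rz (γ * u * γ⁻¹)) (rc (act (γ : MZ) c)) = rc (act (γ : MZ) c) := by
          rw [← rc_act, hfix]
        refine ⟨fun i => box_rep h s T t hT ht c hA g δ hg e γ hγ i, γ * u * γ⁻¹, ?_, ?_, ?_⟩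
        · intro h1
          apply hu1
          have := mul_inv_eq_one.mp h1
          exact mul_eq_left.mp this
        · have e3 : rc (act (γ : MZ) c) = act (rz γ * g) (hes δ) := by rw [rc_act, e, act_mul]
          rw [e3] at hfix2
          exact stab_bd T hT (rz γ * g) (by rw [rz_mul_det]; exact hg) (by rw [rz_mul_det]; exact hγ) δ hδ _ hfix2
        · have e4 : (fun i => ((act (γ : MZ) c i : ℤ) : ℝ) / t) = t⁻¹ • rc (act (γ : MZ) c) := by
            funext i
            simp only [Pi.smul_apply, smul_eq_mul, rc]
            rw [div_eq_inv_mul]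
          rw [e4, act_smul, hfix2]
    have hcard := (Finset.card_le_card hsub).trans ((Finset.card_union_le _ _).trans
      (Nat.add_le_add_right (Finset.card_union_le _ _) _))
    have h2 : (hK.toFinset.image orbitZ).card ≤ {c : Fin 10 → ℤ | (fun i => (c i : ℝ) / t) ∈ KK T}.ncard := by
      rw [Set.ncard_eq_toFinset_card _ hK]
      exact Finset.card_image_le
    have h3 : ((hO.toFinset.filter (fun o => 1 ≤ ∑ c ∈ F with orbitZ c = o, psi P Q s T (fun i => (c i : ℝ) / t))).card : ℝ) ≤
        ∑ o ∈ hO.toFinset, ∑ c ∈ F with orbitZ c = o, psi P Q s T (fun i => (c i : ℝ) / t) := by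
      rw [Finset.card_eq_sum_ones, Nat.cast_sum]
      refine (Finset.sum_le_sum (fun o ho => ?_)).trans
        (Finset.sum_le_sum_of_subset_of_nonneg (Finset.filter_subset _ _) fun o _ _ =>
          Finset.sum_nonneg fun c _ => psi_nonneg s T _)
      rw [Nat.cast_one]
      exact (Finset.mem_filter.mp ho).2
    rw [← Set.ncard_eq_toFinset_card _ hfin] at hcard
    have h4 : (hO.toFinset.card : ℝ) ≤ (Tail T t).ncard + (hK.toFinset.image orbitZ).card +
      (hO.toFinset.filter (fun o => 1 ≤ ∑ c ∈ F with orbitZ c = o, psi P Q s T (fun i => (c i : ℝ) / t))).card := by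
      exact_mod_cast hcard
    have h5 : ((hK.toFinset.image orbitZ).card : ℝ) ≤ {c : Fin 10 → ℤ | (fun i => (c i : ℝ) / t) ∈ KK T}.ncard := by
      exact_mod_cast h2
    linarith

end
end TC


namespace TC
open Matrix Filter Topology MeasureTheory

section
variable {P Q : MvPolynomial (Fin 10) ℚ} (h : IsInvariantPair ℚ P Q)
include h

lemma tsum_split (S : Set (Fin 10 → ℤ)) (s T t : ℝ) (hT : 0 < T) (ht : 0 < t) : ∃ F : Finset (Fin 10 → ℤ),
    (∀ c, c ∈ F ↔ psi P Q s T (fun i => (c i : ℝ) / t) ≠ 0 ∧ c ∈ S ∧ StronglyIrred c) ∧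
    ∑ c ∈ F, psi P Q s T (fun i => (c i : ℝ) / t) ≤ ∑' c, S.indicator (fun c => psi P Q s T (fun i => (c i : ℝ) / t)) c ∧
    ∑' c, S.indicator (fun c => psi P Q s T (fun i => (c i : ℝ) / t)) c ≤ ∑ c ∈ F, psi P Q s T (fun i => (c i : ℝ) / t) +
      {c : Fin 10 → ℤ | ¬ StronglyIrred c ∧ ∀ i, |(c i : ℝ)| ≤ 60 * 26 * (2 * T) ^ 3 * t}.ncard := by
  classical
  have tame := psi_tame h s T hT
  have hfin := tame.finite t ht
  obtain ⟨F0, hF0⟩ : ∃ F0 : Finset (Fin 10 → ℤ), F0 = hfin.toFinset.filter (fun c => c ∈ S) := ⟨_, rfl⟩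
  have e1 : ∑' c, S.indicator (fun c => psi P Q s T (fun i => (c i : ℝ) / t)) c =
      ∑ c ∈ F0, psi P Q s T (fun i => (c i : ℝ) / t) := by
    rw [tsum_eq_sum (s := F0)]
    · refine Finset.sum_congr rfl fun c hc => ?_
      rw [hF0] at hc
      exact Set.indicator_of_mem (Finset.mem_filter.mp hc).2 _
    · intro c hc
      by_contra hne
      have hcS : c ∈ S := by
        by_contra hcS
        exact hne (Set.indicator_of_notMem hcS _)
      rw [Set.indicator_of_mem hcS] at hne
      apply hc
      rw [hF0, Finset.mem_filter]
      exact ⟨hfin.mem_toFinset.mpr hne, hcS⟩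
  have hred : {c : Fin 10 → ℤ | ¬ StronglyIrred c ∧ ∀ i, |(c i : ℝ)| ≤ 60 * 26 * (2 * T) ^ 3 * t}.Finite :=
    (finite_lattice (60 * 26 * (2 * T) ^ 3 * t)).subset fun c hc => hc.2
  have e2 := Finset.sum_filter_add_sum_filter_not F0 StronglyIrred (fun c => psi P Q s T (fun i => (c i : ℝ) / t))
  refine ⟨F0.filter StronglyIrred, fun c => ?_, ?_, ?_⟩
  · rw [Finset.mem_filter, hF0, Finset.mem_filter, hfin.mem_toFinset]
    simp only [Set.mem_ofPred_eq, and_assoc]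
  · rw [e1, ← e2]
    exact le_add_of_nonneg_right (Finset.sum_nonneg fun c _ => psi_nonneg s T _)
  · rw [e1, ← e2]
    refine add_le_add_right ?_ _
    have hsub : F0.filter (fun c => ¬ StronglyIrred c) ⊆ hred.toFinset := by
      intro c hc
      obtain ⟨hc1, hc2⟩ := Finset.mem_filter.mp hc
      rw [hF0] at hc1
      have hc3 := hfin.mem_toFinset.mp (Finset.mem_filter.mp hc1).1
      refine hred.mem_toFinset.mpr ⟨hc2, fun i => ?_⟩
      have := tame.supp _ hc3 i
      rwa [abs_div, abs_of_pos ht, div_le_iff₀ ht] at this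
    have hcard : ((F0.filter (fun c => ¬ StronglyIrred c)).card : ℝ) ≤
        {c : Fin 10 → ℤ | ¬ StronglyIrred c ∧ ∀ i, |(c i : ℝ)| ≤ 60 * 26 * (2 * T) ^ 3 * t}.ncard := by
      rw [Set.ncard_eq_toFinset_card _ hred]
      exact_mod_cast Finset.card_le_card hsub
    refine le_trans ?_ hcard
    refine (Finset.sum_le_card_nsmul _ _ 1 fun c _ => ?_).trans (by simp)
    exact (le_abs_self _).trans (tame.bd _)

theorem main_t {m : ℕ} [NeZero m] (Sbar : Set (Fin 10 → ZMod m)) (S : Set (Fin 10 → ℤ))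
    (hSb : S = {c : Fin 10 → ℤ | (fun i => (c i : ZMod m)) ∈ Sbar})
    (hS : ∀ c ∈ S, ∀ γ : SLZ, act (γ : MZ) c ∈ S) (s : ℝ) (hs : s ≠ 0) (K : ℝ) (hK0 : 0 ≤ K)
    (hK : ∀ T : ℝ, 0 < T → ∫ c, psi P Q s T c = 9 * mu7 T * K) :
    Tendsto (fun t : ℝ => ((Om P Q S s t).ncard : ℝ) / t ^ 10) atTop
      (𝓝 ((Sbar.ncard : ℝ) / (m : ℝ) ^ 10 * (9 * (zeta2 * zeta3 / 10) * K))) := by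
  rw [Metric.tendsto_nhds]
  intro ε hε
  obtain ⟨D, hD⟩ : ∃ D : ℝ, D = (Sbar.ncard : ℝ) / (m : ℝ) ^ 10 * (9 * K) := ⟨_, rfl⟩
  have hD0 : 0 ≤ D := by rw [hD]; positivity
  obtain ⟨T1, hT1, hmu⟩ := mu7_lim (ε / 8 / (D + 1)) (by positivity)
  obtain ⟨T2, hT2, htail⟩ := form_tail 26 (ε / 8) (by norm_num) (by positivity)
  obtain ⟨T, hT⟩ : ∃ T, T = max T1 T2 := ⟨_, rfl⟩
  have hTp : 0 < T := hT ▸ hT1.trans_le (le_max_left _ _)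
  have hmuT := hmu T (hT ▸ le_max_left _ _)
  have htailT := htail T (hT ▸ le_max_right _ _)
  have hR := riemann Sbar (psi_tame h s T hTp) (psi_cont h s T hs hTp)
  rw [hK T hTp, ← hSb, Metric.tendsto_nhds] at hR
  have hmu2 : |D * mu7 T - D * (zeta2 * zeta3 / 10)| ≤ ε / 8 := by
    rw [← mul_sub, abs_mul, abs_of_nonneg hD0]
    calc D * |mu7 T - zeta2 * zeta3 / 10| ≤ (D + 1) * (ε / 8 / (D + 1)) :=
          mul_le_mul (by linarith) hmuT (abs_nonneg _) (by linarith)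
      _ = ε / 8 := mul_div_cancel₀ _ (by linarith)
  filter_upwards [hR (ε / 8) (by positivity), eventually_gt_atTop 0,
    null_count (KK T) (KK_closed T) (R := 60 * 26 * (2 * T) ^ 3) (fun x hx => hx.1) (KK_null T) (ε / 8) (by positivity),
    reducible_count (60 * 26 * (2 * T) ^ 3) (by positivity) (ε / 8) (by positivity)] with t h1 ht h2 h3
  obtain ⟨h4, h5⟩ := htailT t ht
  obtain ⟨F, hF, h6, h7⟩ := tsum_split h S s T t hTp ht
  obtain ⟨h8, h9⟩ := sandwich h S hS s T t hTp ht h4 h2.1 F hF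
  have h5' : ((Tail T t).ncard : ℝ) ≤ ε / 8 * t ^ 10 := h5
  have h2' := h2.2
  have ht10 : 0 < t ^ 10 := by positivity
  generalize (∑' c, S.indicator (fun c => psi P Q s T (fun i => (c i : ℝ) / t)) c) = A at *
  generalize (∑ c ∈ F, psi P Q s T (fun i => (c i : ℝ) / t)) = B at *
  generalize ((Om P Q S s t).ncard : ℝ) = N at *
  have k1 : N ≤ A + ε / 4 * t ^ 10 := by linarith
  have h7' : A ≤ B + ε / 8 * t ^ 10 := h7.trans (add_le_add le_rfl h3)
  have k2 : A - ε / 8 * t ^ 10 ≤ N := by linarith only [h7', h8]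
  have k3 : N / t ^ 10 ≤ A / t ^ 10 + ε / 4 := by
    rw [div_le_iff₀ ht10, add_mul, div_mul_cancel₀ _ ht10.ne']; exact k1
  have k4 : A / t ^ 10 - ε / 8 ≤ N / t ^ 10 := by
    rw [le_div_iff₀ ht10, sub_mul, div_mul_cancel₀ _ ht10.ne']; exact k2
  rw [Real.dist_eq, abs_lt] at h1 ⊢
  rw [show (Sbar.ncard : ℝ) / (m : ℝ) ^ 10 * (9 * mu7 T * K) = D * mu7 T by rw [hD]; ring] at h1
  rw [show (Sbar.ncard : ℝ) / (m : ℝ) ^ 10 * (9 * (zeta2 * zeta3 / 10) * K) = D * (zeta2 * zeta3 / 10) by rw [hD]; ring]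
  rw [abs_le] at hmu2
  constructor <;> linarith [h1.1, h1.2, hmu2.1, hmu2.2]

omit h in
lemma Hinv_hv (c : Fin 10 → ℤ) : ((Hinv P Q c : ℚ) : ℝ) = hv P Q (rc c) ∧ ((Δinv P Q c : ℚ) : ℝ) = dv P Q (rc c) / 27 := by
  have e : ∀ p : MvPolynomial (Fin 10) ℚ, iv p (rc c) = ((MvPolynomial.aeval (fun k => (c k : ℚ)) p : ℚ) : ℝ) := by
    intro p
    rw [← iv_cast]
    unfold rc
    congr 1
  unfold Hinv Δinv hv dv Iinv Jinv
  rw [e, e]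
  push_cast
  exact ⟨rfl, rfl⟩

theorem main_X {m : ℕ} (hm : 1 ≤ m) (Sbar : Set (Fin 10 → ZMod m)) (S : Set (Fin 10 → ℤ))
    (hSb : S = {c : Fin 10 → ℤ | (fun i => (c i : ZMod m)) ∈ Sbar})
    (hS : ∀ c ∈ S, ∀ γ : SLZ, act (γ : MZ) c ∈ S) (s : ℝ) (hs : s ≠ 0) (K : ℝ) (hK0 : 0 ≤ K)
    (hK : ∀ T : ℝ, 0 < T → ∫ c, psi P Q s T c = 9 * mu7 T * K) (N : ℝ → ℕ)
    (hN : ∀ X, N X = Set.ncard {o : Set (Fin 10 → ℤ) | ∃ c ∈ S, StronglyIrred c ∧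
      0 < s * dv P Q (rc c) ∧ hv P Q (rc c) < X ∧ o = orbitZ c}) :
    Tendsto (fun X : ℝ => (N X : ℝ) / X ^ ((5 : ℝ) / 6)) atTop
      (𝓝 ((Sbar.ncard : ℝ) / (m : ℝ) ^ 10 * (9 * (zeta2 * zeta3 / 10) * K))) := by
  have : NeZero m := ⟨by omega⟩
  have h1 := (main_t h Sbar S hSb hS s hs K hK0 hK).comp (tendsto_rpow_atTop (y := (1 : ℝ) / 12) (by norm_num))
  refine h1.congr' ?_
  filter_upwards [eventually_gt_atTop 0] with X hX
  have e12 : (X ^ ((1 : ℝ) / 12)) ^ 12 = X := by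
    rw [← Real.rpow_natCast (X ^ ((1 : ℝ) / 12)) 12, ← Real.rpow_mul hX.le]; norm_num
  have e10 : (X ^ ((1 : ℝ) / 12)) ^ 10 = X ^ ((5 : ℝ) / 6) := by
    rw [← Real.rpow_natCast (X ^ ((1 : ℝ) / 12)) 10, ← Real.rpow_mul hX.le]; norm_num
  change ((Om P Q S s (X ^ ((1 : ℝ) / 12))).ncard : ℝ) / (X ^ ((1 : ℝ) / 12)) ^ 10 = _
  rw [e10, hN]
  congr 3
  unfold Om Adm
  rw [e12]
  ext o
  constructor
  · rintro ⟨c, a, b, ⟨d, e⟩, f⟩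
    exact ⟨c, a, b, e, d, f⟩
  · rintro ⟨c, a, b, e, d, f⟩
    exact ⟨c, a, b, ⟨d, e⟩, f⟩

theorem final {m k : ℕ} (hm : 1 ≤ m) (S : Set (Fin 10 → ℤ))
    (hinv : ∀ c ∈ S, ∀ (γ : Matrix.SpecialLinearGroup (Fin 3) ℤ) (c' : Fin 10 → ℤ),
      actGL (γ : Matrix (Fin 3) (Fin 3) ℤ) (cubic c) = cubic c' → c' ∈ S)
    (Sbar : Set (Fin 10 → ZMod m)) (hk : Sbar.ncard = k)
    (hSb : S = {c : Fin 10 → ℤ | (fun i => ((c i : ZMod m))) ∈ Sbar}) :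
    Tendsto (fun X : ℝ => (NposS P Q S X : ℝ) / X ^ ((5 : ℝ) / 6)) atTop
      (𝓝 (((k : ℝ) / (m : ℝ) ^ 10) * (32 / 45) * zeta2 * zeta3)) ∧
    Tendsto (fun X : ℝ => (NnegS P Q S X : ℝ) / X ^ ((5 : ℝ) / 6)) atTop
      (𝓝 (((k : ℝ) / (m : ℝ) ^ 10) * (128 / 45) * zeta2 * zeta3)) := by
  have hS : ∀ c ∈ S, ∀ γ : SLZ, act (γ : MZ) c ∈ S := fun c hc γ => hinv c hc γ _ (actGL_cubic _ _)
  constructor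
  · have := main_X h hm Sbar S hSb hS 1 one_ne_zero (64 / 81) (by norm_num) (fun T hT => psi_int_pos h T hT)
      (NposS P Q S) (fun X => by
        unfold NposS
        congr 1
        ext o
        refine exists_congr fun c => and_congr_right fun _ => and_congr_right fun _ => and_congr ?_ (by rw [(Hinv_hv c).1])
        rw [← Rat.cast_pos (K := ℝ), (Hinv_hv c).2, one_mul]
        constructor <;> intro hh <;> linarith)
    rw [hk] at this
    convert this using 2
    ring
  · have := main_X h hm Sbar S hSb hS (-1) (by norm_num) (256 / 81) (by norm_num) (fun T hT => psi_int_neg h T hT)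
      (NnegS P Q S) (fun X => by
        unfold NnegS
        congr 1
        ext o
        refine exists_congr fun c => and_congr_right fun _ => and_congr_right fun _ => and_congr ?_ (by rw [(Hinv_hv c).1])
        rw [← Rat.cast_lt_zero (K := ℝ), (Hinv_hv c).2]
        constructor <;> intro hh <;> linarith)
    rw [hk] at this
    convert this using 2
    ring

end
end TC

/-- Let `S ⊆ ℤ¹⁰` be `SL₃(ℤ)`-invariant and the union of exactly `k` distinct cosets of
`m·ℤ¹⁰` (i.e. the preimage of a `k`-element set under reduction modulo `m`). Then
`lim N⁺(S;X)/X^{5/6} = (k/m¹⁰)(32/45)ζ(2)ζ(3)` and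
`lim N⁻(S;X)/X^{5/6} = (k/m¹⁰)(128/45)ζ(2)ζ(3)`. -/
theorem stmt10 (P Q : MvPolynomial (Fin 10) ℚ) (hPQ : IsInvariantPair ℚ P Q)
    (m k : ℕ) (hm : 1 ≤ m) (S : Set (Fin 10 → ℤ))
    (hinv : ∀ c ∈ S, ∀ (γ : Matrix.SpecialLinearGroup (Fin 3) ℤ) (c' : Fin 10 → ℤ),
      actGL (γ : Matrix (Fin 3) (Fin 3) ℤ) (cubic c) = cubic c' → c' ∈ S)
    (Sbar : Set (Fin 10 → ZMod m)) (hk : Sbar.ncard = k)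
    (hS : S = {c : Fin 10 → ℤ | (fun i => ((c i : ZMod m))) ∈ Sbar}) :
    Filter.Tendsto (fun X : ℝ => (NposS P Q S X : ℝ) / X ^ ((5 : ℝ)/6)) Filter.atTop
      (nhds (((k : ℝ) / (m : ℝ) ^ 10) * (32/45) * zeta2 * zeta3)) ∧
    Filter.Tendsto (fun X : ℝ => (NnegS P Q S X : ℝ) / X ^ ((5 : ℝ)/6)) Filter.atTop
      (nhds (((k : ℝ) / (m : ℝ) ^ 10) * (128/45) * zeta2 * zeta3)) := by
  exact TC.final hPQ hm S hinv Sbar hk hS
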